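/- For every integer n ≥ 1, the congruences on the twisted partition monoid P_n^Φ are precisely the relations cg(Θ,M), where (Θ,M) ranges over all C-pairs, together with the relations cgx(Θ,M), where (Θ,M) ranges over all exceptional C-pairs. -/

import Mathlib

namespace TPM

/-- Vertex set `{1,…,n} ∪ {1',…,n'}`: `Sum.inl` = unprimed (upper row),
`Sum.inr` = primed (lower row). -/
abbrev V (n : ℕ) := Fin n ⊕ Fin n

/-- The partition monoid `P_n`: set partitions of the `2n`-element set `V n`,
encoded as equivalence relations (setoids). -/
abbrev PM (n : ℕ) := Setoid (V n)

/-- Three-row vertex set of the product graph: top / middle / bottom. -/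
abbrev W (n : ℕ) := Fin n ⊕ (Fin n ⊕ Fin n)

variable {n : ℕ}

/-- First factor: unprimed ↦ top, primed ↦ middle. -/
def topMid : V n → W n
  | Sum.inl i => Sum.inl i
  | Sum.inr i => Sum.inr (Sum.inl i)

/-- Second factor: unprimed ↦ middle, primed ↦ bottom. -/
def midBot : V n → W n
  | Sum.inl i => Sum.inr (Sum.inl i)
  | Sum.inr i => Sum.inr (Sum.inr i)

/-- Embedding of `V n` as top and bottom rows of the three-row set. -/
def topBot : V n → W n
  | Sum.inl i => Sum.inl i
  | Sum.inr i => Sum.inr (Sum.inr i)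

/-- Edge relation of the product graph `Γ(α,β)`. -/
def graphRel (α β : PM n) (x y : W n) : Prop :=
  (∃ u v : V n, α.r u v ∧ x = topMid u ∧ y = topMid v) ∨
  (∃ u v : V n, β.r u v ∧ x = midBot u ∧ y = midBot v)

/-- Connectivity (equivalence closure of the edge relation) in `Γ(α,β)`. -/
def conn (α β : PM n) : W n → W n → Prop := Relation.EqvGen (graphRel α β)

/-- Connectivity in `Γ(α,β)`, as a setoid on the three-row vertex set. -/
def connSetoid (α β : PM n) : Setoid (W n) :=
  ⟨conn α β, Relation.EqvGen.is_equivalence _⟩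

/-- The product of two partitions: `x,y` lie in the same block of `αβ` iff they are
connected in `Γ(α,β)`. -/
def pmul (α β : PM n) : PM n :=
  ⟨fun x y => conn α β (topBot x) (topBot y),
    ⟨fun _ => Relation.EqvGen.refl _, fun h => Relation.EqvGen.symm _ _ h, fun h h' => Relation.EqvGen.trans _ _ _ h h'⟩⟩

/-- A vertex of the three-row set lies in the middle row. -/
def isMid (x : W n) : Prop := ∃ i : Fin n, x = Sum.inr (Sum.inl i)

/-- `Φ(α,β)`: the number of floating components of `Γ(α,β)`, i.e. connected components
all of whose vertices lie in the middle row. -/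
noncomputable def Phi (α β : PM n) : ℕ :=
  Nat.card {c : Quotient (connSetoid α β) //
    ∀ x : W n, Quotient.mk (connSetoid α β) x = c → isMid x}

/-- The rank of a partition: the number of transversal blocks (blocks containing both an
unprimed and a primed element). -/
noncomputable def rnk (α : PM n) : ℕ :=
  Nat.card {c : Quotient α //
    (∃ i : Fin n, Quotient.mk α (Sum.inl i) = c) ∧ ∃ i : Fin n, Quotient.mk α (Sum.inr i) = c}

/-- Which row of `V n` a point lies in. -/
def side : V n → Bool
  | Sum.inl _ => true
  | Sum.inr _ => false

/-- `α̂`: split each transversal of `α` into its unprimed part and its primed part. -/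
def hat (α : PM n) : PM n :=
  ⟨fun x y => α.r x y ∧ side x = side y,
    ⟨fun x => ⟨α.iseqv.refl x, rfl⟩,
     fun h => ⟨α.iseqv.symm h.1, h.2.symm⟩,
     fun h h' => ⟨α.iseqv.trans h.1 h'.1, h.2.trans h'.2⟩⟩⟩

/-- The twisted product on `ℕ × P_n`:  `(i,α)(j,β) = (i + j + Φ(α,β), αβ)`. -/
noncomputable def tmul (a b : ℕ × PM n) : ℕ × PM n :=
  (a.1 + b.1 + Phi a.2 b.2, pmul a.2 b.2)

/-- A congruence on a set equipped with a binary operation: an equivalence relation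
compatible with the operation on both sides. -/
def IsCongruence {M : Type*} (mul : M → M → M) (σ : M → M → Prop) : Prop :=
  Equivalence σ ∧ ∀ x y a, σ x y → σ (mul a x) (mul a y) ∧ σ (mul x a) (mul y a)

/-- Green's relation `R`: equality of the right ideals `xM = yM`. -/
def greenR {M : Type*} (mul : M → M → M) (x y : M) : Prop :=
  Set.range (mul x) = Set.range (mul y)

/-- Green's relation `L`: `Mx = My`. -/
def greenL {M : Type*} (mul : M → M → M) (x y : M) : Prop :=
  Set.range (fun a => mul a x) = Set.range (fun a => mul a y)

/-- The principal two-sided ideal `MxM`. -/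
def jSet {M : Type*} (mul : M → M → M) (x : M) : Set M :=
  Set.range (fun p : M × M => mul (mul p.1 x) p.2)

/-- Green's relation `J`: `MxM = MyM`. -/
def greenJ {M : Type*} (mul : M → M → M) (x y : M) : Prop :=
  jSet mul x = jSet mul y

/-- Green's relation `H = R ∩ L`. -/
def greenH {M : Type*} (mul : M → M → M) (x y : M) : Prop :=
  greenR mul x y ∧ greenL mul x y

/-- Green's relation `D = R ∘ L`. -/
def greenD {M : Type*} (mul : M → M → M) (x y : M) : Prop :=
  ∃ z, greenR mul x z ∧ greenL mul z y

/-- `pd(α,β)` satisfies `P`, where `α` has `p` transversals: there are representatives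
`a s` of the upper parts of the `p` (pairwise distinct) transversals of `α`, with `b s`
representing the corresponding lower parts, and a permutation `π` with `P π` such that the
block of `β` containing `a s` contains `b (π s)`.  (For H-related `α, β ∈ D_p` this says
exactly that some representation of the permutational difference `pd(α,β)` satisfies `P`.) -/
def pdIn (p : ℕ) (P : Equiv.Perm (Fin p) → Prop) (α β : PM n) : Prop :=
  ∃ (a b : Fin p → Fin n) (π : Equiv.Perm (Fin p)),
    (∀ s t, α.r (Sum.inl (a s)) (Sum.inl (a t)) → s = t) ∧
    (∀ s, α.r (Sum.inl (a s)) (Sum.inr (b s))) ∧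
    (∀ s, β.r (Sum.inl (a s)) (Sum.inr (b (π s)))) ∧
    P π

/-- The relation `ν_N` on `D_p`, for a subgroup `N ≤ S_p`:  H-related pairs of rank-`p`
partitions whose permutational difference lies in `N`. -/
def nuRel (p : ℕ) (N : Subgroup (Equiv.Perm (Fin p))) (α β : PM n) : Prop :=
  rnk α = p ∧ rnk β = p ∧ greenH pmul α β ∧ pdIn p (· ∈ N) α β

/-- The congruence `(m, m+d)^♯` on the additive monoid `ℕ` (intended for `d ≥ 1`). -/
def natCong (m d : ℕ) (i j : ℕ) : Prop :=
  i = j ∨ (m ≤ i ∧ m ≤ j ∧ i % d = j % d)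

/-- `min θ ≤ i` for a congruence `θ` on `ℕ` (with `min Δ_ℕ = ∞`). -/
def minLE (θ : ℕ → ℕ → Prop) (i : ℕ) : Prop :=
  ∃ a b, θ a b ∧ a ≠ b ∧ a ≤ i

/-- `k ≤ min θ` for a congruence `θ` on `ℕ` (with `min Δ_ℕ = ∞`). -/
def leMin (k : ℕ) (θ : ℕ → ℕ → Prop) : Prop :=
  ∀ a b, θ a b → a ≠ b → k ≤ a

/-- The possible entries of a C-matrix. -/
inductive CEntry : Type
  | delta | muUp | muDown | mu | lam | rho | R
  | nsym (q : ℕ) (N : Subgroup (Equiv.Perm (Fin q)))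

/-- Whether a C-matrix entry is an N-symbol. -/
def isNsym : CEntry → Prop
  | CEntry.nsym _ _ => True
  | _ => False

/-- The allowed values of the symbol `ζ` in row types RT2, RT5, RT6. -/
def isZeta (e : CEntry) : Prop :=
  e = CEntry.mu ∨ e = CEntry.muUp ∨ e = CEntry.muDown ∨ e = CEntry.delta

/-- The allowed values of the symbol `ξ` in row types RT4–RT7: any of `μ,ρ,λ,R` if
`d = 1`, and only `μ` if `d > 1`. -/
def xiOK (d : ℕ) (e : CEntry) : Prop :=
  e = CEntry.mu ∨ (d = 1 ∧ (e = CEntry.rho ∨ e = CEntry.lam ∨ e = CEntry.R))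

/-- Row type RT1 for rows 0 and 1: all entries `Δ`. -/
def RT1 (M0 M1 : ℕ → CEntry) : Prop :=
  (∀ i, M0 i = CEntry.delta) ∧ (∀ i, M1 i = CEntry.delta)

/-- Row type RT2. -/
def RT2 (Θ0 Θ1 : ℕ → ℕ → Prop) (M0 M1 : ℕ → CEntry) : Prop :=
  Θ0 = Eq ∧ Θ1 = Eq ∧
  ∃ i ζ, isZeta ζ ∧
    (∀ j, j < i → M0 j = CEntry.delta) ∧ (∀ j, i ≤ j → M0 j = CEntry.mu) ∧
    (∀ j, j < i → M1 j = CEntry.delta) ∧ M1 i = ζ ∧ (∀ j, i < j → M1 j = CEntry.mu)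

/-- Row type RT3. -/
def RT3 (Θ0 : ℕ → ℕ → Prop) (M0 M1 : ℕ → CEntry) : Prop :=
  ∃ m ξ, Θ0 = natCong m 1 ∧ (ξ = CEntry.rho ∨ ξ = CEntry.lam ∨ ξ = CEntry.R) ∧
    (∀ i, M1 i = CEntry.delta) ∧
    (∀ j, j < m → M0 j = CEntry.delta) ∧ (∀ j, m ≤ j → M0 j = ξ)

/-- Row type RT4. -/
def RT4 (Θ0 Θ1 : ℕ → ℕ → Prop) (M0 M1 : ℕ → CEntry) : Prop :=
  ∃ m d ξ, 1 ≤ d ∧ Θ0 = natCong m d ∧ Θ1 = natCong m d ∧ xiOK d ξ ∧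
    (∀ j, j < m → M0 j = CEntry.delta ∧ M1 j = CEntry.delta) ∧
    (∀ j, m ≤ j → M0 j = ξ ∧ M1 j = ξ)

/-- Row type RT5. -/
def RT5 (Θ0 Θ1 : ℕ → ℕ → Prop) (M0 M1 : ℕ → CEntry) : Prop :=
  ∃ m d i ξ ζ, 1 ≤ d ∧ i < m ∧ Θ0 = natCong m d ∧ Θ1 = natCong (m + 1) d ∧
    xiOK d ξ ∧ isZeta ζ ∧
    (∀ j, j < i → M0 j = CEntry.delta) ∧ (∀ j, i ≤ j → j < m → M0 j = CEntry.mu) ∧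
    (∀ j, m ≤ j → M0 j = ξ) ∧
    (∀ j, j < i → M1 j = CEntry.delta) ∧ M1 i = ζ ∧
    (∀ j, i < j → j ≤ m → M1 j = CEntry.mu) ∧ (∀ j, m < j → M1 j = ξ)

/-- Row type RT6. -/
def RT6 (Θ0 Θ1 : ℕ → ℕ → Prop) (M0 M1 : ℕ → CEntry) : Prop :=
  ∃ m l d ξ ζ, 1 ≤ d ∧ m < l ∧ Θ0 = natCong m d ∧ Θ1 = natCong l d ∧
    xiOK d ξ ∧ isZeta ζ ∧
    (∀ j, j < m → M0 j = CEntry.delta) ∧ (∀ j, m ≤ j → M0 j = ξ) ∧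
    (∀ j, j < l - 1 → M1 j = CEntry.delta) ∧ M1 (l - 1) = ζ ∧ (∀ j, l ≤ j → M1 j = ξ)

/-- Row type RT7. -/
def RT7 (Θ0 Θ1 : ℕ → ℕ → Prop) (M0 M1 : ℕ → CEntry) : Prop :=
  ∃ m l d ξ, 1 ≤ d ∧ 0 < m ∧ m + 1 < l ∧ (l - 1) % d = m % d ∧
    Θ0 = natCong m d ∧ Θ1 = natCong l d ∧ xiOK d ξ ∧
    (∀ j, j < m - 1 → M0 j = CEntry.delta) ∧ M0 (m - 1) = CEntry.mu ∧
    (∀ j, m ≤ j → M0 j = ξ) ∧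
    (∀ j, j < l - 1 → M1 j = CEntry.delta) ∧ M1 (l - 1) = CEntry.mu ∧
    (∀ j, l ≤ j → M1 j = ξ)

/-- Row type RT8 for a row `q ≥ 2`: all entries `Δ`. -/
def RT8 (Mq : ℕ → CEntry) : Prop := ∀ i, Mq i = CEntry.delta

/-- Row type RT9 for a row `q ≥ 2`. -/
def RT9 (q : ℕ) (Θq : ℕ → ℕ → Prop) (Mq : ℕ → CEntry) : Prop :=
  ∃ (i k : ℕ) (Ns : ℕ → Subgroup (Equiv.Perm (Fin q))),
    i ≤ k ∧ leMin k Θq ∧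
    (∀ j, i ≤ j → j ≤ k → Ns j ≠ ⊥ ∧ (Ns j).Normal) ∧
    (∀ j j', i ≤ j → j ≤ j' → j' ≤ k → Ns j ≤ Ns j') ∧
    (∀ j, j < i → Mq j = CEntry.delta) ∧
    (∀ j, i ≤ j → j < k → Mq j = CEntry.nsym q (Ns j)) ∧
    (∀ j, k ≤ j → Mq j = CEntry.nsym q (Ns k))

/-- Row type RT10 for a row `q ≥ 2`. -/
def RT10 (q : ℕ) (Θq : ℕ → ℕ → Prop) (Mq : ℕ → CEntry) : Prop :=
  ∃ (i m : ℕ) (Ns : ℕ → Subgroup (Equiv.Perm (Fin q))),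
    i ≤ m ∧ Θq = natCong m 1 ∧
    (∀ j, i ≤ j → j < m → Ns j ≠ ⊥ ∧ (Ns j).Normal) ∧
    (∀ j j', i ≤ j → j ≤ j' → j' < m → Ns j ≤ Ns j') ∧
    (∀ j, j < i → Mq j = CEntry.delta) ∧
    (∀ j, i ≤ j → j < m → Mq j = CEntry.nsym q (Ns j)) ∧
    (∀ j, m ≤ j → Mq j = CEntry.R)

/-- A C-pair for `P_n^Φ`: a descending chain `Θ = (θ_0 ⊇ ⋯ ⊇ θ_n)` of congruences on
`(ℕ,+)` together with a matrix `M = (M_{qi})`, `0 ≤ q ≤ n`, `i ∈ ℕ`, whose rows 0 and 1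
jointly have one of the types RT1–RT7, whose rows `q ≥ 2` have one of the types RT8–RT10,
and which satisfies the verticality conditions (V1) and (V2). -/
def IsCPair (n : ℕ) (Θ : ℕ → ℕ → ℕ → Prop) (M : ℕ → ℕ → CEntry) : Prop :=
  (∀ q, q ≤ n → IsCongruence (· + ·) (Θ q)) ∧
  (∀ q r, q ≤ r → r ≤ n → ∀ i j, Θ r i j → Θ q i j) ∧
  (RT1 (M 0) (M 1) ∨ RT2 (Θ 0) (Θ 1) (M 0) (M 1) ∨ RT3 (Θ 0) (M 0) (M 1) ∨
    RT4 (Θ 0) (Θ 1) (M 0) (M 1) ∨ RT5 (Θ 0) (Θ 1) (M 0) (M 1) ∨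
    RT6 (Θ 0) (Θ 1) (M 0) (M 1) ∨ RT7 (Θ 0) (Θ 1) (M 0) (M 1)) ∧
  (∀ q, 2 ≤ q → q ≤ n → (RT8 (M q) ∨ RT9 q (Θ q) (M q) ∨ RT10 q (Θ q) (M q))) ∧
  (∀ q i, 1 ≤ q → q ≤ n → isNsym (M q i) →
    ¬(M (q - 1) i = CEntry.delta ∨ M (q - 1) i = CEntry.muUp ∨
      M (q - 1) i = CEntry.muDown ∨ isNsym (M (q - 1) i))) ∧
  (∀ q i, 2 ≤ q → q ≤ n → M q i = CEntry.R → M (q - 1) i = CEntry.R)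

/-- The relation `cg(Θ,M)` on `P_n^Φ` associated with a C-pair `(Θ,M)`: conditions
(C1)–(C8). -/
def cg (n : ℕ) (Θ : ℕ → ℕ → ℕ → Prop) (M : ℕ → ℕ → CEntry)
    (a b : ℕ × PM n) : Prop :=
  -- (C1)
  (M (rnk a.2) a.1 = CEntry.delta ∧ M (rnk b.2) b.1 = CEntry.delta ∧
    Θ (rnk a.2) a.1 b.1 ∧ a.2 = b.2) ∨
  -- (C2)
  (M (rnk a.2) a.1 = CEntry.R ∧ M (rnk b.2) b.1 = CEntry.R) ∨
  -- (C3)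
  (∃ p N, M (rnk a.2) a.1 = CEntry.nsym p N ∧ M (rnk b.2) b.1 = CEntry.nsym p N ∧
    Θ (rnk a.2) a.1 b.1 ∧ rnk a.2 = p ∧ greenH pmul a.2 b.2 ∧ pdIn p (· ∈ N) a.2 b.2) ∨
  -- (C4)
  (M (rnk a.2) a.1 = CEntry.lam ∧ M (rnk b.2) b.1 = CEntry.lam ∧
    greenL pmul (hat a.2) (hat b.2)) ∨
  -- (C5)
  (M (rnk a.2) a.1 = CEntry.rho ∧ M (rnk b.2) b.1 = CEntry.rho ∧
    greenR pmul (hat a.2) (hat b.2)) ∨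
  -- (C6)
  (M (rnk a.2) a.1 = CEntry.muDown ∧ M (rnk b.2) b.1 = CEntry.muDown ∧
    hat a.2 = hat b.2 ∧ greenL pmul a.2 b.2) ∨
  -- (C7)
  (M (rnk a.2) a.1 = CEntry.muUp ∧ M (rnk b.2) b.1 = CEntry.muUp ∧
    hat a.2 = hat b.2 ∧ greenR pmul a.2 b.2) ∨
  -- (C8)
  (M (rnk a.2) a.1 = CEntry.mu ∧ M (rnk b.2) b.1 = CEntry.mu ∧
    hat a.2 = hat b.2 ∧
    ((rnk a.2 = rnk b.2 ∧ Θ (rnk a.2) a.1 b.1) ∨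
     (rnk a.2 ≠ rnk b.2 ∧ Θ 0 (a.1 + rnk b.2) (b.1 + rnk a.2) ∧
        ¬ minLE (Θ (rnk a.2)) a.1 ∧ ¬ minLE (Θ (rnk b.2)) b.1) ∨
     (rnk a.2 ≠ rnk b.2 ∧ Θ 0 (a.1 + rnk b.2) (b.1 + rnk a.2) ∧
        minLE (Θ (rnk a.2)) a.1 ∧ minLE (Θ (rnk b.2)) b.1)))

/-- The C-pair `(Θ,M)` is exceptional with exceptional row `q`, where
`θ_q = (m, m+2d)^♯`. -/
def ExcAt (n : ℕ) (Θ : ℕ → ℕ → ℕ → Prop) (M : ℕ → ℕ → CEntry) (q m d : ℕ) : Prop :=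
  2 ≤ q ∧ q ≤ n ∧ 1 ≤ d ∧ Θ q = natCong m (2 * d) ∧
  ((2 < q ∧ M q m = CEntry.nsym q (alternatingGroup (Fin q))) ∨
   (q = 2 ∧ M 2 m = CEntry.delta ∧
     (M 1 m = CEntry.mu ∨ M 1 m = CEntry.rho ∨ M 1 m = CEntry.lam ∨ M 1 m = CEntry.R) ∧
     (∀ i j, natCong m d i j → Θ 1 i j)))

/-- The exceptional congruence `cgx(Θ,M)` associated with an exceptional C-pair:
`cg(Θ,M)` together with the pairs of (C9). -/
def cgx (n : ℕ) (Θ : ℕ → ℕ → ℕ → Prop) (M : ℕ → ℕ → CEntry) (q m d : ℕ)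
    (a b : ℕ × PM n) : Prop :=
  cg n Θ M a b ∨
  (rnk a.2 = q ∧ rnk b.2 = q ∧ natCong m d a.1 b.1 ∧ ¬ Θ q a.1 b.1 ∧
    greenH pmul a.2 b.2 ∧ pdIn q (fun π => π ∉ alternatingGroup (Fin q)) a.2 b.2)

/-- The Rees relation of a subset `I`. -/
def rees {M : Type*} (I : Set M) (x y : M) : Prop := x = y ∨ (x ∈ I ∧ y ∈ I)

/-- A (possibly empty) ideal of `P_n^Φ`: `MIM ⊆ I`. -/
def tIdeal (n : ℕ) (I : Set (ℕ × PM n)) : Prop :=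
  ∀ a b x, x ∈ I → tmul (tmul a x) b ∈ I

/-- `I(σ)`: the union of all ideals `I` of `P_n^Φ` whose Rees congruence is contained
in `σ`. -/
def Isig (n : ℕ) (σ : (ℕ × PM n) → (ℕ × PM n) → Prop) : Set (ℕ × PM n) :=
  ⋃₀ {I | tIdeal n I ∧ ∀ x y, rees I x y → σ x y}

/-- The 0-twisted partition monoid `P_{n,0}^Φ`, carried by `Option (P_n)` with
`none` the zero element `✗`. -/
noncomputable def mul0 (a b : Option (PM n)) : Option (PM n) :=
  match a, b with
  | some α, some β => if Phi α β = 0 then some (pmul α β) else none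
  | _, _ => none

/-- `rank a ≤ q`, where `rank ✗ = -∞`. -/
def rnkLE (a : Option (PM n)) (q : ℕ) : Prop :=
  ∀ α, a = some α → rnk α ≤ q

/-- The Rees congruence `R_q` on `P_{n,0}^Φ`. -/
def ReesQ (q : ℕ) (a b : Option (PM n)) : Prop :=
  a = b ∨ (rnkLE a q ∧ rnkLE b q)

/-- Lift a relation on `P_n` to `P_{n,0}^Φ = P_n ∪ {✗}`. -/
def lift2 (r : PM n → PM n → Prop) (a b : Option (PM n)) : Prop :=
  ∃ α β, a = some α ∧ b = some β ∧ r α β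


section Part1

/-! ### Basic structure of partitions -/

theorem pm_ext {α β : PM n}
    (h1 : ∀ x x', α.r (Sum.inl x) (Sum.inl x') ↔ β.r (Sum.inl x) (Sum.inl x'))
    (h2 : ∀ x x', α.r (Sum.inr x) (Sum.inr x') ↔ β.r (Sum.inr x) (Sum.inr x'))
    (h3 : ∀ x y, α.r (Sum.inl x) (Sum.inr y) ↔ β.r (Sum.inl x) (Sum.inr y)) : α = β := by
  apply Setoid.ext
  rintro (x | x) (y | y)
  · exact h1 x y
  · exact h3 x y
  · exact ⟨fun h => β.iseqv.symm ((h3 y x).1 (α.iseqv.symm h)),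
      fun h => α.iseqv.symm ((h3 y x).2 (β.iseqv.symm h))⟩
  · exact h2 x y

/-- Upper kernel. -/
def krS (α : PM n) : Setoid (Fin n) := Setoid.comap Sum.inl α
/-- Lower kernel. -/
def ckS (α : PM n) : Setoid (Fin n) := Setoid.comap Sum.inr α

theorem krS_r (α : PM n) (x y) : (krS α).r x y ↔ α.r (Sum.inl x) (Sum.inl y) := Iff.rfl
theorem ckS_r (α : PM n) (x y) : (ckS α).r x y ↔ α.r (Sum.inr x) (Sum.inr y) := Iff.rfl

/-- Domain. -/
def dm (α : PM n) (x : Fin n) : Prop := ∃ y, α.r (Sum.inl x) (Sum.inr y)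
/-- Codomain. -/
def cd (α : PM n) (y : Fin n) : Prop := ∃ x, α.r (Sum.inl x) (Sum.inr y)

/-- The graph on the middle and bottom rows. -/
def G (L : Setoid (Fin n)) (γ : PM n) : Setoid (V n) :=
  Relation.EqvGen.setoid (fun u v => γ.r u v ∨ ∃ y y', L.r y y' ∧ u = Sum.inl y ∧ v = Sum.inl y')

theorem G_refl (L : Setoid (Fin n)) (γ : PM n) (u) : (G L γ).r u u := (G L γ).iseqv.refl u
theorem G_symm {L : Setoid (Fin n)} {γ : PM n} {u v} (h : (G L γ).r u v) : (G L γ).r v u :=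
  (G L γ).iseqv.symm h
theorem G_trans {L : Setoid (Fin n)} {γ : PM n} {u v w} (h : (G L γ).r u v) (h' : (G L γ).r v w) :
    (G L γ).r u w := (G L γ).iseqv.trans h h'
theorem G_of_right {L : Setoid (Fin n)} {γ : PM n} {u v} (h : γ.r u v) : (G L γ).r u v :=
  Relation.EqvGen.rel _ _ (Or.inl h)
theorem G_of_left {L : Setoid (Fin n)} {γ : PM n} {y y'} (h : L.r y y') :
    (G L γ).r (Sum.inl y) (Sum.inl y') :=
  Relation.EqvGen.rel _ _ (Or.inr ⟨y, y', h, rfl, rfl⟩)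

theorem G_le {L : Setoid (Fin n)} {γ : PM n} {S : Setoid (V n)}
    (h1 : ∀ u v, γ.r u v → S.r u v) (h2 : ∀ y y', L.r y y' → S.r (Sum.inl y) (Sum.inl y'))
    {u v} (h : (G L γ).r u v) : S.r u v := by
  replace h : Relation.EqvGen _ u v := h
  induction h with
  | rel x y h =>
    rcases h with h | ⟨a, b, h, rfl, rfl⟩
    · exact h1 _ _ h
    · exact h2 _ _ h
  | refl x => exact S.iseqv.refl x
  | symm x y _ ih => exact S.iseqv.symm ih
  | trans x y z _ _ ih1 ih2 => exact S.iseqv.trans ih1 ih2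

open Classical in
/-- Labelling of the three-row graph by components. -/
noncomputable def wlab (α γ : PM n) : W n → Quotient (G (ckS α) γ) ⊕ Quotient α
  | Sum.inr v => Sum.inl (Quotient.mk _ v)
  | Sum.inl x => if h : dm α x then Sum.inl (Quotient.mk _ (Sum.inl h.choose)) else
      Sum.inr (Quotient.mk _ (Sum.inl x))

theorem conn_wlab {α γ : PM n} {p q} (h : conn α γ p q) : wlab α γ p = wlab α γ q := by
  induction h with
  | refl x => rfl
  | symm x y _ ih => exact ih.symm
  | trans x y z _ _ ih1 ih2 => exact ih1.trans ih2
  | rel p q h =>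
    rcases h with ⟨u, v, h, rfl, rfl⟩ | ⟨u, v, h, rfl, rfl⟩
    · have key : ∀ (x y : Fin n), α.r (Sum.inl x) (Sum.inr y) →
          wlab α γ (Sum.inl x) = Sum.inl (Quotient.mk _ (Sum.inl y)) := by
        intro x y h
        have hd : dm α x := ⟨y, h⟩
        simp only [wlab, hd, dif_pos]
        congr 1
        apply Quotient.sound
        exact G_of_left (α.iseqv.trans (α.iseqv.symm hd.choose_spec) h)
      rcases u with x | y <;> rcases v with x' | y'
      · by_cases hd : dm α x
        · obtain ⟨y, hy⟩ := hd
          rw [topMid, topMid, key x y hy, key x' y (α.iseqv.trans (α.iseqv.symm h) hy)]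
        · have hd' : ¬ dm α x' := fun ⟨y, hy⟩ => hd ⟨y, α.iseqv.trans h hy⟩
          simp only [topMid, wlab, hd, hd', dif_neg, not_false_eq_true]
          congr 1
          exact Quotient.sound h
      · simp only [topMid, key x y' h]; rfl
      · simp only [topMid, key x' y (α.iseqv.symm h)]; rfl
      · simp only [topMid, wlab]
        congr 1
        exact Quotient.sound (G_of_left h)
    · have hm : ∀ w : V n, midBot w = Sum.inr w := by rintro (w | w) <;> rfl
      rw [hm, hm]
      simp only [wlab]
      congr 1
      exact Quotient.sound (G_of_right h)

theorem conn_G {α γ : PM n} {u v} (h : (G (ckS α) γ).r u v) :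
    conn α γ (Sum.inr u) (Sum.inr v) := by
  refine G_le (S := Setoid.comap Sum.inr (connSetoid α γ)) ?_ ?_ h
  · intro u v h
    have hm : ∀ w : V n, midBot w = Sum.inr w := by rintro (w | w) <;> rfl
    exact Relation.EqvGen.rel _ _ (Or.inr ⟨u, v, h, (hm _).symm, (hm _).symm⟩)
  · intro y y' h
    exact Relation.EqvGen.rel _ _ (Or.inl ⟨_, _, h, rfl, rfl⟩)

theorem conn_tm {α γ : PM n} {x y} (h : α.r (Sum.inl x) (Sum.inr y)) :
    conn α γ (Sum.inl x) (Sum.inr (Sum.inl y)) :=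
  Relation.EqvGen.rel _ _ (Or.inl ⟨_, _, h, rfl, rfl⟩)

theorem conn_mb_iff {α γ : PM n} {u v} :
    conn α γ (Sum.inr u) (Sum.inr v) ↔ (G (ckS α) γ).r u v := by
  refine ⟨fun h => ?_, conn_G⟩
  have := conn_wlab h
  simp only [wlab, Sum.inl.injEq] at this
  exact Quotient.exact this

theorem conn_tmb_iff {α γ : PM n} {x v} :
    conn α γ (Sum.inl x) (Sum.inr v) ↔
      ∃ y, α.r (Sum.inl x) (Sum.inr y) ∧ (G (ckS α) γ).r (Sum.inl y) v := by
  constructor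
  · intro h
    have := conn_wlab h
    by_cases hd : dm α x
    · simp only [wlab, hd, dif_pos, Sum.inl.injEq] at this
      exact ⟨_, hd.choose_spec, Quotient.exact this⟩
    · simp [wlab, hd] at this
  · rintro ⟨y, h, h'⟩
    exact Relation.EqvGen.trans _ _ _ (conn_tm h) (conn_G h')

theorem conn_tt_iff {α γ : PM n} {x x'} :
    conn α γ (Sum.inl x) (Sum.inl x') ↔
      α.r (Sum.inl x) (Sum.inl x') ∨ ∃ y y', α.r (Sum.inl x) (Sum.inr y) ∧
        α.r (Sum.inl x') (Sum.inr y') ∧ (G (ckS α) γ).r (Sum.inl y) (Sum.inl y') := by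
  constructor
  · intro h
    have := conn_wlab h
    by_cases hd : dm α x <;> by_cases hd' : dm α x'
    · simp only [wlab, hd, hd', dif_pos, Sum.inl.injEq] at this
      exact Or.inr ⟨_, _, hd.choose_spec, hd'.choose_spec, Quotient.exact this⟩
    · simp [wlab, hd, hd'] at this
    · simp [wlab, hd, hd'] at this
    · simp only [wlab, hd, hd', dif_neg, not_false_eq_true, Sum.inr.injEq] at this
      exact Or.inl (Quotient.exact this)
  · rintro (h | ⟨y, y', h, h', h''⟩)
    · exact Relation.EqvGen.rel _ _ (Or.inl ⟨_, _, h, rfl, rfl⟩)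
    · exact Relation.EqvGen.trans _ _ _ (conn_tm h) (Relation.EqvGen.trans _ _ _ (conn_G h'')
        (Relation.EqvGen.symm _ _ (conn_tm h')))

theorem pmul_ll {α γ : PM n} {x x'} : (pmul α γ).r (Sum.inl x) (Sum.inl x') ↔
      α.r (Sum.inl x) (Sum.inl x') ∨ ∃ y y', α.r (Sum.inl x) (Sum.inr y) ∧
        α.r (Sum.inl x') (Sum.inr y') ∧ (G (ckS α) γ).r (Sum.inl y) (Sum.inl y') := conn_tt_iff
theorem pmul_lr {α γ : PM n} {x z} : (pmul α γ).r (Sum.inl x) (Sum.inr z) ↔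
      ∃ y, α.r (Sum.inl x) (Sum.inr y) ∧ (G (ckS α) γ).r (Sum.inl y) (Sum.inr z) := conn_tmb_iff
theorem pmul_rr {α γ : PM n} {z z'} : (pmul α γ).r (Sum.inr z) (Sum.inr z') ↔
      (G (ckS α) γ).r (Sum.inr z) (Sum.inr z') := conn_mb_iff

/-- Floating components in terms of `G`. -/
theorem Phi_eq (α γ : PM n) : Phi α γ = Nat.card {c : Quotient (G (ckS α) γ) //
    (∀ z, Quotient.mk _ (Sum.inr z) ≠ c) ∧ ∀ y, cd α y → Quotient.mk _ (Sum.inl y) ≠ c} := by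
  unfold Phi
  symm
  have hf : ∀ u v : V n, (G (ckS α) γ).r u v → (connSetoid α γ).r (Sum.inr u) (Sum.inr v) :=
    fun u v h => conn_G h
  let F : Quotient (G (ckS α) γ) → Quotient (connSetoid α γ) :=
    Quotient.map (sa := G (ckS α) γ) (sb := connSetoid α γ) Sum.inr hf
  have Finj : Function.Injective F := by
    intro a b
    induction a using Quotient.inductionOn
    induction b using Quotient.inductionOn
    intro h
    exact Quotient.sound (conn_mb_iff.1 (Quotient.exact h))
  apply Nat.card_congr
  refine Equiv.ofBijective (fun c => ⟨F c.1, ?_⟩) ⟨?_, ?_⟩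
  · obtain ⟨c, hc1, hc2⟩ := c
    induction c using Quotient.inductionOn with
    | h u =>
    intro p hp
    have hp : conn α γ p (Sum.inr u) := Quotient.exact hp
    rcases p with x | y | z
    · obtain ⟨y, hy, hy'⟩ := conn_tmb_iff.1 hp
      exact absurd (Quotient.sound hy') (hc2 y ⟨x, hy⟩)
    · exact ⟨y, rfl⟩
    · exact absurd (Quotient.sound (conn_mb_iff.1 hp)) (hc1 z)
  · intro a b h
    exact Subtype.ext (Finj (congrArg Subtype.val h))
  · rintro ⟨c, hc⟩
    induction c using Quotient.inductionOn with
    | h p =>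
    obtain ⟨y, rfl⟩ := hc p rfl
    refine ⟨⟨Quotient.mk _ (Sum.inl y), ?_, ?_⟩, rfl⟩
    · intro z hz
      obtain ⟨i, hi⟩ := hc (Sum.inr (Sum.inr z)) (Quotient.sound (conn_G (Quotient.exact hz)))
      simp at hi
    · rintro y' ⟨x, hx⟩ hy'
      obtain ⟨i, hi⟩ := hc (Sum.inl x) (Quotient.sound (Relation.EqvGen.trans _ _ _ (conn_tm hx)
        (conn_G (Quotient.exact hy'))))
      simp at hi

/-! ### Duality -/

/-- The involution turning partitions upside down. -/
def flip (α : PM n) : PM n := Setoid.comap Sum.swap α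

theorem flip_flip (α : PM n) : flip (flip α) = α := by
  apply Setoid.ext; intro a b; show α.r _ _ ↔ _; simp

theorem flip_r (α : PM n) (u v) : (flip α).r u v ↔ α.r u.swap v.swap := Iff.rfl

/-- Reflection of the three rows. -/
def wswap : W n → W n
  | Sum.inl x => Sum.inr (Sum.inr x)
  | Sum.inr (Sum.inl x) => Sum.inr (Sum.inl x)
  | Sum.inr (Sum.inr x) => Sum.inl x

theorem wswap_wswap (p : W n) : wswap (wswap p) = p := by
  rcases p with x | x | x <;> rfl

theorem conn_flip {α β : PM n} {p q} (h : conn α β p q) :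
    conn (flip β) (flip α) (wswap p) (wswap q) := by
  induction h with
  | refl x => exact Relation.EqvGen.refl _
  | symm x y _ ih => exact Relation.EqvGen.symm _ _ ih
  | trans x y z _ _ ih1 ih2 => exact Relation.EqvGen.trans _ _ _ ih1 ih2
  | rel p q h =>
    apply Relation.EqvGen.rel
    rcases h with ⟨u, v, h, rfl, rfl⟩ | ⟨u, v, h, rfl, rfl⟩
    · right
      refine ⟨u.swap, v.swap, by simpa [flip_r] using h, ?_, ?_⟩
      · rcases u with u | u <;> rfl
      · rcases v with u | u <;> rfl
    · left
      refine ⟨u.swap, v.swap, by simpa [flip_r] using h, ?_, ?_⟩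
      · rcases u with u | u <;> rfl
      · rcases v with u | u <;> rfl

theorem conn_flip_iff {α β : PM n} {p q} :
    conn (flip β) (flip α) (wswap p) (wswap q) ↔ conn α β p q := by
  refine ⟨fun h => ?_, conn_flip⟩
  have := conn_flip h
  rwa [flip_flip, flip_flip, wswap_wswap, wswap_wswap] at this

theorem flip_pmul (α β : PM n) : flip (pmul α β) = pmul (flip β) (flip α) := by
  apply Setoid.ext
  intro u v
  show conn α β (topBot u.swap) (topBot v.swap) ↔ conn _ _ (topBot u) (topBot v)
  rw [← conn_flip_iff]
  have : ∀ w : V n, wswap (topBot w.swap) = topBot w := by rintro (w | w) <;> rfl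
  rw [this, this]

theorem flip_Phi (α β : PM n) : Phi (flip β) (flip α) = Phi α β := by
  symm
  unfold Phi
  have hf : ∀ p q : W n, (connSetoid α β).r p q → (connSetoid (flip β) (flip α)).r (wswap p) (wswap q) :=
    fun p q h => conn_flip h
  let F : Quotient (connSetoid α β) → Quotient (connSetoid (flip β) (flip α)) :=
    Quotient.map (sa := connSetoid α β) (sb := connSetoid (flip β) (flip α)) wswap hf
  have hmid : ∀ p : W n, isMid (wswap p) ↔ isMid p := by
    rintro (x | x | x) <;> simp [isMid, wswap]
  have Fbij : Function.Bijective F := by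
    constructor
    · intro a b
      induction a using Quotient.inductionOn
      induction b using Quotient.inductionOn
      intro h
      exact Quotient.sound (conn_flip_iff.1 (Quotient.exact h))
    · intro c
      induction c using Quotient.inductionOn with
      | h p => exact ⟨Quotient.mk _ (wswap p), by
          show Quotient.mk _ (wswap (wswap p)) = _; rw [wswap_wswap]⟩
  apply Nat.card_congr
  refine Equiv.subtypeEquiv (Equiv.ofBijective F Fbij) ?_
  intro c
  induction c using Quotient.inductionOn with
  | h p =>
  constructor
  · intro h q hq
    rw [← hmid]
    apply h
    apply Quotient.sound
    have hq : conn _ _ q (wswap p) := Quotient.exact hq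
    have := conn_flip hq
    rwa [flip_flip, flip_flip, wswap_wswap] at this
  · intro h q hq
    rw [← hmid]
    apply h
    exact Quotient.sound (conn_flip (Quotient.exact hq))

/-! ### Rank -/

theorem le_rnk_iff {α : PM n} {q : ℕ} : q ≤ rnk α ↔ ∃ a b : Fin q → Fin n,
    (∀ s, α.r (Sum.inl (a s)) (Sum.inr (b s))) ∧
    ∀ s t, α.r (Sum.inl (a s)) (Sum.inl (a t)) → s = t := by
  classical
  set T := {c : Quotient α //
    (∃ i : Fin n, Quotient.mk α (Sum.inl i) = c) ∧ ∃ i : Fin n, Quotient.mk α (Sum.inr i) = c} with hT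
  have hr : rnk α = Nat.card T := rfl
  constructor
  · intro h
    rw [hr, ← Nat.card_fin q] at h
    obtain ⟨e⟩ : Nonempty (Fin q ↪ T) := by
      have := Fintype.ofFinite T
      rw [Nat.card_eq_fintype_card, Nat.card_eq_fintype_card] at h
      exact Function.Embedding.nonempty_of_card_le h
    choose a ha using fun s => (e s).2.1
    choose b hb using fun s => (e s).2.2
    refine ⟨a, b, fun s => Quotient.exact ((ha s).trans (hb s).symm), fun s t h => ?_⟩
    apply e.injective
    apply Subtype.ext
    rw [← ha s, ← ha t]
    exact Quotient.sound h
  · rintro ⟨a, b, h1, h2⟩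
    rw [hr, ← Nat.card_fin q]
    refine Nat.card_le_card_of_injective (fun s => (⟨Quotient.mk α (Sum.inl (a s)), ⟨_, rfl⟩,
      ⟨b s, Quotient.sound (α.iseqv.symm (h1 s))⟩⟩ : T)) ?_
    intro s t h
    exact h2 s t (Quotient.exact (congrArg Subtype.val h))

/-- A full system of transversal representatives. -/
theorem rnk_reps {α : PM n} {q : ℕ} (h : rnk α = q) : ∃ a b : Fin q → Fin n,
    (∀ s, α.r (Sum.inl (a s)) (Sum.inr (b s))) ∧
    (∀ s t, α.r (Sum.inl (a s)) (Sum.inl (a t)) → s = t) ∧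
    ∀ x, dm α x → ∃ s, α.r (Sum.inl x) (Sum.inl (a s)) := by
  obtain ⟨a, b, h1, h2⟩ := le_rnk_iff.1 h.ge
  refine ⟨a, b, h1, h2, ?_⟩
  by_contra hc
  push Not at hc
  obtain ⟨x, ⟨y, hy⟩, hx⟩ := hc
  have : q + 1 ≤ rnk α := le_rnk_iff.2 ⟨Fin.snoc (α := fun _ => Fin n) a x,
    Fin.snoc (α := fun _ => Fin n) b y, ?_, ?_⟩
  · omega
  · intro s
    refine Fin.lastCases ?_ ?_ s
    · simpa using hy
    · intro s; simpa using h1 s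
  · intro s t
    refine Fin.lastCases ?_ ?_ s <;> refine Fin.lastCases ?_ ?_ t
    · simp
    · intro t h; simp only [Fin.snoc_last, Fin.snoc_castSucc] at h; exact absurd h (hx t)
    · intro t h; simp only [Fin.snoc_last, Fin.snoc_castSucc] at h; exact absurd (α.iseqv.symm h) (hx t)
    · intro s t h; simp only [Fin.snoc_castSucc] at h; rw [h2 _ _ h]

theorem rnk_flip_le (α : PM n) : rnk α ≤ rnk (flip α) := by
  obtain ⟨a, b, h1, h2⟩ := le_rnk_iff.1 (le_refl (rnk α))
  refine le_rnk_iff.2 ⟨b, a, fun s => α.iseqv.symm (h1 s), fun s t h => h2 s t ?_⟩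
  have h : α.r (Sum.inr (b s)) (Sum.inr (b t)) := h
  exact α.iseqv.trans (h1 s) (α.iseqv.trans h (α.iseqv.symm (h1 t)))

theorem rnk_flip (α : PM n) : rnk (flip α) = rnk α :=
  le_antisymm (by simpa [flip_flip] using rnk_flip_le (flip α)) (rnk_flip_le α)

theorem rnk_le (α : PM n) : rnk α ≤ n := by
  obtain ⟨a, b, h1, h2⟩ := le_rnk_iff.1 (le_refl (rnk α))
  have : Function.Injective a := fun s t h => h2 s t (by rw [h])
  simpa using Fintype.card_le_of_injective a this

theorem rnk_pmul_le_left (α γ : PM n) : rnk (pmul α γ) ≤ rnk α := by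
  obtain ⟨a, b, h1, h2⟩ := le_rnk_iff.1 (le_refl (rnk (pmul α γ)))
  choose y hy hy' using fun s => pmul_lr.1 (h1 s)
  exact le_rnk_iff.2 ⟨a, y, hy, fun s t h => h2 s t (pmul_ll.2 (Or.inl h))⟩

theorem rnk_pmul_le_right (α γ : PM n) : rnk (pmul α γ) ≤ rnk γ := by
  rw [← rnk_flip, flip_pmul, ← rnk_flip γ]
  exact rnk_pmul_le_left _ _


end Part1

section Part2

/-! ### Compatible products -/

theorem G_eq_of_le {L : Setoid (Fin n)} {γ : PM n}
    (h : ∀ y y', L.r y y' → γ.r (Sum.inl y) (Sum.inl y')) : G L γ = γ := by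
  apply Setoid.ext
  intro u v
  exact ⟨fun h' => G_le (fun _ _ h => h) h h', fun h' => G_of_right h'⟩

theorem pmul_c {α γ : PM n} (h : ∀ y y', α.r (Sum.inr y) (Sum.inr y') → γ.r (Sum.inl y) (Sum.inl y')) :
    (∀ x x', (pmul α γ).r (Sum.inl x) (Sum.inl x') ↔ α.r (Sum.inl x) (Sum.inl x') ∨
      ∃ y y', α.r (Sum.inl x) (Sum.inr y) ∧ α.r (Sum.inl x') (Sum.inr y') ∧
        γ.r (Sum.inl y) (Sum.inl y')) ∧
    (∀ x z, (pmul α γ).r (Sum.inl x) (Sum.inr z) ↔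
      ∃ y, α.r (Sum.inl x) (Sum.inr y) ∧ γ.r (Sum.inl y) (Sum.inr z)) ∧
    (∀ z z', (pmul α γ).r (Sum.inr z) (Sum.inr z') ↔ γ.r (Sum.inr z) (Sum.inr z')) := by
  have hG : G (ckS α) γ = γ := G_eq_of_le h
  refine ⟨fun x x' => ?_, fun x z => ?_, fun z z' => ?_⟩
  · rw [pmul_ll, hG]
  · rw [pmul_lr, hG]
  · rw [pmul_rr, hG]

theorem flip_ll {α : PM n} {x y} : (flip α).r (Sum.inl x) (Sum.inl y) ↔ α.r (Sum.inr x) (Sum.inr y) :=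
  Iff.rfl
theorem flip_rr {α : PM n} {x y} : (flip α).r (Sum.inr x) (Sum.inr y) ↔ α.r (Sum.inl x) (Sum.inl y) :=
  Iff.rfl
theorem flip_lr {α : PM n} {x y} : (flip α).r (Sum.inl x) (Sum.inr y) ↔ α.r (Sum.inl y) (Sum.inr x) :=
  ⟨fun h => α.iseqv.symm h, fun h => α.iseqv.symm h⟩
theorem pr_symm {α : PM n} {u v} : α.r u v ↔ α.r v u := ⟨fun h => α.iseqv.symm h, fun h => α.iseqv.symm h⟩

theorem pmul_flip (α γ : PM n) : pmul α γ = flip (pmul (flip γ) (flip α)) := by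
  rw [flip_pmul, flip_flip, flip_flip]

theorem pmul_d {α γ : PM n} (h : ∀ y y', γ.r (Sum.inl y) (Sum.inl y') → α.r (Sum.inr y) (Sum.inr y')) :
    (∀ x x', (pmul α γ).r (Sum.inl x) (Sum.inl x') ↔ α.r (Sum.inl x) (Sum.inl x')) ∧
    (∀ x z, (pmul α γ).r (Sum.inl x) (Sum.inr z) ↔
      ∃ y, α.r (Sum.inl x) (Sum.inr y) ∧ γ.r (Sum.inl y) (Sum.inr z)) ∧
    (∀ z z', (pmul α γ).r (Sum.inr z) (Sum.inr z') ↔ γ.r (Sum.inr z) (Sum.inr z') ∨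
      ∃ y y', γ.r (Sum.inl y) (Sum.inr z) ∧ γ.r (Sum.inl y') (Sum.inr z') ∧
        α.r (Sum.inr y) (Sum.inr y')) := by
  obtain ⟨h1, h2, h3⟩ := pmul_c (α := flip γ) (γ := flip α) h
  rw [pmul_flip]
  refine ⟨fun x x' => ?_, fun x z => ?_, fun z z' => ?_⟩
  · rw [flip_ll, h3]; rfl
  · rw [flip_lr, h2]
    constructor
    · rintro ⟨y, h, h'⟩; exact ⟨y, flip_lr.1 h', flip_lr.1 h⟩
    · rintro ⟨y, h, h'⟩; exact ⟨y, flip_lr.2 h', flip_lr.2 h⟩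
  · rw [flip_rr, h1]
    simp only [flip_ll, flip_lr]

theorem Phi_zero {α γ : PM n} (hf : ∀ y, (∃ z, γ.r (Sum.inl y) (Sum.inr z)) ∨
    (∃ x, α.r (Sum.inl x) (Sum.inr y)) ∨
    (∃ x y', α.r (Sum.inl x) (Sum.inr y') ∧ γ.r (Sum.inl y') (Sum.inl y)) ∨
    (∃ z y', γ.r (Sum.inl y') (Sum.inr z) ∧ α.r (Sum.inr y') (Sum.inr y))) : Phi α γ = 0 := by
  rw [Phi_eq, Nat.card_eq_zero]
  left
  constructor
  rintro ⟨c, h1, h2⟩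
  induction c using Quotient.inductionOn with
  | h u =>
  rcases u with y | z
  · rcases hf y with ⟨z, hz⟩ | ⟨x, hx⟩ | ⟨x, y', hx, hy⟩ | ⟨z, y', hz, hy⟩
    · exact h1 z (Quotient.sound (G_of_right (γ.iseqv.symm hz)))
    · exact h2 y ⟨x, hx⟩ rfl
    · exact h2 y' ⟨x, hx⟩ (Quotient.sound (G_of_right hy))
    · exact h1 z (Quotient.sound (G_trans (G_symm (G_of_right hz)) (G_of_left hy)))
  · exact h1 z rfl

/-- Labelled partitions. -/
def lab {X : Type*} (g f : Fin n → X) : PM n := Setoid.ker (Sum.elim g f)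

section lab
variable {X : Type*} {g f : Fin n → X}
theorem lab_ll {x y} : (lab g f).r (Sum.inl x) (Sum.inl y) ↔ g x = g y := Iff.rfl
theorem lab_lr {x y} : (lab g f).r (Sum.inl x) (Sum.inr y) ↔ g x = f y := Iff.rfl
theorem lab_rr {x y} : (lab g f).r (Sum.inr x) (Sum.inr y) ↔ f x = f y := Iff.rfl
theorem flip_lab : flip (lab g f) = lab f g := by
  apply pm_ext
  · intro x y; exact Iff.rfl
  · intro x y; exact Iff.rfl
  · intro x y; rw [flip_lr, lab_lr, lab_lr, eq_comm]
end lab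

/-- The identity partition. -/
def one : PM n := lab id id

theorem pmul_one (α : PM n) : pmul α one = α := by
  have h : ∀ y y', (one : PM n).r (Sum.inl y) (Sum.inl y') → α.r (Sum.inr y) (Sum.inr y') := by
    rintro y y' h
    have h : y = y' := h
    rw [h]
  obtain ⟨h1, h2, h3⟩ := pmul_d h
  have e : ∀ y z : Fin n, (one : PM n).r (Sum.inl y) (Sum.inr z) ↔ y = z := fun _ _ => Iff.rfl
  have e' : ∀ y z : Fin n, (one : PM n).r (Sum.inr y) (Sum.inr z) ↔ y = z := fun _ _ => Iff.rfl
  apply pm_ext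
  · exact h1
  · intro z z'; rw [h3]; simp only [e, e']
    constructor
    · rintro (rfl | ⟨y, y', rfl, rfl, h⟩)
      · exact α.iseqv.refl _
      · exact h
    · intro h; exact Or.inr ⟨_, _, rfl, rfl, h⟩
  · intro x y; rw [h2]; simp [e]

/-! ### Green's relations -/

theorem range_le {α β : PM n} (hk : krS α = krS β) (hd : ∀ x, dm α x ↔ dm β x) (γ : PM n) :
    ∃ γ', pmul β γ' = pmul α γ := by
  classical
  have hk' : ∀ x x', α.r (Sum.inl x) (Sum.inl x') ↔ β.r (Sum.inl x) (Sum.inl x') := fun x x' => by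
    rw [← krS_r, ← krS_r, hk]
  set ω := pmul α γ with hω
  have w1 : ∀ x x', α.r (Sum.inl x) (Sum.inl x') → ω.r (Sum.inl x) (Sum.inl x') := fun x x' h =>
    pmul_ll.2 (Or.inl h)
  have w2 : ∀ x x', ω.r (Sum.inl x) (Sum.inl x') → ¬ dm α x → α.r (Sum.inl x) (Sum.inl x') := by
    intro x x' h hx
    rcases pmul_ll.1 h with h | ⟨y, _, h, _⟩
    · exact h
    · exact absurd ⟨y, h⟩ hx
  have w3 : ∀ x z, ω.r (Sum.inl x) (Sum.inr z) → dm α x := by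
    intro x z h
    obtain ⟨y, h, _⟩ := pmul_lr.1 h
    exact ⟨y, h⟩
  let m : Fin n → Option (Quotient ω) := fun y =>
    if h : cd β y then some (Quotient.mk _ (Sum.inl h.choose)) else none
  let k : Fin n → Option (Quotient ω) := fun z => some (Quotient.mk _ (Sum.inr z))
  have hm : ∀ x y, β.r (Sum.inl x) (Sum.inr y) → m y = some (Quotient.mk _ (Sum.inl x)) := by
    intro x y h
    have hc : cd β y := ⟨x, h⟩
    simp only [m, hc, dif_pos]
    congr 1
    apply Quotient.sound
    apply w1
    rw [hk']
    exact β.iseqv.trans hc.choose_spec (β.iseqv.symm h)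
  have hc : ∀ y y', β.r (Sum.inr y) (Sum.inr y') → (lab m k).r (Sum.inl y) (Sum.inl y') := by
    intro y y' h
    rw [lab_ll]
    by_cases hy : cd β y
    · obtain ⟨x, hx⟩ := hy
      rw [hm x y hx, hm x y' (β.iseqv.trans hx h)]
    · have hy' : ¬ cd β y' := fun ⟨x, hx⟩ => hy ⟨x, β.iseqv.trans hx (β.iseqv.symm h)⟩
      simp only [m, hy, hy', dif_neg, not_false_eq_true]
  obtain ⟨h1, h2, h3⟩ := pmul_c hc
  refine ⟨lab m k, pm_ext ?_ ?_ ?_⟩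
  · intro x x'
    rw [h1]
    constructor
    · rintro (h | ⟨y, y', hy, hy', h⟩)
      · exact w1 _ _ ((hk' _ _).2 h)
      · rw [lab_ll, hm _ _ hy, hm _ _ hy'] at h
        exact Quotient.exact (Option.some.inj h)
    · intro h
      by_cases hx : dm α x
      · by_cases hx' : dm α x'
        · obtain ⟨y, hy⟩ := (hd x).1 hx
          obtain ⟨y', hy'⟩ := (hd x').1 hx'
          refine Or.inr ⟨y, y', hy, hy', ?_⟩
          rw [lab_ll, hm _ _ hy, hm _ _ hy']
          exact congrArg some (Quotient.sound h)
        · exact Or.inl ((hk' _ _).1 (α.iseqv.symm (w2 _ _ (ω.iseqv.symm h) hx')))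
      · exact Or.inl ((hk' _ _).1 (w2 _ _ h hx))
  · intro z z'
    rw [h3, lab_rr]
    exact ⟨fun h => Quotient.exact (Option.some.inj h), fun h => congrArg some (Quotient.sound h)⟩
  · intro x z
    rw [h2]
    constructor
    · rintro ⟨y, hy, h⟩
      rw [lab_lr, hm _ _ hy] at h
      exact Quotient.exact (Option.some.inj h)
    · intro h
      obtain ⟨y, hy⟩ := (hd x).1 (w3 _ _ h)
      refine ⟨y, hy, ?_⟩
      rw [lab_lr, hm _ _ hy]
      exact congrArg some (Quotient.sound h)

theorem greenR_iff {α β : PM n} : greenR pmul α β ↔ krS α = krS β ∧ ∀ x, dm α x ↔ dm β x := by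
  constructor
  · intro h
    have key : ∀ α β : PM n, Set.range (pmul α) = Set.range (pmul β) →
        (∀ x x', β.r (Sum.inl x) (Sum.inl x') → α.r (Sum.inl x) (Sum.inl x')) ∧
        ∀ x, dm α x → dm β x := by
      intro α β h
      have : α ∈ Set.range (pmul β) := by rw [← h]; exact ⟨one, pmul_one α⟩
      obtain ⟨γ, rfl⟩ := this
      refine ⟨fun x x' h => pmul_ll.2 (Or.inl h), ?_⟩
      rintro x ⟨z, hz⟩
      obtain ⟨y, hy, _⟩ := pmul_lr.1 hz
      exact ⟨y, hy⟩
    have a := key α β h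
    have b := key β α h.symm
    exact ⟨Setoid.ext fun x x' => ⟨b.1 x x', a.1 x x'⟩, fun x => ⟨a.2 x, b.2 x⟩⟩
  · rintro ⟨h1, h2⟩
    apply Set.Subset.antisymm
    · rintro _ ⟨γ, rfl⟩
      exact range_le h1 h2 γ
    · rintro _ ⟨γ, rfl⟩
      exact range_le h1.symm (fun x => (h2 x).symm) γ

theorem greenL_flip {α β : PM n} : greenL pmul α β ↔ greenR pmul (flip α) (flip β) := by
  have key : ∀ α : PM n, Set.range (pmul (flip α)) = Set.image flip (Set.range (fun a => pmul a α)) := by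
    intro α
    ext ω
    constructor
    · rintro ⟨γ, rfl⟩
      exact ⟨_, ⟨flip γ, rfl⟩, by simp only [flip_pmul, flip_flip]⟩
    · rintro ⟨_, ⟨γ, rfl⟩, rfl⟩
      exact ⟨flip γ, by simp only [flip_pmul]⟩
  have inj : Function.Injective (flip : PM n → PM n) := fun a b h => by
    rw [← flip_flip a, h, flip_flip]
  unfold greenL greenR
  rw [key, key]
  exact ((Set.image_injective.2 inj).eq_iff).symm

theorem krS_flip (α : PM n) : krS (flip α) = ckS α := rfl
theorem ckS_flip (α : PM n) : ckS (flip α) = krS α := rfl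
theorem dm_flip (α : PM n) (x) : dm (flip α) x ↔ cd α x := by
  simp only [dm, cd, flip_lr]
theorem cd_flip (α : PM n) (x) : cd (flip α) x ↔ dm α x := by
  simp only [dm, cd, flip_lr]

theorem greenL_iff {α β : PM n} : greenL pmul α β ↔ ckS α = ckS β ∧ ∀ x, cd α x ↔ cd β x := by
  rw [greenL_flip, greenR_iff, krS_flip, krS_flip]
  simp only [dm_flip]

/-- Green's H relation, concretely. -/
theorem greenH_iff {α β : PM n} : greenH pmul α β ↔ (krS α = krS β ∧ ∀ x, dm α x ↔ dm β x) ∧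
    (ckS α = ckS β ∧ ∀ x, cd α x ↔ cd β x) := by
  unfold greenH
  rw [greenR_iff, greenL_iff]

theorem greenH_flip {α β : PM n} : greenH pmul (flip α) (flip β) ↔ greenH pmul α β := by
  rw [greenH_iff, greenH_iff]
  simp only [krS_flip, ckS_flip, dm_flip, cd_flip]
  exact and_comm

theorem greenH_symm {α β : PM n} (h : greenH pmul α β) : greenH pmul β α := ⟨h.1.symm, h.2.symm⟩

/-! hats -/
theorem krS_hat (α : PM n) : krS (hat α) = krS α := by
  apply Setoid.ext; intro x y
  exact ⟨fun h => h.1, fun h => ⟨h, rfl⟩⟩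
theorem ckS_hat (α : PM n) : ckS (hat α) = ckS α := by
  apply Setoid.ext; intro x y
  exact ⟨fun h => h.1, fun h => ⟨h, rfl⟩⟩
theorem hat_lr (α : PM n) (x y) : ¬ (hat α).r (Sum.inl x) (Sum.inr y) := by
  rintro ⟨_, h⟩; simp [side] at h
theorem hat_eq_iff {α β : PM n} : hat α = hat β ↔ krS α = krS β ∧ ckS α = ckS β := by
  constructor
  · intro h
    rw [← krS_hat α, ← ckS_hat α, h, krS_hat, ckS_hat]
    exact ⟨rfl, rfl⟩
  · rintro ⟨h1, h2⟩
    rw [← krS_hat α, ← krS_hat β] at h1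
    rw [← ckS_hat α, ← ckS_hat β] at h2
    apply pm_ext
    · intro x y; rw [← krS_r, h1, krS_r]
    · intro x y; rw [← ckS_r, h2, ckS_r]
    · intro x y; exact ⟨fun h => absurd h (hat_lr _ _ _), fun h => absurd h (hat_lr _ _ _)⟩
theorem dm_hat (α : PM n) (x) : ¬ dm (hat α) x := fun ⟨y, h⟩ => hat_lr α x y h
theorem cd_hat (α : PM n) (x) : ¬ cd (hat α) x := fun ⟨y, h⟩ => hat_lr α y x h
theorem greenL_hat {α β : PM n} : greenL pmul (hat α) (hat β) ↔ ckS α = ckS β := by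
  rw [greenL_iff, ckS_hat, ckS_hat]
  simp [cd_hat]
theorem greenR_hat {α β : PM n} : greenR pmul (hat α) (hat β) ↔ krS α = krS β := by
  rw [greenR_iff, krS_hat, krS_hat]
  simp [dm_hat]


end Part2

section Part3

/-! ### Abstract data describing congruences -/

/-- Data for rows 0 and 1. -/
structure D1 where
  t0 : ℕ → ℕ → Prop
  t1 : ℕ → ℕ → Prop
  E : ℕ → ℕ → Prop
  lam : ℕ → Prop
  rho : ℕ → Prop
  up : ℕ → Prop
  dn : ℕ → Prop

/-- Validity for rows 0 and 1. -/
structure D1.Valid (D : D1) : Prop where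
  t0_refl : ∀ i, D.t0 i i
  t0_symm : ∀ {i j}, D.t0 i j → D.t0 j i
  t0_trans : ∀ {i j k}, D.t0 i j → D.t0 j k → D.t0 i k
  t0_shift : ∀ {i j}, D.t0 i j → D.t0 (i + 1) (j + 1)
  t1_refl : ∀ i, D.t1 i i
  t1_symm : ∀ {i j}, D.t1 i j → D.t1 j i
  t1_trans : ∀ {i j k}, D.t1 i j → D.t1 j k → D.t1 i k
  t1_shift : ∀ {i j}, D.t1 i j → D.t1 (i + 1) (j + 1)
  t1_t0 : ∀ {i j}, D.t1 i j → D.t0 i j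
  E_shift : ∀ {i j}, D.E i j → D.E (i + 1) (j + 1)
  E_t1 : ∀ {i i' j}, D.E i j → D.t1 i i' → D.E i' j
  E_t0 : ∀ {i j j'}, D.E i j → D.t0 j j' → D.E i j'
  E_inj1 : ∀ {i i' j}, D.E i j → D.E i' j → D.t1 i i'
  E_inj0 : ∀ {i j j'}, D.E i j → D.E i j' → D.t0 j j'
  E_next : ∀ {i j}, D.E i j → D.t0 i (j + 1)
  E_dn : ∀ {i j}, D.E i j → D.dn i
  E_up : ∀ {i j}, D.E i j → D.up i
  dn_E : ∀ {i}, D.dn i → D.E (i + 1) i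
  up_E : ∀ {i}, D.up i → D.E (i + 1) i
  dn_t1 : ∀ {i j}, D.dn i → D.t1 i j → D.dn j
  up_t1 : ∀ {i j}, D.up i → D.t1 i j → D.up j
  lam_t0 : ∀ {i j}, D.lam i → D.t0 i j → D.lam j
  rho_t0 : ∀ {i j}, D.rho i → D.t0 i j → D.rho j
  lam_next : ∀ {i}, D.lam i → D.t0 i (i + 1)
  rho_next : ∀ {i}, D.rho i → D.t0 i (i + 1)

/-- Full data. -/
structure Dat extends D1 where
  Re : ℕ → ℕ → Prop
  NN : (q : ℕ) → ℕ → ℕ → Equiv.Perm (Fin q) → Prop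

/-- Rees part of row `q`. -/
def Dat.Rs (D : Dat) : ℕ → ℕ → Prop
  | 0, i => D.lam i ∧ D.rho i
  | 1, i => D.E i i ∧ D.lam i ∧ D.rho i
  | (q + 2), i => D.Re (q + 2) i

/-- The index congruence of row `q`. -/
def Dat.T (D : Dat) : ℕ → ℕ → ℕ → Prop
  | 0, i, j => D.t0 i j
  | 1, i, j => D.t1 i j
  | (q + 2), i, j => D.NN (q + 2) i j 1

/-- Validity of data. -/
structure Dat.Valid (n : ℕ) (D : Dat) : Prop extends D.toD1.Valid where
  nn_one : ∀ {q} i, 2 ≤ q → q ≤ n → D.NN q i i 1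
  nn_inv : ∀ {q i j π}, 2 ≤ q → q ≤ n → D.NN q i j π → D.NN q j i π⁻¹
  nn_mul : ∀ {q i j k π π'}, 2 ≤ q → q ≤ n → D.NN q i j π → D.NN q j k π' → D.NN q i k (π * π')
  nn_conj : ∀ {q i j π} τ, 2 ≤ q → q ≤ n → D.NN q i j π → D.NN q i j (τ⁻¹ * π * τ)
  nn_shift : ∀ {q i j π}, 2 ≤ q → q ≤ n → D.NN q i j π → D.NN q (i + 1) (j + 1) π
  re_nn : ∀ {q i j π}, 2 ≤ q → q ≤ n → D.NN q i j π → D.Re q i → D.Re q j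
  re_shift : ∀ {q i}, 2 ≤ q → q ≤ n → D.Re q i → D.Re q (i + 1)
  re_down : ∀ {q i}, 2 ≤ q → q ≤ n → D.Re q i → D.Rs (q - 1) i
  t_down : ∀ {q i j}, 2 ≤ q → q ≤ n → D.NN q i j 1 → D.T (q - 1) i j
  nn_drop : ∀ {q i j π}, 3 ≤ q → q ≤ n → π ≠ 1 → D.NN q i j π → D.Re (q - 1) i
  nn_drop2 : ∀ {i j π}, 2 ≤ n → π ≠ 1 → D.NN 2 i j π → D.t1 i j ∧ D.up i ∧ D.dn i

/-- (0,0) pairs. -/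
def rel00 (D : D1) (i : ℕ) (α : PM n) (j : ℕ) (β : PM n) : Prop :=
  D.t0 i j ∧ (D.lam i ∨ krS α = krS β) ∧ (D.rho i ∨ ckS α = ckS β)
/-- (1,1) pairs. -/
def rel11 (D : D1) (i : ℕ) (α : PM n) (j : ℕ) (β : PM n) : Prop :=
  D.t1 i j ∧ ((D.E i i ∧ D.lam i) ∨ (krS α = krS β ∧ (D.dn i ∨ dm α = dm β))) ∧
    ((D.E i i ∧ D.rho i) ∨ (ckS α = ckS β ∧ (D.up i ∨ cd α = cd β)))
/-- (1,0) pairs. -/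
def rel10 (D : D1) (i : ℕ) (α : PM n) (j : ℕ) (β : PM n) : Prop :=
  D.E i j ∧ (D.lam j ∨ krS α = krS β) ∧ (D.rho j ∨ ckS α = ckS β)

/-- pairs of rank at most one. -/
def rel1 (D : D1) (i : ℕ) (α : PM n) (j : ℕ) (β : PM n) : Prop :=
  (rnk α = 0 ∧ rnk β = 0 ∧ rel00 D i α j β) ∨ (rnk α = 1 ∧ rnk β = 1 ∧ rel11 D i α j β) ∨
  (rnk α = 1 ∧ rnk β = 0 ∧ rel10 D i α j β) ∨ (rnk α = 0 ∧ rnk β = 1 ∧ rel10 D j β i α)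

/-- The relation associated with data. -/
def rel (D : Dat) (a b : ℕ × PM n) : Prop :=
  (D.Rs (rnk a.2) a.1 ∧ D.Rs (rnk b.2) b.1) ∨ rel1 D.toD1 a.1 a.2 b.1 b.2 ∨
  (∃ q, 2 ≤ q ∧ rnk a.2 = q ∧ rnk b.2 = q ∧ greenH pmul a.2 b.2 ∧
    pdIn q (D.NN q a.1 b.1) a.2 b.2)

/-- Dual data. -/
def D1.dual (D : D1) : D1 := ⟨D.t0, D.t1, D.E, D.rho, D.lam, D.dn, D.up⟩
/-- Dual data. -/
def Dat.dual (D : Dat) : Dat := ⟨D.toD1.dual, D.Re, fun q i j π => D.NN q j i π⟩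

theorem D1.Valid.dual {D : D1} (h : D.Valid) : D.dual.Valid :=
  ⟨h.t0_refl, h.t0_symm, h.t0_trans, h.t0_shift, h.t1_refl, h.t1_symm, h.t1_trans, h.t1_shift,
  h.t1_t0, h.E_shift, h.E_t1, h.E_t0, h.E_inj1, h.E_inj0, h.E_next, h.E_up, h.E_dn, h.up_E, h.dn_E,
  h.up_t1, h.dn_t1, h.rho_t0, h.lam_t0, h.rho_next, h.lam_next⟩

theorem Dat.dual_Rs (D : Dat) (q i) : D.dual.Rs q i ↔ D.Rs q i := by
  match q with
  | 0 => exact and_comm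
  | 1 => exact and_congr_right fun _ => and_comm
  | (q + 2) => exact Iff.rfl

theorem Dat.Valid.T_symm {D : Dat} (h : D.Valid n) {q i j} (hq : q ≤ n) (hT : D.T q i j) : D.T q j i := by
  match q, hT with
  | 0, hT => exact h.t0_symm hT
  | 1, hT => exact h.t1_symm hT
  | (q + 2), hT =>
    have := h.nn_inv (by omega) hq hT
    rwa [inv_one] at this

theorem Dat.dual_T {D : Dat} (h : D.Valid n) (q i j) (hq : q ≤ n) : D.dual.T q i j ↔ D.T q i j := by
  match q, hq with
  | 0, hq => exact Iff.rfl
  | 1, hq => exact Iff.rfl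
  | (q + 2), hq => exact ⟨fun hT => h.T_symm hq hT, fun hT => h.T_symm hq hT⟩

theorem Dat.Valid.nn_drop' {D : Dat} (h : D.Valid n) {q i j π} (hq : 3 ≤ q) (hq' : q ≤ n) (hp : π ≠ 1)
    (hN : D.NN q i j π) : D.Re (q - 1) j :=
  h.nn_drop hq hq' (inv_ne_one.2 hp) (h.nn_inv (by omega) hq' hN)

theorem Dat.Valid.dual {D : Dat} (h : D.Valid n) : D.dual.Valid n where
  toValid := h.toValid.dual
  nn_one i := h.nn_one i
  nn_inv h1 h2 h3 := h.nn_inv h1 h2 h3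
  nn_mul {q i j k π π'} h1 h2 h3 h4 := by
    have := h.nn_mul h1 h2 h4 h3
    have := h.nn_conj π' h1 h2 this
    have e : π'⁻¹ * (π' * π) * π' = π * π' := by group
    rwa [e] at this
  nn_conj τ h1 h2 h3 := h.nn_conj τ h1 h2 h3
  nn_shift h1 h2 h3 := h.nn_shift h1 h2 h3
  re_nn h1 h2 h3 h4 := h.re_nn h1 h2 (h.nn_inv h1 h2 h3) h4
  re_shift h1 h2 h3 := h.re_shift h1 h2 h3
  re_down h1 h2 h3 := (D.dual_Rs _ _).2 (h.re_down h1 h2 h3)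
  t_down h1 h2 h3 := (D.dual_T h _ _ _ (by omega)).2 (h.T_symm (by omega) (h.t_down h1 h2 h3))
  nn_drop h1 h2 h3 h4 := h.nn_drop' h1 h2 h3 h4
  nn_drop2 h1 h2 h3 := by
    obtain ⟨a, b, c⟩ := h.nn_drop2 h1 h2 h3
    exact ⟨h.t1_symm a, h.dn_t1 c a, h.up_t1 b a⟩

/-! ### Rank at most one -/

theorem rnk_pos_iff {α : PM n} : 1 ≤ rnk α ↔ ∃ x y, α.r (Sum.inl x) (Sum.inr y) := by
  rw [le_rnk_iff]
  constructor
  · rintro ⟨a, b, h, _⟩; exact ⟨_, _, h 0⟩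
  · rintro ⟨x, y, h⟩; exact ⟨fun _ => x, fun _ => y, fun _ => h, fun s t _ => Subsingleton.elim s t⟩

theorem rnk_le_one {α : PM n} (h : rnk α ≤ 1) {x x' y y'} (h1 : α.r (Sum.inl x) (Sum.inr y))
    (h2 : α.r (Sum.inl x') (Sum.inr y')) : α.r (Sum.inl x) (Sum.inl x') := by
  by_contra hc
  have : 2 ≤ rnk α := le_rnk_iff.2 ⟨![x, x'], ![y, y'], ?_, ?_⟩
  · omega
  · intro s; fin_cases s <;> simpa
  · intro s t; fin_cases s <;> fin_cases t <;> simp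
    · exact hc
    · exact fun h => hc (α.iseqv.symm h)

theorem lr_of_le_one {α : PM n} (h : rnk α ≤ 1) {x y} (h1 : dm α x) (h2 : cd α y) :
    α.r (Sum.inl x) (Sum.inr y) := by
  obtain ⟨y', h1⟩ := h1
  obtain ⟨x', h2⟩ := h2
  exact α.iseqv.trans (rnk_le_one h h1 h2) h2

theorem ext_le_one {α β : PM n} (ha : rnk α ≤ 1) (hb : rnk β ≤ 1) (h1 : krS α = krS β)
    (h2 : ckS α = ckS β) (h3 : dm α = dm β) (h4 : cd α = cd β) : α = β := by
  apply pm_ext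
  · intro x y; rw [← krS_r, h1, krS_r]
  · intro x y; rw [← ckS_r, h2, ckS_r]
  · intro x y
    exact ⟨fun h => lr_of_le_one hb (h3 ▸ ⟨y, h⟩) (h4 ▸ ⟨x, h⟩),
      fun h => lr_of_le_one ha (h3 ▸ ⟨y, h⟩) (h4 ▸ ⟨x, h⟩)⟩

theorem rnk_zero_cd {α : PM n} (h : rnk α = 0) (y) : ¬ cd α y := by
  rintro ⟨x, hx⟩
  have := rnk_pos_iff.2 ⟨x, y, hx⟩
  omega
theorem rnk_zero_dm {α : PM n} (h : rnk α = 0) (y) : ¬ dm α y := by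
  rintro ⟨x, hx⟩
  have := rnk_pos_iff.2 ⟨y, x, hx⟩
  omega
theorem rnk_zero_of {α : PM n} (h : ∀ x y, ¬ α.r (Sum.inl x) (Sum.inr y)) : rnk α = 0 := by
  by_contra hc
  obtain ⟨x, y, hx⟩ := rnk_pos_iff.1 (Nat.one_le_iff_ne_zero.2 hc)
  exact h _ _ hx

/-- Number of components not meeting the bottom. -/
noncomputable def FF (L : Setoid (Fin n)) (γ : PM n) : ℕ :=
  Set.ncard {c : Quotient (G L γ) | ∀ z, Quotient.mk _ (Sum.inr z) ≠ c}

/-- The lower kernel of a product. -/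
def botS (L : Setoid (Fin n)) (γ : PM n) : Setoid (Fin n) := Setoid.comap Sum.inr (G L γ)

theorem Phi_ncard (α γ : PM n) : Phi α γ = Set.ncard {c : Quotient (G (ckS α) γ) |
    (∀ z, Quotient.mk _ (Sum.inr z) ≠ c) ∧ ∀ y, cd α y → Quotient.mk _ (Sum.inl y) ≠ c} := by
  rw [Phi_eq]; rfl

theorem Phi_rank {α : PM n} (h : rnk α ≤ 1) (γ : PM n) :
    Phi α γ + rnk α = FF (ckS α) γ + rnk (pmul α γ) := by
  rw [Phi_ncard, FF]
  by_cases h0 : rnk α = 0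
  · have h1 : rnk (pmul α γ) = 0 := by have := rnk_pmul_le_left α γ; omega
    rw [h0, h1]
    congr 2
    ext c
    exact ⟨fun hc => hc.1, fun hc => ⟨hc, fun y hy => absurd hy (rnk_zero_cd h0 y)⟩⟩
  · have h1 : rnk α = 1 := by omega
    obtain ⟨x0, y0, h2⟩ := rnk_pos_iff.1 h1.ge
    have hy0 : ∀ y, cd α y → Quotient.mk (G (ckS α) γ) (Sum.inl y) = Quotient.mk _ (Sum.inl y0) := by
      rintro y ⟨x, hx⟩
      apply Quotient.sound
      apply G_of_left
      exact α.iseqv.trans (α.iseqv.symm hx) (α.iseqv.trans (rnk_le_one h hx h2) h2)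
    by_cases hz : ∃ z, (G (ckS α) γ).r (Sum.inl y0) (Sum.inr z)
    · obtain ⟨z, hz⟩ := hz
      have h3 : rnk (pmul α γ) = 1 := by
        have := rnk_pmul_le_left α γ
        have := rnk_pos_iff.2 ⟨x0, z, pmul_lr.2 ⟨y0, h2, hz⟩⟩
        omega
      rw [h1, h3]
      congr 2
      ext c
      refine ⟨fun hc => hc.1, fun hc => ⟨hc, fun y hy => ?_⟩⟩
      rw [hy0 y hy, show Quotient.mk (G (ckS α) γ) (Sum.inl y0) = Quotient.mk _ (Sum.inr z) from
        Quotient.sound hz]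
      exact hc z
    · have h3 : rnk (pmul α γ) = 0 := by
        apply rnk_zero_of
        intro x z hxz
        obtain ⟨y, hy, hyz⟩ := pmul_lr.1 hxz
        exact hz ⟨z, G_trans (G_symm (Quotient.exact (hy0 y ⟨x, hy⟩))) hyz⟩
      rw [h1, h3]
      rw [← Set.ncard_insert_of_notMem (a := Quotient.mk _ (Sum.inl y0))]
      · rw [Nat.add_zero]
        congr 1
        ext c
        constructor
        · rintro (rfl | hc)
          · intro z hc
            exact hz ⟨z, G_symm (Quotient.exact hc)⟩
          · exact hc.1
        · intro hc
          by_cases e : c = Quotient.mk _ (Sum.inl y0)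
          · exact Or.inl e
          · refine Or.inr ⟨hc, fun y hy hc' => e ?_⟩
            rw [← hc', hy0 y hy]
      · rintro ⟨_, hc⟩
        exact hc y0 ⟨x0, h2⟩ rfl

theorem krS_pmul {α : PM n} (h : rnk α ≤ 1) (γ : PM n) : krS (pmul α γ) = krS α := by
  apply Setoid.ext
  intro x x'
  constructor
  · intro hx
    rcases pmul_ll.1 hx with h | ⟨y, y', h1, h2, _⟩
    · exact h
    · exact rnk_le_one h h1 h2
  · intro hx; exact pmul_ll.2 (Or.inl hx)

theorem ckS_pmul (α γ : PM n) : ckS (pmul α γ) = botS (ckS α) γ := by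
  apply Setoid.ext
  intro z z'
  exact pmul_rr

theorem cd_pmul (α γ : PM n) : cd (pmul α γ) = fun z => ∃ y, cd α y ∧ (G (ckS α) γ).r (Sum.inl y) (Sum.inr z) := by
  funext z
  apply propext
  constructor
  · rintro ⟨x, hx⟩
    obtain ⟨y, hy, h⟩ := pmul_lr.1 hx
    exact ⟨y, ⟨x, hy⟩, h⟩
  · rintro ⟨y, ⟨x, hx⟩, h⟩
    exact ⟨x, pmul_lr.2 ⟨y, hx, h⟩⟩

theorem dm_pmul {α γ : PM n} (h : rnk (pmul α γ) = rnk α) (h' : rnk α ≤ 1) : dm (pmul α γ) = dm α := by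
  funext x
  apply propext
  constructor
  · rintro ⟨z, hz⟩
    obtain ⟨y, hy, _⟩ := pmul_lr.1 hz
    exact ⟨y, hy⟩
  · rintro ⟨y, hy⟩
    have : 1 ≤ rnk (pmul α γ) := by rw [h]; exact rnk_pos_iff.2 ⟨_, _, hy⟩
    obtain ⟨x', z, hx'⟩ := rnk_pos_iff.1 this
    obtain ⟨y', hy', hyz⟩ := pmul_lr.1 hx'
    exact ⟨z, pmul_lr.2 ⟨y', lr_of_le_one h' ⟨y, hy⟩ ⟨x', hy'⟩, hyz⟩⟩

theorem rnk_pos_iff_cd {α : PM n} : 1 ≤ rnk α ↔ ∃ y, cd α y := by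
  rw [rnk_pos_iff]
  exact ⟨fun ⟨x, y, h⟩ => ⟨y, x, h⟩, fun ⟨y, x, h⟩ => ⟨x, y, h⟩⟩


end Part3

section Part4

namespace D1.Valid
variable {D : D1} (h : D.Valid)
include h

theorem t0_add {i j} (k : ℕ) (hh : D.t0 i j) : D.t0 (i + k) (j + k) := by
  induction k with
  | zero => exact hh
  | succ k ih => exact h.t0_shift ih
theorem t1_add {i j} (k : ℕ) (hh : D.t1 i j) : D.t1 (i + k) (j + k) := by
  induction k with
  | zero => exact hh
  | succ k ih => exact h.t1_shift ih
theorem E_add {i j} (k : ℕ) (hh : D.E i j) : D.E (i + k) (j + k) := by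
  induction k with
  | zero => exact hh
  | succ k ih => exact h.E_shift ih
theorem lam_run {i} (k : ℕ) (hh : D.lam i) : D.t0 i (i + k) := by
  induction k with
  | zero => exact h.t0_refl i
  | succ k ih => exact h.t0_trans ih (h.t0_add k (h.lam_next hh) |> fun e => by
      rwa [Nat.add_right_comm] at e)
theorem lam_add {i} (k : ℕ) (hh : D.lam i) : D.lam (i + k) := h.lam_t0 hh (h.lam_run k hh)
theorem lam_E {i j} (hE : D.E i j) : D.lam j ↔ (D.E i i ∧ D.lam i) := by
  constructor
  · intro hl
    have h1 : D.t0 j i := h.t0_trans (h.lam_next hl) (h.t0_symm (h.E_next hE))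
    exact ⟨h.E_t0 hE h1, h.lam_t0 hl h1⟩
  · rintro ⟨h1, h2⟩
    exact h.lam_t0 h2 (h.E_inj0 h1 hE)
theorem lam1_run {i} (k : ℕ) (hE : D.E i i) (hl : D.lam i) : D.t1 i (i + k) := by
  have h1 := h.E_add k hE
  exact h.E_inj1 (h.E_t0 hE (h.lam_run k hl)) h1
theorem lam1_add {i} (k : ℕ) (hE : D.E i i) (hl : D.lam i) : D.E (i + k) (i + k) ∧ D.lam (i + k) :=
  ⟨h.E_add k hE, h.lam_add k hl⟩
theorem rho_run {i} (k : ℕ) (hh : D.rho i) : D.t0 i (i + k) := h.dual.lam_run k hh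
theorem rho_add {i} (k : ℕ) (hh : D.rho i) : D.rho (i + k) := h.dual.lam_add k hh
theorem rho_E {i j} (hE : D.E i j) : D.rho j ↔ (D.E i i ∧ D.rho i) := h.dual.lam_E hE
theorem rho1_run {i} (k : ℕ) (hE : D.E i i) (hl : D.rho i) : D.t1 i (i + k) := h.dual.lam1_run k hE hl
theorem dn_add {i} (k : ℕ) (hh : D.dn i) : D.dn (i + k) := by
  induction k with
  | zero => exact hh
  | succ k ih => exact h.E_dn (h.dn_E ih)
theorem up_add {i} (k : ℕ) (hh : D.up i) : D.up (i + k) := h.dual.dn_add k hh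
end D1.Valid

/-! ### Rank at most one: equivalence -/
section
variable {D : D1}

theorem rel1_symm (h : D.Valid) {i j} {α β : PM n} (hr : rel1 D i α j β) : rel1 D j β i α := by
  rcases hr with ⟨h1, h2, h3, h4, h5⟩ | ⟨h1, h2, h3, h4, h5⟩ | hr | hr
  · refine Or.inl ⟨h2, h1, h.t0_symm h3, ?_, ?_⟩
    · exact h4.imp (fun e => h.lam_t0 e h3) Eq.symm
    · exact h5.imp (fun e => h.rho_t0 e h3) Eq.symm
  · refine Or.inr (Or.inl ⟨h2, h1, h.t1_symm h3, ?_, ?_⟩)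
    · refine h4.imp (fun e => ⟨h.E_t0 (h.E_t1 e.1 h3) (h.t1_t0 h3), h.lam_t0 e.2 (h.t1_t0 h3)⟩)
        (fun e => ⟨e.1.symm, e.2.imp (fun e => h.dn_t1 e h3) Eq.symm⟩)
    · refine h5.imp (fun e => ⟨h.E_t0 (h.E_t1 e.1 h3) (h.t1_t0 h3), h.rho_t0 e.2 (h.t1_t0 h3)⟩)
        (fun e => ⟨e.1.symm, e.2.imp (fun e => h.up_t1 e h3) Eq.symm⟩)
  · exact Or.inr (Or.inr (Or.inr ⟨hr.2.1, hr.1, hr.2.2⟩))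
  · exact Or.inr (Or.inr (Or.inl ⟨hr.2.1, hr.1, hr.2.2⟩))

theorem rel1_trans (h : D.Valid) {i j k} {α β γ : PM n} (hr : rel1 D i α j β) (hs : rel1 D j β k γ) :
    rel1 D i α k γ := by
  rcases hr with ⟨h1, h2, h3, h4, h5⟩ | ⟨h1, h2, h3, h4, h5⟩ | ⟨h1, h2, h3, h4, h5⟩ |
    ⟨h1, h2, h3, h4, h5⟩ <;>
  rcases hs with ⟨k1, k2, k3, k4, k5⟩ | ⟨k1, k2, k3, k4, k5⟩ | ⟨k1, k2, k3, k4, k5⟩ |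
    ⟨k1, k2, k3, k4, k5⟩ <;> try omega
  · -- 0 0 0
    refine Or.inl ⟨h1, k2, h.t0_trans h3 k3, ?_, ?_⟩
    · have := fun e => h.lam_t0 e (h.t0_symm h3); grind
    · have := fun e => h.rho_t0 e (h.t0_symm h3); grind
  · -- 0 0 1
    refine Or.inr (Or.inr (Or.inr ⟨h1, k2, h.E_t0 k3 (h.t0_symm h3), ?_, ?_⟩))
    · have := fun e => h.lam_t0 e (h.t0_symm h3); grind
    · have := fun e => h.rho_t0 e (h.t0_symm h3); grind
  · -- 1 1 1
    have hE : D.E j j → D.E i i := fun e =>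
      h.E_t0 (h.E_t1 e (h.t1_symm h3)) (h.t0_symm (h.t1_t0 h3))
    refine Or.inr (Or.inl ⟨h1, k2, h.t1_trans h3 k3, ?_, ?_⟩)
    · have := fun e => h.lam_t0 e (h.t0_symm (h.t1_t0 h3))
      have := fun e => h.dn_t1 e (h.t1_symm h3)
      grind
    · have := fun e => h.rho_t0 e (h.t0_symm (h.t1_t0 h3))
      have := fun e => h.up_t1 e (h.t1_symm h3)
      grind
  · -- 1 1 0
    have hE : D.E i k := h.E_t1 k3 (h.t1_symm h3)
    refine Or.inr (Or.inr (Or.inl ⟨h1, k2, hE, ?_, ?_⟩))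
    · have := h.lam_E hE; grind
    · have := h.rho_E hE; grind
  · -- 1 0 0
    have hE := h.E_t0 h3 k3
    refine Or.inr (Or.inr (Or.inl ⟨h1, k2, hE, ?_, ?_⟩))
    · have := fun e => h.lam_t0 e k3; grind
    · have := fun e => h.rho_t0 e k3; grind
  · -- 1 0 1
    refine Or.inr (Or.inl ⟨h1, k2, h.E_inj1 h3 k3, ?_, ?_⟩)
    · have := h.lam_E h3; have := h.E_dn h3; grind
    · have := h.rho_E h3; have := h.E_up h3; grind
  · -- 0 1 1
    have hE : D.E k i := h.E_t1 h3 k3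
    refine Or.inr (Or.inr (Or.inr ⟨h1, k2, hE, ?_, ?_⟩))
    · have := h.lam_E h3; grind
    · have := h.rho_E h3; grind
  · -- 0 1 0
    refine Or.inl ⟨h1, k2, h.E_inj0 h3 k3, ?_, ?_⟩
    · have := h.lam_E h3; have := h.lam_E k3; grind
    · have := h.rho_E h3; have := h.rho_E k3; grind

theorem rel1_mulR (h : D.Valid) {i j} {α β : PM n} (hr : rel1 D i α j β) (γ : PM n) :
    rel1 D (i + Phi α γ) (pmul α γ) (j + Phi β γ) (pmul β γ) := by
  -- the four cases, with the (0,1) case by symmetry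
  have main10 : ∀ {i j} {α β : PM n}, rnk α = 1 → rnk β = 0 → rel10 D i α j β →
      rel1 D (i + Phi α γ) (pmul α γ) (j + Phi β γ) (pmul β γ) := by
    rintro i j α β h1 h2 ⟨h3, h4, h5⟩
    have p1 := Phi_rank h1.le γ
    have p2 := Phi_rank (h2.le.trans zero_le_one) γ
    have q1 := rnk_pmul_le_left α γ
    have q2 := rnk_pmul_le_left β γ
    have r2 : rnk (pmul β γ) = 0 := by omega
    have kk : D.t0 (j + FF (ckS α) γ) (j + FF (ckS β) γ) := by
      rcases h5 with h5 | h5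
      · exact h.t0_trans (h.t0_symm (h.rho_run _ h5)) (h.rho_run _ h5)
      · rw [h5]; exact h.t0_refl _
    have k1 : krS (pmul α γ) = krS α := krS_pmul h1.le γ
    have k2 : krS (pmul β γ) = krS β := krS_pmul (by omega) γ
    have c : ckS α = ckS β → ckS (pmul α γ) = ckS (pmul β γ) := by
      intro e; rw [ckS_pmul, ckS_pmul, e]
    have e2 : Phi β γ = FF (ckS β) γ := by omega
    by_cases r1 : rnk (pmul α γ) = 1
    · have e1 : Phi α γ = FF (ckS α) γ := by omega
      refine Or.inr (Or.inr (Or.inl ⟨r1, r2, ?_, ?_, ?_⟩))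
      · rw [e1, e2]
        exact h.E_t0 (h.E_add _ h3) kk
      · rw [k1, k2]; exact h4.imp (h.lam_add _) id
      · exact h5.imp (h.rho_add _) c
    · have r1 : rnk (pmul α γ) = 0 := by omega
      have e1 : Phi α γ + 1 = FF (ckS α) γ := by omega
      have tt : D.t0 (i + Phi α γ) (j + FF (ckS β) γ) := by
        have := h.t0_add (Phi α γ) (h.E_next h3)
        rw [show j + 1 + Phi α γ = j + FF (ckS α) γ by omega] at this
        exact h.t0_trans this kk
      refine Or.inl ⟨r1, r2, ?_, ?_, ?_⟩
      · rw [e2]; exact tt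
      · rw [k1, k2]; exact h4.imp (fun e => h.lam_t0 (h.lam_add _ e) (h.t0_symm tt)) id
      · exact h5.imp (fun e => h.rho_t0 (h.rho_add _ e) (h.t0_symm tt)) c
  have main11 : ∀ {i j} {α β : PM n}, rnk α = 1 → rnk β = 1 → rel11 D i α j β →
      rnk (pmul α γ) = 1 →
      rel1 D (i + Phi α γ) (pmul α γ) (j + Phi β γ) (pmul β γ) := by
    rintro i j α β h1 h2 ⟨h3, h4, h5⟩ r1
    have p1 := Phi_rank h1.le γ
    have p2 := Phi_rank h2.le γ
    have q1 := rnk_pmul_le_left α γ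
    have q2 := rnk_pmul_le_left β γ
    have k1 : krS (pmul α γ) = krS α := krS_pmul h1.le γ
    have k2 : krS (pmul β γ) = krS β := krS_pmul (by omega) γ
    have c : ckS α = ckS β → ckS (pmul α γ) = ckS (pmul β γ) := by
      intro e; rw [ckS_pmul, ckS_pmul, e]
    have e1 : Phi α γ = FF (ckS α) γ := by omega
    by_cases r2 : rnk (pmul β γ) = 1
    · have e2 : Phi β γ = FF (ckS β) γ := by omega
      have d1 := dm_pmul (r1.trans h1.symm) h1.le
      have d2 := dm_pmul (r2.trans h2.symm) h2.le
      refine Or.inr (Or.inl ⟨r1, r2, ?_, ?_, ?_⟩)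
      · rcases h5 with h5 | h5
        · exact h.t1_trans (h.t1_symm (h.rho1_run _ h5.1 h5.2)) (h.t1_trans h3
            (h.rho1_run _ (h.E_t0 (h.E_t1 h5.1 h3) (h.t1_t0 h3)) (h.rho_t0 h5.2 (h.t1_t0 h3))))
        · rw [e1, e2, h5.1]; exact h.t1_add _ h3
      · rw [k1, k2, d1, d2]
        exact h4.imp (fun e => ⟨h.E_add _ e.1, h.lam_add _ e.2⟩)
          (fun e => ⟨e.1, e.2.imp (h.dn_add _) id⟩)
      · refine h5.imp (fun e => ⟨h.E_add _ e.1, h.rho_add _ e.2⟩)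
          (fun e => ⟨c e.1, e.2.imp (h.up_add _) fun e' => ?_⟩)
        rw [cd_pmul, cd_pmul, e.1, e']
    · have r2 : rnk (pmul β γ) = 0 := by omega
      have e2 : Phi β γ + 1 = FF (ckS β) γ := by omega
      have hE : D.E (i + Phi α γ) (j + Phi β γ) := by
        rcases h5 with h5 | ⟨h5, h6 | h6⟩
        · have a := h.rho1_run (Phi α γ) h5.1 h5.2
          have b := h.t0_trans (h.rho_run (Phi β γ) h5.2) (h.t0_add (Phi β γ) (h.t1_t0 h3))
          exact h.E_t0 (h.E_t1 h5.1 a) b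
        · have a := h.E_add (Phi β γ) (h.up_E h6)
          rw [show i + 1 + Phi β γ = i + Phi α γ by rw [e1, h5]; omega] at a
          exact h.E_t0 a (h.t0_add _ (h.t1_t0 h3))
        · exfalso
          obtain ⟨z, hz⟩ := rnk_pos_iff_cd.1 r1.ge
          refine rnk_zero_cd r2 z ?_
          rw [cd_pmul, h5, h6] at hz
          rw [cd_pmul]
          exact hz
      refine Or.inr (Or.inr (Or.inl ⟨r1, r2, hE, ?_, ?_⟩))
      · rw [k1, k2]
        exact h4.imp (fun e => (h.lam_E hE).2 ⟨h.E_add _ e.1, h.lam_add _ e.2⟩) (fun e => e.1)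
      · exact h5.imp (fun e => (h.rho_E hE).2 ⟨h.E_add _ e.1, h.rho_add _ e.2⟩) (fun e => c e.1)
  rcases hr with ⟨h1, h2, h3, h4, h5⟩ | ⟨h1, h2, hr⟩ | ⟨h1, h2, hr⟩ | ⟨h1, h2, hr⟩
  · have p1 := Phi_rank (α := α) (by omega) γ
    have p2 := Phi_rank (α := β) (by omega) γ
    have q1 := rnk_pmul_le_left α γ
    have q2 := rnk_pmul_le_left β γ
    have e1 : Phi α γ = FF (ckS α) γ := by omega
    have e2 : Phi β γ = FF (ckS β) γ := by omega
    refine Or.inl ⟨by omega, by omega, ?_, ?_, ?_⟩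
    · rcases h5 with h5 | h5
      · exact h.t0_trans (h.t0_symm (h.rho_run _ h5)) (h.t0_trans h3 (h.rho_run _ (h.rho_t0 h5 h3)))
      · rw [e1, e2, h5]; exact h.t0_add _ h3
    · rw [krS_pmul (by omega), krS_pmul (by omega)]; exact h4.imp (h.lam_add _) id
    · refine h5.imp (h.rho_add _) fun e => ?_
      rw [ckS_pmul, ckS_pmul, e]
  · have q1 := rnk_pmul_le_left α γ
    have q2 := rnk_pmul_le_left β γ
    by_cases r1 : rnk (pmul α γ) = 1
    · exact main11 h1 h2 hr r1
    by_cases r2 : rnk (pmul β γ) = 1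
    · have hr' := rel1_symm h (Or.inr (Or.inl ⟨h1, h2, hr⟩))
      rcases hr' with h0 | h0 | h0 | h0 <;> try omega
      exact rel1_symm h (main11 h2 h1 h0.2.2 r2)
    · obtain ⟨h3, h4, h5⟩ := hr
      have p1 := Phi_rank (α := α) (by omega) γ
      have p2 := Phi_rank (α := β) (by omega) γ
      have e1 : Phi α γ + 1 = FF (ckS α) γ := by omega
      have e2 : Phi β γ + 1 = FF (ckS β) γ := by omega
      refine Or.inl ⟨by omega, by omega, ?_, ?_, ?_⟩
      · rcases h5 with h5 | h5
        · exact h.t0_trans (h.t0_symm (h.rho_run _ h5.2)) (h.t0_trans (h.t1_t0 h3)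
            (h.rho_run _ (h.rho_t0 h5.2 (h.t1_t0 h3))))
        · rw [h5.1] at e1
          rw [show Phi α γ = Phi β γ by omega]; exact h.t0_add _ (h.t1_t0 h3)
      · rw [krS_pmul (by omega), krS_pmul (by omega)]
        exact h4.imp (fun e => h.lam_add _ e.2) (fun e => e.1)
      · refine h5.imp (fun e => h.rho_add _ e.2) fun e => ?_
        rw [ckS_pmul, ckS_pmul, e.1]
  · exact main10 h1 h2 hr
  · exact rel1_symm h (main10 h2 h1 hr)

theorem rel1_flip {i j} {α β : PM n} (hr : rel1 D i α j β) :
    rel1 D.dual i (flip α) j (flip β) := by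
  have fd : ∀ α : PM n, dm (flip α) = cd α := fun α => funext fun x => propext (dm_flip α x)
  have fc : ∀ α : PM n, cd (flip α) = dm α := fun α => funext fun x => propext (cd_flip α x)
  unfold rel1 rel00 rel11 rel10 at hr ⊢
  simp only [rnk_flip, krS_flip, ckS_flip, fd, fc]
  rcases hr with ⟨h1, h2, h3, h4, h5⟩ | ⟨h1, h2, h3, h4, h5⟩ | ⟨h1, h2, h3, h4, h5⟩ |
    ⟨h1, h2, h3, h4, h5⟩
  · exact Or.inl ⟨h1, h2, h3, h5, h4⟩
  · exact Or.inr (Or.inl ⟨h1, h2, h3, h5, h4⟩)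
  · exact Or.inr (Or.inr (Or.inl ⟨h1, h2, h3, h5, h4⟩))
  · exact Or.inr (Or.inr (Or.inr ⟨h1, h2, h3, h5, h4⟩))
end


end Part4

section Part5

/-! ### Theorem A: valid data give congruences -/

theorem reps_full {α : PM n} {q : ℕ} (h : rnk α = q) {a b : Fin q → Fin n}
    (h1 : ∀ s, α.r (Sum.inl (a s)) (Sum.inr (b s)))
    (h2 : ∀ s t, α.r (Sum.inl (a s)) (Sum.inl (a t)) → s = t) {x} (hx : dm α x) :
    ∃ s, α.r (Sum.inl x) (Sum.inl (a s)) := by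
  by_contra hc
  push Not at hc
  obtain ⟨y, hy⟩ := hx
  have : q + 1 ≤ rnk α := by
    refine le_rnk_iff.2 ⟨Fin.cons x a, Fin.cons y b, ?_, ?_⟩
    · intro s; refine Fin.cases ?_ ?_ s
      · exact hy
      · exact h1
    · intro s t; refine Fin.cases ?_ ?_ s <;> refine Fin.cases ?_ ?_ t
      · intro _; rfl
      · intro t ht; exact absurd ht (hc t)
      · intro t ht; exact absurd (α.iseqv.symm ht) (hc t)
      · intro s t ht; exact congrArg _ (h2 t s ht)
  omega

theorem reps_full' {α : PM n} {q : ℕ} (h : rnk α = q) {a b : Fin q → Fin n}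
    (h1 : ∀ s, α.r (Sum.inl (a s)) (Sum.inr (b s)))
    (h2 : ∀ s t, α.r (Sum.inl (a s)) (Sum.inl (a t)) → s = t) {x y}
    (hx : α.r (Sum.inl x) (Sum.inr y)) :
    ∃ s, α.r (Sum.inl x) (Sum.inl (a s)) ∧ α.r (Sum.inr y) (Sum.inr (b s)) := by
  obtain ⟨s, hs⟩ := reps_full h h1 h2 ⟨y, hx⟩
  exact ⟨s, hs, α.iseqv.trans (α.iseqv.symm hx) (α.iseqv.trans hs (h1 s))⟩

theorem rkr {α β : PM n} (h : krS α = krS β) {x y} : α.r (Sum.inl x) (Sum.inl y) ↔ β.r (Sum.inl x) (Sum.inl y) := by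
  rw [← krS_r, h, krS_r]
theorem rck {α β : PM n} (h : ckS α = ckS β) {x y} : α.r (Sum.inr x) (Sum.inr y) ↔ β.r (Sum.inr x) (Sum.inr y) := by
  rw [← ckS_r, h, ckS_r]

theorem pd_any {α β : PM n} {q : ℕ} {P : Equiv.Perm (Fin q) → Prop} (hr : rnk α = q)
    (hH : greenH pmul α β) (hP : ∀ π τ, P π → P (τ⁻¹ * π * τ)) (hpd : pdIn q P α β)
    {a b : Fin q → Fin n} (h1 : ∀ s, α.r (Sum.inl (a s)) (Sum.inr (b s)))
    (h2 : ∀ s t, α.r (Sum.inl (a s)) (Sum.inl (a t)) → s = t) :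
    ∃ π, P π ∧ ∀ s, β.r (Sum.inl (a s)) (Sum.inr (b (π s))) := by
  obtain ⟨⟨k1, -⟩, k2, -⟩ := greenH_iff.1 hH
  obtain ⟨a', b', π, i1, i2, i3, i4⟩ := hpd
  choose f hf hf' using fun s => reps_full' hr i2 i1 (h1 s)
  have finj : Function.Injective f := by
    intro s t hst
    have := hf t
    rw [← hst] at this
    exact h2 s t (α.iseqv.trans (hf s) (α.iseqv.symm this))
  let τ : Equiv.Perm (Fin q) := Equiv.ofBijective f (Finite.injective_iff_bijective.1 finj)
  refine ⟨τ⁻¹ * π * τ, hP π τ i4, fun s => ?_⟩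
  have e : τ ((τ⁻¹ * π * τ) s) = π (f s) := by
    simp [τ, Equiv.Perm.mul_apply]
  have h3 := hf' ((τ⁻¹ * π * τ) s)
  rw [show f ((τ⁻¹ * π * τ) s) = π (f s) from e] at h3
  exact β.iseqv.trans ((rkr k1).1 (hf s)) (β.iseqv.trans (i3 (f s)) (β.iseqv.symm ((rck k2).1 h3)))

section basic
variable {D : Dat}

theorem Dat.Valid.Rs_down1 (h : D.Valid n) {q i} (hq : q + 1 ≤ n) (hR : D.Rs (q + 1) i) : D.Rs q i := by
  match q with
  | 0 => exact hR.2
  | q + 1 => exact h.re_down (q := q + 2) (by omega) hq hR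

theorem Dat.Valid.Rs_down (h : D.Valid n) {q r i} (hq : q ≤ n) (hr : r ≤ q) (hR : D.Rs q i) : D.Rs r i := by
  induction q with
  | zero => obtain rfl : r = 0 := by omega
            exact hR
  | succ q ih =>
    rcases Nat.lt_or_ge r (q + 1) with h1 | h1
    · exact ih (by omega) (by omega) (h.Rs_down1 hq hR)
    · obtain rfl : r = q + 1 := by omega
      exact hR

theorem Dat.Valid.Rs_add (h : D.Valid n) {q i} (k) (hq : q ≤ n) (hR : D.Rs q i) : D.Rs q (i + k) := by
  induction k with
  | zero => exact hR
  | succ k ih =>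
    match q, ih with
    | 0, ih => exact ⟨h.toValid.lam_add 1 ih.1, h.toValid.rho_add 1 ih.2⟩
    | 1, ih =>  exact ⟨h.E_shift ih.1, h.toValid.lam_add 1 ih.2.1, h.toValid.rho_add 1 ih.2.2⟩
    | q + 2, ih => exact h.re_shift (by omega) hq ih

theorem Dat.Valid.T_down1 (h : D.Valid n) {q i j} (hq : q + 1 ≤ n) (hR : D.T (q + 1) i j) : D.T q i j := by
  match q with
  | 0 => exact h.t1_t0 hR
  | q + 1 => exact h.t_down (q := q + 2) (by omega) hq hR

theorem Dat.Valid.T_down (h : D.Valid n) {q r i j} (hq : q ≤ n) (hr : r ≤ q) (hR : D.T q i j) : D.T r i j := by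
  induction q with
  | zero => obtain rfl : r = 0 := by omega
            exact hR
  | succ q ih =>
    rcases Nat.lt_or_ge r (q + 1) with h1 | h1
    · exact ih (by omega) (by omega) (h.T_down1 hq hR)
    · obtain rfl : r = q + 1 := by omega
      exact hR

theorem Dat.Valid.nn_add (h : D.Valid n) {q i j π} (k) (hq : 2 ≤ q) (hq' : q ≤ n) (hR : D.NN q i j π) :
    D.NN q (i + k) (j + k) π := by
  induction k with
  | zero => exact hR
  | succ k ih => exact h.nn_shift hq hq' ih

theorem Dat.Valid.T_add (h : D.Valid n) {q i j} (k) (hq : q ≤ n) (hR : D.T q i j) : D.T q (i + k) (j + k) := by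
  match q, hR with
  | 0, hR => exact h.toValid.t0_add k hR
  | 1, hR => exact h.toValid.t1_add k hR
  | q + 2, hR => exact h.nn_add k (by omega) hq hR

theorem Dat.Valid.T_refl (h : D.Valid n) {q} (i) (hq : q ≤ n) : D.T q i i := by
  match q with
  | 0 => exact h.t0_refl i
  | 1 => exact h.t1_refl i
  | q + 2 => exact h.nn_one i (by omega) hq

theorem rel_T (D : Dat) {i j} {α : PM n} (hT : D.T (rnk α) i j) : rel D (i, α) (j, α) := by
  match hr : rnk α, hT with
  | 0, hT => exact Or.inr (Or.inl (Or.inl ⟨hr, hr, hT, Or.inr rfl, Or.inr rfl⟩))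
  | 1, hT => exact Or.inr (Or.inl (Or.inr (Or.inl ⟨hr, hr, hT, Or.inr ⟨rfl, Or.inr rfl⟩, Or.inr ⟨rfl, Or.inr rfl⟩⟩)))
  | q + 2, hT =>
    obtain ⟨a, b, h1, h2, h3⟩ := rnk_reps hr
    exact Or.inr (Or.inr ⟨q + 2, by omega, hr, hr, ⟨rfl, rfl⟩, a, b, 1, h2, h1, h1, hT⟩)

theorem rel1_Rs (h : D.Valid n) {i j} {α β : PM n} (hr : rel1 D.toD1 i α j β)
    (hR : D.Rs (rnk α) i) : D.Rs (rnk β) j := by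
  rcases hr with ⟨h1, h2, h3⟩ | ⟨h1, h2, h3⟩ | ⟨h1, h2, h3⟩ | ⟨h1, h2, h3⟩ <;> rw [h1] at hR <;> rw [h2]
  · exact ⟨h.lam_t0 hR.1 h3.1, h.rho_t0 hR.2 h3.1⟩
  · have h4 := h.t1_t0 h3.1
    exact ⟨h.E_t0 (h.E_t1 hR.1 h3.1) h4, h.lam_t0 hR.2.1 h4, h.rho_t0 hR.2.2 h4⟩
  · exact ⟨(h.toValid.lam_E h3.1).2 ⟨hR.1, hR.2.1⟩, (h.toValid.rho_E h3.1).2 ⟨hR.1, hR.2.2⟩⟩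
  · have := (h.toValid.lam_E h3.1).1 hR.1
    exact ⟨this.1, this.2, ((h.toValid.rho_E h3.1).1 hR.2).2⟩

/-- pairs of rank at least two. -/
def rel2 (D : Dat) (q i : ℕ) (α : PM n) (j : ℕ) (β : PM n) : Prop :=
  rnk α = q ∧ rnk β = q ∧ greenH pmul α β ∧ pdIn q (D.NN q i j) α β

theorem rel2_symm (h : D.Valid n) {q i j} {α β : PM n} (hq : 2 ≤ q) (hr : rel2 D q i α j β) :
    rel2 D q j β i α := by
  obtain ⟨h1, h2, h3, a, b, π, i1, i2, i3, i4⟩ := hr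
  have hn : q ≤ n := h1 ▸ rnk_le α
  obtain ⟨⟨k1, -⟩, k2, -⟩ := greenH_iff.1 h3
  refine ⟨h2, h1, greenH_symm h3, a, b ∘ π, π⁻¹, fun s t hst => i1 s t ((rkr k1).2 hst), i3, fun s => ?_,
    h.nn_inv hq hn i4⟩
  simpa using i2 s

theorem rel_symm (h : D.Valid n) {x y : ℕ × PM n} (hr : rel D x y) : rel D y x := by
  rcases hr with hr | hr | ⟨q, hq, hr⟩
  · exact Or.inl hr.symm
  · exact Or.inr (Or.inl (rel1_symm h.toValid hr))
  · exact Or.inr (Or.inr ⟨q, hq, rel2_symm h hq hr⟩)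

theorem rel2_Rs (h : D.Valid n) {q i j} {α β : PM n} (hq : 2 ≤ q) (hr : rel2 D q i α j β)
    (hR : D.Rs (rnk α) i) : D.Rs (rnk β) j := by
  obtain ⟨h1, h2, h3, a, b, π, i1, i2, i3, i4⟩ := hr
  have hn : q ≤ n := h1 ▸ rnk_le α
  rw [h1] at hR
  rw [h2]
  obtain ⟨q, rfl⟩ := Nat.exists_eq_add_of_le' hq
  exact h.re_nn hq hn i4 hR

theorem rel_Rs (h : D.Valid n) {x y : ℕ × PM n} (hr : rel D x y) (hx : D.Rs (rnk x.2) x.1) :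
    D.Rs (rnk y.2) y.1 := by
  rcases hr with hr | hr | ⟨q, hq, hr⟩
  · exact hr.2
  · exact rel1_Rs h hr hx
  · exact rel2_Rs h hq hr hx

theorem rel1_le {D : D1} {i j} {α β : PM n} (h : rel1 D i α j β) : rnk α ≤ 1 ∧ rnk β ≤ 1 := by
  unfold rel1 at h; omega

theorem rel_trans (h : D.Valid n) {x y z : ℕ × PM n} (hr : rel D x y) (hs : rel D y z) : rel D x z := by
  rcases hr with hr | hr | ⟨q, hq, hr⟩
  · exact Or.inl ⟨hr.1, rel_Rs h hs hr.2⟩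
  · rcases hs with hs | hs | ⟨q', hq', hs⟩
    · exact Or.inl ⟨rel1_Rs h (rel1_symm h.toValid hr) hs.1, hs.2⟩
    · exact Or.inr (Or.inl (rel1_trans h.toValid hr hs))
    · have := rel1_le hr; omega
  · rcases hs with hs | hs | ⟨q', hq', hs⟩
    · exact Or.inl ⟨rel2_Rs h hq (rel2_symm h hq hr) hs.1, hs.2⟩
    · have := rel1_le hs; omega
    · obtain ⟨h1, h2, h3, a, b, π, i1, i2, i3, i4⟩ := hr
      obtain rfl : q = q' := by omega
      obtain ⟨h1', h2', h3', hpd⟩ := hs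
      have hn : q ≤ n := h1 ▸ rnk_le _
      obtain ⟨⟨k1, -⟩, k2, -⟩ := greenH_iff.1 h3
      obtain ⟨π', j1, j2⟩ := pd_any h2 h3' (fun π τ => h.nn_conj τ hq hn) hpd (a := a) (b := b ∘ π) i3
        (fun s t hst => i1 s t ((rkr k1).2 hst))
      exact Or.inr (Or.inr ⟨q, hq, h1, h2', ⟨h3.1.trans h3'.1, h3.2.trans h3'.2⟩, a, b, π * π', i1, i2, j2,
        h.nn_mul hq hn i4 j1⟩)

theorem Phi_congr {α β : PM n} (h : greenH pmul α β) (γ : PM n) : Phi α γ = Phi β γ := by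
  obtain ⟨-, k2, k3⟩ := greenH_iff.1 h
  rw [Phi_ncard, Phi_ncard, k2]
  simp only [k3]

theorem kept {α γ : PM n} {q : ℕ} (h : rnk α = q) {a b : Fin q → Fin n}
    (h1 : ∀ s, α.r (Sum.inl (a s)) (Sum.inr (b s)))
    (h2 : ∀ s t, α.r (Sum.inl (a s)) (Sum.inl (a t)) → s = t) (hk : rnk (pmul α γ) = q) :
    (∀ s t, (G (ckS α) γ).r (Sum.inl (b s)) (Sum.inl (b t)) → s = t) ∧
    ∀ s, ∃ z, (G (ckS α) γ).r (Sum.inl (b s)) (Sum.inr z) := by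
  obtain ⟨c, d, e1, e2, -⟩ := rnk_reps hk
  choose y hy hyd using fun s => pmul_lr.1 (e1 s)
  choose f hf hf' using fun s => reps_full' h h1 h2 (hy s)
  have finj : Function.Injective f := by
    intro s t hst
    have := hf t
    rw [← hst] at this
    exact e2 s t (pmul_ll.2 (Or.inl (α.iseqv.trans (hf s) (α.iseqv.symm this))))
  have fsurj := Finite.injective_iff_surjective.1 finj
  constructor
  · intro s t hst
    obtain ⟨s, rfl⟩ := fsurj s
    obtain ⟨t, rfl⟩ := fsurj t
    congr 1
    exact e2 s t (pmul_ll.2 (Or.inr ⟨_, _, hy s, hy t,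
      G_trans (G_of_left (hf' s)) (G_trans hst (G_symm (G_of_left (hf' t))))⟩))
  · intro s
    obtain ⟨s, rfl⟩ := fsurj s
    exact ⟨d s, G_trans (G_symm (G_of_left (hf' s))) (hyd s)⟩

theorem kept_ll {α γ : PM n} {q : ℕ} (h : rnk α = q) {a b : Fin q → Fin n}
    (h1 : ∀ s, α.r (Sum.inl (a s)) (Sum.inr (b s)))
    (h2 : ∀ s t, α.r (Sum.inl (a s)) (Sum.inl (a t)) → s = t)
    (hG : ∀ s t, (G (ckS α) γ).r (Sum.inl (b s)) (Sum.inl (b t)) → s = t) :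
    krS (pmul α γ) = krS α := by
  apply Setoid.ext
  intro x x'
  constructor
  · intro hx
    rcases pmul_ll.1 hx with hx | ⟨y, y', hy, hy', hG'⟩
    · exact hx
    · obtain ⟨s, e1, e2⟩ := reps_full' h h1 h2 hy
      obtain ⟨t, e3, e4⟩ := reps_full' h h1 h2 hy'
      obtain rfl := hG s t (G_trans (G_symm (G_of_left e2)) (G_trans hG' (G_of_left e4)))
      exact α.iseqv.trans e1 (α.iseqv.symm e3)
  · intro hx; exact pmul_ll.2 (Or.inl hx)

theorem kept_rank {α γ : PM n} {q : ℕ} (h : rnk α = q) {a b : Fin q → Fin n}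
    (h1 : ∀ s, α.r (Sum.inl (a s)) (Sum.inr (b s)))
    (h2 : ∀ s t, α.r (Sum.inl (a s)) (Sum.inl (a t)) → s = t)
    (hG : ∀ s t, (G (ckS α) γ).r (Sum.inl (b s)) (Sum.inl (b t)) → s = t)
    (hz : ∀ s, ∃ z, (G (ckS α) γ).r (Sum.inl (b s)) (Sum.inr z)) : rnk (pmul α γ) = q := by
  apply le_antisymm
  · rw [← h]; exact rnk_pmul_le_left _ _
  · choose z hz using hz
    refine le_rnk_iff.2 ⟨a, z, fun s => pmul_lr.2 ⟨b s, h1 s, hz s⟩, fun s t hst => ?_⟩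
    have := kept_ll h h1 h2 hG
    exact h2 s t ((rkr this).1 hst)

theorem kept_dm {α γ : PM n} {q : ℕ} (h : rnk α = q) {a b : Fin q → Fin n}
    (h1 : ∀ s, α.r (Sum.inl (a s)) (Sum.inr (b s)))
    (h2 : ∀ s t, α.r (Sum.inl (a s)) (Sum.inl (a t)) → s = t)
    (hz : ∀ s, ∃ z, (G (ckS α) γ).r (Sum.inl (b s)) (Sum.inr z)) (x) : dm (pmul α γ) x ↔ dm α x := by
  constructor
  · rintro ⟨z, hz⟩
    obtain ⟨y, hy, _⟩ := pmul_lr.1 hz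
    exact ⟨y, hy⟩
  · rintro ⟨y, hy⟩
    obtain ⟨s, e1, e2⟩ := reps_full' h h1 h2 hy
    obtain ⟨z, hz⟩ := hz s
    exact ⟨z, pmul_lr.2 ⟨y, hy, G_trans (G_of_left e2) hz⟩⟩

theorem krS_le2 {α β γ : PM n} (h : rnk α = 2) {a b : Fin 2 → Fin n} {π : Equiv.Perm (Fin 2)}
    (h1 : ∀ s, α.r (Sum.inl (a s)) (Sum.inr (b s)))
    (h2 : ∀ s t, α.r (Sum.inl (a s)) (Sum.inl (a t)) → s = t)
    (h3 : ∀ s, β.r (Sum.inl (a s)) (Sum.inr (b (π s)))) (k1 : krS α = krS β) (k2 : ckS α = ckS β) {x x'}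
    (hx : (pmul α γ).r (Sum.inl x) (Sum.inl x')) : (pmul β γ).r (Sum.inl x) (Sum.inl x') := by
  rcases pmul_ll.1 hx with hx | ⟨y, y', hy, hy', hG'⟩
  · exact pmul_ll.2 (Or.inl ((rkr k1).1 hx))
  · obtain ⟨s, e1, e2⟩ := reps_full' h h1 h2 hy
    obtain ⟨t, e3, e4⟩ := reps_full' h h1 h2 hy'
    refine pmul_ll.2 (Or.inr ⟨b (π s), b (π t), β.iseqv.trans ((rkr k1).1 e1) (h3 s),
      β.iseqv.trans ((rkr k1).1 e3) (h3 t), ?_⟩)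
    rw [← k2]
    have hst := G_trans (G_symm (G_of_left e2)) (G_trans hG' (G_of_left e4))
    by_cases hh : s = t
    · subst hh; exact G_refl _ _ _
    · have : (π s = s ∧ π t = t) ∨ (π s = t ∧ π t = s) := by
        have : π s ≠ π t := fun h => hh (π.injective h)
        omega
      rcases this with ⟨h5, h6⟩ | ⟨h5, h6⟩ <;> rw [h5, h6]
      · exact hst
      · exact G_symm hst

theorem rel2_mulR (h : D.Valid n) {q i j} {α β : PM n} (hq : 2 ≤ q) (hr : rel2 D q i α j β) (γ : PM n) (k : ℕ) :
    rel D (i + k, pmul α γ) (j + k, pmul β γ) := by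
  have hsym := rel2_symm h hq hr
  obtain ⟨h1, h2, h3, a, b, π, i1, i2, i3, i4⟩ := hr
  have hn : q ≤ n := h1 ▸ rnk_le α
  obtain ⟨⟨k1, d1⟩, k2, d2⟩ := greenH_iff.1 h3
  have i1' : ∀ s t, β.r (Sum.inl (a s)) (Sum.inl (a t)) → s = t := fun s t hst => i1 s t ((rkr k1).2 hst)
  have hck : ckS (pmul α γ) = ckS (pmul β γ) := by rw [ckS_pmul, ckS_pmul, k2]
  have d2' : cd α = cd β := funext fun x => propext (d2 x)
  have hcd : cd (pmul α γ) = cd (pmul β γ) := by rw [cd_pmul, cd_pmul, k2, d2']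
  by_cases hk : rnk (pmul α γ) = q
  · obtain ⟨hG, hz⟩ := kept h1 i2 i1 hk
    have hG' : ∀ s t, (G (ckS β) γ).r (Sum.inl ((b ∘ π) s)) (Sum.inl ((b ∘ π) t)) → s = t :=
      fun s t hst => π.injective (hG _ _ (by rw [k2]; exact hst))
    have hz' : ∀ s, ∃ z, (G (ckS β) γ).r (Sum.inl ((b ∘ π) s)) (Sum.inr z) :=
      fun s => by rw [← k2]; exact hz (π s)
    refine Or.inr (Or.inr ⟨q, hq, hk, kept_rank h2 i3 i1' hG' hz', greenH_iff.2 ⟨⟨?_, fun x => ?_⟩, hck, fun x => ?_⟩, ?_⟩)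
    · rw [kept_ll h1 i2 i1 hG, kept_ll h2 i3 i1' hG', k1]
    · change dm (pmul α γ) x ↔ dm (pmul β γ) x
      rw [kept_dm h1 i2 i1 hz, kept_dm h2 i3 i1' hz', d1]
    · change cd (pmul α γ) x ↔ cd (pmul β γ) x
      rw [hcd]
    · choose z hz using hz
      refine ⟨a, z, π, fun s t hst => ?_, fun s => pmul_lr.2 ⟨b s, i2 s, hz s⟩,
        fun s => pmul_lr.2 ⟨b (π s), i3 s, ?_⟩, h.nn_add k hq hn i4⟩
      · exact i1 s t ((rkr (kept_ll h1 i2 i1 hG)).1 hst)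
      · rw [← k2]; exact hz (π s)
  · have hk' : rnk (pmul β γ) ≠ q := by
      intro hk'
      obtain ⟨hG, hz⟩ := kept h2 i3 i1' hk'
      apply hk
      refine kept_rank h1 i2 i1 (fun s t hst => ?_) (fun s => ?_)
      · rw [k2] at hst
        exact π.symm.injective (hG _ _ (by simpa using hst))
      · rw [k2]; simpa using hz (π.symm s)
    have hkl : rnk (pmul α γ) < q := lt_of_le_of_ne (h1 ▸ rnk_pmul_le_left _ _) hk
    have hkl' : rnk (pmul β γ) < q := lt_of_le_of_ne (h2 ▸ rnk_pmul_le_left _ _) hk'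
    by_cases hπ : π = 1
    · have : α = β := by
        subst hπ
        refine pm_ext (fun x y => rkr k1) (fun x y => rck k2) (fun x y => ⟨fun hx => ?_, fun hx => ?_⟩)
        · obtain ⟨s, e1, e2⟩ := reps_full' h1 i2 i1 hx
          exact β.iseqv.trans ((rkr k1).1 e1) (β.iseqv.trans (i3 s) (β.iseqv.symm ((rck k2).1 e2)))
        · obtain ⟨s, e1, e2⟩ := reps_full' h2 i3 i1' hx
          exact α.iseqv.trans ((rkr k1).2 e1) (α.iseqv.trans (i2 s) (α.iseqv.symm ((rck k2).2 e2)))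
      subst this
      apply rel_T
      apply h.T_add _ (by omega)
      apply h.T_down hn hkl.le
      obtain ⟨q, rfl⟩ := Nat.exists_eq_add_of_le' hq
      subst hπ
      exact i4
    · rcases Nat.lt_or_ge 2 q with hq3 | hq3
      · have r1 := h.nn_drop hq3 hn hπ i4
        have r2 := h.nn_drop' hq3 hn hπ i4
        obtain ⟨q, rfl⟩ := Nat.exists_eq_add_of_le' (show 3 ≤ q from hq3)
        exact Or.inl ⟨h.Rs_add k (rnk_le _) (h.Rs_down (q := q + 2) (by omega) (by dsimp only; omega) r1),
          h.Rs_add k (rnk_le _) (h.Rs_down (q := q + 2) (by omega) (by dsimp only; omega) r2)⟩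
      · obtain rfl : q = 2 := by omega
        obtain ⟨ht, hu, hd⟩ := h.nn_drop2 hn hπ i4
        have hkr : krS (pmul α γ) = krS (pmul β γ) := by
          apply Setoid.ext
          intro x x'
          refine ⟨krS_le2 h1 i2 i1 i3 k1 k2, krS_le2 (π := π⁻¹) h2 i3 i1' (fun s => ?_) k1.symm k2.symm⟩
          simpa using i2 s
        have hrr : 1 ≤ rnk (pmul α γ) ↔ 1 ≤ rnk (pmul β γ) := by
          rw [rnk_pos_iff_cd, rnk_pos_iff_cd, hcd]
        right; left
        rcases Nat.lt_or_ge (rnk (pmul α γ)) 1 with hl | hl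
        · exact Or.inl ⟨show rnk (pmul α γ) = 0 by omega, show rnk (pmul β γ) = 0 by omega, h.toValid.t0_add k (h.t1_t0 ht), Or.inr hkr, Or.inr hck⟩
        · exact Or.inr (Or.inl ⟨show rnk (pmul α γ) = 1 by omega, show rnk (pmul β γ) = 1 by omega, h.toValid.t1_add k ht,
            Or.inr ⟨hkr, Or.inl (h.toValid.dn_add k hd)⟩, Or.inr ⟨hck, Or.inr hcd⟩⟩)

theorem rel_mulR (h : D.Valid n) {x y : ℕ × PM n} (hr : rel D x y) (c : ℕ × PM n) :
    rel D (tmul x c) (tmul y c) := by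
  have key : rel D (x.1 + Phi x.2 c.2, pmul x.2 c.2) (y.1 + Phi y.2 c.2, pmul y.2 c.2) → rel D (tmul x c) (tmul y c) := by
    intro hr
    have e : ∀ z : ℕ × PM n, tmul z c = (z.1 + Phi z.2 c.2 + c.1, pmul z.2 c.2) := by
      intro z; simp only [tmul]; congr 1; ring
    rw [e, e]
    generalize x.1 + Phi x.2 c.2 = i at hr ⊢
    generalize y.1 + Phi y.2 c.2 = j at hr ⊢
    generalize pmul x.2 c.2 = α at hr ⊢
    generalize pmul y.2 c.2 = β at hr ⊢
    rcases hr with hr | hr | ⟨q, hq, hr⟩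
    · exact Or.inl ⟨h.Rs_add _ (rnk_le _) hr.1, h.Rs_add _ (rnk_le _) hr.2⟩
    · right; left
      rcases hr with ⟨h1, h2, h3⟩ | ⟨h1, h2, h3⟩ | ⟨h1, h2, h3⟩ | ⟨h1, h2, h3⟩
      · exact Or.inl ⟨h1, h2, h.toValid.t0_add _ h3.1, h3.2.1.imp_left (h.toValid.lam_add _), h3.2.2.imp_left (h.toValid.rho_add _)⟩
      · refine Or.inr (Or.inl ⟨h1, h2, h.toValid.t1_add _ h3.1, h3.2.1.imp (fun hh => ⟨h.toValid.E_add _ hh.1, h.toValid.lam_add _ hh.2⟩) (fun hh => ⟨hh.1, hh.2.imp_left (h.toValid.dn_add _)⟩), h3.2.2.imp (fun hh => ⟨h.toValid.E_add _ hh.1, h.toValid.rho_add _ hh.2⟩) (fun hh => ⟨hh.1, hh.2.imp_left (h.toValid.up_add _)⟩)⟩)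
      · exact Or.inr (Or.inr (Or.inl ⟨h1, h2, h.toValid.E_add _ h3.1, h3.2.1.imp_left (h.toValid.lam_add _), h3.2.2.imp_left (h.toValid.rho_add _)⟩))
      · exact Or.inr (Or.inr (Or.inr ⟨h1, h2, h.toValid.E_add _ h3.1, h3.2.1.imp_left (h.toValid.lam_add _), h3.2.2.imp_left (h.toValid.rho_add _)⟩))
    · obtain ⟨h1, h2, h3, a, b, π, i1, i2, i3, i4⟩ := hr
      have hn : q ≤ n := h1 ▸ rnk_le _
      exact Or.inr (Or.inr ⟨q, hq, h1, h2, h3, a, b, π, i1, i2, i3, h.nn_add _ hq hn i4⟩)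
  apply key
  rcases hr with hr | hr | ⟨q, hq, hr⟩
  · exact Or.inl ⟨h.Rs_add _ (rnk_le _) (h.Rs_down (rnk_le _) (rnk_pmul_le_left _ _) hr.1),
      h.Rs_add _ (rnk_le _) (h.Rs_down (rnk_le _) (rnk_pmul_le_left _ _) hr.2)⟩
  · exact Or.inr (Or.inl (rel1_mulR h.toValid hr _))
  · have := rel2_mulR h hq hr c.2 (Phi x.2 c.2)
    rwa [Phi_congr hr.2.2.1] at this ⊢

theorem rel_flip (h : D.Valid n) {i j} {α β : PM n} (hr : rel D (i, α) (j, β)) : rel D.dual (i, flip α) (j, flip β) := by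
  rcases hr with hr | hr | ⟨q, hq, hr⟩
  · left
    rw [Dat.dual_Rs, Dat.dual_Rs, rnk_flip, rnk_flip]
    exact hr
  · exact Or.inr (Or.inl (rel1_flip hr))
  · obtain ⟨h1, h2, h3, a, b, π, i1, i2, i3, i4⟩ := hr
    have hn : q ≤ n := h1 ▸ rnk_le _
    have h1 : rnk α = q := h1
    have h2 : rnk β = q := h2
    refine Or.inr (Or.inr ⟨q, hq, by rw [rnk_flip, h1], by rw [rnk_flip, h2], greenH_flip.2 h3, b, a, π⁻¹, ?_, ?_, ?_, h.nn_inv hq hn i4⟩)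
    · intro s t hst
      exact i1 s t (α.iseqv.trans (i2 s) (α.iseqv.trans (flip_ll.1 hst) (α.iseqv.symm (i2 t))))
    · intro s; exact flip_lr.2 (i2 s)
    · intro s; have := i3 (π⁻¹ s)
      refine flip_lr.2 ?_
      simpa using this

theorem Dat.dual_dual (D : Dat) : D.dual.dual = D := rfl

theorem rel_flip_iff (h : D.Valid n) {i j} {α β : PM n} : rel D.dual (i, flip α) (j, flip β) ↔ rel D (i, α) (j, β) := by
  refine ⟨fun hh => ?_, rel_flip h⟩
  have := rel_flip h.dual hh
  rwa [flip_flip, flip_flip, Dat.dual_dual] at this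

theorem rel_mulL (h : D.Valid n) {x y : ℕ × PM n} (hr : rel D x y) (c : ℕ × PM n) :
    rel D (tmul c x) (tmul c y) := by
  have e : ∀ z : ℕ × PM n, tmul c z = ((tmul (z.1, flip z.2) (c.1, flip c.2)).1, flip (tmul (z.1, flip z.2) (c.1, flip c.2)).2) := by
    intro z; simp only [tmul]
    rw [flip_Phi, flip_pmul, flip_flip, flip_flip, add_comm z.1 c.1]
  rw [e, e]
  have := rel_mulR h.dual (rel_flip h (show rel D (x.1, x.2) (y.1, y.2) from hr)) (c.1, flip c.2)
  have := rel_flip h.dual (show rel D.dual ((tmul (x.1, flip x.2) (c.1, flip c.2)).1, (tmul (x.1, flip x.2) (c.1, flip c.2)).2) ((tmul (y.1, flip y.2) (c.1, flip c.2)).1, (tmul (y.1, flip y.2) (c.1, flip c.2)).2) from this)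
  exact this

/-- Theorem A. -/
theorem rel_cong (h : D.Valid n) : IsCongruence (tmul (n := n)) (rel D) :=
  ⟨⟨fun x => rel_T D (h.T_refl _ (rnk_le _)), fun hh => rel_symm h hh, fun h1 h2 => rel_trans h h1 h2⟩,
    fun _ _ c hr => ⟨rel_mulL h hr c, rel_mulR h hr c⟩⟩

end basic

end Part5

section Part6

/-! ### Partitions of rank at most one and multipliers -/

/-- rank zero partition -/
def p0 (U L : Setoid (Fin n)) : PM n :=
  lab (fun x => (Sum.inl (Quotient.mk U x) : Quotient U ⊕ Quotient L)) (fun y => Sum.inr (Quotient.mk L y))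

open Classical in
/-- rank one partition -/
noncomputable def p1 (U : Setoid (Fin n)) (x : Fin n) (L : Setoid (Fin n)) (y : Fin n) : PM n :=
  lab (fun a => if U.r a x then none else some (Sum.inl (Quotient.mk U a) : Quotient U ⊕ Quotient L))
    (fun b => if L.r b y then none else some (Sum.inr (Quotient.mk L b)))

theorem qmk {X : Type*} (U : Setoid X) {a b : X} : Quotient.mk U a = Quotient.mk U b ↔ U.r a b := Quotient.eq

theorem krS_p0 (U L : Setoid (Fin n)) : krS (p0 U L) = U := by
  apply Setoid.ext; intro a b
  refine lab_ll.trans ?_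
  simp [qmk]
theorem ckS_p0 (U L : Setoid (Fin n)) : ckS (p0 U L) = L := by
  apply Setoid.ext; intro a b
  refine lab_rr.trans ?_
  simp [qmk]
theorem rnk_p0 (U L : Setoid (Fin n)) : rnk (p0 U L) = 0 := by
  apply rnk_zero_of
  intro x y h
  have := lab_lr.1 h
  simp at this

theorem setoid_if {X Y : Type*} (U : Setoid X) (x a b : X) (f : Quotient U → Y) (hf : Function.Injective f)
    [Decidable (U.r a x)] [Decidable (U.r b x)] :
    (if U.r a x then none else some (f (Quotient.mk U a))) = (if U.r b x then none else some (f (Quotient.mk U b))) ↔ U.r a b := by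
  by_cases ha : U.r a x <;> by_cases hb : U.r b x <;> simp only [ha, hb, if_true, if_false]
  · simp only [true_iff]; exact U.iseqv.trans ha (U.iseqv.symm hb)
  · simp only [reduceCtorEq, false_iff]; intro h; exact hb (U.iseqv.trans (U.iseqv.symm h) ha)
  · simp only [reduceCtorEq, false_iff]; intro h; exact ha (U.iseqv.trans h hb)
  · rw [Option.some_inj, hf.eq_iff, qmk]

open Classical in
theorem krS_p1 (U : Setoid (Fin n)) (x : Fin n) (L : Setoid (Fin n)) (y : Fin n) : krS (p1 U x L y) = U := by
  apply Setoid.ext; intro a b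
  refine lab_ll.trans ?_
  exact setoid_if U x a b _ Sum.inl_injective
open Classical in
theorem ckS_p1 (U : Setoid (Fin n)) (x : Fin n) (L : Setoid (Fin n)) (y : Fin n) : ckS (p1 U x L y) = L := by
  apply Setoid.ext; intro a b
  refine lab_rr.trans ?_
  exact setoid_if L y a b _ Sum.inr_injective
theorem p1_lr (U : Setoid (Fin n)) (x : Fin n) (L : Setoid (Fin n)) (y : Fin n) {a b} :
    (p1 U x L y).r (Sum.inl a) (Sum.inr b) ↔ U.r a x ∧ L.r b y := by
  refine lab_lr.trans ?_
  by_cases ha : U.r a x <;> by_cases hb : L.r b y <;> simp [ha, hb]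
theorem dm_p1 (U : Setoid (Fin n)) (x : Fin n) (L : Setoid (Fin n)) (y : Fin n) :
    dm (p1 U x L y) = fun a => U.r a x := by
  funext a; apply propext
  exact ⟨fun ⟨b, h⟩ => ((p1_lr U x L y).1 h).1, fun h => ⟨y, (p1_lr U x L y).2 ⟨h, L.iseqv.refl y⟩⟩⟩
theorem cd_p1 (U : Setoid (Fin n)) (x : Fin n) (L : Setoid (Fin n)) (y : Fin n) :
    cd (p1 U x L y) = fun a => L.r a y := by
  funext a; apply propext
  exact ⟨fun ⟨b, h⟩ => ((p1_lr U x L y).1 h).2, fun h => ⟨x, (p1_lr U x L y).2 ⟨U.iseqv.refl x, h⟩⟩⟩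
theorem rnk_p1 (U : Setoid (Fin n)) (x : Fin n) (L : Setoid (Fin n)) (y : Fin n) : rnk (p1 U x L y) = 1 := by
  have h1 : 1 ≤ rnk (p1 U x L y) := rnk_pos_iff.2 ⟨x, y, (p1_lr U x L y).2 ⟨U.iseqv.refl x, L.iseqv.refl y⟩⟩
  have h2 : ¬ 2 ≤ rnk (p1 U x L y) := by
    intro h
    obtain ⟨a, b, h1, h2⟩ := le_rnk_iff.1 h
    have := h2 0 1 (by
      have e0 := ((p1_lr U x L y).1 (h1 0)).1
      have e1 := ((p1_lr U x L y).1 (h1 1)).1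
      have := U.iseqv.trans e0 (U.iseqv.symm e1)
      exact (krS_r _ _ _).1 (by rw [krS_p1]; exact this))
    exact absurd this (by decide)
  omega

theorem eq_p0 {α : PM n} (h : rnk α = 0) : α = p0 (krS α) (ckS α) := by
  have h1 := rnk_p0 (krS α) (ckS α)
  apply ext_le_one (by omega) (by omega)
  · rw [krS_p0]
  · rw [ckS_p0]
  · funext x; exact propext ⟨fun h' => absurd h' (rnk_zero_dm h x), fun h' => absurd h' (rnk_zero_dm h1 x)⟩
  · funext x; exact propext ⟨fun h' => absurd h' (rnk_zero_cd h x), fun h' => absurd h' (rnk_zero_cd h1 x)⟩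

theorem dm_eq_of_one {α : PM n} (h : rnk α = 1) {x} (hx : dm α x) : dm α = fun a => (krS α).r a x := by
  funext a; apply propext
  constructor
  · rintro ⟨y, hy⟩
    obtain ⟨y', hy'⟩ := hx
    exact rnk_le_one h.le hy hy'
  · intro ha
    obtain ⟨y', hy'⟩ := hx
    exact ⟨y', α.iseqv.trans ha hy'⟩
theorem cd_eq_of_one {α : PM n} (h : rnk α = 1) {x} (hx : cd α x) : cd α = fun a => (ckS α).r a x := by
  have := dm_eq_of_one (α := flip α) (by rw [rnk_flip, h]) (x := x) ((dm_flip α x).2 hx)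
  rw [krS_flip] at this
  funext a
  rw [← congrFun this a]
  exact propext (dm_flip α a).symm

theorem eq_p1 {α : PM n} (h : rnk α = 1) {x y} (hx : dm α x) (hy : cd α y) : α = p1 (krS α) x (ckS α) y := by
  have h1 := rnk_p1 (krS α) x (ckS α) y
  apply ext_le_one (by omega) (by omega)
  · rw [krS_p1]
  · rw [ckS_p1]
  · rw [dm_eq_of_one h hx, dm_p1]
  · rw [cd_eq_of_one h hy, cd_p1]

theorem flip_p0 (U L : Setoid (Fin n)) : flip (p0 U L) = p0 L U := by
  have : rnk (flip (p0 U L)) = 0 := by rw [rnk_flip, rnk_p0]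
  rw [eq_p0 this, krS_flip, ckS_flip, krS_p0, ckS_p0]
theorem flip_p1 (U : Setoid (Fin n)) (x : Fin n) (L : Setoid (Fin n)) (y : Fin n) : flip (p1 U x L y) = p1 L y U x := by
  have : rnk (flip (p1 U x L y)) = 1 := by rw [rnk_flip, rnk_p1]
  rw [eq_p1 this (x := y) (y := x), krS_flip, ckS_flip, krS_p1, ckS_p1]
  · rw [dm_flip, cd_p1]
  · rw [cd_flip, dm_p1]

theorem exists_p1 {α : PM n} (h : rnk α = 1) : ∃ x y, dm α x ∧ cd α y := by
  obtain ⟨x, y, hxy⟩ := rnk_pos_iff.1 h.ge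
  exact ⟨x, y, ⟨y, hxy⟩, ⟨x, hxy⟩⟩

/-- The two-colour multiplier. -/
def Mu (c : Fin n → Bool) (K : Setoid (Fin n)) (z : Bool → Option (Fin n)) : PM n :=
  lab (fun x => (match z (c x) with | some w => Sum.inl (Quotient.mk K w) | none => Sum.inr (c x) : Quotient K ⊕ Bool))
    (fun w => Sum.inl (Quotient.mk K w))

theorem Mu_lr {c : Fin n → Bool} {K z} {y w : Fin n} : (Mu c K z).r (Sum.inl y) (Sum.inr w) ↔
    ∃ z0, z (c y) = some z0 ∧ K.r z0 w := by
  refine lab_lr.trans ?_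
  cases h : z (c y) with
  | none => simp
  | some v => simp [qmk]
theorem Mu_rr {c : Fin n → Bool} {K z} {y w : Fin n} : (Mu c K z).r (Sum.inr y) (Sum.inr w) ↔ K.r y w := by
  refine lab_rr.trans ?_
  simp [qmk]
theorem Mu_ll {c : Fin n → Bool} {K z} {y w : Fin n} (h : c y = c w) : (Mu c K z).r (Sum.inl y) (Sum.inl w) := by
  refine lab_ll.2 ?_
  simp only [h]

theorem G_compat {c : Fin n → Bool} {K z} {L : Setoid (Fin n)} (h : ∀ y y', L.r y y' → c y = c y') :
    G L (Mu c K z) = Mu c K z := G_eq_of_le fun y y' hy => Mu_ll (h y y' hy)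

theorem G_incompat {c : Fin n → Bool} {K z} {L : Setoid (Fin n)} {y1 y2} (h : L.r y1 y2) (hc : c y1 ≠ c y2) (y y') :
    (G L (Mu c K z)).r (Sum.inl y) (Sum.inl y') := by
  have key : ∀ y, (G L (Mu c K z)).r (Sum.inl y) (Sum.inl y1) := by
    intro y
    by_cases h1 : c y = c y1
    · exact G_of_right (Mu_ll h1)
    · have : c y = c y2 := by
        revert h1 hc; cases c y <;> cases c y1 <;> cases c y2 <;> simp
      exact G_trans (G_of_right (Mu_ll this)) (G_symm (G_of_left h))
  exact G_trans (key y) (G_symm (key y'))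

theorem FF_zero {L : Setoid (Fin n)} {γ : PM n} (h : ∀ y, ∃ w, (G L γ).r (Sum.inl y) (Sum.inr w)) : FF L γ = 0 := by
  unfold FF
  rw [Set.ncard_eq_zero]
  ext c
  simp only [Set.mem_ofPred_eq, Set.mem_empty_iff_false, iff_false, not_forall, not_not]
  induction c using Quotient.ind with | _ v
  rcases v with y | w
  · obtain ⟨w, hw⟩ := h y
    exact ⟨w, Quotient.sound (G_symm hw)⟩
  · exact ⟨w, rfl⟩

theorem FF_one {L : Setoid (Fin n)} {γ : PM n} (y0) (h0 : ∀ w, ¬ (G L γ).r (Sum.inl y0) (Sum.inr w))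
    (h : ∀ y, (∃ w, (G L γ).r (Sum.inl y) (Sum.inr w)) ∨ (G L γ).r (Sum.inl y) (Sum.inl y0)) : FF L γ = 1 := by
  unfold FF
  rw [Set.ncard_eq_one]
  refine ⟨Quotient.mk _ (Sum.inl y0), ?_⟩
  ext c
  simp only [Set.mem_ofPred_eq, Set.mem_singleton_iff]
  constructor
  · intro hc
    induction c using Quotient.ind with | _ v
    rcases v with y | w
    · rcases h y with ⟨w, hw⟩ | hw
      · exact absurd (Quotient.sound (G_symm hw)) (hc w)
      · exact Quotient.sound hw
    · exact absurd rfl (hc w)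
  · rintro rfl w hw
    exact h0 w (G_symm (Quotient.exact hw))

theorem prod_p0 (U L : Setoid (Fin n)) (γ : PM n) :
    Phi (p0 U L) γ = FF L γ ∧ pmul (p0 U L) γ = p0 U (botS L γ) := by
  have h := rnk_p0 U L
  have h1 := Phi_rank (α := p0 U L) (by omega) γ
  have h2 := rnk_pmul_le_left (p0 U L) γ
  rw [ckS_p0] at h1
  have h3 : rnk (pmul (p0 U L) γ) = 0 := by omega
  refine ⟨by omega, ?_⟩
  rw [eq_p0 h3, krS_pmul (by omega), ckS_pmul, krS_p0, ckS_p0]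

theorem prod_p1 (U : Setoid (Fin n)) (x) (L : Setoid (Fin n)) {y} {γ : PM n} {z}
    (hz : (G L γ).r (Sum.inl y) (Sum.inr z)) :
    Phi (p1 U x L y) γ = FF L γ ∧ pmul (p1 U x L y) γ = p1 U x (botS L γ) z := by
  have h := rnk_p1 U x L y
  have h1 := Phi_rank (α := p1 U x L y) (by omega) γ
  have h2 := rnk_pmul_le_left (p1 U x L y) γ
  rw [ckS_p1] at h1
  have hlr : (pmul (p1 U x L y) γ).r (Sum.inl x) (Sum.inr z) :=
    pmul_lr.2 ⟨y, (p1_lr U x L y).2 ⟨U.iseqv.refl x, L.iseqv.refl y⟩, by rw [ckS_p1]; exact hz⟩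
  have h3 : rnk (pmul (p1 U x L y) γ) = 1 := by have := rnk_pos_iff.2 ⟨_, _, hlr⟩; omega
  refine ⟨by omega, ?_⟩
  rw [eq_p1 h3 ⟨_, hlr⟩ ⟨_, hlr⟩, krS_pmul (by omega), ckS_pmul, krS_p1, ckS_p1]

theorem prod_p1' (U : Setoid (Fin n)) (x) (L : Setoid (Fin n)) {y} {γ : PM n}
    (hz : ∀ z, ¬ (G L γ).r (Sum.inl y) (Sum.inr z)) :
    Phi (p1 U x L y) γ + 1 = FF L γ ∧ pmul (p1 U x L y) γ = p0 U (botS L γ) := by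
  have h := rnk_p1 U x L y
  have h1 := Phi_rank (α := p1 U x L y) (by omega) γ
  rw [ckS_p1] at h1
  have h3 : rnk (pmul (p1 U x L y) γ) = 0 := by
    apply rnk_zero_of
    intro a b hab
    obtain ⟨y', hy', hG⟩ := pmul_lr.1 hab
    rw [ckS_p1] at hG
    exact hz b (G_trans (G_symm (G_of_left ((p1_lr U x L y).1 hy').2)) hG)
  refine ⟨by omega, ?_⟩
  rw [eq_p0 h3, krS_pmul (by omega), ckS_pmul, krS_p1, ckS_p1]

/-- attach everything -/
def T1 (K : Setoid (Fin n)) (z : Fin n) : PM n := Mu (fun _ => true) K (fun _ => some z)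
/-- attach nothing -/
def T0 (K : Setoid (Fin n)) : PM n := Mu (fun _ => true) K (fun _ => none)
/-- attach one colour -/
def T2 (c : Fin n → Bool) (K : Setoid (Fin n)) (z : Fin n) : PM n := Mu c K (fun b => if b then some z else none)
/-- attach two colours -/
def T3 (c : Fin n → Bool) (K : Setoid (Fin n)) (z1 z2 : Fin n) : PM n := Mu c K (fun b => some (if b then z1 else z2))

theorem botS_compat {c : Fin n → Bool} {K z} {L : Setoid (Fin n)} (h : ∀ y y', L.r y y' → c y = c y') :
    botS L (Mu c K z) = K := by
  apply Setoid.ext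
  intro w w'
  show (G _ _).r _ _ ↔ _
  rw [G_compat h]
  exact Mu_rr

theorem T1_p0 (U L K : Setoid (Fin n)) (z) : Phi (p0 U L) (T1 K z) = 0 ∧ pmul (p0 U L) (T1 K z) = p0 U K := by
  have := prod_p0 U L (T1 K z)
  rwa [FF_zero, T1, botS_compat (fun _ _ _ => rfl)] at this
  intro y
  exact ⟨z, G_of_right (Mu_lr.2 ⟨z, rfl, K.iseqv.refl z⟩)⟩
theorem T1_p1 (U : Setoid (Fin n)) (x) (L : Setoid (Fin n)) (y) (K : Setoid (Fin n)) (z) :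
    Phi (p1 U x L y) (T1 K z) = 0 ∧ pmul (p1 U x L y) (T1 K z) = p1 U x K z := by
  have := prod_p1 U x L (y := y) (γ := T1 K z) (z := z) (G_of_right (Mu_lr.2 ⟨z, rfl, K.iseqv.refl z⟩))
  rwa [FF_zero, T1, botS_compat (fun _ _ _ => rfl)] at this
  intro y
  exact ⟨z, G_of_right (Mu_lr.2 ⟨z, rfl, K.iseqv.refl z⟩)⟩

theorem T0_no (L K : Setoid (Fin n)) (y w) : ¬ (G L (T0 K)).r (Sum.inl y) (Sum.inr w) := by
  rw [T0, G_compat (fun _ _ _ => rfl), Mu_lr]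
  simp
theorem T0_FF (L K : Setoid (Fin n)) (o : Fin n) : FF L (T0 K) = 1 := by
  refine FF_one o (T0_no L K o) (fun y => Or.inr (G_of_right (Mu_ll rfl)))

theorem T0_p0 (U L K : Setoid (Fin n)) (o : Fin n) : Phi (p0 U L) (T0 K) = 1 ∧ pmul (p0 U L) (T0 K) = p0 U K := by
  have := prod_p0 U L (T0 K)
  rwa [T0_FF _ _ o, T0, botS_compat (fun _ _ _ => rfl)] at this
theorem T0_p1 (U : Setoid (Fin n)) (x) (L : Setoid (Fin n)) (y) (K : Setoid (Fin n)) :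
    Phi (p1 U x L y) (T0 K) = 0 ∧ pmul (p1 U x L y) (T0 K) = p0 U K := by
  have := prod_p1' U x L (y := y) (γ := T0 K) (T0_no L K y)
  rw [T0_FF _ _ x, T0, botS_compat (fun _ _ _ => rfl)] at this
  exact ⟨by have := this.1; rw [T0]; omega, this.2⟩

section T2
variable {c : Fin n → Bool} {L : Setoid (Fin n)}
theorem T2_yes {K : Setoid (Fin n)} {z y} (h : c y = true) : (G L (T2 c K z)).r (Sum.inl y) (Sum.inr z) :=
  G_of_right (Mu_lr.2 ⟨z, by simp [h], K.iseqv.refl z⟩)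
theorem T2_no {K : Setoid (Fin n)} {z y} (hL : ∀ y y', L.r y y' → c y = c y') (h : c y = false) (w) :
    ¬ (G L (T2 c K z)).r (Sum.inl y) (Sum.inr w) := by
  rw [T2, G_compat hL, Mu_lr]
  simp [h]
theorem T2_FF {K : Setoid (Fin n)} {z y} (hL : ∀ y y', L.r y y' → c y = c y') (h : c y = false) :
    FF L (T2 c K z) = 1 := by
  refine FF_one y (T2_no hL h) (fun y' => ?_)
  cases h' : c y' with
  | true => exact Or.inl ⟨z, T2_yes h'⟩
  | false => exact Or.inr (G_of_right (Mu_ll (h'.trans h.symm)))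

theorem T2_p0 (U : Setoid (Fin n)) {K : Setoid (Fin n)} {z y} (hL : ∀ y y', L.r y y' → c y = c y') (h : c y = false) :
    Phi (p0 U L) (T2 c K z) = 1 ∧ pmul (p0 U L) (T2 c K z) = p0 U K := by
  have := prod_p0 U L (T2 c K z)
  rwa [T2_FF hL h, T2, botS_compat hL] at this
theorem T2_p1_yes (U : Setoid (Fin n)) (x) {K : Setoid (Fin n)} {z y y'} (hL : ∀ y y', L.r y y' → c y = c y')
    (h : c y = false) (h' : c y' = true) :
    Phi (p1 U x L y') (T2 c K z) = 1 ∧ pmul (p1 U x L y') (T2 c K z) = p1 U x K z := by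
  have := prod_p1 U x L (y := y') (γ := T2 c K z) (z := z) (T2_yes h')
  rwa [T2_FF hL h, T2, botS_compat hL] at this
theorem T2_p1_no (U : Setoid (Fin n)) (x) {K : Setoid (Fin n)} {z y} (hL : ∀ y y', L.r y y' → c y = c y')
    (h : c y = false) :
    Phi (p1 U x L y) (T2 c K z) = 0 ∧ pmul (p1 U x L y) (T2 c K z) = p0 U K := by
  have := prod_p1' U x L (y := y) (γ := T2 c K z) (T2_no hL h)
  rw [T2_FF hL h, T2, botS_compat hL] at this
  exact ⟨by have := this.1; rw [T2]; omega, this.2⟩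

variable {y1 y2 : Fin n} (hL : L.r y1 y2) (h1 : c y1 = true) (h2 : c y2 = false)
include hL h1 h2
theorem T2_inc {K : Setoid (Fin n)} {z} (y) : (G L (T2 c K z)).r (Sum.inl y) (Sum.inr z) :=
  G_trans (G_incompat hL (by simp [h1, h2]) y y1) (T2_yes h1)
theorem T2_inc_bot {z} : botS L (T2 c ⊤ z) = ⊤ := by
  apply Setoid.ext
  intro w w'
  exact ⟨fun _ => trivial, fun _ => G_of_right (Mu_rr.2 trivial)⟩
theorem T2_inc_p0 (U : Setoid (Fin n)) {z} :
    Phi (p0 U L) (T2 c ⊤ z) = 0 ∧ pmul (p0 U L) (T2 c ⊤ z) = p0 U ⊤ := by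
  have := prod_p0 U L (T2 c ⊤ z)
  rwa [FF_zero (fun y => ⟨z, T2_inc hL h1 h2 y⟩), T2_inc_bot hL h1 h2] at this
theorem T2_inc_p1 (U : Setoid (Fin n)) (x y) {z} :
    Phi (p1 U x L y) (T2 c ⊤ z) = 0 ∧ pmul (p1 U x L y) (T2 c ⊤ z) = p1 U x ⊤ z := by
  have := prod_p1 U x L (γ := T2 c ⊤ z) (T2_inc hL h1 h2 y)
  rwa [FF_zero (fun y => ⟨z, T2_inc hL h1 h2 y⟩), T2_inc_bot hL h1 h2] at this
theorem T3_inc_p0 (U : Setoid (Fin n)) (K : Setoid (Fin n)) (z1 z2) :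
    ∃ K', K ≤ K' ∧ K'.r z1 z2 ∧ Phi (p0 U L) (T3 c K z1 z2) = 0 ∧ pmul (p0 U L) (T3 c K z1 z2) = p0 U K' := by
  have hF : FF L (T3 c K z1 z2) = 0 :=
    FF_zero (fun y => ⟨_, G_of_right (Mu_lr.2 ⟨_, rfl, K.iseqv.refl _⟩)⟩)
  have h3 : (G L (T3 c K z1 z2)).r (Sum.inl y1) (Sum.inr z1) := G_of_right (Mu_lr.2 ⟨z1, by simp [h1], K.iseqv.refl z1⟩)
  have h4 : (G L (T3 c K z1 z2)).r (Sum.inl y2) (Sum.inr z2) := G_of_right (Mu_lr.2 ⟨z2, by simp [h2], K.iseqv.refl z2⟩)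
  have := prod_p0 U L (T3 c K z1 z2)
  rw [hF] at this
  exact ⟨botS L (T3 c K z1 z2), fun {a b} hab => G_of_right (Mu_rr.2 hab),
    G_trans (G_symm h3) (G_trans (G_of_left hL) h4), this⟩
end T2

theorem T3_p0 {c : Fin n → Bool} {L : Setoid (Fin n)} (U : Setoid (Fin n)) {K : Setoid (Fin n)} {z1 z2}
    (hL : ∀ y y', L.r y y' → c y = c y') :
    Phi (p0 U L) (T3 c K z1 z2) = 0 ∧ pmul (p0 U L) (T3 c K z1 z2) = p0 U K := by
  have hF : FF L (T3 c K z1 z2) = 0 :=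
    FF_zero (fun y => ⟨_, G_of_right (Mu_lr.2 ⟨_, rfl, K.iseqv.refl _⟩)⟩)
  have := prod_p0 U L (T3 c K z1 z2)
  rwa [hF, T3, botS_compat hL] at this
theorem T3_p1 {c : Fin n → Bool} {L : Setoid (Fin n)} (U : Setoid (Fin n)) (x) {K : Setoid (Fin n)} {z1 z2} (y)
    (hL : ∀ y y', L.r y y' → c y = c y') :
    Phi (p1 U x L y) (T3 c K z1 z2) = 0 ∧ pmul (p1 U x L y) (T3 c K z1 z2) = p1 U x K (if c y then z1 else z2) := by
  have hF : FF L (T3 c K z1 z2) = 0 :=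
    FF_zero (fun y => ⟨_, G_of_right (Mu_lr.2 ⟨_, rfl, K.iseqv.refl _⟩)⟩)
  have := prod_p1 U x L (y := y) (γ := T3 c K z1 z2) (z := if c y then z1 else z2) (G_of_right (Mu_lr.2 ⟨_, rfl, K.iseqv.refl _⟩))
  rwa [hF, T3, botS_compat hL] at this


end Part6

section Part7

/-! ### Theorem B, rank at most one -/

/-- dual relation -/
def dS (σ : ℕ × PM n → ℕ × PM n → Prop) (a b : ℕ × PM n) : Prop := σ (a.1, flip a.2) (b.1, flip b.2)

/-- abbreviation -/
abbrev Cong (σ : ℕ × PM n → ℕ × PM n → Prop) : Prop := IsCongruence (tmul (n := n)) σ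

variable {σ : ℕ × PM n → ℕ × PM n → Prop}

theorem tmul_flip (a b : ℕ × PM n) : ((tmul a b).1, flip (tmul a b).2) = tmul (b.1, flip b.2) (a.1, flip a.2) := by
  simp only [tmul]
  rw [flip_Phi, flip_pmul, add_comm b.1 a.1]

theorem dS_cong (h : Cong σ) : Cong (dS σ) := by
  refine ⟨⟨fun x => h.1.refl _, fun hh => h.1.symm hh, fun h1 h2 => h.1.trans h1 h2⟩, fun x y a hxy => ?_⟩
  have := h.2 _ _ (a.1, flip a.2) hxy
  unfold dS
  rw [tmul_flip, tmul_flip, tmul_flip, tmul_flip]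
  exact this.symm

theorem dS_dS : dS (dS σ) = σ := by
  funext a b
  simp [dS, flip_flip]

theorem dS_iff {i j} {α β : PM n} : dS σ (i, flip α) (j, flip β) ↔ σ (i, α) (j, β) := by
  simp [dS, flip_flip]

theorem mR (h : Cong σ) {i j} {α β : PM n} (hs : σ (i, α) (j, β)) (γ : PM n) {k l} {α' β' : PM n}
    (h1 : Phi α γ = k ∧ pmul α γ = α') (h2 : Phi β γ = l ∧ pmul β γ = β') : σ (i + k, α') (j + l, β') := by
  have := (h.2 _ _ (0, γ) hs).2
  simpa only [tmul, h1.1, h1.2, h2.1, h2.2, Nat.add_zero] using this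

theorem mL (h : Cong σ) {i j} {α β : PM n} (hs : σ (i, α) (j, β)) (γ : PM n) {k l} {α' β' : PM n}
    (h1 : Phi γ α = k ∧ pmul γ α = α') (h2 : Phi γ β = l ∧ pmul γ β = β') : σ (i + k, α') (j + l, β') := by
  have := (h.2 _ _ (0, γ) hs).1
  simpa only [tmul, h1.1, h1.2, h2.1, h2.2, Nat.zero_add] using this

theorem Phi_one (α : PM n) : Phi α one = 0 := by
  apply Phi_zero
  intro y
  exact Or.inl ⟨y, lab_lr.2 rfl⟩

theorem s_add (h : Cong σ) {i j} {α β : PM n} (k : ℕ) (hs : σ (i, α) (j, β)) : σ (i + k, α) (j + k, β) := by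
  have := (h.2 _ _ (k, one) hs).2
  simpa only [tmul, Phi_one, pmul_one, Nat.add_zero] using this

theorem c00R (h : Cong σ) {i j} {U L U' L' : Setoid (Fin n)} (hs : σ (i, p0 U L) (j, p0 U' L'))
    (o : Fin n) (K : Setoid (Fin n)) : σ (i, p0 U K) (j, p0 U' K) :=
  mR h hs (T1 K o) (T1_p0 U L K o) (T1_p0 U' L' K o)
theorem c00L (h : Cong σ) {i j} {U L U' L' : Setoid (Fin n)} (hs : σ (i, p0 U L) (j, p0 U' L'))
    (o : Fin n) (K : Setoid (Fin n)) : σ (i, p0 K L) (j, p0 K L') := by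
  replace hs := dS_iff.2 hs
  refine dS_iff.1 ?_
  simp only [flip_p0] at hs ⊢
  exact c00R (dS_cong h) hs o K
theorem c10R (h : Cong σ) {i j} {U L U' L' : Setoid (Fin n)} {x y} (hs : σ (i, p1 U x L y) (j, p0 U' L'))
    (K : Setoid (Fin n)) (z) : σ (i, p1 U x K z) (j, p0 U' K) :=
  mR h hs (T1 K z) (T1_p1 U x L y K z) (T1_p0 U' L' K z)
theorem c10L (h : Cong σ) {i j} {U L U' L' : Setoid (Fin n)} {x y} (hs : σ (i, p1 U x L y) (j, p0 U' L'))
    (K : Setoid (Fin n)) (z) : σ (i, p1 K z L y) (j, p0 K L') := by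
  replace hs := dS_iff.2 hs
  refine dS_iff.1 ?_
  simp only [flip_p0, flip_p1] at hs ⊢
  exact c10R (dS_cong h) hs K z
theorem c11R (h : Cong σ) {i j} {U L U' L' : Setoid (Fin n)} {x y x' y'} (hs : σ (i, p1 U x L y) (j, p1 U' x' L' y'))
    (K : Setoid (Fin n)) (z) : σ (i, p1 U x K z) (j, p1 U' x' K z) :=
  mR h hs (T1 K z) (T1_p1 U x L y K z) (T1_p1 U' x' L' y' K z)
theorem c11L (h : Cong σ) {i j} {U L U' L' : Setoid (Fin n)} {x y x' y'} (hs : σ (i, p1 U x L y) (j, p1 U' x' L' y'))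
    (K : Setoid (Fin n)) (z) : σ (i, p1 K z L y) (j, p1 K z L' y') := by
  replace hs := dS_iff.2 hs
  refine dS_iff.1 ?_
  simp only [flip_p1] at hs ⊢
  exact c11R (dS_cong h) hs K z

theorem p1_congr {U L : Setoid (Fin n)} {x x' y y'} (hx : U.r x x') (hy : L.r y y') : p1 U x L y = p1 U x' L y' := by
  have h1 := rnk_p1 U x L y
  have h2 := rnk_p1 U x' L y'
  apply ext_le_one h1.le h2.le
  · rw [krS_p1, krS_p1]
  · rw [ckS_p1, ckS_p1]
  · rw [dm_p1, dm_p1]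
    funext a
    exact propext ⟨fun h => U.iseqv.trans h hx, fun h => U.iseqv.trans h (U.iseqv.symm hx)⟩
  · rw [cd_p1, cd_p1]
    funext a
    exact propext ⟨fun h => L.iseqv.trans h hy, fun h => L.iseqv.trans h (L.iseqv.symm hy)⟩

variable [NeZero n]

/-- rows 0 and 1 data of a relation -/
def d1 (σ : ℕ × PM n → ℕ × PM n → Prop) : D1 where
  t0 i j := σ (i, p0 ⊤ ⊤) (j, p0 ⊤ ⊤)
  t1 i j := σ (i, p1 ⊤ 0 ⊤ 0) (j, p1 ⊤ 0 ⊤ 0)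
  E i j := σ (i, p1 ⊤ 0 ⊤ 0) (j, p0 ⊤ ⊤)
  lam i := (∀ U U' L, σ (i, p0 U L) (i, p0 U' L)) ∧ σ (i, p0 ⊤ ⊤) (i + 1, p0 ⊤ ⊤)
  rho i := (∀ U L L', σ (i, p0 U L) (i, p0 U L')) ∧ σ (i, p0 ⊤ ⊤) (i + 1, p0 ⊤ ⊤)
  up i := (∀ U x L y y', σ (i, p1 U x L y) (i, p1 U x L y')) ∧ σ (i + 1, p1 ⊤ 0 ⊤ 0) (i, p0 ⊤ ⊤)
  dn i := (∀ U x x' L y, σ (i, p1 U x L y) (i, p1 U x' L y)) ∧ σ (i + 1, p1 ⊤ 0 ⊤ 0) (i, p0 ⊤ ⊤)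

theorem d1_dS : d1 (dS σ) = (d1 σ).dual := by
  unfold d1 D1.dual dS
  simp only [flip_p0, flip_p1, D1.mk.injEq, true_and]
  refine ⟨?_, ?_, ?_, ?_⟩ <;> funext i <;> refine propext (and_congr_left fun _ => ?_)
  · exact ⟨fun h U L L' => h L L' U, fun h U U' L => h L U U'⟩
  · exact ⟨fun h U U' L => h L U U', fun h U L L' => h L L' U⟩
  · exact ⟨fun h U x x' L y => h L y U x x', fun h U x L y y' => h L y y' U x⟩
  · exact ⟨fun h U x L y y' => h L y y' U x, fun h U x x' L y => h L y U x x'⟩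

theorem t0_of (h : Cong σ) {i j} {U L U' L' : Setoid (Fin n)} (hs : σ (i, p0 U L) (j, p0 U' L')) : (d1 σ).t0 i j :=
  c00L h (c00R h hs 0 ⊤) 0 ⊤
theorem t0_to (h : Cong σ) {i j} (hs : (d1 σ).t0 i j) (U L : Setoid (Fin n)) : σ (i, p0 U L) (j, p0 U L) :=
  c00L h (c00R h hs 0 L) 0 U
theorem t1_of (h : Cong σ) {i j} {U L U' L' : Setoid (Fin n)} {x y x' y'} (hs : σ (i, p1 U x L y) (j, p1 U' x' L' y')) :
    (d1 σ).t1 i j := c11L h (c11R h hs ⊤ 0) ⊤ 0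
theorem t1_to (h : Cong σ) {i j} (hs : (d1 σ).t1 i j) (U x L y) : σ (i, p1 U x L y) (j, p1 U x L y) :=
  c11L h (c11R h hs L y) U x
theorem E_of (h : Cong σ) {i j} {U L U' L' : Setoid (Fin n)} {x y} (hs : σ (i, p1 U x L y) (j, p0 U' L')) :
    (d1 σ).E i j := c10L h (c10R h hs ⊤ 0) ⊤ 0
theorem E_to (h : Cong σ) {i j} (hs : (d1 σ).E i j) (U x L y) : σ (i, p1 U x L y) (j, p0 U L) :=
  c10L h (c10R h hs L y) U x

theorem E_nextS (h : Cong σ) {i j} (hs : (d1 σ).E i j) : (d1 σ).t0 i (j + 1) :=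
  mR h hs (T0 ⊤) (T0_p1 _ _ _ _ _) (T0_p0 _ _ _ 0)

theorem E_nextE (h : Cong σ) {i j} (hs : (d1 σ).E i j) : (d1 σ).E (i + 1) i := by
  have h1 := s_add h 1 hs
  exact h.1.trans h1 (h.1.symm (E_nextS h hs))

theorem d1_valid (h : Cong σ) : (d1 σ).Valid where
  t0_refl i := h.1.refl _
  t0_symm hh := h.1.symm hh
  t0_trans h1 h2 := h.1.trans h1 h2
  t0_shift hh := s_add h 1 hh
  t1_refl i := h.1.refl _
  t1_symm hh := h.1.symm hh
  t1_trans h1 h2 := h.1.trans h1 h2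
  t1_shift hh := s_add h 1 hh
  t1_t0 hh := mR h hh (T0 ⊤) (T0_p1 _ _ _ _ _) (T0_p1 _ _ _ _ _)
  E_shift hh := s_add h 1 hh
  E_t1 h1 h2 := h.1.trans (h.1.symm h2) h1
  E_t0 h1 h2 := h.1.trans h1 h2
  E_inj1 h1 h2 := h.1.trans h1 (h.1.symm h2)
  E_inj0 h1 h2 := h.1.trans (h.1.symm h1) h2
  E_next hh := E_nextS h hh
  E_dn hh := ⟨fun U x x' L y => h.1.trans (E_to h hh U x L y) (h.1.symm (E_to h hh U x' L y)), E_nextE h hh⟩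
  E_up hh := ⟨fun U x L y y' => h.1.trans (E_to h hh U x L y) (h.1.symm (E_to h hh U x L y')), E_nextE h hh⟩
  dn_E hh := hh.2
  up_E hh := hh.2
  dn_t1 := by
    intro i j h1 h2
    refine ⟨fun U x x' L y => h.1.trans (h.1.symm (t1_to h h2 _ _ _ _)) (h.1.trans (h1.1 U x x' L y) (t1_to h h2 _ _ _ _)), ?_⟩
    exact h.1.trans (s_add h 1 (h.1.symm h2)) (h.1.trans h1.2 (mR h h2 (T0 ⊤) (T0_p1 _ _ _ _ _) (T0_p1 _ _ _ _ _)))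
  up_t1 := by
    intro i j h1 h2
    refine ⟨fun U x x' L y => h.1.trans (h.1.symm (t1_to h h2 _ _ _ _)) (h.1.trans (h1.1 U x x' L y) (t1_to h h2 _ _ _ _)), ?_⟩
    exact h.1.trans (s_add h 1 (h.1.symm h2)) (h.1.trans h1.2 (mR h h2 (T0 ⊤) (T0_p1 _ _ _ _ _) (T0_p1 _ _ _ _ _)))
  lam_t0 h1 h2 := ⟨fun U U' L => h.1.trans (h.1.symm (t0_to h h2 _ _)) (h.1.trans (h1.1 U U' L) (t0_to h h2 _ _)),
    h.1.trans (h.1.symm h2) (h.1.trans h1.2 (s_add h 1 h2))⟩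
  rho_t0 h1 h2 := ⟨fun U U' L => h.1.trans (h.1.symm (t0_to h h2 _ _)) (h.1.trans (h1.1 U U' L) (t0_to h h2 _ _)),
    h.1.trans (h.1.symm h2) (h.1.trans h1.2 (s_add h 1 h2))⟩
  lam_next hh := hh.2
  rho_next hh := hh.2

open Classical in
/-- class colouring -/
noncomputable def cl (L : Setoid (Fin n)) (y : Fin n) (x : Fin n) : Bool := decide (L.r x y)
omit [NeZero n] in
theorem cl_compat (L : Setoid (Fin n)) (y : Fin n) : ∀ a b, L.r a b → cl L y a = cl L y b := by
  intro a b hab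
  unfold cl
  rw [decide_eq_decide]
  exact ⟨fun h => L.iseqv.trans (L.iseqv.symm hab) h, fun h => L.iseqv.trans hab h⟩
omit [NeZero n] in
theorem cl_self (L : Setoid (Fin n)) (y : Fin n) : cl L y y = true := by
  unfold cl; simpa using L.iseqv.refl y
omit [NeZero n] in
theorem cl_false {L : Setoid (Fin n)} {y x : Fin n} (h : ¬ L.r x y) : cl L y x = false := by
  unfold cl; simpa using h

theorem lem0a (h : Cong σ) {i j} {U L U' L' : Setoid (Fin n)} (hs : σ (i, p0 U L) (j, p0 U' L')) {y1 y2}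
    (h1 : ¬ L.r y1 y2) (h2 : L'.r y1 y2) : (d1 σ).rho i := by
  have ht := t0_of h hs
  have hc := cl_compat L y2
  have e1 : cl L y2 y1 = false := cl_false h1
  have e2 := cl_self L y2
  have h2' := L'.iseqv.symm h2
  constructor
  · intro V
    have hs' := c00L h hs 0 V
    haveI : Finite (Setoid (Fin n)) := Finite.of_injective (fun S : Setoid (Fin n) => S.r) (fun a b hab => Setoid.ext fun x y => by
      have := congrFun (congrFun hab x) y
      exact iff_of_eq this)
    haveI : WellFoundedGT (Setoid (Fin n)) := Finite.to_wellFoundedGT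
    have top : ∀ K, σ (i, p0 V K) (i, p0 V ⊤) := by
      intro K
      induction K using WellFoundedGT.induction with | _ K ih
      by_cases hK : K = ⊤
      · rw [hK]; exact h.1.refl _
      · obtain ⟨z1, z2, hz⟩ : ∃ z1 z2, ¬ K.r z1 z2 := by
          by_contra hcon
          push Not at hcon
          exact hK (Setoid.ext fun a b => ⟨fun _ => trivial, fun _ => hcon a b⟩)
        obtain ⟨K', k1, k2, k3⟩ := T3_inc_p0 h2' e2 e1 V K z1 z2
        have hlt : K < K' := lt_of_le_of_ne k1 (fun e => hz (e ▸ k2))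
        have := mR h hs' (T3 (cl L y2) K z1 z2) (T3_p0 V hc) k3
        exact h.1.trans this (h.1.trans (h.1.symm (t0_to h ht V K')) (ih K' hlt))
    exact fun L L' => h.1.trans (top L) (h.1.symm (top L'))
  · have := mR h (c00L h hs 0 ⊤) (T2 (cl L y2) ⊤ 0) (T2_p0 ⊤ hc e1) (T2_inc_p0 h2' e2 e1 ⊤)
    exact h.1.trans ht (h.1.symm this)

theorem lem0 (h : Cong σ) {i j} {U L U' L' : Setoid (Fin n)} (hs : σ (i, p0 U L) (j, p0 U' L')) (hne : L ≠ L') :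
    (d1 σ).rho i := by
  by_contra hc
  apply hne
  apply Setoid.ext
  intro a b
  by_contra hab
  rcases (not_iff.1 hab) with hh
  by_cases h1 : L.r a b
  · have h2 : ¬ L'.r a b := fun h2 => hab ⟨fun _ => h2, fun _ => h1⟩
    exact hc ((d1_valid h).rho_t0 (lem0a h (h.1.symm hs) h2 h1) (h.1.symm (t0_of h hs)))
  · have h2 : L'.r a b := hh.1 h1
    exact hc (lem0a h hs h1 h2)

theorem lem1 (h : Cong σ) {i j} {U L U' L' : Setoid (Fin n)} {x y} (hs : σ (i, p1 U x L y) (j, p0 U' L')) (hne : L ≠ L') :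
    (d1 σ).rho j :=
  lem0 h (h.1.trans (h.1.symm (E_to h (E_of h hs) U x L y)) hs) hne

theorem lem2a (h : Cong σ) {i j} {U U' L : Setoid (Fin n)} {x y x' y'} (hs : σ (i, p1 U x L y) (j, p1 U' x' L y'))
    (hne : ¬ L.r y' y) : (d1 σ).up i := by
  have ht := t1_of h hs
  have hc := cl_compat L y
  have e1 := cl_false hne
  have e2 := cl_self L y
  constructor
  · intro V c K z1 z2
    have := mR h hs (T3 (cl L y) K z1 z2) (T3_p1 U x y hc) (T3_p1 U' x' y' hc)
    rw [e1, e2] at this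
    exact h.1.trans (c11L h this V c) (h.1.symm (t1_to h ht V c K z2))
  · have := mR h hs (T2 (cl L y) ⊤ 0) (T2_p1_yes U x hc e1 e2) (T2_p1_no U' x' hc e1)
    exact h.1.trans (E_of h this) (h.1.symm ((d1_valid h).t1_t0 ht))

theorem lem2b' (h : Cong σ) {i j} {U U' L L' : Setoid (Fin n)} {x y x' y'} (hs : σ (i, p1 U x L y) (j, p1 U' x' L' y'))
    {c : Fin n → Bool} (hc : ∀ a b, L.r a b → c a = c b) {y1 y2} (hy : L'.r y1 y2) (h1 : c y1 = true) (h2 : c y2 = false)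
    (h3 : c y = false) : (d1 σ).E i i ∧ (d1 σ).rho i := by
  have ht := t1_of h hs
  have hE : (d1 σ).E j i := E_of h (h.1.symm (mR h hs (T2 c ⊤ 0) (T2_p1_no U x hc h3) (T2_inc_p1 hy h1 h2 U' x' y')))
  have hE' : (d1 σ).E i i := (d1_valid h).E_t1 hE (h.1.symm ht)
  refine ⟨hE', ?_⟩
  have := h.1.trans (h.1.symm (E_to h hE' U x L y)) (h.1.trans hs (E_to h hE U' x' L' y'))
  refine lem0 h this ?_
  rintro rfl
  have := hc _ _ hy
  rw [h1, h2] at this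
  exact absurd this (by decide)

theorem lem2b (h : Cong σ) {i j} {U U' L L' : Setoid (Fin n)} {x y x' y'} (hs : σ (i, p1 U x L y) (j, p1 U' x' L' y'))
    (hne : L ≠ L') : (d1 σ).E i i ∧ (d1 σ).rho i := by
  have key : ∀ {i j} {U U' L L' : Setoid (Fin n)} {x y x' y'} (_ : σ (i, p1 U x L y) (j, p1 U' x' L' y'))
      {a b} (_ : ¬ L.r a b) (_ : L'.r a b), (d1 σ).E i i ∧ (d1 σ).rho i := by
    intro i j U U' L L' x y x' y' hs a b h1 h2
    have hc := cl_compat L b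
    have e1 : cl L b a = false := cl_false h1
    have e2 := cl_self L b
    cases h3 : cl L b y with
    | false => exact lem2b' h hs hc (L'.iseqv.symm h2) e2 e1 h3
    | true => exact lem2b' h hs (c := fun x => !(cl L b x)) (fun a' b' hab => by rw [hc a' b' hab]) h2 (by simp [e1]) (by simp [e2]) (by simp [h3])
  by_contra hc
  apply hne
  apply Setoid.ext
  intro a b
  by_contra hab
  rcases (not_iff.1 hab) with hh
  by_cases h1 : L.r a b
  · have h2 : ¬ L'.r a b := fun h2 => hab ⟨fun _ => h2, fun _ => h1⟩
    obtain ⟨e1, e2⟩ := key (h.1.symm hs) h2 h1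
    have ht := h.1.symm (t1_of h hs)
    have ht0 := (d1_valid h).t1_t0 ht
    exact hc ⟨(d1_valid h).E_t0 ((d1_valid h).E_t1 e1 ht) ht0, (d1_valid h).rho_t0 e2 ht0⟩
  · exact hc (key hs h1 (hh.1 h1))

theorem s_00 (h : Cong σ) {i j} {U L U' L' : Setoid (Fin n)} : σ (i, p0 U L) (j, p0 U' L') ↔
    (d1 σ).t0 i j ∧ ((d1 σ).lam i ∨ U = U') ∧ ((d1 σ).rho i ∨ L = L') := by
  constructor
  · intro hs
    refine ⟨t0_of h hs, ?_, ?_⟩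
    · by_contra hc
      push Not at hc
      have := dS_iff.2 hs
      rw [flip_p0, flip_p0] at this
      have := lem0 (dS_cong h) this hc.2
      rw [d1_dS] at this
      exact hc.1 this
    · by_contra hc
      push Not at hc
      exact hc.1 (lem0 h hs hc.2)
  · rintro ⟨h1, h2, h3⟩
    refine h.1.trans (y := (i, p0 U' L)) ?_ (h.1.trans (y := (i, p0 U' L')) ?_ (t0_to h h1 U' L'))
    · rcases h2 with h2 | rfl
      · exact h2.1 U U' L
      · exact h.1.refl _
    · rcases h3 with h3 | rfl
      · exact h3.1 U' L L'
      · exact h.1.refl _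

theorem s_10 (h : Cong σ) {i j} {U L U' L' : Setoid (Fin n)} {x y} : σ (i, p1 U x L y) (j, p0 U' L') ↔
    (d1 σ).E i j ∧ ((d1 σ).lam j ∨ U = U') ∧ ((d1 σ).rho j ∨ L = L') := by
  constructor
  · intro hs
    have hE := E_of h hs
    exact ⟨hE, ((s_00 h).1 (h.1.trans (h.1.symm (E_to h hE U x L y)) hs)).2⟩
  · rintro ⟨h1, h2, h3⟩
    exact h.1.trans (E_to h h1 U x L y) ((s_00 h).2 ⟨h.1.refl _, h2, h3⟩)

theorem s_11 (h : Cong σ) {i j} {U L U' L' : Setoid (Fin n)} {x y x' y'} : σ (i, p1 U x L y) (j, p1 U' x' L' y') ↔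
    (d1 σ).t1 i j ∧ (((d1 σ).E i i ∧ (d1 σ).lam i) ∨ (U = U' ∧ ((d1 σ).dn i ∨ U.r x' x))) ∧
    (((d1 σ).E i i ∧ (d1 σ).rho i) ∨ (L = L' ∧ ((d1 σ).up i ∨ L.r y' y))) := by
  constructor
  · have key : ∀ {σ : ℕ × PM n → ℕ × PM n → Prop} (_ : Cong σ) {i j} {U L U' L' : Setoid (Fin n)} {x y x' y'},
        σ (i, p1 U x L y) (j, p1 U' x' L' y') →
        (((d1 σ).E i i ∧ (d1 σ).rho i) ∨ (L = L' ∧ ((d1 σ).up i ∨ L.r y' y))) := by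
      intro σ h i j U L U' L' x y x' y' hs
      by_cases e : L = L'
      · subst e
        by_cases e : L.r y' y
        · exact Or.inr ⟨rfl, Or.inr e⟩
        · exact Or.inr ⟨rfl, Or.inl (lem2a h hs e)⟩
      · exact Or.inl (lem2b h hs e)
    intro hs
    refine ⟨t1_of h hs, ?_, key h hs⟩
    have hs' := dS_iff.2 hs
    rw [flip_p1, flip_p1] at hs'
    have := key (dS_cong h) hs'
    rw [d1_dS] at this
    exact this
  · rintro ⟨h1, h2, h3⟩
    by_cases hE : (d1 σ).E i i
    · have hE' : (d1 σ).E j i := (d1_valid h).E_t1 hE h1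
      refine h.1.trans (E_to h hE U x L y) (h.1.trans ((s_00 h).2 ⟨h.1.refl _, ?_, ?_⟩) (h.1.symm (E_to h hE' U' x' L' y')))
      · exact h2.imp And.right And.left
      · exact h3.imp And.right And.left
    · obtain ⟨rfl, g2⟩ := h2.resolve_left (fun hh => hE hh.1)
      obtain ⟨rfl, g3⟩ := h3.resolve_left (fun hh => hE hh.1)
      refine h.1.trans (y := (i, p1 U x' L y)) ?_ (h.1.trans (y := (i, p1 U x' L y')) ?_ (t1_to h h1 U x' L y'))
      · rcases g2 with h2 | h2
        · exact h2.1 U x x' L y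
        · rw [p1_congr (U.iseqv.symm h2) (L.iseqv.refl y)]; exact h.1.refl _
      · rcases g3 with h3 | h3
        · exact h3.1 U x' L y y'
        · rw [p1_congr (U.iseqv.refl x') (L.iseqv.symm h3)]; exact h.1.refl _

/-- Rank at most one. -/
theorem s_rel1 (h : Cong σ) {i j} {α β : PM n} (ha : rnk α ≤ 1) (hb : rnk β ≤ 1) :
    σ (i, α) (j, β) ↔ rel1 (d1 σ) i α j β := by
  have key10 : ∀ {i j} {α β : PM n}, rnk α = 1 → rnk β = 0 → (σ (i, α) (j, β) ↔ rel10 (d1 σ) i α j β) := by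
    intro i j α β ha hb
    obtain ⟨x, y, hx, hy⟩ := exists_p1 ha
    conv_lhs => rw [eq_p1 ha hx hy, eq_p0 hb, s_10 h]
    rfl
  have ha' : rnk α = 0 ∨ rnk α = 1 := by omega
  have hb' : rnk β = 0 ∨ rnk β = 1 := by omega
  rcases ha' with ha | ha <;> rcases hb' with hb | hb
  · conv_lhs => rw [eq_p0 ha, eq_p0 hb, s_00 h]
    simp only [rel1, ha, hb, rel00]; simp
  · have := key10 (i := j) (j := i) hb ha
    rw [show σ (i, α) (j, β) ↔ σ (j, β) (i, α) from ⟨fun h' => h.1.symm h', fun h' => h.1.symm h'⟩, this]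
    simp [rel1, ha, hb]
  · rw [key10 ha hb]; simp [rel1, ha, hb]
  · obtain ⟨x, y, hx, hy⟩ := exists_p1 ha
    obtain ⟨x', y', hx', hy'⟩ := exists_p1 hb
    have e1 := dm_eq_of_one ha hx
    have e2 := cd_eq_of_one ha hy
    have e1' := dm_eq_of_one hb hx'
    have e2' := cd_eq_of_one hb hy'
    conv_lhs => rw [eq_p1 ha hx hy, eq_p1 hb hx' hy', s_11 h]
    have f1 : ∀ {U : Setoid (Fin n)} {x x'}, U.r x' x ↔ (fun a => U.r a x) = (fun a => U.r a x') := by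
      intro U x x'
      constructor
      · intro h; funext a
        exact propext ⟨fun h' => U.iseqv.trans h' (U.iseqv.symm h), fun h' => U.iseqv.trans h' h⟩
      · intro h
        exact (congrFun h x').mpr (U.iseqv.refl x')
    simp only [rel1, ha, hb, rel11, e1, e2, e1', e2']
    simp only [one_ne_zero, false_and, and_false, true_and, false_or, or_false]
    refine and_congr_right fun _ => and_congr ?_ ?_
    · refine or_congr_right (and_congr_right fun e => or_congr_right ?_)
      rw [f1, e]
    · refine or_congr_right (and_congr_right fun e => or_congr_right ?_)
      rw [f1, e]


end Part7

section Part8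

/-! ### Labelled partitions -/

section labs
variable {X Y Z : Type*}

theorem lab_inj {g f : Fin n → X} {φ : X → Y} (hφ : Function.Injective φ) : lab (φ ∘ g) (φ ∘ f) = lab g f := by
  apply pm_ext <;> intro x y <;> simp only [lab_ll, lab_rr, lab_lr, Function.comp] <;> exact hφ.eq_iff

theorem lab_lab {g f h : Fin n → X} (hh : ∀ x z, g x = h z → ∃ y, f y = g x) :
    pmul (lab g f) (lab f h) = lab g h := by
  obtain ⟨h1, h2, h3⟩ := pmul_d (α := lab g f) (γ := lab f h) (fun y y' hy => lab_rr.2 (lab_ll.1 hy))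
  apply pm_ext
  · intro x x'; rw [h1, lab_ll, lab_ll]
  · intro x x'
    rw [h3]
    simp only [lab_rr, lab_lr]
    constructor
    · rintro (e | ⟨y, y', e1, e2, e3⟩)
      · exact e
      · rw [← e1, ← e2, e3]
    · exact Or.inl
  · intro x z
    rw [h2]
    simp only [lab_lr]
    constructor
    · rintro ⟨y, e1, e2⟩; rw [e1, e2]
    · intro e
      obtain ⟨y, hy⟩ := hh x z e
      exact ⟨y, hy.symm, hy.trans e⟩

theorem Phi_lab {g f : Fin n → X} {f' h : Fin n → Y} (hh : ∀ y, (∃ x, g x = f y) ∨ ∃ z, f' y = h z) :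
    Phi (lab g f) (lab f' h) = 0 := by
  apply Phi_zero
  intro y
  rcases hh y with ⟨x, hx⟩ | ⟨z, hz⟩
  · exact Or.inr (Or.inl ⟨x, lab_lr.2 hx⟩)
  · exact Or.inl ⟨z, lab_lr.2 hz⟩

theorem Phi_labL {g f : Fin n → X} {α : PM n} (hh : ∀ y, (∃ x, g x = f y)) :
    Phi (lab g f) α = 0 := by
  apply Phi_zero
  intro y
  obtain ⟨x, hx⟩ := hh y
  exact Or.inr (Or.inl ⟨x, lab_lr.2 hx⟩)

theorem lab_coarse {g : Fin n → Y} {f h : Fin n → X} {φ : X → Y} (hh : ∀ z, ∃ y, f y = h z) :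
    pmul (lab g (φ ∘ f)) (lab f h) = lab g (φ ∘ h) := by
  obtain ⟨h1, h2, h3⟩ := pmul_d (α := lab g (φ ∘ f)) (γ := lab f h) (fun y y' hy => lab_rr.2 (congrArg φ (lab_ll.1 hy)))
  apply pm_ext
  · intro x x'; rw [h1, lab_ll, lab_ll]
  · intro x x'
    rw [h3]
    simp only [lab_rr, lab_lr, Function.comp]
    constructor
    · rintro (e | ⟨y, y', e1, e2, e3⟩)
      · rw [e]
      · rw [← e1, ← e2, e3]
    · intro e
      obtain ⟨y, hy⟩ := hh x
      obtain ⟨y', hy'⟩ := hh x'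
      exact Or.inr ⟨y, y', hy, hy', by rw [hy, hy', e]⟩
  · intro x z
    rw [h2]
    simp only [lab_lr, Function.comp]
    constructor
    · rintro ⟨y, e1, e2⟩; rw [e1, e2]
    · intro e
      obtain ⟨y, hy⟩ := hh z
      exact ⟨y, by rw [hy, e], hy⟩

theorem lab_coarse' {h : Fin n → Y} {f g : Fin n → X} {φ : X → Y} (hh : ∀ z, ∃ y, f y = g z) :
    pmul (lab g f) (lab (φ ∘ f) h) = lab (φ ∘ g) h := by
  rw [pmul_flip, flip_lab, flip_lab, lab_coarse hh, flip_lab]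

theorem lab_pick {q : ℕ} {f : Fin n → Fin q} {g h : Fin n → Fin q ⊕ Z} {c : Z → Fin q}
    (hg : ∀ t, ∃ x, g x = Sum.inl t) (hgh : ∀ x z, g x = h z → ∃ t, g x = Sum.inl t) :
    pmul (lab f (Sum.elim id c ∘ g)) (lab g h) = lab (Sum.inl ∘ f) h := by
  obtain ⟨h1, h2, h3⟩ := pmul_d (α := lab f (Sum.elim id c ∘ g)) (γ := lab g h)
    (fun y y' hy => lab_rr.2 (congrArg (Sum.elim id c) (lab_ll.1 hy)))
  apply pm_ext
  · intro x x'; rw [h1, lab_ll, lab_ll]; simp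
  · intro x x'
    rw [h3]
    simp only [lab_rr, lab_lr, Function.comp]
    constructor
    · rintro (e | ⟨y, y', e1, e2, e3⟩)
      · exact e
      · obtain ⟨t, ht⟩ := hgh _ _ e1
        obtain ⟨t', ht'⟩ := hgh _ _ e2
        rw [ht, ht'] at e3
        simp only [Sum.elim_inl, id] at e3
        rw [← e1, ← e2, ht, ht', e3]
    · exact Or.inl
  · intro x z
    rw [h2]
    simp only [lab_lr, Function.comp]
    constructor
    · rintro ⟨y, e1, e2⟩
      obtain ⟨t, ht⟩ := hgh _ _ e2
      rw [ht] at e1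
      rw [← e2, ht, e1]; rfl
    · intro e
      obtain ⟨y, hy⟩ := hg (f x)
      exact ⟨y, by rw [hy]; rfl, hy.trans e⟩

theorem rnk_lab_le {q : ℕ} {g : Fin n → X} {f : Fin n → Fin q} {φ : Fin q → X} : rnk (lab g (φ ∘ f)) ≤ q := by
  obtain ⟨a, b, h1, h2⟩ := le_rnk_iff.1 (le_refl (rnk (lab g (φ ∘ f))))
  have : Function.Injective (fun s => f (b s)) := by
    intro s t hst
    apply h2
    rw [lab_ll, lab_lr.1 (h1 s), lab_lr.1 (h1 t)]
    simp only [Function.comp] at hst ⊢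
    rw [hst]
  simpa using Fintype.card_le_of_injective _ this

theorem rnk_lab_eq {q : ℕ} {g f : Fin n → Fin q} (hg : ∀ t, ∃ x, g x = t) (hf : ∀ t, ∃ x, f x = t) : rnk (lab g f) = q := by
  apply le_antisymm (rnk_lab_le (φ := id))
  choose a ha using hg
  choose b hb using hf
  exact le_rnk_iff.2 ⟨a, b, fun s => lab_lr.2 (by rw [ha]; exact (hb s).symm), fun s t hst => by
    have := lab_ll.1 hst
    rwa [ha, ha] at this⟩

end labs

/-- Normal form. -/
theorem NF {α : PM n} {q : ℕ} (hr : rnk α = q) {a b : Fin q → Fin n}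
    (h1 : ∀ s, α.r (Sum.inl (a s)) (Sum.inr (b s)))
    (h2 : ∀ s t, α.r (Sum.inl (a s)) (Sum.inl (a t)) → s = t) :
    ∃ g h : Fin n → Fin q ⊕ Quotient α, α = lab g h ∧ (∀ t, g (a t) = Sum.inl t) ∧ (∀ t, h (b t) = Sum.inl t) ∧
      ∀ x z, g x = h z → ∃ t, g x = Sum.inl t := by
  classical
  let k : V n → Fin q ⊕ Quotient α := fun v => if hv : ∃ t, α.r v (Sum.inl (a t)) then Sum.inl hv.choose else
    Sum.inr (Quotient.mk α v)
  have kv : ∀ {v t}, α.r v (Sum.inl (a t)) → k v = Sum.inl t := by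
    intro v t hv
    have he : ∃ t, α.r v (Sum.inl (a t)) := ⟨t, hv⟩
    simp only [k, dif_pos he]
    rw [h2 _ _ (α.iseqv.trans (α.iseqv.symm he.choose_spec) hv)]
  have kn : ∀ {v}, (¬ ∃ t, α.r v (Sum.inl (a t))) → k v = Sum.inr (Quotient.mk α v) := by
    intro v hv
    simp only [k, dif_neg hv]
  have kk : ∀ u v, k u = k v ↔ α.r u v := by
    intro u v
    constructor
    · intro e
      by_cases hu : ∃ t, α.r u (Sum.inl (a t)) <;> by_cases hv : ∃ t, α.r v (Sum.inl (a t))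
      · obtain ⟨t, ht⟩ := hu
        obtain ⟨s, hs⟩ := hv
        rw [kv ht, kv hs] at e
        cases Sum.inl_injective e
        exact α.iseqv.trans ht (α.iseqv.symm hs)
      · obtain ⟨t, ht⟩ := hu
        rw [kv ht, kn hv] at e; cases e
      · obtain ⟨t, ht⟩ := hv
        rw [kv ht, kn hu] at e; cases e
      · rw [kn hu, kn hv] at e
        exact (qmk α).1 (Sum.inr_injective e)
    · intro e
      by_cases hu : ∃ t, α.r u (Sum.inl (a t))
      · obtain ⟨t, ht⟩ := hu
        rw [kv ht, kv (α.iseqv.trans (α.iseqv.symm e) ht)]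
      · have hv : ¬ ∃ t, α.r v (Sum.inl (a t)) := fun ⟨t, ht⟩ => hu ⟨t, α.iseqv.trans e ht⟩
        rw [kn hu, kn hv, (qmk α).2 e]
  refine ⟨fun x => k (Sum.inl x), fun y => k (Sum.inr y), ?_, fun t => kv (α.iseqv.refl _),
    fun t => kv (α.iseqv.symm (h1 t)), ?_⟩
  · apply pm_ext <;> intro x y <;> simp only [lab_ll, lab_rr, lab_lr, kk]
  · intro x z e
    obtain ⟨t, ht⟩ := reps_full hr h1 h2 (x := x) ⟨z, (kk _ _).1 e⟩
    exact ⟨t, kv ht⟩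

theorem NF_H {α β : PM n} {q : ℕ} {a b : Fin q → Fin n} {Z : Type*} {g h : Fin n → Fin q ⊕ Z} (e : α = lab g h)
    (ga : ∀ t, g (a t) = Sum.inl t) (hb : ∀ t, h (b t) = Sum.inl t) (hgh : ∀ x z, g x = h z → ∃ t, g x = Sum.inl t)
    (hH : greenH pmul α β) {π : Equiv.Perm (Fin q)} (hp : ∀ s, β.r (Sum.inl (a s)) (Sum.inr (b (π s)))) :
    β = lab (Sum.map π id ∘ g) h := by
  obtain ⟨⟨k1, k2⟩, k3, k4⟩ := greenH_iff.1 hH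
  have inj : Function.Injective (Sum.map π id : Fin q ⊕ Z → Fin q ⊕ Z) :=
    Function.Injective.sumMap π.injective Function.injective_id
  have ll : ∀ x x', β.r (Sum.inl x) (Sum.inl x') ↔ g x = g x' := by
    intro x x'; rw [← rkr k1, e, lab_ll]
  have rr : ∀ x x', β.r (Sum.inr x) (Sum.inr x') ↔ h x = h x' := by
    intro x x'; rw [← rck k3, e, lab_rr]
  apply pm_ext
  · intro x x'
    rw [ll, lab_ll]; exact inj.eq_iff.symm
  · intro x x'
    rw [rr, lab_rr]
  · intro x y
    rw [lab_lr]
    constructor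
    · intro hxy
      have hd : dm α x := (k2 x).2 ⟨y, hxy⟩
      obtain ⟨z, hz⟩ := hd
      rw [e, lab_lr] at hz
      obtain ⟨t, ht⟩ := hgh _ _ hz
      have h1 : β.r (Sum.inl x) (Sum.inl (a t)) := (ll _ _).2 (by rw [ht, ga])
      have h2 := β.iseqv.trans (β.iseqv.symm hxy) (β.iseqv.trans h1 (hp t))
      simp only [Function.comp, ht, (rr _ _).1 h2, hb, Sum.map_inl]
    · intro hxy
      cases hg : g x with
      | inl t =>
        simp only [Function.comp, hg, Sum.map_inl] at hxy
        have h1 : β.r (Sum.inl x) (Sum.inl (a t)) := (ll _ _).2 (by rw [hg, ga])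
        have h2 : β.r (Sum.inr (b (π t))) (Sum.inr y) := (rr _ _).2 (by rw [hb, hxy])
        exact β.iseqv.trans h1 (β.iseqv.trans (hp t) h2)
      | inr c =>
        simp only [Function.comp, hg, Sum.map_inr, id] at hxy
        obtain ⟨t, ht⟩ := hgh x y (by rw [hg, hxy])
        rw [hg] at ht; cases ht

/-- Existence of the permutational difference. -/
theorem pd_exists {α β : PM n} {q : ℕ} (hr : rnk α = q) {a b : Fin q → Fin n}
    (h1 : ∀ s, α.r (Sum.inl (a s)) (Sum.inr (b s)))
    (h2 : ∀ s t, α.r (Sum.inl (a s)) (Sum.inl (a t)) → s = t) (hH : greenH pmul α β) :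
    ∃ π : Equiv.Perm (Fin q), ∀ s, β.r (Sum.inl (a s)) (Sum.inr (b (π s))) := by
  obtain ⟨⟨k1, k2⟩, k3, k4⟩ := greenH_iff.1 hH
  have : ∀ s, ∃ t, β.r (Sum.inl (a s)) (Sum.inr (b t)) := by
    intro s
    obtain ⟨y, hy⟩ := (k2 (a s)).1 ⟨_, h1 s⟩
    obtain ⟨x, hx⟩ := (k4 y).2 ⟨_, hy⟩
    obtain ⟨t, -, ht⟩ := reps_full' hr h1 h2 hx
    exact ⟨t, β.iseqv.trans hy ((rck k3).1 ht)⟩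
  choose p hp using this
  have inj : Function.Injective p := by
    intro s t hst
    apply h2
    rw [rkr k1]
    have := hp t
    rw [← hst] at this
    exact β.iseqv.trans (hp s) (β.iseqv.symm this)
  exact ⟨Equiv.ofBijective p (Finite.injective_iff_bijective.1 inj), hp⟩


end Part8

section Part9

/-! ### Theorem B, rank at least two -/

/-- `h` is good for `α`. -/
def good {q : ℕ} (h : Fin n → Fin q) (α : PM n) : Prop :=
  (∀ x x', α.r (Sum.inl x) (Sum.inl x') → h x = h x') ∧ ∀ t, ∃ x, h x = t ∧ dm α x

theorem good_rnk {q : ℕ} {f h : Fin n → Fin q} {α : PM n} (hf : ∀ t, ∃ x, f x = t) (hg : good h α) :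
    rnk (pmul (lab f h) α) = q := by
  apply le_antisymm ((rnk_pmul_le_left _ _).trans (rnk_lab_le (φ := id)))
  obtain ⟨h1, h2, h3⟩ := pmul_d (α := lab f h) (γ := α) (fun y y' hy => lab_rr.2 (hg.1 _ _ hy))
  choose a ha using hf
  choose x hx hd using hg.2
  choose b hb using hd
  refine le_rnk_iff.2 ⟨a, b, fun s => (h2 _ _).2 ⟨x s, lab_lr.2 (by rw [ha, hx]), hb s⟩, fun s t hst => ?_⟩
  have := lab_ll.1 ((h1 _ _).1 hst)
  rwa [ha, ha] at this

theorem rnk_good {q : ℕ} {f h : Fin n → Fin q} {α : PM n} (hr : rnk (pmul (lab f h) α) = q) : good h α := by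
  obtain ⟨a, b, h1, h2⟩ := le_rnk_iff.1 hr.ge
  have inj : Function.Injective (fun s => f (a s)) := by
    intro s t hst
    exact h2 s t (pmul_ll.2 (Or.inl (lab_ll.2 hst)))
  have sur := (Finite.injective_iff_surjective.1 inj)
  have g1 : ∀ x x', α.r (Sum.inl x) (Sum.inl x') → h x = h x' := by
    intro x x' hx
    obtain ⟨s, hs⟩ := sur (h x)
    obtain ⟨t, ht⟩ := sur (h x')
    have := h2 s t (pmul_ll.2 (Or.inr ⟨x, x', lab_lr.2 hs, lab_lr.2 ht, G_of_right hx⟩))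
    rw [← hs, ← ht, this]
  refine ⟨g1, fun t => ?_⟩
  obtain ⟨k1, k2, k3⟩ := pmul_d (α := lab f h) (γ := α) (fun y y' hy => lab_rr.2 (g1 _ _ hy))
  obtain ⟨s, hs⟩ := sur t
  obtain ⟨y, hy, hz⟩ := (k2 _ _).1 (h1 s)
  exact ⟨y, by rw [← hs]; exact (lab_lr.1 hy).symm, _, hz⟩

theorem good_lab {q : ℕ} {Z : Type*} {g h : Fin n → Fin q ⊕ Z} (hg : ∀ t, ∃ x, g x = Sum.inl t) (hh : ∀ t, ∃ x, h x = Sum.inl t)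
    (c : Z → Fin q) : good (Sum.elim id c ∘ g) (lab g h) := by
  refine ⟨fun x x' hx => congrArg (Sum.elim id c) (lab_ll.1 hx), fun t => ?_⟩
  obtain ⟨x, hx⟩ := hg t
  obtain ⟨y, hy⟩ := hh t
  exact ⟨x, by simp [hx], y, lab_lr.2 (hx.trans hy.symm)⟩

theorem NF' (α : PM n) : ∃ g h : Fin n → Fin (rnk α) ⊕ Quotient α, α = lab g h ∧ (∀ t, ∃ x, g x = Sum.inl t) ∧
    (∀ t, ∃ y, h y = Sum.inl t) ∧ ∀ x z, g x = h z → ∃ t, g x = Sum.inl t := by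
  obtain ⟨a, b, h1, h2⟩ := le_rnk_iff.1 (le_refl (rnk α))
  obtain ⟨g, h, e, ga, hb, hgh⟩ := NF rfl h1 h2
  exact ⟨g, h, e, fun t => ⟨_, ga t⟩, fun t => ⟨_, hb t⟩, hgh⟩

theorem sep1 {β : PM n} {q : ℕ} (hr : rnk β = q) (hq : 2 ≤ q) {x x'} (hx : ¬ β.r (Sum.inl x) (Sum.inl x')) :
    ∃ h : Fin n → Fin q, good h β ∧ h x ≠ h x' := by
  classical
  subst hr
  obtain ⟨g, h, e, hg, hh, hgh⟩ := NF' β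
  have hx' : g x ≠ g x' := fun e' => hx (by rw [e]; exact lab_ll.2 e')
  have key : ∃ c : Quotient β → Fin (rnk β), Sum.elim id c (g x) ≠ Sum.elim id c (g x') := by
    have ne : ∀ t : Fin (rnk β), ∃ t', t' ≠ t := fun t => by
      haveI : Nontrivial (Fin (rnk β)) := Fin.nontrivial_iff_two_le.2 hq
      exact exists_ne t
    cases e1 : g x with
    | inl t =>
      cases e2 : g x' with
      | inl t' => exact ⟨fun _ => t, by rw [e1, e2] at hx'; simpa using hx'⟩
      | inr z => obtain ⟨t', ht'⟩ := ne t; exact ⟨fun _ => t', by simpa using ht'.symm⟩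
    | inr z =>
      cases e2 : g x' with
      | inl t => obtain ⟨t', ht'⟩ := ne t; exact ⟨fun _ => t', by simpa using ht'⟩
      | inr z' =>
        obtain ⟨t', ht'⟩ := ne ⟨0, by omega⟩
        refine ⟨fun w => if w = z then t' else ⟨0, by omega⟩, ?_⟩
        have : z' ≠ z := by rintro rfl; exact hx' (by rw [e1, e2])
        simpa [this] using ht'
  obtain ⟨c, hc⟩ := key
  refine ⟨Sum.elim id c ∘ g, ?_, hc⟩
  have := good_lab hg hh c
  rwa [← e] at this

theorem sep2 {α β : PM n} {q : ℕ} (hr : rnk α = q) (hq : 2 ≤ q) (hk : krS α = krS β) {x} (hx : dm α x) (hx' : ¬ dm β x) :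
    ∃ h : Fin n → Fin q, good h α ∧ ¬ good h β := by
  subst hr
  obtain ⟨g, h, e, hg, hh, hgh⟩ := NF' α
  have hx0 := hx
  obtain ⟨y, hy⟩ := hx0
  rw [e, lab_lr] at hy
  obtain ⟨s, hs⟩ := hgh _ _ hy
  haveI : Nontrivial (Fin (rnk α)) := Fin.nontrivial_iff_two_le.2 hq
  obtain ⟨t', ht'⟩ := exists_ne s
  refine ⟨Sum.elim id (fun _ => t') ∘ g, ?_, fun hb => ?_⟩
  · have := good_lab hg hh (fun _ => t')
    rwa [← e] at this
  · obtain ⟨y, e1, e2⟩ := hb.2 s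
    cases e3 : g y with
    | inr z => simp [e3, ht'] at e1
    | inl t =>
      simp only [Function.comp, e3, Sum.elim_inl, id] at e1
      have : α.r (Sum.inl x) (Sum.inl y) := by rw [e]; exact lab_ll.2 (by rw [hs, e3, e1])
      obtain ⟨w, hw⟩ := e2
      exact hx' ⟨w, β.iseqv.trans ((rkr hk).1 this) hw⟩

theorem sep {α β : PM n} {q : ℕ} (hr : rnk α = q) (hr' : rnk β = q) (hq : 2 ≤ q)
    (hne : ¬ (krS α = krS β ∧ ∀ x, dm α x ↔ dm β x)) :
    ∃ h : Fin n → Fin q, (good h α ∧ ¬ good h β) ∨ (good h β ∧ ¬ good h α) := by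
  by_cases hk : krS α = krS β
  · have : ∃ x, ¬ (dm α x ↔ dm β x) := by
      by_contra hc; push Not at hc; exact hne ⟨hk, hc⟩
    obtain ⟨x, hx⟩ := this
    by_cases h1 : dm α x
    · obtain ⟨h, hh⟩ := sep2 hr hq hk h1 (fun h2 => hx ⟨fun _ => h2, fun _ => h1⟩)
      exact ⟨h, Or.inl hh⟩
    · have h2 : dm β x := by tauto
      obtain ⟨h, hh⟩ := sep2 hr' hq hk.symm h2 h1
      exact ⟨h, Or.inr hh⟩
  · have : ∃ x x', ¬ (α.r (Sum.inl x) (Sum.inl x') ↔ β.r (Sum.inl x) (Sum.inl x')) := by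
      by_contra hc; push Not at hc
      exact hk (Setoid.ext hc)
    obtain ⟨x, x', hx⟩ := this
    by_cases h1 : α.r (Sum.inl x) (Sum.inl x')
    · obtain ⟨h, hh, hh'⟩ := sep1 hr' hq (x := x) (x' := x') (fun h2 => hx ⟨fun _ => h2, fun _ => h1⟩)
      exact ⟨h, Or.inr ⟨hh, fun hg => hh' (hg.1 _ _ h1)⟩⟩
    · obtain ⟨h, hh, hh'⟩ := sep1 hr hq h1
      have h2 : β.r (Sum.inl x) (Sum.inl x') := by tauto
      exact ⟨h, Or.inl ⟨hh, fun hg => hh' (hg.1 _ _ h2)⟩⟩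

theorem exists_surj {q : ℕ} (h1 : 1 ≤ q) (hq : q ≤ n) : ∃ f : Fin n → Fin q, ∀ t, ∃ x, f x = t := by
  refine ⟨fun x => ⟨min x.1 (q - 1), by omega⟩, fun t => ⟨⟨t.1, by omega⟩, ?_⟩⟩
  ext
  simp only
  omega

variable {σ : ℕ × PM n → ℕ × PM n → Prop}

/-- Factoring through `lab f f`. -/
theorem fact (α : PM n) {q : ℕ} (h1 : 1 ≤ q) (hr : rnk α ≤ q) [NeZero n] {f : Fin n → Fin q} (hf : ∀ t, ∃ x, f x = t) :
    ∃ Γ Δ : PM n, Phi Γ (lab f f) = 0 ∧ pmul Γ (lab f f) = Γ ∧ Phi Γ Δ = 0 ∧ pmul Γ Δ = α := by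
  obtain ⟨g, h, e, hg, hh, hgh⟩ := NF' α
  let F : Fin q → Fin (rnk α) ⊕ Quotient α := fun t => if ht : t.1 < rnk α then Sum.inl ⟨t.1, ht⟩ else g 0
  have F1 : ∀ t, ∃ x, g x = F t := by
    intro t
    by_cases ht : t.1 < rnk α
    · simp only [F, dif_pos ht]; exact hg _
    · simp only [F, dif_neg ht]; exact ⟨0, rfl⟩
  have F2 : ∀ t, ∃ y, F y = Sum.inl t := by
    intro t
    exact ⟨⟨t.1, by omega⟩, by simp [F]⟩
  refine ⟨lab g (F ∘ f), lab (F ∘ f) h, ?_, ?_, ?_, ?_⟩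
  · exact Phi_lab (fun y => Or.inr ⟨y, rfl⟩)
  · exact lab_coarse (fun z => ⟨z, rfl⟩)
  · exact Phi_lab (fun y => Or.inl (F1 (f y)))
  · conv_rhs => rw [e]
    apply lab_lab
    intro x z hxz
    obtain ⟨t, ht⟩ := hgh x z hxz
    obtain ⟨s, hs⟩ := F2 t
    obtain ⟨y, hy⟩ := hf s
    exact ⟨y, by simp only [Function.comp]; rw [hy, hs, ht]⟩

/-- From `α` of rank `q` to `lab f f`. -/
theorem unfact (α : PM n) {q : ℕ} (h1 : 1 ≤ q) (hr : rnk α = q) {f : Fin n → Fin q} (hf : ∀ t, ∃ x, f x = t) :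
    ∃ γ δ : PM n, Phi γ α = 0 ∧ Phi (pmul γ α) δ = 0 ∧ pmul (pmul γ α) δ = lab f f := by
  subst hr
  obtain ⟨g, h, e, hg, hh, hgh⟩ := NF' α
  have hgh' : ∀ x z, h x = g z → ∃ t, h x = Sum.inl t := fun x z hxz => by rw [hxz]; exact hgh z x hxz.symm
  let c : Quotient α → Fin (rnk α) := fun _ => ⟨0, by omega⟩
  refine ⟨lab f (Sum.elim id c ∘ g), lab (Sum.elim id c ∘ h) f, Phi_labL (fun y => hf _), ?_⟩
  have e2 : pmul (lab f (Sum.elim id c ∘ g)) α = lab (Sum.inl ∘ f) h :=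
    (congrArg (pmul _) e).trans (lab_pick hg hgh)
  rw [e2]
  constructor
  · exact Phi_lab (fun y => Or.inr ((hf _).imp fun _ hx => hx.symm))
  · rw [pmul_flip, flip_lab, flip_lab, lab_pick (h := Sum.inl ∘ f) hh (fun x z hxz => ⟨f z, hxz⟩), flip_lab, lab_inj Sum.inl_injective]

/-- The left identity of `β` of small rank. -/
theorem eta (β : PM n) [NeZero n] : ∃ η : PM n, Phi η β = 0 ∧ pmul η β = β ∧ rnk η ≤ max 1 (rnk β) := by
  obtain ⟨g, h, e, hg, hh, hgh⟩ := NF' β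
  let r := max 1 (rnk β)
  let F : Fin r → Fin (rnk β) ⊕ Quotient β := fun t => if ht : t.1 < rnk β then Sum.inl ⟨t.1, ht⟩ else g 0
  have F1 : ∀ t, ∃ x, g x = F t := by
    intro t
    by_cases ht : t.1 < rnk β
    · simp only [F, dif_pos ht]; exact hg _
    · simp only [F, dif_neg ht]; exact ⟨0, rfl⟩
  let i : Fin (rnk β) ⊕ Quotient β → Fin r :=
    Sum.elim (fun t => ⟨t.1, lt_of_lt_of_le t.2 (le_max_right _ _)⟩) (fun _ => ⟨0, lt_of_lt_of_le Nat.one_pos (le_max_left _ _)⟩)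
  have Fi : ∀ t, F (i (Sum.inl t)) = Sum.inl t := by intro t; simp [F, i]
  refine ⟨lab g (F ∘ (i ∘ g)), Phi_labL (fun y => F1 _), ?_, rnk_lab_le⟩
  suffices hsuf : pmul (lab g (F ∘ (i ∘ g))) (lab g h) = lab g h from
    (congrArg (pmul _) e).trans (hsuf.trans e.symm)
  obtain ⟨h1, h2, h3⟩ := pmul_d (α := lab g (F ∘ (i ∘ g))) (γ := lab g h)
    (fun y y' hy => lab_rr.2 (congrArg (fun x => F (i x)) (lab_ll.1 hy)))
  apply pm_ext
  · intro x x'; rw [h1, lab_ll, lab_ll]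
  · intro x x'
    rw [h3]
    simp only [lab_rr, lab_lr, Function.comp]
    constructor
    · rintro (e | ⟨y, y', e1, e2, e3⟩)
      · exact e
      · obtain ⟨t, ht⟩ := hgh _ _ e1
        obtain ⟨t', ht'⟩ := hgh _ _ e2
        rw [ht, ht', Fi, Fi] at e3
        rw [← e1, ← e2, ht, ht', e3]
    · exact Or.inl
  · intro x z
    rw [h2]
    simp only [lab_lr, Function.comp]
    constructor
    · rintro ⟨y, e1, e2⟩
      obtain ⟨t, ht⟩ := hgh _ _ e2
      rw [ht, Fi] at e1
      rw [← e2, ht, e1]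
    · intro e
      obtain ⟨t, ht⟩ := hgh _ _ e
      exact ⟨x, by rw [ht, Fi], e⟩


end Part9

section Part10

variable {σ : ℕ × PM n → ℕ × PM n → Prop} [NeZero n]

theorem mR' (h : Cong σ) {i j} {α β : PM n} (hs : σ (i, α) (j, β)) (γ : PM n) :
    σ (i + Phi α γ, pmul α γ) (j + Phi β γ, pmul β γ) := mR h hs γ ⟨rfl, rfl⟩ ⟨rfl, rfl⟩
theorem mL' (h : Cong σ) {i j} {α β : PM n} (hs : σ (i, α) (j, β)) (γ : PM n) :
    σ (i + Phi γ α, pmul γ α) (j + Phi γ β, pmul γ β) := mL h hs γ ⟨rfl, rfl⟩ ⟨rfl, rfl⟩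

/-- Everything of rank at most `q` and index at least `i` is collapsed. -/
def Co (σ : ℕ × PM n → ℕ × PM n → Prop) (q i : ℕ) : Prop := ∀ k α', rnk α' ≤ q → σ (i + k, α') (i, p0 ⊤ ⊤)

theorem Co_mono {q r i} (hr : r ≤ q) (hc : Co σ q i) : Co σ r i := fun k α' ha => hc k α' (ha.trans hr)

theorem Co_add (h : Cong σ) {q i} (k) (hc : Co σ q i) : Co σ q (i + k) := by
  intro l α' ha
  have h1 := hc (k + l) α' ha
  have h2 := hc k (p0 ⊤ ⊤) (by rw [rnk_p0]; omega)
  rw [← add_assoc] at h1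
  exact h.1.trans h1 (h.1.symm h2)

theorem Co_zero (h : Cong σ) {i} : Co σ 0 i ↔ (d1 σ).lam i ∧ (d1 σ).rho i := by
  have hv := d1_valid h
  constructor
  · intro hc
    have h1 := hc 1 (p0 ⊤ ⊤) (by rw [rnk_p0])
    refine ⟨⟨fun U U' L => ?_, h.1.symm h1⟩, ⟨fun U L L' => ?_, h.1.symm h1⟩⟩
    · exact h.1.trans (hc 0 (p0 U L) (by rw [rnk_p0])) (h.1.symm (hc 0 (p0 U' L) (by rw [rnk_p0])))
    · exact h.1.trans (hc 0 (p0 U L) (by rw [rnk_p0])) (h.1.symm (hc 0 (p0 U L') (by rw [rnk_p0])))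
  · rintro ⟨h1, h2⟩ k α' ha
    rw [eq_p0 (α := α') (by omega), s_00 h]
    exact ⟨hv.t0_symm (hv.lam_run k h1), Or.inl (hv.lam_add k h1), Or.inl (hv.rho_add k h2)⟩

theorem Co_one (h : Cong σ) {i} : Co σ 1 i ↔ (d1 σ).E i i ∧ (d1 σ).lam i ∧ (d1 σ).rho i := by
  have hv := d1_valid h
  constructor
  · intro hc
    exact ⟨hc 0 (p1 ⊤ 0 ⊤ 0) (by rw [rnk_p1]), (Co_zero h).1 (Co_mono (by omega) hc)⟩
  · rintro ⟨hE, h1, h2⟩ k α' ha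
    rcases Nat.lt_or_ge (rnk α') 1 with h0 | h0
    · exact (Co_zero h).2 ⟨h1, h2⟩ k α' (by omega)
    · have h0' : rnk α' = 1 := by omega
      obtain ⟨x, y, hx, hy⟩ := exists_p1 h0'
      rw [eq_p1 h0' hx hy, s_10 h]
      exact ⟨hv.E_t0 (hv.E_add k hE) (hv.t0_symm (hv.lam_run k h1)), Or.inl h1, Or.inl h2⟩

theorem lab_ker {q : ℕ} {f : Fin n → Fin q} (π : Equiv.Perm (Fin q)) {K : Setoid (Fin n)} {y z z1 : Fin n} {L : Setoid (Fin n)}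
    (hK : ∀ a b, f a = f b → K.r a b) (hπ : ∀ a b, K.r a b ↔ ∀ a' b', π (f a') = f a → π (f b') = f b → K.r a' b')
    (hf : ∀ t, ∃ x, f x = t) (hz : π (f z1) = f z) :
    pmul (lab (π ∘ f) f) (p1 K z L y) = p1 K z1 L y := by
  have hG : G (ckS (lab (π ∘ f) f)) (p1 K z L y) = p1 K z L y :=
    G_eq_of_le (fun a b hab => (show (krS (p1 K z L y)).r a b by rw [krS_p1]; exact hK _ _ hab))
  have e1 : ∀ a b, (p1 K z L y).r (Sum.inl a) (Sum.inl b) ↔ K.r a b := fun a b => by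
    have : (krS (p1 K z L y)).r a b ↔ K.r a b := by rw [krS_p1]
    exact this
  have e1' : ∀ a b, (p1 K z1 L y).r (Sum.inl a) (Sum.inl b) ↔ K.r a b := fun a b => by
    have : (krS (p1 K z1 L y)).r a b ↔ K.r a b := by rw [krS_p1]
    exact this
  have e2 : ∀ z, ∀ a b, (p1 K z L y).r (Sum.inr a) (Sum.inr b) ↔ L.r a b := fun z a b => by
    have : (ckS (p1 K z L y)).r a b ↔ L.r a b := by rw [ckS_p1]
    exact this
  have key : ∀ a b a' b', π (f a') = f a → π (f b') = f b → (K.r a b ↔ K.r a' b') := by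
    intro a b a' b' h1 h2
    refine ⟨fun h => (hπ a b).1 h a' b' h1 h2, fun h => (hπ a b).2 fun a'' b'' h3 h4 => ?_⟩
    have e1 := hK a'' a' (π.injective (h3.trans h1.symm))
    have e2 := hK b'' b' (π.injective (h4.trans h2.symm))
    exact K.iseqv.trans e1 (K.iseqv.trans h (K.iseqv.symm e2))
  apply pm_ext
  · intro a b
    rw [pmul_ll, hG, e1']
    simp only [lab_ll, lab_lr, e1, Function.comp]
    constructor
    · rintro (e | ⟨a', b', h1, h2, h3⟩)
      · exact hK _ _ (π.injective e)
      · exact (key _ _ _ _ h1 h2).1 h3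
    · intro e
      obtain ⟨a', ha'⟩ := hf (π (f a))
      obtain ⟨b', hb'⟩ := hf (π (f b))
      exact Or.inr ⟨a', b', ha'.symm, hb'.symm, (key _ _ _ _ ha'.symm hb'.symm).2 e⟩
  · intro a b
    rw [pmul_rr, hG, e2, e2]
  · intro a b
    rw [pmul_lr, hG]
    simp only [lab_lr, p1_lr, Function.comp]
    constructor
    · rintro ⟨a', h1, h2, h3⟩
      exact ⟨(key _ _ _ _ h1 hz).1 h2, h3⟩
    · rintro ⟨h2, h3⟩
      obtain ⟨a', ha'⟩ := hf (π (f a))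
      exact ⟨a', ha'.symm, (key _ _ _ _ ha'.symm hz).2 h2, h3⟩

theorem lemS1 (h : Cong σ) {q i i'} (hq : 2 ≤ q) {f : Fin n → Fin q} (hf : ∀ t, ∃ x, f x = t) {ζ : PM n}
    (hs : σ (i, lab f f) (i', ζ)) (hz : rnk ζ ≤ 1) : (d1 σ).E i i ∧ (d1 σ).lam i := by
  have hv := d1_valid h
  have hK : ∃ K : Setoid (Fin n), (∀ a b, f a = f b → K.r a b) ∧ K ≠ krS ζ := by
    by_cases hk : krS ζ = ⊤
    · refine ⟨Setoid.ker f, fun a b hab => hab, fun e => ?_⟩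
      obtain ⟨x0, h0⟩ := hf ⟨0, by omega⟩
      obtain ⟨x1, h1⟩ := hf ⟨1, by omega⟩
      have : (Setoid.ker f).r x0 x1 := by rw [e, hk]; trivial
      have : f x0 = f x1 := this
      rw [h0, h1] at this
      simp at this
    · exact ⟨⊤, fun _ _ _ => trivial, fun e => hk e.symm⟩
  obtain ⟨K, hK1, hK2⟩ := hK
  set γ := p1 K 0 ⊤ 0 with hγ
  have e1 : pmul (lab f f) γ = γ := by
    refine lab_ker 1 hK1 (fun a b => ⟨fun hab a' b' h1 h2 => ?_, fun hab => hab a b rfl rfl⟩) hf rfl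
    exact K.iseqv.trans (hK1 _ _ h1) (K.iseqv.trans hab (K.iseqv.symm (hK1 _ _ h2)))
  have hs2 := mR h hs γ ⟨Phi_labL (fun y => ⟨y, rfl⟩), e1⟩ ⟨rfl, rfl⟩
  rw [add_zero] at hs2
  have hkr : krS (pmul ζ γ) = krS ζ := by
    obtain ⟨a, b, h1, h2, -⟩ := rnk_reps (rfl : rnk ζ = rnk ζ)
    refine kept_ll rfl h1 h2 (fun s t _ => ?_)
    ext; omega
  have hr := (rnk_pmul_le_left ζ γ).trans hz
  rcases Nat.lt_or_ge (rnk (pmul ζ γ)) 1 with h0 | h0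
  · rw [eq_p0 (α := pmul ζ γ) (by omega), s_10 h, hkr] at hs2
    obtain ⟨hE, h1, -⟩ := hs2
    exact (hv.lam_E hE).1 (h1.resolve_right hK2)
  · have h0' : rnk (pmul ζ γ) = 1 := by omega
    obtain ⟨x, y, hx, hy⟩ := exists_p1 h0'
    rw [eq_p1 h0' hx hy, s_11 h, hkr] at hs2
    exact hs2.2.1.resolve_right (fun hh => hK2 hh.1)

theorem lemS (h : Cong σ) {q i i'} (hq : 2 ≤ q) {f : Fin n → Fin q} (hf : ∀ t, ∃ x, f x = t) {ζ : PM n}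
    (hs : σ (i, lab f f) (i', ζ)) (hz : rnk ζ ≤ 1) : Co σ 1 i := by
  obtain ⟨h1, h2⟩ := lemS1 h hq hf hs hz
  have hs' := dS_iff.2 hs
  rw [flip_lab] at hs'
  obtain ⟨h3, h4⟩ := lemS1 (dS_cong h) hq hf hs' (by rwa [rnk_flip])
  rw [d1_dS] at h4
  exact (Co_one h).2 ⟨h1, h2, h4⟩

theorem Co_of_one (h : Cong σ) {q i i'} (hq : 1 ≤ q) {f : Fin n → Fin q} (hf : ∀ t, ∃ x, f x = t) {ζ : PM n} {j p} (hc : Co σ p j)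
    (hs : σ (i, lab f f) (i', ζ)) (hz : rnk ζ ≤ p) (hi : j ≤ i') :
    ∀ k α', rnk α' ≤ q → σ (i + k, α') (j, p0 ⊤ ⊤) := by
  intro k α' ha
  obtain ⟨Γ, Δ, h1, h2, h3, h4⟩ := fact α' hq ha hf
  have hs2 := mR h (mL h hs Γ ⟨h1, h2⟩ ⟨rfl, rfl⟩) Δ ⟨h3, h4⟩ ⟨rfl, rfl⟩
  have hs3 := s_add h k hs2
  simp only [add_zero] at hs3
  have := hc (i' + Phi Γ ζ + Phi (pmul Γ ζ) Δ + k - j) (pmul (pmul Γ ζ) Δ)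
    ((rnk_pmul_le_left _ _).trans ((rnk_pmul_le_right _ _).trans hz))
  rw [show j + (i' + Phi Γ ζ + Phi (pmul Γ ζ) Δ + k - j) = i' + Phi Γ ζ + Phi (pmul Γ ζ) Δ + k by omega] at this
  exact h.1.trans hs3 this

theorem lab_idem {q : ℕ} {f : Fin n → Fin q} : pmul (lab f f) (lab f f) = lab f f := lab_lab (fun x _ _ => ⟨x, rfl⟩)

theorem low (h : Cong σ) : ∀ q, 2 ≤ q → ∀ {i j} {α β : PM n}, σ (i, α) (j, β) → rnk α = q → rnk β < q → Co σ q i := by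
  intro q
  induction q using Nat.strong_induction_on with
  | _ q ih =>
  intro hq i j α β hs ha hb
  have hqn : q ≤ n := ha ▸ rnk_le α
  obtain ⟨f, hf⟩ := exists_surj (n := n) (q := q) (by omega) hqn
  obtain ⟨γ, δ, h1, h2, h3⟩ := unfact α (by omega) ha hf
  have hs1 := mR h (mL h hs γ ⟨h1, rfl⟩ ⟨rfl, rfl⟩) δ ⟨h2, h3⟩ ⟨rfl, rfl⟩
  simp only [add_zero] at hs1
  set β' := pmul (pmul γ β) δ
  have hb' : rnk β' < q := lt_of_le_of_lt ((rnk_pmul_le_left _ _).trans (rnk_pmul_le_right _ _)) hb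
  obtain ⟨η, e1, e2, e3⟩ := eta β'
  have hs2 := mL h hs1 η ⟨rfl, rfl⟩ ⟨e1, e2⟩
  rw [add_zero] at hs2
  have hs3 := h.1.trans hs1 (h.1.symm hs2)
  have hs4 := mL h hs3 (lab f f) ⟨Phi_labL (fun y => ⟨y, rfl⟩), lab_idem⟩ ⟨rfl, rfl⟩
  rw [add_zero, add_assoc] at hs4
  set K := Phi η (lab f f) + Phi (lab f f) (pmul η (lab f f))
  set ζ := pmul (lab f f) (pmul η (lab f f)) with hζ
  have hzr : rnk ζ < q := by
    refine lt_of_le_of_lt ((rnk_pmul_le_right _ _).trans ((rnk_pmul_le_left _ _).trans e3)) ?_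
    omega
  have key : ∃ i' ζ0, i ≤ i' ∧ rnk ζ0 ≤ 1 ∧ σ (i, lab f f) (i', ζ0) := by
    by_cases hr : rnk ζ ≤ 1
    · exact ⟨i + K, ζ, by omega, hr, hs4⟩
    refine ⟨i, p0 ⊤ ⊤, le_refl _, by rw [rnk_p0]; omega, h.1.trans hs4 ?_⟩
    choose z hz using hf
    have zf : ∀ x y, f x = f y → ζ.r (Sum.inl x) (Sum.inl y) := fun x y hxy => pmul_ll.2 (Or.inl (lab_ll.2 hxy))
    have bad : ∃ t, (¬ dm ζ (z t)) ∨ ∃ s, s ≠ t ∧ ζ.r (Sum.inl (z t)) (Sum.inl (z s)) := by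
      by_contra hc
      push Not at hc
      choose b hb using fun t => (hc t).1
      have : q ≤ rnk ζ := le_rnk_iff.2 ⟨z, b, hb, fun s t hst => by
        by_contra hne
        exact (hc s).2 t (fun e => hne e.symm) hst⟩
      omega
    obtain ⟨t, ht⟩ := bad
    set r := rnk ζ with hrdef
    have hr2 : 2 ≤ r := by omega
    obtain ⟨fr, hfr⟩ := exists_surj (n := n) (q := r) (by omega) (by omega)
    let o : Fin q := ⟨0, by omega⟩
    let g : Fin q → Fin r := fun x => ⟨min x.1 (r - 1), by omega⟩
    let h' : Fin q → Fin r := fun x => g (Equiv.swap t o x)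
    have h'0 : ∀ x, h' x = ⟨0, by omega⟩ → x = t := by
      intro x hx
      have : (Equiv.swap t o x).1 = 0 := by
        have := congrArg Fin.val hx
        simp only [h', g] at this
        omega
      have : Equiv.swap t o x = o := Fin.ext this
      rw [Equiv.swap_apply_eq_iff, Equiv.swap_apply_right] at this
      exact this
    have h't : h' t = ⟨0, by omega⟩ := by
      simp [h', g, o]
    have h's : ∀ u, ∃ x, h' (f x) = u := by
      intro u
      refine ⟨z (Equiv.swap t o ⟨u.1, by omega⟩), ?_⟩
      rw [hz]
      simp only [h', Equiv.swap_apply_self, g]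
      ext
      simp only
      omega
    have nb : ¬ good (h' ∘ f) ζ := by
      rintro ⟨g1, g2⟩
      rcases ht with ht | ⟨s, hst, ht⟩
      · obtain ⟨x, hx, y, hy⟩ := g2 ⟨0, by omega⟩
        have := h'0 _ hx
        exact ht ⟨y, ζ.iseqv.trans (zf _ _ (by rw [hz, this])) hy⟩
      · have := g1 _ _ ht
        simp only [Function.comp, hz] at this
        exact hst (h'0 s (by rw [← this, h't]))
    have hs5 := mL h hs4 (lab fr (h' ∘ f)) ⟨Phi_labL (fun y => hfr _), lab_coarse (fun z => ⟨z, rfl⟩)⟩ ⟨rfl, rfl⟩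
    rw [add_zero] at hs5
    have hco := ih r hzr hr2 hs5 (rnk_lab_eq hfr h's) (by
      refine lt_of_le_of_ne (rnk_pmul_le_right _ _) (fun e => nb (rnk_good e)))
    exact hco K ζ le_rfl
  obtain ⟨i', ζ0, hi', hz0, hs6⟩ := key
  have hc1 := lemS h hq hf hs6 hz0
  exact Co_of_one h (by omega) hf hc1 hs6 hz0 hi'

theorem Co_transfer (h : Cong σ) {q p i j} {α β : PM n} (hs : σ (i, α) (j, β)) (ha : rnk α ≤ p) (hb : rnk β = q) (hqp : q ≤ p)
    (hc : Co σ p i) : Co σ q j := by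
  have key : ∀ k α', rnk α' ≤ q → σ (j + k, α') (i, p0 ⊤ ⊤) := by
    rcases Nat.eq_zero_or_pos q with rfl | hq
    · intro k α' ha'
      have e1 := h.1.trans (h.1.symm hs) (hc 0 α ha)
      rw [eq_p0 hb] at e1
      have e2 := t0_to h (t0_of h e1) (krS α') (ckS α')
      rw [← eq_p0 (by omega)] at e2
      exact h.1.trans (s_add h k e2) (hc k α' (by omega))
    · have hqn : q ≤ n := hb ▸ rnk_le β
      obtain ⟨f, hf⟩ := exists_surj (n := n) (q := q) (by omega) hqn
      obtain ⟨γ, δ, h1, h2, h3⟩ := unfact β (by omega) hb hf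
      have hs1 := mR h (mL h (h.1.symm hs) γ ⟨h1, rfl⟩ ⟨rfl, rfl⟩) δ ⟨h2, h3⟩ ⟨rfl, rfl⟩
      simp only [add_zero] at hs1
      exact Co_of_one h hq hf hc hs1 ((rnk_pmul_le_left _ _).trans ((rnk_pmul_le_right _ _).trans ha)) (by omega)
  intro k α' ha'
  exact h.1.trans (key k α' ha') (h.1.symm (key 0 (p0 ⊤ ⊤) (by rw [rnk_p0]; omega)))

theorem Co_dS (h : Cong σ) {q i} (hc : Co (dS σ) q i) : Co σ q i := by
  intro k α' ha
  have := hc k (flip α') (by rwa [rnk_flip])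
  simpa [dS, flip_flip, flip_p0] using this

theorem nonR (h : Cong σ) {q i j} {α β : PM n} (hq : 2 ≤ q) (hs : σ (i, α) (j, β)) (ha : rnk α = q) (hb : rnk β = q)
    (hne : ¬ (krS α = krS β ∧ ∀ x, dm α x ↔ dm β x)) : Co σ q i := by
  obtain ⟨f, hf⟩ := exists_surj (n := n) (q := q) (by omega) (ha ▸ rnk_le α)
  obtain ⟨g, hg⟩ := sep ha hb hq hne
  have hs1 := mL h hs (lab f g) ⟨Phi_labL (fun y => hf _), rfl⟩ ⟨Phi_labL (fun y => hf _), rfl⟩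
  rw [add_zero, add_zero] at hs1
  rcases hg with ⟨g1, g2⟩ | ⟨g1, g2⟩
  · exact low h q hq hs1 (good_rnk hf g1)
      (lt_of_le_of_ne ((rnk_pmul_le_right _ _).trans hb.le) (fun e => g2 (rnk_good e)))
  · have := low h q hq (h.1.symm hs1) (good_rnk hf g1)
      (lt_of_le_of_ne ((rnk_pmul_le_right _ _).trans ha.le) (fun e => g2 (rnk_good e)))
    exact Co_transfer h (h.1.symm hs) hb.le ha le_rfl this

theorem nonL (h : Cong σ) {q i j} {α β : PM n} (hq : 2 ≤ q) (hs : σ (i, α) (j, β)) (ha : rnk α = q) (hb : rnk β = q)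
    (hne : ¬ (ckS α = ckS β ∧ ∀ x, cd α x ↔ cd β x)) : Co σ q i := by
  apply Co_dS h
  refine nonR (dS_cong h) hq (dS_iff.2 hs) (by rwa [rnk_flip]) (by rwa [rnk_flip]) ?_
  simpa only [krS_flip, dm_flip] using hne

theorem nonH (h : Cong σ) {q i j} {α β : PM n} (hq : 2 ≤ q) (hs : σ (i, α) (j, β)) (ha : rnk α = q) (hb : rnk β = q)
    (hne : ¬ greenH pmul α β) : Co σ q i := by
  rw [greenH_iff] at hne
  by_cases h1 : (krS α = krS β ∧ ∀ x, dm α x ↔ dm β x)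
  · exact nonL h hq hs ha hb (fun h2 => hne ⟨h1, h2⟩)
  · exact nonR h hq hs ha hb h1


end Part10

section Part11

variable {σ : ℕ × PM n → ℕ × PM n → Prop} [NeZero n]

/-- data of a congruence -/
def Dof (σ : ℕ × PM n → ℕ × PM n → Prop) : Dat where
  toD1 := d1 σ
  Re := Co σ
  NN q i j π := ∃ f : Fin n → Fin q, (∀ t, ∃ x, f x = t) ∧ σ (i, lab f f) (j, lab (π ∘ f) f)

theorem Dof_Rs (h : Cong σ) (q i) : (Dof σ).Rs q i ↔ Co σ q i := by
  match q with
  | 0 => exact (Co_zero h).symm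
  | 1 => exact (Co_one h).symm
  | q + 2 => exact Iff.rfl

section
variable {q : ℕ}

theorem lab_perm (f : Fin n → Fin q) (g : Fin n → Fin q) (π : Equiv.Perm (Fin q)) : lab (π ∘ f) (π ∘ g) = lab f g :=
  lab_inj π.injective

theorem lab_perm' (f : Fin n → Fin q) (g : Fin n → Fin q) (π : Equiv.Perm (Fin q)) : lab (π ∘ f) g = lab f ((π⁻¹ : Equiv.Perm (Fin q)) ∘ g) := by
  rw [← lab_perm f _ π]
  congr 1
  funext x
  simp

theorem NN_iff (h : Cong σ) {i j} {π : Equiv.Perm (Fin q)} {f : Fin n → Fin q} (hf : ∀ t, ∃ x, f x = t) :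
    (Dof σ).NN q i j π ↔ σ (i, lab f f) (j, lab (π ∘ f) f) := by
  refine ⟨?_, fun hh => ⟨f, hf, hh⟩⟩
  rintro ⟨g, hg, hs⟩
  have h1 : ∀ τ : Equiv.Perm (Fin q), pmul (pmul (lab f g) (lab (τ ∘ g) g)) (lab g f) = lab (τ ∘ f) f := by
    intro τ
    rw [← lab_perm f g τ, lab_lab (fun x _ _ => hg _ |>.imp fun y hy => by
      show τ (g y) = τ (f x); rw [hy]), lab_lab (fun x _ _ => hg _)]
  have h2 : ∀ τ : Equiv.Perm (Fin q), Phi (pmul (lab f g) (lab (τ ∘ g) g)) (lab g f) = 0 := by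
    intro τ
    rw [← lab_perm f g τ, lab_lab (fun x _ _ => hg _ |>.imp fun y hy => by
      show τ (g y) = τ (f x); rw [hy])]
    exact Phi_lab (fun y => Or.inr ((hf (g y)).imp fun _ e => e.symm))
  have h3 : ∀ α, Phi (lab f g) α = 0 := fun α => Phi_labL (fun y => hf _)
  have := mR h (mL h hs (lab f g) ⟨h3 _, rfl⟩ ⟨h3 _, rfl⟩) (lab g f) ⟨h2 1, h1 1⟩ ⟨h2 π, h1 π⟩
  simpa using this

theorem e_mul {f : Fin n → Fin q} (hf : ∀ t, ∃ x, f x = t) (π τ : Equiv.Perm (Fin q)) :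
    Phi (lab (π ∘ f) f) (lab (τ ∘ f) f) = 0 ∧ pmul (lab (π ∘ f) f) (lab (τ ∘ f) f) = lab ((τ * π : Equiv.Perm (Fin q)) ∘ f) f := by
  constructor
  · refine Phi_labL (fun y => ?_)
    obtain ⟨x, hx⟩ := hf (π⁻¹ (f y))
    exact ⟨x, by simp [hx]⟩
  · rw [← lab_perm (π ∘ f) f τ, lab_lab]
    · rfl
    · intro x _ _
      obtain ⟨y, hy⟩ := hf (π (f x))
      exact ⟨y, by simp [hy]⟩
end

theorem nn_drop2a (h : Cong σ) {i j π} (hn : 2 ≤ n) (hπ : π ≠ 1) (hN : (Dof σ).NN 2 i j π) : (d1 σ).t1 i j ∧ (d1 σ).dn i := by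
  have hv := d1_valid h
  obtain ⟨f, hf⟩ := exists_surj (n := n) (q := 2) (by omega) hn
  have hs := (NN_iff h hf).1 hN
  obtain ⟨t, ht⟩ : ∃ t, π t ≠ t := by
    by_contra hc; push Not at hc; exact hπ (Equiv.ext hc)
  obtain ⟨z1, hz1⟩ := hf t
  obtain ⟨z0, hz0⟩ := hf (π t)
  have key : ∀ (τ : Equiv.Perm (Fin 2)) z1, τ (f z1) = f z0 → Phi (lab (τ ∘ f) f) (p1 (Setoid.ker f) z0 ⊤ 0) = 0 ∧
      pmul (lab (τ ∘ f) f) (p1 (Setoid.ker f) z0 ⊤ 0) = p1 (Setoid.ker f) z1 ⊤ 0 := by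
    intro τ z1 hz
    constructor
    · refine Phi_labL (fun y => ?_)
      obtain ⟨x, hx⟩ := hf (τ⁻¹ (f y))
      exact ⟨x, by simp [hx]⟩
    · refine lab_ker τ (fun a b hab => hab) (fun a b => ?_) hf hz
      constructor
      · intro hab a' b' h1 h2
        have hab : f a = f b := hab
        rw [← h1, ← h2] at hab
        exact τ.injective hab
      · intro hh
        obtain ⟨a', ha⟩ := hf (τ⁻¹ (f a))
        obtain ⟨b', hb⟩ := hf (τ⁻¹ (f b))
        have : f a' = f b' := hh a' b' (by simp [ha]) (by simp [hb])
        rw [ha, hb] at this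
        exact τ⁻¹.injective this
  have hs2 := mR h hs (p1 (Setoid.ker f) z0 ⊤ 0) (key 1 z0 rfl) (key π z1 (by rw [hz1, hz0]))
  rw [s_11 h] at hs2
  obtain ⟨h1, h2, -⟩ := hs2
  refine ⟨h1, ?_⟩
  rcases h2 with h2 | ⟨-, h2 | h2⟩
  · exact hv.E_dn h2.1
  · exact h2
  · have h2 : f z1 = f z0 := h2
    rw [hz1, hz0] at h2
    exact absurd h2.symm ht

theorem Dof_valid (h : Cong σ) : (Dof σ).Valid n where
  toValid := d1_valid h
  nn_one := by
    intro q i hq hqn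
    obtain ⟨f, hf⟩ := exists_surj (n := n) (q := q) (by omega) hqn
    exact ⟨f, hf, h.1.refl _⟩
  nn_inv := by
    rintro q i j π hq hqn ⟨f, hf, hs⟩
    refine ⟨f, hf, h.1.symm ?_⟩
    have h1 := e_mul hf (π⁻¹) 1
    have h2 := e_mul hf (π⁻¹) π
    rw [one_mul] at h1
    rw [mul_inv_cancel] at h2
    exact mL h hs _ h1 h2
  nn_mul := by
    rintro q i j k π π' hq hqn ⟨f, hf, hs⟩ hN
    have hs' := (NN_iff h hf).1 hN
    refine ⟨f, hf, h.1.trans hs ?_⟩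
    have h1 := e_mul hf 1 π
    have h2 := e_mul hf π' π
    rw [mul_one] at h1
    exact mR h hs' _ h1 h2
  nn_conj := by
    rintro q i j π τ hq hqn ⟨f, hf, hs⟩
    refine ⟨(τ⁻¹ : Equiv.Perm (Fin q)) ∘ f, fun t => ?_, ?_⟩
    · obtain ⟨x, hx⟩ := hf (τ t)
      exact ⟨x, by simp [hx]⟩
    · rw [lab_perm]
      have : ((τ⁻¹ * π * τ : Equiv.Perm (Fin q)) : Fin q → Fin q) ∘ ((τ⁻¹ : Equiv.Perm (Fin q)) ∘ f) = (τ⁻¹ : Equiv.Perm (Fin q)) ∘ (π ∘ f) := by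
        funext x; simp
      rw [this, lab_perm]
      exact hs
  nn_shift := by
    rintro q i j π hq hqn ⟨f, hf, hs⟩
    exact ⟨f, hf, s_add h 1 hs⟩
  re_nn := by
    rintro q i j π hq hqn ⟨f, hf, hs⟩ hc
    have hr : ∀ τ : Equiv.Perm (Fin q), rnk (lab (τ ∘ f) f) = q := fun τ => rnk_lab_eq (fun t => by
      obtain ⟨x, hx⟩ := hf (τ⁻¹ t)
      exact ⟨x, by simp [hx]⟩) hf
    exact Co_transfer h hs (hr 1).le (hr π) le_rfl hc
  re_shift := by
    intro q i hq hqn hc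
    exact Co_add h 1 hc
  re_down := by
    intro q i hq hqn hc
    rw [Dof_Rs h]
    exact Co_mono (by omega) hc
  t_down := by
    rintro q i j hq hqn ⟨f, hf, hs⟩
    obtain ⟨f', hf'⟩ := exists_surj (n := q) (q := q - 1) (by omega) (by omega)
    have hs' : σ (i, lab (f' ∘ f) (f' ∘ f)) (j, lab (f' ∘ f) (f' ∘ f)) := by
      have e : Phi (lab (f' ∘ f) (f' ∘ f)) (lab f f) = 0 ∧ pmul (lab (f' ∘ f) (f' ∘ f)) (lab f f) = lab (f' ∘ f) (f' ∘ f) :=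
        ⟨Phi_labL (fun y => ⟨y, rfl⟩), lab_coarse (fun z => ⟨z, rfl⟩)⟩
      exact mL h hs _ e e
    have hff : ∀ t, ∃ x, (f' ∘ f) x = t := fun t => by
      obtain ⟨s, hs⟩ := hf' t
      obtain ⟨x, hx⟩ := hf s
      exact ⟨x, by simp [hx, hs]⟩
    obtain ⟨r, rfl⟩ : ∃ r, q = r + 2 := ⟨q - 2, by omega⟩
    match r with
    | 0 =>
      show (d1 σ).t1 i j
      have hr : rnk (lab (f' ∘ f) (f' ∘ f)) = 1 := rnk_lab_eq hff hff
      obtain ⟨x, y, hx, hy⟩ := exists_p1 hr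
      rw [eq_p1 hr hx hy] at hs'
      exact t1_of h hs'
    | r + 1 =>
      show (Dof σ).NN (r + 2) i j 1
      exact ⟨f' ∘ f, hff, hs'⟩
  nn_drop := by
    classical
    rintro q i j π hq hqn hπ ⟨f, hf, hs⟩
    obtain ⟨a, ha⟩ : ∃ t, π t ≠ t := by
      by_contra hc; push Not at hc; exact hπ (Equiv.ext hc)
    obtain ⟨c, hc⟩ : ∃ c, c ∉ ({a, π a} : Finset (Fin q)) := by
      by_contra hc
      push Not at hc
      have h1 := Finset.card_le_card (fun x _ => hc x : (Finset.univ : Finset (Fin q)) ⊆ {a, π a})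
      have h2 := Finset.card_le_two (a := a) (b := π a)
      rw [Finset.card_univ, Fintype.card_fin] at h1
      omega
    simp only [Finset.mem_insert, Finset.mem_singleton, not_or] at hc
    let e : {x : Fin q // x ≠ c} ≃ Fin (q - 1) := Fintype.equivFinOfCardEq (by simp)
    let κ : Fin q → Fin (q - 1) := fun x => e (if hx : x = c then ⟨a, fun h => hc.1 h.symm⟩ else ⟨x, hx⟩)
    have κs : ∀ t, ∃ x, κ x = t := fun t => ⟨(e.symm t).1, by
      simp only [κ, dif_neg (e.symm t).2]
      exact e.apply_symm_apply t⟩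
    have κi : ∀ x y, x ≠ a → x ≠ c → κ x = κ y → x = y := by
      intro x y h1 h2 h3
      have := e.injective h3
      rw [dif_neg h2] at this
      by_cases hy : y = c
      · rw [dif_pos hy] at this
        exact absurd (congrArg Subtype.val this) h1
      · rw [dif_neg hy] at this
        exact congrArg Subtype.val this
    have κac : κ a = κ c := by
      simp only [κ]
      rw [dif_neg (fun h => hc.1 h.symm), dif_pos trivial]
    have hff : ∀ t, ∃ x, (κ ∘ f) x = t := fun t => by
      obtain ⟨s, hs⟩ := κs t
      obtain ⟨x, hx⟩ := hf s
      exact ⟨x, by simp [hx, hs]⟩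
    have hff' : ∀ t, ∃ x, (κ ∘ ((π⁻¹ : Equiv.Perm (Fin q)) ∘ f)) x = t := fun t => by
      obtain ⟨s, hs⟩ := κs t
      obtain ⟨x, hx⟩ := hf (π s)
      exact ⟨x, by simp [hx, hs]⟩
    rw [lab_perm'] at hs
    have hs2 := mL h hs (lab (κ ∘ f) (κ ∘ f)) ⟨Phi_labL (fun y => ⟨y, rfl⟩), lab_coarse (fun z => ⟨z, rfl⟩)⟩
      ⟨Phi_labL (fun y => ⟨y, rfl⟩), lab_coarse (fun z => hf _)⟩
    refine nonL h (by omega) hs2 (rnk_lab_eq hff hff) (rnk_lab_eq hff hff') ?_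
    rintro ⟨hk, -⟩
    obtain ⟨z, hz⟩ := hf (π a)
    obtain ⟨z', hz'⟩ := hf (π c)
    have h1 : (lab (κ ∘ f) (κ ∘ ((π⁻¹ : Equiv.Perm (Fin q)) ∘ f))).r (Sum.inr z) (Sum.inr z') := by
      rw [lab_rr]
      simp [hz, hz', κac]
    have h2 := lab_rr.1 ((rck hk).2 h1)
    simp only [Function.comp, hz, hz'] at h2
    have := κi _ _ ha (fun e => hc.2 e.symm) h2
    exact hc.1 (π.injective this).symm
  nn_drop2 := by
    intro i j π hn hπ hN
    obtain ⟨h1, h2⟩ := nn_drop2a h hn hπ hN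
    have hN' : (Dof (dS σ)).NN 2 i j π⁻¹ := by
      obtain ⟨f, hf, hs⟩ := hN
      refine ⟨f, hf, ?_⟩
      have := dS_iff.2 hs
      rw [flip_lab, flip_lab] at this
      rwa [lab_perm', inv_inv]
    obtain ⟨h3, h4⟩ := nn_drop2a (dS_cong h) hn (by simpa using hπ) hN'
    rw [d1_dS] at h4
    exact ⟨h1, h4, h2⟩

theorem to_e {i j} (h : Cong σ) {α β : PM n} {q : ℕ} (hq : 2 ≤ q) (hs : σ (i, α) (j, β)) (ha : rnk α = q)
    (hH : greenH pmul α β) : pdIn q ((Dof σ).NN q i j) α β := by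
  obtain ⟨a, b, h1, h2, -⟩ := rnk_reps ha
  obtain ⟨π, hp⟩ := pd_exists ha h1 h2 hH
  refine ⟨a, b, π, h2, h1, hp, ?_⟩
  obtain ⟨g, k, e, ga, kb, hgk⟩ := NF ha h1 h2
  have e' := NF_H e ga kb hgk hH hp
  obtain ⟨f, hf⟩ := exists_surj (n := n) (q := q) (by omega) (ha ▸ rnk_le α)
  refine ⟨f, hf, ?_⟩
  let c : Quotient α → Fin q := fun _ => ⟨0, by omega⟩
  have hP : ∀ γ, Phi (lab f (Sum.elim id c ∘ g)) γ = 0 := fun γ => Phi_labL (fun y => hf _)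
  have m1 : pmul (lab f (Sum.elim id c ∘ g)) α = lab (Sum.inl ∘ f) k :=
    (congrArg (pmul _) e).trans (lab_pick (fun t => ⟨_, ga t⟩) hgk)
  have m2 : pmul (lab f (Sum.elim id c ∘ g)) β = lab (Sum.inl ∘ (π ∘ f)) k := by
    have : lab f (Sum.elim id c ∘ g) = lab (π ∘ f) (Sum.elim id (fun z => π (c z)) ∘ (Sum.map π id ∘ g)) := by
      rw [← lab_perm f _ π]
      congr 1
      funext x
      cases hx : g x <;> simp [hx]
    rw [this]
    refine (congrArg (pmul _) e').trans (lab_pick (fun t => ⟨a (π⁻¹ t), by simp [ga]⟩) ?_)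
    intro x z hxz
    cases hx : g x with
    | inl t => exact ⟨π t, by simp [hx]⟩
    | inr w =>
      simp only [Function.comp, hx, Sum.map_inr, id] at hxz
      obtain ⟨t, ht⟩ := hgk x z (hx.trans hxz)
      rw [hx] at ht
      exact absurd ht (by simp)
  have hs1 := mL h hs _ ⟨hP _, m1⟩ ⟨hP _, m2⟩
  have m3 : ∀ τ : Equiv.Perm (Fin q), Phi (lab (Sum.inl ∘ (τ ∘ f)) k) (lab (Sum.elim id c ∘ k) f) = 0 ∧
      pmul (lab (Sum.inl ∘ (τ ∘ f)) k) (lab (Sum.elim id c ∘ k) f) = lab (τ ∘ f) f := by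
    intro τ
    constructor
    · exact Phi_lab (fun y => Or.inr ((hf _).imp fun _ hx => hx.symm))
    · rw [pmul_flip, flip_lab, flip_lab, lab_pick (h := Sum.inl ∘ (τ ∘ f)) (fun t => ⟨_, kb t⟩) (fun x z hxz => ⟨τ (f z), hxz⟩), flip_lab,
        lab_inj Sum.inl_injective]
  exact mR h hs1 _ (m3 1) (m3 π)

theorem of_e {i j} (h : Cong σ) {α β : PM n} {q : ℕ} (ha : rnk α = q)
    (hH : greenH pmul α β) (hp : pdIn q ((Dof σ).NN q i j) α β) : σ (i, α) (j, β) := by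
  obtain ⟨a, b, π, h2, h1, hp, f, hf, hs⟩ := hp
  obtain ⟨g, k, e, ga, kb, hgk⟩ := NF ha h1 h2
  have e' := NF_H e ga kb hgk hH hp
  have hP : ∀ γ, Phi (lab g (Sum.inl ∘ f)) γ = 0 := fun γ => Phi_labL (fun y => ⟨_, ga _⟩)
  have m1 : pmul (lab g (Sum.inl ∘ f)) (lab f f) = lab g (Sum.inl ∘ f) := lab_coarse (fun z => ⟨z, rfl⟩)
  have m2 : pmul (lab g (Sum.inl ∘ f)) (lab (π ∘ f) f) = lab (Sum.map π id ∘ g) (Sum.inl ∘ f) := by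
    have hi : Function.Injective (Sum.map π id : Fin q ⊕ Quotient α → Fin q ⊕ Quotient α) :=
      Sum.map_injective.2 ⟨π.injective, Function.injective_id⟩
    rw [← lab_inj hi]
    have : (Sum.map π id : Fin q ⊕ Quotient α → Fin q ⊕ Quotient α) ∘ (Sum.inl ∘ f) = Sum.inl ∘ (π ∘ f) := by
      funext x; simp
    rw [this, lab_coarse]
    intro z
    obtain ⟨x, hx⟩ := hf (π⁻¹ (f z))
    exact ⟨x, by simp [hx]⟩
  have hs1 := mL h hs _ ⟨hP _, m1⟩ ⟨hP _, m2⟩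
  have k1 : Phi (lab g (Sum.inl ∘ f)) (lab (Sum.inl ∘ f) k) = 0 ∧ pmul (lab g (Sum.inl ∘ f)) (lab (Sum.inl ∘ f) k) = α := by
    refine ⟨hP _, (lab_lab ?_).trans e.symm⟩
    intro x z hxz
    obtain ⟨t, ht⟩ := hgk x z hxz
    obtain ⟨y, hy⟩ := hf t
    exact ⟨y, by simp [hy, ht]⟩
  have k2 : Phi (lab (Sum.map π id ∘ g) (Sum.inl ∘ f)) (lab (Sum.inl ∘ f) k) = 0 ∧
      pmul (lab (Sum.map π id ∘ g) (Sum.inl ∘ f)) (lab (Sum.inl ∘ f) k) = β := by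
    refine ⟨Phi_labL (fun y => ⟨a (π⁻¹ (f y)), by simp [ga]⟩), (lab_lab ?_).trans e'.symm⟩
    intro x z hxz
    cases hx : g x with
    | inl t =>
      obtain ⟨y, hy⟩ := hf (π t)
      exact ⟨y, by simp [hy, hx]⟩
    | inr w =>
      simp only [Function.comp, hx, Sum.map_inr, id] at hxz
      obtain ⟨t, ht⟩ := hgk x z (hx.trans hxz)
      rw [hx] at ht
      exact absurd ht (by simp)
  exact mR h hs1 _ k1 k2

theorem rel_of_le (h : Cong σ) {i j} {α β : PM n} (hs : σ (i, α) (j, β)) (hr : rnk β ≤ rnk α) : rel (Dof σ) (i, α) (j, β) := by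
  by_cases h1 : rnk α ≤ 1
  · exact Or.inr (Or.inl ((s_rel1 h h1 (hr.trans h1)).1 hs))
  have fin : Co σ (rnk α) i → rel (Dof σ) (i, α) (j, β) := fun hc =>
    Or.inl ⟨(Dof_Rs h _ _).2 hc, (Dof_Rs h _ _).2 (Co_transfer h hs le_rfl rfl hr hc)⟩
  rcases Nat.lt_or_ge (rnk β) (rnk α) with hlt | hge
  · exact fin (low h _ (by omega) hs rfl hlt)
  · by_cases hH : greenH pmul α β
    · exact Or.inr (Or.inr ⟨rnk α, by omega, rfl, by simp only; omega, hH, to_e h (by omega) hs rfl hH⟩)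
    · exact fin (nonH h (by omega) hs rfl (by omega) hH)

/-- Theorem B. -/
theorem eq_rel (h : Cong σ) : σ = rel (Dof σ) := by
  funext a b
  obtain ⟨i, α⟩ := a
  obtain ⟨j, β⟩ := b
  refine propext ⟨fun hs => ?_, ?_⟩
  · rcases Nat.le_total (rnk β) (rnk α) with hr | hr
    · exact rel_of_le h hs hr
    · exact rel_symm (Dof_valid h) (rel_of_le h (h.1.symm hs) hr)
  · rintro (⟨h1, h2⟩ | h1 | ⟨q, hq, h1, h2, h3, h4⟩)
    · rw [Dof_Rs h] at h1 h2
      have e1 := h1 0 α le_rfl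
      have e2 := h2 0 β le_rfl
      have e3 := h1 (max i j - i) (p0 ⊤ ⊤) (by rw [rnk_p0]; omega)
      have e4 := h2 (max i j - j) (p0 ⊤ ⊤) (by rw [rnk_p0]; omega)
      simp only at e1 e2 e3 e4
      rw [show i + (max i j - i) = max i j by omega] at e3
      rw [show j + (max i j - j) = max i j by omega] at e4
      exact h.1.trans e1 (h.1.trans (h.1.trans (h.1.symm e3) e4) (h.1.symm e2))
    · exact (s_rel1 h (rel1_le h1).1 (rel1_le h1).2).2 h1
    · exact of_e h h1 h3 h4


end Part11

section Part12

/-! ### Theorem C: combinatorics of C-pairs -/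

/-- entries `λ, ρ, R` -/
def big (e : CEntry) : Prop := e = CEntry.lam ∨ e = CEntry.rho ∨ e = CEntry.R
/-- entries `μ, λ, ρ, R` -/
def mid (e : CEntry) : Prop := e = CEntry.mu ∨ big e

/-- data of rows 0 and 1 -/
def D1of (Θ0 Θ1 : ℕ → ℕ → Prop) (M0 M1 : ℕ → CEntry) : D1 where
  t0 := Θ0
  t1 := Θ1
  E i j := M1 i = M0 j ∧ mid (M1 i) ∧ Θ0 i (j + 1) ∧ (minLE Θ1 i ↔ minLE Θ0 j)
  lam i := M0 i = CEntry.lam ∨ M0 i = CEntry.R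
  rho i := M0 i = CEntry.rho ∨ M0 i = CEntry.R
  up i := mid (M1 i) ∨ M1 i = CEntry.muUp
  dn i := mid (M1 i) ∨ M1 i = CEntry.muDown

/-- facts about rows 0 and 1 -/
structure F01 (Θ0 Θ1 : ℕ → ℕ → Prop) (M0 M1 : ℕ → CEntry) : Prop where
  f1 : ∀ i j, Θ0 i j → M0 i = M0 j
  f2 : ∀ i j, Θ1 i j → M1 i = M1 j
  f3 : ∀ i j, big (M0 i) → M0 j = M0 i → Θ0 i j
  f3' : ∀ i, big (M0 i) → M0 (i + 1) = M0 i
  f4 : ∀ i, big (M1 i) → M0 i = M1 i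
  f4a : ∀ i j, big (M1 i) → M1 j = M1 i → Θ1 i j
  f4b : ∀ i, big (M1 i) → M1 (i + 1) = M1 i
  f5 : ∀ i j, (M1 i = CEntry.muUp ∨ M1 i = CEntry.muDown) → M1 j = M1 i → i = j
  f6 : ∀ i, M0 i = CEntry.delta ∨ mid (M0 i)
  f6' : ∀ i, isZeta (M1 i) ∨ big (M1 i)
  f7 : ∀ i j, (D1of Θ0 Θ1 M0 M1).E i j → (D1of Θ0 Θ1 M0 M1).E (i + 1) (j + 1)
  f8 : ∀ i, M1 i ≠ CEntry.delta → (D1of Θ0 Θ1 M0 M1).E (i + 1) i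
  f9 : ∀ i i' j, (D1of Θ0 Θ1 M0 M1).E i j → (D1of Θ0 Θ1 M0 M1).E i' j → Θ1 i i'

theorem minLE_Eq (i : ℕ) : ¬ minLE Eq i := by
  rintro ⟨a, b, h, hne, -⟩; exact hne h

theorem minLE_nat {m d i : ℕ} (hd : 1 ≤ d) : minLE (natCong m d) i ↔ m ≤ i := by
  constructor
  · rintro ⟨a, b, h, hne, hi⟩
    rcases h with h | ⟨h, -, -⟩
    · exact absurd h hne
    · omega
  · intro h
    exact ⟨m, m + d, Or.inr ⟨le_rfl, by omega, by simp⟩, by omega, h⟩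

theorem mod_succ {i j d : ℕ} (h : i % d = j % d) : (i + 1) % d = (j + 1) % d := Nat.ModEq.add_right 1 h

theorem mod_pred {i j d : ℕ} (h : (i + 1) % d = (j + 1) % d) : i % d = j % d := Nat.ModEq.add_right_cancel' 1 h

@[simp] theorem mid_mu : mid CEntry.mu := Or.inl rfl
@[simp] theorem mid_delta : ¬ mid CEntry.delta := by simp [mid, big]
@[simp] theorem mid_muUp : ¬ mid CEntry.muUp := by simp [mid, big]
@[simp] theorem mid_muDown : ¬ mid CEntry.muDown := by simp [mid, big]
@[simp] theorem big_mu : ¬ big CEntry.mu := by simp [big]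
@[simp] theorem big_delta : ¬ big CEntry.delta := by simp [big]
@[simp] theorem big_muUp : ¬ big CEntry.muUp := by simp [big]
@[simp] theorem big_muDown : ¬ big CEntry.muDown := by simp [big]
theorem big_mid {e} (h : big e) : mid e := Or.inr h

theorem F01_RT1 {Θ0 Θ1 : ℕ → ℕ → Prop} {M0 M1 : ℕ → CEntry} (h : RT1 M0 M1) : F01 Θ0 Θ1 M0 M1 := by
  obtain ⟨h0, h1⟩ := h
  constructor <;> simp [h0, h1, D1of, isZeta]

theorem F01_RT2 {Θ0 Θ1 : ℕ → ℕ → Prop} {M0 M1 : ℕ → CEntry} (h : RT2 Θ0 Θ1 M0 M1) : F01 Θ0 Θ1 M0 M1 := by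
  obtain ⟨rfl, rfl, i0, ζ, hζ, a1, a2, b1, b2, b3⟩ := h
  have A : ∀ i, (i < i0 ∧ M0 i = CEntry.delta) ∨ (i0 ≤ i ∧ M0 i = CEntry.mu) := fun i => by
    rcases lt_or_ge i i0 with h | h
    · exact Or.inl ⟨h, a1 i h⟩
    · exact Or.inr ⟨h, a2 i h⟩
  have B : ∀ i, (i < i0 ∧ M1 i = CEntry.delta) ∨ (i = i0 ∧ M1 i = ζ) ∨ (i0 < i ∧ M1 i = CEntry.mu) := fun i => by
    rcases lt_trichotomy i i0 with h | h | h
    · exact Or.inl ⟨h, b1 i h⟩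
    · exact Or.inr (Or.inl ⟨h, h ▸ b2⟩)
    · exact Or.inr (Or.inr ⟨h, b3 i h⟩)
  have nb0 : ∀ i, ¬ big (M0 i) := fun i => by rcases A i with ⟨-, e⟩ | ⟨-, e⟩ <;> simp [e]
  have zb : ¬ big ζ := by rcases hζ with rfl | rfl | rfl | rfl <;> simp
  have nb1 : ∀ i, ¬ big (M1 i) := fun i => by rcases B i with ⟨-, e⟩ | ⟨-, e⟩ | ⟨-, e⟩ <;> simp [e, zb]
  have hE : ∀ i j, (D1of Eq Eq M0 M1).E i j ↔ i = j + 1 ∧ i0 ≤ j := by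
    intro i j
    simp only [D1of, minLE_Eq]
    constructor
    · rintro ⟨h1, h2, h3, -⟩
      refine ⟨h3, ?_⟩
      rcases A j with ⟨-, e⟩ | ⟨h, -⟩
      · rw [h1, e] at h2; exact absurd h2 mid_delta
      · exact h
    · rintro ⟨rfl, h⟩
      rw [b3 (j + 1) (by omega), a2 j h]
      simp
  constructor
  · rintro i j rfl; rfl
  · rintro i j rfl; rfl
  · intro i j h; exact absurd h (nb0 i)
  · intro i h; exact absurd h (nb0 i)
  · intro i h; exact absurd h (nb1 i)
  · intro i j h; exact absurd h (nb1 i)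
  · intro i h; exact absurd h (nb1 i)
  · have : ∀ i, (M1 i = CEntry.muUp ∨ M1 i = CEntry.muDown) → i = i0 := by
      intro i h
      rcases B i with ⟨-, e⟩ | ⟨h', e⟩ | ⟨-, e⟩
      · simp [e] at h
      · exact h'
      · simp [e] at h
    intro i j h1 h2
    rw [this i h1, this j (h2 ▸ h1)]
  · intro i; rcases A i with ⟨-, e⟩ | ⟨-, e⟩ <;> simp [e]
  · intro i; rcases B i with ⟨-, e⟩ | ⟨-, e⟩ | ⟨-, e⟩ <;> simp [e, isZeta] <;> left <;> exact hζ
  · intro i j; rw [hE, hE]; omega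
  · intro i h; rw [hE]
    rcases B i with ⟨-, e⟩ | ⟨h, e⟩ | ⟨h, e⟩
    · exact absurd e h
    · omega
    · omega
  · intro i i' j; rw [hE, hE]; omega

theorem F01_RT3 {Θ0 Θ1 : ℕ → ℕ → Prop} {M0 M1 : ℕ → CEntry} (h : RT3 Θ0 M0 M1) : F01 Θ0 Θ1 M0 M1 := by
  obtain ⟨m, ξ, rfl, hξ, a, b1, b2⟩ := h
  have A : ∀ i, (i < m ∧ M0 i = CEntry.delta) ∨ (m ≤ i ∧ M0 i = ξ) := fun i => by
    rcases lt_or_ge i m with h | h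
    · exact Or.inl ⟨h, b1 i h⟩
    · exact Or.inr ⟨h, b2 i h⟩
  have xb : big ξ := by rcases hξ with rfl | rfl | rfl <;> simp [big]
  have B : ∀ i, big (M0 i) → m ≤ i := by
    intro i hi
    rcases A i with ⟨-, e⟩ | ⟨h, -⟩
    · rw [e] at hi; exact absurd hi big_delta
    · exact h
  constructor
  · rintro i j (rfl | ⟨h1, h2, -⟩)
    · rfl
    · rw [b2 i h1, b2 j h2]
  · simp [a]
  · intro i j h e
    exact Or.inr ⟨B i h, B j (e ▸ h), by omega⟩
  · intro i h
    rw [b2 i (B i h), b2 (i + 1) (by have := B i h; omega)]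
  · simp [a]
  · simp [a]
  · simp [a]
  · simp [a]
  · intro i
    rcases A i with ⟨-, e⟩ | ⟨-, e⟩
    · exact Or.inl e
    · exact Or.inr (e ▸ big_mid xb)
  · simp [a, isZeta]
  · simp [a, D1of]
  · simp [a]
  · simp [a, D1of]

/-- Common part of RT4 - RT7. -/
theorem F01_main {m l d : ℕ} {ξ : CEntry} {M0 M1 : ℕ → CEntry} (hd : 1 ≤ d) (hml : m ≤ l) (hξ : xiOK d ξ)
    (S : ℕ → ℕ → Prop)
    (a : ∀ j, m ≤ j → M0 j = ξ) (b : ∀ j, l ≤ j → M1 j = ξ)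
    (a' : ∀ j, j < m → M0 j = CEntry.delta ∨ M0 j = CEntry.mu)
    (b' : ∀ j, j < l → isZeta (M1 j))
    (bz : ∀ i j, i < l → j < l → (M1 i = CEntry.muUp ∨ M1 i = CEntry.muDown) → M1 j = M1 i → i = j)
    (hS : ∀ i j, i < l → j < m → (S i j ↔ (M0 j = CEntry.mu ∧ M1 i = CEntry.mu ∧ natCong m d i (j + 1))))
    (S1 : ∀ i j, i < l → j < m → S i j → (i + 1 < l ∧ j + 1 < m ∧ S (i + 1) (j + 1)) ∨ (i + 1 = l ∧ j + 1 = m))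
    (S2 : ∀ i, i < l → M1 i ≠ CEntry.delta → (i + 1 < l ∧ i < m ∧ S (i + 1) i) ∨ (i + 1 = l ∧ m ≤ i))
    (S3 : ∀ i i' j, i < l → i' < l → j < m → S i j → S i' j → i = i') :
    F01 (natCong m d) (natCong l d) M0 M1 := by
  have xm : mid ξ := by
    rcases hξ with rfl | ⟨-, rfl | rfl | rfl⟩ <;> simp [mid, big]
  have xb : big ξ → d = 1 := by
    rcases hξ with rfl | ⟨e, -⟩
    · simp
    · exact fun _ => e
  have nz : ∀ e, isZeta e → ¬ big e := by rintro e (rfl | rfl | rfl | rfl) <;> simp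
  have A : ∀ j, big (M0 j) → m ≤ j ∧ d = 1 := by
    intro j hj
    rcases lt_or_ge j m with h | h
    · rcases a' j h with e | e <;> rw [e] at hj <;> simp at hj
    · exact ⟨h, xb (a j h ▸ hj)⟩
  have B : ∀ j, big (M1 j) → l ≤ j ∧ d = 1 := by
    intro j hj
    rcases lt_or_ge j l with h | h
    · exact absurd hj (nz _ (b' j h))
    · exact ⟨h, xb (b j h ▸ hj)⟩
  have m1 : ∀ i j, d = 1 → i % d = j % d := by rintro i j rfl; omega
  have hE : ∀ i j, (D1of (natCong m d) (natCong l d) M0 M1).E i j ↔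
      (l ≤ i ∧ m ≤ j ∧ i % d = (j + 1) % d) ∨ (i < l ∧ j < m ∧ S i j) := by
    intro i j
    simp only [D1of, minLE_nat hd]
    constructor
    · rintro ⟨h1, h2, h3, h4⟩
      by_cases hi : l ≤ i
      · refine Or.inl ⟨hi, h4.1 hi, ?_⟩
        rcases h3 with h3 | h3
        · rw [h3]
        · exact h3.2.2
      · have hj : j < m := by
          by_contra hj; exact hi (h4.2 (by omega))
        refine Or.inr ⟨by omega, hj, (hS i j (by omega) hj).2 ?_⟩
        rcases a' j hj with e | e
        · rw [h1, e] at h2; exact absurd h2 mid_delta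
        · exact ⟨e, h1.trans e, h3⟩
    · rintro (⟨h1, h2, h3⟩ | ⟨h1, h2, h3⟩)
      · rw [a j h2, b i h1]
        exact ⟨rfl, xm, Or.inr ⟨by omega, by omega, h3⟩, by simp [h1, h2]⟩
      · obtain ⟨e1, e2, e3⟩ := (hS i j h1 h2).1 h3
        rw [e1, e2]
        exact ⟨rfl, mid_mu, e3, by constructor <;> omega⟩
  constructor
  · rintro i j (rfl | ⟨h1, h2, -⟩)
    · rfl
    · rw [a i h1, a j h2]
  · rintro i j (rfl | ⟨h1, h2, -⟩)
    · rfl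
    · rw [b i h1, b j h2]
  · intro i j h e
    exact Or.inr ⟨(A i h).1, (A j (e ▸ h)).1, m1 _ _ (A i h).2⟩
  · intro i h
    have := (A i h).1
    rw [a i this, a (i + 1) (by omega)]
  · intro i h
    have := (B i h).1
    rw [a i (by omega), b i this]
  · intro i j h e
    exact Or.inr ⟨(B i h).1, (B j (e ▸ h)).1, m1 _ _ (B i h).2⟩
  · intro i h
    have := (B i h).1
    rw [b i this, b (i + 1) (by omega)]
  · have key : ∀ j, (M1 j = CEntry.muUp ∨ M1 j = CEntry.muDown) → j < l := by
      intro j hj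
      by_contra hc
      rw [b j (by omega)] at hj
      rcases hj with e | e <;> rw [e] at xm <;> simp at xm
    intro i j h1 h2
    exact bz i j (key i h1) (key j (h2 ▸ h1)) h1 h2
  · intro i
    rcases lt_or_ge i m with h | h
    · rcases a' i h with e | e <;> simp [e]
    · rw [a i h]; exact Or.inr xm
  · intro i
    rcases lt_or_ge i l with h | h
    · exact Or.inl (b' i h)
    · rw [b i h]
      rcases xm with e | e
      · exact Or.inl (Or.inl e)
      · exact Or.inr e
  · intro i j
    rw [hE, hE]
    rintro (⟨h1, h2, h3⟩ | ⟨h1, h2, h3⟩)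
    · exact Or.inl ⟨by omega, by omega, mod_succ h3⟩
    · rcases S1 i j h1 h2 h3 with h | ⟨e1, e2⟩
      · exact Or.inr h
      · refine Or.inl ⟨by omega, by omega, mod_succ ?_⟩
        rcases ((hS i j h1 h2).1 h3).2.2 with e | e
        · rw [e]
        · exact e.2.2
  · intro i h
    rw [hE]
    rcases lt_or_ge i l with h' | h'
    · rcases S2 i h' h with e | e
      · exact Or.inr e
      · exact Or.inl ⟨by omega, e.2, rfl⟩
    · exact Or.inl ⟨by omega, by omega, rfl⟩
  · intro i i' j
    rw [hE, hE]
    rintro (⟨h1, h2, h3⟩ | ⟨h1, h2, h3⟩) (⟨h1', h2', h3'⟩ | ⟨h1', h2', h3'⟩)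
    · exact Or.inr ⟨h1, h1', h3.trans h3'.symm⟩
    · omega
    · omega
    · exact Or.inl (S3 i i' j h1 h1' h2 h3 h3')

theorem F01_RT4 {Θ0 Θ1 : ℕ → ℕ → Prop} {M0 M1 : ℕ → CEntry} (h : RT4 Θ0 Θ1 M0 M1) : F01 Θ0 Θ1 M0 M1 := by
  obtain ⟨m, d, ξ, hd, rfl, rfl, hξ, h1, h2⟩ := h
  refine F01_main hd le_rfl hξ (fun _ _ => False) (fun j hj => (h2 j hj).1) (fun j hj => (h2 j hj).2)
    (fun j hj => Or.inl (h1 j hj).1) (fun j hj => by rw [(h1 j hj).2]; simp [isZeta]) ?_ ?_ ?_ ?_ ?_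
  · intro i j hi _ h; rw [(h1 i hi).2] at h; simp at h
  · intro i j _ hj; rw [(h1 j hj).1]; simp
  · intro i j _ _ h; exact h.elim
  · intro i hi h; exact absurd (h1 i hi).2 h
  · intro i i' j _ _ _ h; exact h.elim

theorem F01_RT5 {Θ0 Θ1 : ℕ → ℕ → Prop} {M0 M1 : ℕ → CEntry} (h : RT5 Θ0 Θ1 M0 M1) : F01 Θ0 Θ1 M0 M1 := by
  obtain ⟨m, d, i0, ξ, ζ, hd, him, rfl, rfl, hξ, hζ, a1, a2, a3, b1, b2, b3, b4⟩ := h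
  have B : ∀ i, i < m + 1 → (i < i0 ∧ M1 i = CEntry.delta) ∨ (i = i0 ∧ M1 i = ζ) ∨ (i0 < i ∧ M1 i = CEntry.mu) := fun i hi => by
    rcases lt_trichotomy i i0 with h | h | h
    · exact Or.inl ⟨h, b1 i h⟩
    · exact Or.inr (Or.inl ⟨h, h ▸ b2⟩)
    · exact Or.inr (Or.inr ⟨h, b3 i h (by omega)⟩)
  refine F01_main hd (by omega) hξ (fun i j => i = j + 1 ∧ i0 ≤ j) a3 (fun j hj => b4 j hj) ?_ ?_ ?_ ?_ ?_ ?_ ?_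
  · intro j hj
    rcases lt_or_ge j i0 with h | h
    · exact Or.inl (a1 j h)
    · exact Or.inr (a2 j h hj)
  · intro j hj
    rcases B j hj with ⟨-, e⟩ | ⟨-, e⟩ | ⟨-, e⟩
    · simp [e, isZeta]
    · rwa [e]
    · simp [e, isZeta]
  · have : ∀ i, i < m + 1 → (M1 i = CEntry.muUp ∨ M1 i = CEntry.muDown) → i = i0 := by
      intro i hi h
      rcases B i hi with ⟨-, e⟩ | ⟨h', e⟩ | ⟨-, e⟩
      · simp [e] at h
      · exact h'
      · simp [e] at h
    intro i j hi hj h1 h2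
    rw [this i hi h1, this j hj (h2 ▸ h1)]
  · intro i j hi hj
    constructor
    · rintro ⟨rfl, h⟩
      exact ⟨a2 j h hj, b3 _ (by omega) (by omega), Or.inl rfl⟩
    · rintro ⟨e1, e2, e3⟩
      refine ⟨?_, ?_⟩
      · rcases e3 with e | e <;> omega
      · by_contra hc
        rw [a1 j (by omega)] at e1
        simp at e1
  · intro i j hi hj h; omega
  · intro i hi h
    rcases B i hi with ⟨-, e⟩ | ⟨h', e⟩ | ⟨h', e⟩
    · exact absurd e h
    · omega
    · omega
  · intro i i' j _ _ _ h h'; omega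

theorem F01_RT6 {Θ0 Θ1 : ℕ → ℕ → Prop} {M0 M1 : ℕ → CEntry} (h : RT6 Θ0 Θ1 M0 M1) : F01 Θ0 Θ1 M0 M1 := by
  obtain ⟨m, l, d, ξ, ζ, hd, hml, rfl, rfl, hξ, hζ, a1, a2, b1, b2, b3⟩ := h
  have B : ∀ i, i < l → (i < l - 1 ∧ M1 i = CEntry.delta) ∨ (i = l - 1 ∧ M1 i = ζ) := fun i hi => by
    rcases lt_or_ge i (l - 1) with h | h
    · exact Or.inl ⟨h, b1 i h⟩
    · have : i = l - 1 := by omega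
      exact Or.inr ⟨this, this ▸ b2⟩
  refine F01_main hd hml.le hξ (fun _ _ => False) a2 b3 (fun j hj => Or.inl (a1 j hj)) ?_ ?_ ?_ ?_ ?_ ?_
  · intro j hj
    rcases B j hj with ⟨-, e⟩ | ⟨-, e⟩
    · simp [e, isZeta]
    · rwa [e]
  · have : ∀ i, i < l → (M1 i = CEntry.muUp ∨ M1 i = CEntry.muDown) → i = l - 1 := by
      intro i hi h
      rcases B i hi with ⟨-, e⟩ | ⟨h', e⟩
      · simp [e] at h
      · exact h'
    intro i j hi hj h1 h2
    rw [this i hi h1, this j hj (h2 ▸ h1)]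
  · intro i j _ hj; rw [a1 j hj]; simp
  · intro i j _ _ h; exact h.elim
  · intro i hi h
    rcases B i hi with ⟨-, e⟩ | ⟨h', e⟩
    · exact absurd e h
    · omega
  · intro i i' j _ _ _ h; exact h.elim

theorem F01_RT7 {Θ0 Θ1 : ℕ → ℕ → Prop} {M0 M1 : ℕ → CEntry} (h : RT7 Θ0 Θ1 M0 M1) : F01 Θ0 Θ1 M0 M1 := by
  obtain ⟨m, l, d, ξ, hd, hm, hml, hmod, rfl, rfl, hξ, a1, a2, a3, b1, b2, b3⟩ := h
  have B : ∀ i, i < l → (i < l - 1 ∧ M1 i = CEntry.delta) ∨ (i = l - 1 ∧ M1 i = CEntry.mu) := fun i hi => by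
    rcases lt_or_ge i (l - 1) with h | h
    · exact Or.inl ⟨h, b1 i h⟩
    · have : i = l - 1 := by omega
      exact Or.inr ⟨this, this ▸ b2⟩
  refine F01_main hd (by omega) hξ (fun i j => i = l - 1 ∧ j = m - 1) a3 b3 ?_ ?_ ?_ ?_ ?_ ?_ ?_
  · intro j hj
    rcases lt_or_ge j (m - 1) with h | h
    · exact Or.inl (a1 j h)
    · have : j = m - 1 := by omega
      exact Or.inr (this ▸ a2)
  · intro j hj
    rcases B j hj with ⟨-, e⟩ | ⟨-, e⟩ <;> simp [e, isZeta]
  · intro i j hi hj h1 h2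
    rcases B i hi with ⟨-, e⟩ | ⟨-, e⟩ <;> simp [e] at h1
  · intro i j hi hj
    constructor
    · rintro ⟨rfl, rfl⟩
      refine ⟨a2, b2, Or.inr ⟨by omega, by omega, ?_⟩⟩
      rw [hmod, Nat.sub_add_cancel hm]
    · rintro ⟨e1, e2, e3⟩
      constructor
      · rcases B i hi with ⟨-, e⟩ | ⟨e, -⟩
        · rw [e] at e2; simp at e2
        · exact e
      · by_contra hc
        rw [a1 j (by omega)] at e1
        simp at e1
  · intro i j hi hj h; omega
  · intro i hi h
    rcases B i hi with ⟨-, e⟩ | ⟨h', e⟩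
    · exact absurd e h
    · omega
  · intro i i' j _ _ _ h h'; omega


end Part12

section Part13

/-! ### Congruences on the naturals -/

section natcong
variable {θ : ℕ → ℕ → Prop}

theorem nc_refl (h : IsCongruence (· + ·) θ) (i) : θ i i := h.1.refl i
theorem nc_symm (h : IsCongruence (· + ·) θ) {i j} (hh : θ i j) : θ j i := h.1.symm hh
theorem nc_trans (h : IsCongruence (· + ·) θ) {i j k} (hh : θ i j) (h2 : θ j k) : θ i k := h.1.trans hh h2
theorem nc_add (h : IsCongruence (· + ·) θ) {i j} (k : ℕ) (hh : θ i j) : θ (i + k) (j + k) := (h.2 _ _ k hh).2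

theorem nc_mul (h : IsCongruence (· + ·) θ) {i e} (hh : θ i (i + e)) (k : ℕ) : θ i (i + k * e) := by
  induction k with
  | zero => simpa using nc_refl h i
  | succ k ih =>
    have := nc_add h (k * e) hh
    have e1 : i + e + k * e = i + (k + 1) * e := by ring
    rw [e1] at this
    exact nc_trans h ih this

theorem natCong_cong (m d : ℕ) : IsCongruence (· + ·) (natCong m d) := by
  refine ⟨⟨fun i => Or.inl rfl, ?_, ?_⟩, ?_⟩
  · rintro i j (rfl | ⟨a, b, c⟩)
    · exact Or.inl rfl
    · exact Or.inr ⟨b, a, c.symm⟩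
  · rintro i j k (rfl | ⟨a, b, c⟩) (rfl | ⟨a', b', c'⟩)
    · exact Or.inl rfl
    · exact Or.inr ⟨a', b', c'⟩
    · exact Or.inr ⟨a, b, c⟩
    · exact Or.inr ⟨a, b', c.trans c'⟩
  · rintro i j k (rfl | ⟨a, b, c⟩)
    · exact ⟨Or.inl rfl, Or.inl rfl⟩
    · exact ⟨Or.inr ⟨by beta_reduce; omega, by beta_reduce; omega, Nat.ModEq.add_left k c⟩,
        Or.inr ⟨by beta_reduce; omega, by beta_reduce; omega, Nat.ModEq.add_right k c⟩⟩

theorem cong_class (h : IsCongruence (· + ·) θ) : θ = Eq ∨ ∃ m d, 1 ≤ d ∧ θ = natCong m d := by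
  classical
  by_cases hE : ∃ a e, 1 ≤ e ∧ θ a (a + e)
  · right
    have hD : ∃ e, 1 ≤ e ∧ ∃ a, θ a (a + e) := by obtain ⟨a, e, h1, h2⟩ := hE; exact ⟨e, h1, a, h2⟩
    set m := Nat.find hE with hm
    set d := Nat.find hD with hd
    obtain ⟨e, he, hme⟩ := Nat.find_spec hE
    obtain ⟨hd1, a, ha⟩ := Nat.find_spec hD
    rw [← hm] at hme
    rw [← hd] at hd1 ha
    have hmd : θ m (m + d) := by
      have h1 := nc_mul h hme a
      have h2 : θ (m + a * e) (m + a * e + d) := by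
        have : a ≤ m + a * e := by nlinarith
        obtain ⟨c, hc⟩ := Nat.exists_eq_add_of_le this
        have := nc_add h c ha
        rwa [show a + d + c = a + c + d by omega, ← hc] at this
      exact nc_trans h h1 (nc_trans h h2 (nc_symm h (nc_add h d h1)))
    have key : ∀ i k, m ≤ i → θ i (i + k * d) := by
      intro i k hi
      obtain ⟨c, rfl⟩ := Nat.exists_eq_add_of_le hi
      have := nc_add h c (nc_mul h hmd k)
      rwa [show m + k * d + c = m + c + k * d by omega] at this
    have L : ∀ i j, i ≤ j → (θ i j ↔ natCong m d i j) := by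
      intro i j hij
      constructor
      · intro hθ
        rcases Nat.eq_or_lt_of_le hij with rfl | hlt
        · exact Or.inl rfl
        have hmi : m ≤ i := Nat.find_min' hE ⟨j - i, by omega, by rwa [show i + (j - i) = j by omega]⟩
        refine Or.inr ⟨hmi, by omega, ?_⟩
        have h1 : θ i (i + (j - i) % d) := by
          have := key (i + (j - i) % d) ((j - i) / d) (by omega)
          have e1 : i + (j - i) % d + (j - i) / d * d = j := by
            have := Nat.mod_add_div (j - i) d
            rw [mul_comm] at this
            omega
          rw [e1] at this
          exact nc_trans h hθ (nc_symm h this)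
        have h2 : (j - i) % d = 0 := by
          by_contra hc
          have := Nat.find_min' hD ⟨by omega, i, h1⟩
          have := Nat.mod_lt (j - i) hd1
          omega
        exact ((Nat.modEq_iff_dvd' hij).2 (Nat.dvd_of_mod_eq_zero h2))
      · rintro (rfl | ⟨a1, a2, a3⟩)
        · exact nc_refl h i
        · obtain ⟨k, hk⟩ := (Nat.modEq_iff_dvd' hij).1 a3
          have := key i k a1
          rwa [mul_comm, ← hk, show i + (j - i) = j by omega] at this
    refine ⟨m, d, hd1, ?_⟩
    funext i j
    apply propext
    rcases le_total i j with hij | hij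
    · exact L i j hij
    · constructor
      · intro hh; exact nc_symm (natCong_cong m d) ((L j i hij).1 (nc_symm h hh))
      · intro hh; exact nc_symm h ((L j i hij).2 (nc_symm (natCong_cong m d) hh))
  · left
    have : ∀ i j, θ i j → i ≤ j := by
      intro i j hh
      by_contra hc
      exact hE ⟨j, i - j, by omega, by rw [show j + (i - j) = i by omega]; exact nc_symm h hh⟩
    funext i j
    apply propext
    constructor
    · intro hh; have h1 := this i j hh; have h2 := this j i (nc_symm h hh); omega
    · rintro rfl; exact nc_refl h i

theorem minLE_congr (h : IsCongruence (· + ·) θ) {i j} (hh : θ i j) : minLE θ i ↔ minLE θ j := by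
  by_cases e : i = j
  · rw [e]
  · exact iff_of_true ⟨i, j, hh, e, le_rfl⟩ ⟨j, i, nc_symm h hh, Ne.symm e, le_rfl⟩

theorem minLE_cancel (h : IsCongruence (· + ·) θ) {i j} (hh : θ (i + 1) (j + 1)) (hm : minLE θ i ↔ minLE θ j) : θ i j := by
  rcases cong_class h with rfl | ⟨m, d, hd, rfl⟩
  · exact Nat.succ_injective hh
  · rw [minLE_nat hd, minLE_nat hd] at hm
    rcases hh with hh | ⟨a, b, c⟩
    · left; omega
    · by_cases h1 : m ≤ i
      · exact Or.inr ⟨h1, hm.1 h1, mod_pred c⟩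
      · have : ¬ m ≤ j := fun h => h1 (hm.2 h)
        left; omega

end natcong

theorem D1of_valid {Θ0 Θ1 : ℕ → ℕ → Prop} {M0 M1 : ℕ → CEntry} (c0 : IsCongruence (· + ·) Θ0)
    (c1 : IsCongruence (· + ·) Θ1) (c10 : ∀ i j, Θ1 i j → Θ0 i j) (F : F01 Θ0 Θ1 M0 M1) :
    (D1of Θ0 Θ1 M0 M1).Valid where
  t0_refl := nc_refl c0
  t0_symm := nc_symm c0
  t0_trans := nc_trans c0
  t0_shift := nc_add c0 1
  t1_refl := nc_refl c1
  t1_symm := nc_symm c1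
  t1_trans := nc_trans c1
  t1_shift := nc_add c1 1
  t1_t0 := c10 _ _
  E_shift := F.f7 _ _
  E_t1 := by
    rintro i i' j ⟨a, b, c, d⟩ h
    have e := F.f2 _ _ h
    exact ⟨e ▸ a, e ▸ b, nc_trans c0 (nc_symm c0 (c10 _ _ h)) c, (minLE_congr c1 h).symm.trans d⟩
  E_t0 := by
    rintro i j j' ⟨a, b, c, d⟩ h
    have e := F.f1 _ _ h
    exact ⟨e ▸ a, b, nc_trans c0 c (nc_add c0 1 h), d.trans (minLE_congr c0 h)⟩
  E_inj1 := F.f9 _ _ _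
  E_inj0 := by
    rintro i j j' ⟨a, b, c, d⟩ ⟨a', b', c', d'⟩
    exact minLE_cancel c0 (nc_trans c0 (nc_symm c0 c) c') (d.symm.trans d')
  E_next := fun h => h.2.2.1
  E_dn := fun h => Or.inl h.2.1
  E_up := fun h => Or.inl h.2.1
  dn_E := fun h => F.f8 _ fun e => by rcases h with h | h <;> simp [e] at h
  up_E := fun h => F.f8 _ fun e => by rcases h with h | h <;> simp [e] at h
  dn_t1 := by
    intro i j h h'
    have e := F.f2 _ _ h'
    simp only [D1of] at h ⊢; rwa [← e]
  up_t1 := by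
    intro i j h h'
    have e := F.f2 _ _ h'
    simp only [D1of] at h ⊢; rwa [← e]
  lam_t0 := by
    intro i j h h'
    have e := F.f1 _ _ h'
    simp only [D1of] at h ⊢; rwa [← e]
  rho_t0 := by
    intro i j h h'
    have e := F.f1 _ _ h'
    simp only [D1of] at h ⊢; rwa [← e]
  lam_next := by
    intro i h
    have : big (M0 i) := by rcases h with h | h <;> simp [big, h]
    exact F.f3 _ _ this (F.f3' _ this)
  rho_next := by
    intro i h
    have : big (M0 i) := by rcases h with h | h <;> simp [big, h]
    exact F.f3 _ _ this (F.f3' _ this)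


end Part13

section Part14

/-! ### C-pairs give valid data -/

theorem rnk_le_of_H {α β : PM n} (h : greenH pmul α β) : rnk α ≤ rnk β := by
  obtain ⟨⟨h1, h2⟩, -⟩ := greenH_iff.1 h
  obtain ⟨a, b, h3, h4⟩ := le_rnk_iff.1 (le_refl (rnk α))
  have : ∀ s, ∃ y, β.r (Sum.inl (a s)) (Sum.inr y) := fun s => (h2 _).1 ⟨_, h3 s⟩
  choose c hc using this
  exact le_rnk_iff.2 ⟨a, c, hc, fun s t hst => h4 s t ((rkr h1).2 hst)⟩

theorem rnk_eq_of_H {α β : PM n} (h : greenH pmul α β) : rnk α = rnk β :=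
  le_antisymm (rnk_le_of_H h) (rnk_le_of_H (greenH_symm h))

theorem eq_of_pd_one {α β : PM n} {q : ℕ} (hr : rnk α = q) (hH : greenH pmul α β) {a b : Fin q → Fin n}
    (h2 : ∀ s t, α.r (Sum.inl (a s)) (Sum.inl (a t)) → s = t)
    (h1 : ∀ s, α.r (Sum.inl (a s)) (Sum.inr (b s)))
    (h3 : ∀ s, β.r (Sum.inl (a s)) (Sum.inr (b s))) : α = β := by
  obtain ⟨g, f, e, ga, fb, hgf⟩ := NF hr h1 h2
  have := NF_H e ga fb hgf hH (π := 1) (by simpa using h3)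
  refine e.trans (Eq.trans ?_ this.symm)
  congr 1
  funext x
  simp

/-- facts about rows `q ≥ 2` -/
structure RF (q : ℕ) (T : ℕ → ℕ → Prop) (M : ℕ → CEntry) : Prop where
  r1 : ∀ i j, T i j → M i = M j
  r2 : ∀ i, M i = CEntry.delta ∨ M i = CEntry.R ∨ ∃ N, M i = CEntry.nsym q N ∧ N ≠ ⊥ ∧ N.Normal
  r3 : ∀ i N, M i = CEntry.nsym q N → M (i + 1) = CEntry.R ∨ ∃ N', M (i + 1) = CEntry.nsym q N' ∧ N ≤ N'
  r4 : ∀ i, M i = CEntry.R → M (i + 1) = CEntry.R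

theorem RF_of {q : ℕ} {T : ℕ → ℕ → Prop} {M : ℕ → CEntry} (hc : IsCongruence (· + ·) T)
    (h : RT8 M ∨ RT9 q T M ∨ RT10 q T M) : RF q T M := by
  rcases h with h | h | h
  · have h : ∀ i, M i = CEntry.delta := h
    constructor <;> simp [h]
  · obtain ⟨i0, k, Ns, hik, hmin, hN, hmono, h1, h2, h3⟩ := h
    have A : ∀ j, (j < i0 ∧ M j = CEntry.delta) ∨ (i0 ≤ j ∧ j < k ∧ M j = CEntry.nsym q (Ns j)) ∨
        (k ≤ j ∧ M j = CEntry.nsym q (Ns k)) := fun j => by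
      rcases lt_or_ge j i0 with h | h
      · exact Or.inl ⟨h, h1 j h⟩
      · rcases lt_or_ge j k with h' | h'
        · exact Or.inr (Or.inl ⟨h, h', h2 j h h'⟩)
        · exact Or.inr (Or.inr ⟨h', h3 j h'⟩)
    constructor
    · intro i j hij
      by_cases e : i = j
      · rw [e]
      · rw [h3 i (hmin _ _ hij e), h3 j (hmin _ _ (nc_symm hc hij) (Ne.symm e))]
    · intro j
      rcases A j with ⟨-, e⟩ | ⟨h, h', e⟩ | ⟨-, e⟩
      · exact Or.inl e
      · exact Or.inr (Or.inr ⟨_, e, hN j h (by omega)⟩)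
      · exact Or.inr (Or.inr ⟨_, e, hN k hik le_rfl⟩)
    · intro j N e'
      right
      rcases A j with ⟨-, e⟩ | ⟨h, h', e⟩ | ⟨h, e⟩
      · rw [e] at e'; simp at e'
      · rw [e] at e'
        simp only [CEntry.nsym.injEq, heq_eq_eq, true_and] at e'
        subst e'
        rcases A (j + 1) with ⟨h3, -⟩ | ⟨h4, h5, e⟩ | ⟨h4, e⟩
        · omega
        · exact ⟨_, e, hmono _ _ h (by omega) (by omega)⟩
        · exact ⟨_, e, hmono _ _ h (by omega) le_rfl⟩
      · rw [e] at e'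
        simp only [CEntry.nsym.injEq, heq_eq_eq, true_and] at e'
        subst e'
        exact ⟨_, h3 (j + 1) (by omega), le_rfl⟩
    · intro j e'
      rcases A j with ⟨-, e⟩ | ⟨h, h', e⟩ | ⟨h, e⟩ <;> · rw [e] at e'; simp at e'
  · obtain ⟨i0, k, Ns, hik, hT, hN, hmono, h1, h2, h3⟩ := h
    have A : ∀ j, (j < i0 ∧ M j = CEntry.delta) ∨ (i0 ≤ j ∧ j < k ∧ M j = CEntry.nsym q (Ns j)) ∨
        (k ≤ j ∧ M j = CEntry.R) := fun j => by
      rcases lt_or_ge j i0 with h | h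
      · exact Or.inl ⟨h, h1 j h⟩
      · rcases lt_or_ge j k with h' | h'
        · exact Or.inr (Or.inl ⟨h, h', h2 j h h'⟩)
        · exact Or.inr (Or.inr ⟨h', h3 j h'⟩)
    constructor
    · intro i j hij
      rw [hT] at hij
      rcases hij with e | ⟨h, h', -⟩
      · rw [e]
      · rw [h3 i h, h3 j h']
    · intro j
      rcases A j with ⟨-, e⟩ | ⟨h, h', e⟩ | ⟨-, e⟩
      · exact Or.inl e
      · exact Or.inr (Or.inr ⟨_, e, hN j h (by omega)⟩)
      · exact Or.inr (Or.inl e)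
    · intro j N e'
      rcases A j with ⟨-, e⟩ | ⟨h, h', e⟩ | ⟨h, e⟩
      · rw [e] at e'; simp at e'
      · rw [e] at e'
        simp only [CEntry.nsym.injEq, heq_eq_eq, true_and] at e'
        subst e'
        rcases A (j + 1) with ⟨h3, -⟩ | ⟨h4, h5, e⟩ | ⟨h4, e⟩
        · omega
        · exact Or.inr ⟨_, e, hmono _ _ h (by omega) (by omega)⟩
        · exact Or.inl e
      · rw [e] at e'; simp at e'
    · intro j e'
      rcases A j with ⟨-, e⟩ | ⟨h, h', e⟩ | ⟨h, e⟩
      · rw [e] at e'; simp at e'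
      · rw [e] at e'; simp at e'
      · exact h3 _ (by omega)

/-- the data of a C-pair, with exceptional part -/
def dataOf (Θ : ℕ → ℕ → ℕ → Prop) (M : ℕ → ℕ → CEntry) (exc : ℕ → ℕ → ℕ → Prop) : Dat where
  toD1 := D1of (Θ 0) (Θ 1) (M 0) (M 1)
  Re q i := M q i = CEntry.R
  NN q i j π := (Θ q i j ∧ (π = 1 ∨ M q i = CEntry.R ∨ ∃ N, M q i = CEntry.nsym q N ∧ π ∈ N)) ∨
    (exc q i j ∧ π ∉ alternatingGroup (Fin q))

/-- what is needed from a C-pair -/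
structure CF (n : ℕ) (Θ : ℕ → ℕ → ℕ → Prop) (M : ℕ → ℕ → CEntry) : Prop where
  cong : ∀ q, q ≤ n → IsCongruence (· + ·) (Θ q)
  chain : ∀ q r, q ≤ r → r ≤ n → ∀ i j, Θ r i j → Θ q i j
  f : F01 (Θ 0) (Θ 1) (M 0) (M 1)
  rf : ∀ q, 2 ≤ q → q ≤ n → RF q (Θ q) (M q)
  v1 : ∀ q i, 1 ≤ q → q ≤ n → isNsym (M q i) →
    ¬(M (q - 1) i = CEntry.delta ∨ M (q - 1) i = CEntry.muUp ∨
      M (q - 1) i = CEntry.muDown ∨ isNsym (M (q - 1) i))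
  v2 : ∀ q i, 2 ≤ q → q ≤ n → M q i = CEntry.R → M (q - 1) i = CEntry.R

theorem CF_of {Θ : ℕ → ℕ → ℕ → Prop} {M : ℕ → ℕ → CEntry} (h : IsCPair n Θ M) : CF n Θ M := by
  obtain ⟨h1, h2, h3, h4, h5, h6⟩ := h
  refine ⟨h1, h2, ?_, fun q hq hq' => RF_of (h1 q hq') (h4 q hq hq'), h5, h6⟩
  rcases h3 with h | h | h | h | h | h | h
  · exact F01_RT1 h
  · exact F01_RT2 h
  · exact F01_RT3 h
  · exact F01_RT4 h
  · exact F01_RT5 h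
  · exact F01_RT6 h
  · exact F01_RT7 h

/-- facts on the exceptional part -/
structure XF (n : ℕ) (Θ : ℕ → ℕ → ℕ → Prop) (M : ℕ → ℕ → CEntry) (exc : ℕ → ℕ → ℕ → Prop) : Prop where
  symm : ∀ {q i j}, exc q i j → exc q j i
  shift : ∀ {q i j}, exc q i j → exc q (i + 1) (j + 1)
  left : ∀ {q i j k}, Θ q i j → exc q j k → exc q i k
  comp : ∀ {q i j k}, exc q i j → exc q j k → Θ q i k
  ent : ∀ {q i j}, exc q i j → (3 ≤ q ∧ M q i = CEntry.nsym q (alternatingGroup (Fin q))) ∨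
    (q = 2 ∧ M 2 i = CEntry.delta ∧ Θ 1 i j ∧ mid (M 1 i))

theorem alt_two : alternatingGroup (Fin 2) = ⊥ := by
  rw [Subgroup.eq_bot_iff_forall]
  intro x hx
  rw [Equiv.Perm.mem_alternatingGroup] at hx
  revert x
  decide

section
variable {Θ : ℕ → ℕ → ℕ → Prop} {M : ℕ → ℕ → CEntry} {exc : ℕ → ℕ → ℕ → Prop}

theorem alt_mul {q : ℕ} {π τ : Equiv.Perm (Fin q)} (h1 : π ∉ alternatingGroup (Fin q))
    (h2 : τ ∉ alternatingGroup (Fin q)) : π * τ ∈ alternatingGroup (Fin q) := by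
  rw [Equiv.Perm.mem_alternatingGroup] at *
  rw [Equiv.Perm.sign_mul, (Int.units_eq_one_or _).resolve_left h1, (Int.units_eq_one_or _).resolve_left h2]
  rfl

theorem alt_mul' {q : ℕ} {π τ : Equiv.Perm (Fin q)} (h1 : π ∈ alternatingGroup (Fin q))
    (h2 : τ ∉ alternatingGroup (Fin q)) : π * τ ∉ alternatingGroup (Fin q) := fun h =>
  h2 ((Subgroup.mul_mem_cancel_left _ h1).1 h)

theorem alt_mul'' {q : ℕ} {π τ : Equiv.Perm (Fin q)} (h1 : π ∉ alternatingGroup (Fin q))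
    (h2 : τ ∈ alternatingGroup (Fin q)) : π * τ ∉ alternatingGroup (Fin q) := fun h =>
  h1 ((Subgroup.mul_mem_cancel_right _ h2).1 h)

theorem Rs0 (i) : (dataOf Θ M exc).Rs 0 i ↔ M 0 i = CEntry.R := by
  simp only [dataOf, Dat.Rs, D1of]
  constructor
  · rintro ⟨h1 | h1, h2 | h2⟩
    · rw [h1] at h2; simp at h2
    all_goals assumption
  · intro h; exact ⟨Or.inr h, Or.inr h⟩

theorem CF.E_self (C : CF n Θ M) {i j} (hb : big (M 1 i)) (he : M 1 i = M 0 j) :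
    (D1of (Θ 0) (Θ 1) (M 0) (M 1)).E i j := by
  have b0 : big (M 0 j) := he ▸ hb
  have t0 := C.f.f3 j (j + 1) b0 (C.f.f3' j b0)
  have t1 := C.f.f4a i (i + 1) hb (C.f.f4b i hb)
  refine ⟨he, big_mid hb, ?_, iff_of_true ⟨i, i + 1, t1, by omega, le_rfl⟩ ⟨j, j + 1, t0, by omega, le_rfl⟩⟩
  have e := C.f.f4 i hb
  exact C.f.f3 i (j + 1) (e ▸ hb) (by rw [C.f.f3' j b0, e, he])

theorem CF.E_lam (C : CF n Θ M) (i) : ((D1of (Θ 0) (Θ 1) (M 0) (M 1)).E i i ∧ (D1of (Θ 0) (Θ 1) (M 0) (M 1)).lam i) ↔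
    (M 1 i = CEntry.lam ∨ M 1 i = CEntry.R) := by
  constructor
  · rintro ⟨h1, h2⟩
    have h2 : M 0 i = CEntry.lam ∨ M 0 i = CEntry.R := h2
    rwa [← h1.1] at h2
  · intro h
    have hb : big (M 1 i) := by rcases h with h | h <;> simp [h, big]
    have e := C.f.f4 i hb
    refine ⟨C.E_self hb e.symm, ?_⟩
    rwa [← e] at h

theorem CF.E_rho (C : CF n Θ M) (i) : ((D1of (Θ 0) (Θ 1) (M 0) (M 1)).E i i ∧ (D1of (Θ 0) (Θ 1) (M 0) (M 1)).rho i) ↔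
    (M 1 i = CEntry.rho ∨ M 1 i = CEntry.R) := by
  constructor
  · rintro ⟨h1, h2⟩
    have h2 : M 0 i = CEntry.rho ∨ M 0 i = CEntry.R := h2
    rwa [← h1.1] at h2
  · intro h
    have hb : big (M 1 i) := by rcases h with h | h <;> simp [h, big]
    have e := C.f.f4 i hb
    refine ⟨C.E_self hb e.symm, ?_⟩
    rwa [← e] at h

theorem CF.Rs1 (C : CF n Θ M) (i) : (dataOf Θ M exc).Rs 1 i ↔ M 1 i = CEntry.R := by
  have h1 := C.E_lam i
  have h2 := C.E_rho i
  have : (dataOf Θ M exc).Rs 1 i ↔ (M 1 i = CEntry.lam ∨ M 1 i = CEntry.R) ∧ (M 1 i = CEntry.rho ∨ M 1 i = CEntry.R) := by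
    rw [← h1, ← h2]
    simp only [dataOf, Dat.Rs]
    tauto
  rw [this]
  constructor
  · rintro ⟨h1 | h1, h2 | h2⟩
    · rw [h1] at h2; simp at h2
    all_goals assumption
  · intro h; exact ⟨Or.inr h, Or.inr h⟩

theorem CF.Rs (C : CF n Θ M) (q i) : (dataOf Θ M exc).Rs q i ↔ M q i = CEntry.R := by
  match q with
  | 0 => exact Rs0 i
  | 1 => exact C.Rs1 i
  | (q + 2) => exact Iff.rfl

theorem CF.drop3 (C : CF n Θ M) {q i N} (hq : 3 ≤ q) (hq' : q ≤ n) (h : M q i = CEntry.nsym q N) :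
    M (q - 1) i = CEntry.R := by
  have v := C.v1 q i (by omega) hq' (by rw [h]; trivial)
  rcases (C.rf (q - 1) (by omega) (by omega)).r2 i with e | e | ⟨N', e, -⟩
  · exact absurd (Or.inl e) v
  · exact e
  · exact absurd (Or.inr (Or.inr (Or.inr (by rw [e]; trivial)))) v

theorem CF.drop2 (C : CF n Θ M) {i N} (hn : 2 ≤ n) (h : M 2 i = CEntry.nsym 2 N) : mid (M 1 i) := by
  have v := C.v1 2 i (by omega) hn (by rw [h]; trivial)
  simp only [show 2 - 1 = 1 from rfl] at v
  rcases C.f.f6' i with (e | e | e | e) | e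
  · simp [e]
  · simp [e] at v
  · simp [e] at v
  · simp [e] at v
  · exact big_mid e

theorem CF.valid (C : CF n Θ M) (hn : 1 ≤ n) (X : XF n Θ M exc) : (dataOf Θ M exc).Valid n where
  toValid := D1of_valid (C.cong 0 (by omega)) (C.cong 1 hn) (C.chain 0 1 (by omega) hn) C.f
  nn_one i hq hq' := Or.inl ⟨nc_refl (C.cong _ hq') i, Or.inl rfl⟩
  nn_inv := by
    rintro q i j π hq hq' (⟨h1, h2⟩ | ⟨h1, h2⟩)
    · have e := (C.rf q hq hq').r1 _ _ h1
      refine Or.inl ⟨nc_symm (C.cong _ hq') h1, ?_⟩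
      rw [← e]
      rcases h2 with rfl | h2 | ⟨N, h2, h3⟩
      · exact Or.inl inv_one
      · exact Or.inr (Or.inl h2)
      · exact Or.inr (Or.inr ⟨N, h2, N.inv_mem h3⟩)
    · exact Or.inr ⟨X.symm h1, fun h => h2 (by simpa using h)⟩
  nn_mul := by
    rintro q i j k π τ hq hq' (⟨h1, h2⟩ | ⟨h1, h2⟩) (⟨h3, h4⟩ | ⟨h3, h4⟩)
    · have e := (C.rf q hq hq').r1 _ _ h1
      refine Or.inl ⟨nc_trans (C.cong _ hq') h1 h3, ?_⟩
      rw [← e] at h4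
      rcases h2 with rfl | h2 | ⟨N, h2, h5⟩
      · rwa [one_mul]
      · exact Or.inr (Or.inl h2)
      · rcases h4 with rfl | h4 | ⟨N', h4, h6⟩
        · exact Or.inr (Or.inr ⟨N, h2, by rwa [mul_one]⟩)
        · exact Or.inr (Or.inl h4)
        · rw [h2] at h4
          simp only [CEntry.nsym.injEq, heq_eq_eq, true_and] at h4
          subst h4
          exact Or.inr (Or.inr ⟨N, h2, N.mul_mem h5 h6⟩)
    · have e := (C.rf q hq hq').r1 _ _ h1
      refine Or.inr ⟨X.left h1 h3, alt_mul' ?_ h4⟩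
      rcases X.ent h3 with ⟨-, e'⟩ | ⟨rfl, e', -⟩
      · rw [e, e'] at h2
        simp only [reduceCtorEq, CEntry.nsym.injEq, heq_eq_eq, true_and, false_or] at h2
        rcases h2 with rfl | ⟨N, rfl, h2⟩
        · exact Subgroup.one_mem _
        · exact h2
      · rw [e, e'] at h2
        simp only [reduceCtorEq, false_and, exists_false, or_false] at h2
        rw [h2]; exact Subgroup.one_mem _
    · have e := (C.rf q hq hq').r1 _ _ h3
      refine Or.inr ⟨X.symm (X.left (nc_symm (C.cong _ hq') h3) (X.symm h1)), alt_mul'' h2 ?_⟩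
      rcases X.ent (X.symm h1) with ⟨-, e'⟩ | ⟨rfl, e', -⟩
      · rw [e'] at h4
        simp only [reduceCtorEq, CEntry.nsym.injEq, heq_eq_eq, true_and, false_or] at h4
        rcases h4 with rfl | ⟨N, rfl, h4⟩
        · exact Subgroup.one_mem _
        · exact h4
      · rw [e'] at h4
        simp only [reduceCtorEq, false_and, exists_false, or_false] at h4
        rw [h4]; exact Subgroup.one_mem _
    · have h5 := alt_mul h2 h4
      refine Or.inl ⟨X.comp h1 h3, ?_⟩
      rcases X.ent h1 with ⟨-, e'⟩ | ⟨rfl, e', -⟩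
      · exact Or.inr (Or.inr ⟨_, e', h5⟩)
      · rw [alt_two] at h5
        exact Or.inl h5
  nn_conj := by
    rintro q i j π τ hq hq' (⟨h1, h2⟩ | ⟨h1, h2⟩)
    · refine Or.inl ⟨h1, ?_⟩
      rcases h2 with rfl | h2 | ⟨N, h2, h3⟩
      · left; group
      · exact Or.inr (Or.inl h2)
      · rcases (C.rf q hq hq').r2 i with e | e | ⟨N', e, -, hN⟩
        · rw [e] at h2; simp at h2
        · rw [e] at h2; simp at h2
        · rw [e] at h2
          simp only [CEntry.nsym.injEq, heq_eq_eq, true_and] at h2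
          subst h2
          refine Or.inr (Or.inr ⟨N', e, ?_⟩)
          have := hN.conj_mem π h3 τ⁻¹
          rwa [inv_inv] at this
    · refine Or.inr ⟨h1, fun h => h2 ?_⟩
      rw [Equiv.Perm.mem_alternatingGroup] at h ⊢
      rw [← h, map_mul, map_mul, map_inv, mul_comm, ← mul_assoc, mul_inv_cancel, one_mul]
  nn_shift := by
    rintro q i j π hq hq' (⟨h1, h2⟩ | ⟨h1, h2⟩)
    · refine Or.inl ⟨nc_add (C.cong _ hq') 1 h1, ?_⟩
      rcases h2 with rfl | h2 | ⟨N, h2, h3⟩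
      · left; rfl
      · exact Or.inr (Or.inl ((C.rf q hq hq').r4 i h2))
      · rcases (C.rf q hq hq').r3 i N h2 with h | ⟨N', h, hl⟩
        · exact Or.inr (Or.inl h)
        · exact Or.inr (Or.inr ⟨N', h, hl h3⟩)
    · exact Or.inr ⟨X.shift h1, h2⟩
  re_nn := by
    rintro q i j π hq hq' (⟨h1, h2⟩ | ⟨h1, h2⟩) hR
    · have e := (C.rf q hq hq').r1 _ _ h1
      exact e.symm.trans hR
    · have hR : M q i = CEntry.R := hR
      rcases X.ent h1 with ⟨-, e'⟩ | ⟨rfl, e', -⟩ <;> · rw [hR] at e'; simp at e'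
  re_shift := fun hq hq' h => (C.rf _ hq hq').r4 _ h
  re_down := fun hq hq' h => (C.Rs _ _).2 (C.v2 _ _ hq hq' h)
  t_down := by
    rintro q i j hq hq' (⟨h1, h2⟩ | ⟨h1, h2⟩)
    · have := C.chain (q - 1) q (by omega) hq' _ _ h1
      match q, hq, this with
      | 2, _, this => exact this
      | (q + 3), _, this => exact Or.inl ⟨this, Or.inl rfl⟩
    · exact absurd (Subgroup.one_mem _) h2
  nn_drop := by
    rintro q i j π hq hq' hπ (⟨h1, h2⟩ | ⟨h1, h2⟩)
    · rcases h2 with h2 | h2 | ⟨N, h2, h3⟩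
      · exact absurd h2 hπ
      · exact C.v2 _ _ (by omega) hq' h2
      · exact C.drop3 hq hq' h2
    · rcases X.ent h1 with ⟨-, e'⟩ | ⟨rfl, e', -⟩
      · exact C.drop3 hq hq' e'
      · omega
  nn_drop2 := by
    rintro i j π hn2 hπ (⟨h1, h2⟩ | ⟨h1, h2⟩)
    · have t1 := C.chain 1 2 (by omega) hn2 _ _ h1
      have : mid (M 1 i) := by
        rcases h2 with h2 | h2 | ⟨N, h2, h3⟩
        · exact absurd h2 hπ
        · have := C.v2 2 _ (by omega) hn2 h2
          exact Or.inr (Or.inr (Or.inr this))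
        · exact C.drop2 hn2 h2
      exact ⟨t1, Or.inl this, Or.inl this⟩
    · rcases X.ent h1 with ⟨h, -⟩ | ⟨-, e', h3, h4⟩
      · omega
      · exact ⟨h3, Or.inl h4, Or.inl h4⟩

end


end Part14

section Part15

section
variable {Θ : ℕ → ℕ → ℕ → Prop} {M : ℕ → ℕ → CEntry} {exc : ℕ → ℕ → ℕ → Prop}

theorem rnk0_eq_iff {α β : PM n} (ha : rnk α = 0) (hb : rnk β = 0) : α = β ↔ krS α = krS β ∧ ckS α = ckS β := by
  constructor
  · rintro rfl; exact ⟨rfl, rfl⟩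
  · rintro ⟨h1, h2⟩
    refine ext_le_one (by omega) (by omega) h1 h2 ?_ ?_
    · funext x; exact propext (iff_of_false (rnk_zero_dm ha x) (rnk_zero_dm hb x))
    · funext x; exact propext (iff_of_false (rnk_zero_cd ha x) (rnk_zero_cd hb x))

theorem rnk1_eq_iff {α β : PM n} (ha : rnk α = 1) (hb : rnk β = 1) : α = β ↔ krS α = krS β ∧ ckS α = ckS β ∧
    dm α = dm β ∧ cd α = cd β := by
  constructor
  · rintro rfl; exact ⟨rfl, rfl, rfl, rfl⟩
  · rintro ⟨h1, h2, h3, h4⟩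
    exact ext_le_one (by omega) (by omega) h1 h2 h3 h4

theorem greenL_iff' {α β : PM n} : greenL pmul α β ↔ ckS α = ckS β ∧ cd α = cd β := by
  rw [greenL_iff, funext_iff]
  simp only [eq_iff_iff]
theorem greenR_iff' {α β : PM n} : greenR pmul α β ↔ krS α = krS β ∧ dm α = dm β := by
  rw [greenR_iff, funext_iff]
  simp only [eq_iff_iff]

theorem CF.cg00 (C : CF n Θ M) {i j} {α β : PM n} (ha : rnk α = 0) (hb : rnk β = 0) :
    cg n Θ M (i, α) (j, β) ↔ (M 0 i = CEntry.R ∧ M 0 j = CEntry.R) ∨ rel00 (D1of (Θ 0) (Θ 1) (M 0) (M 1)) i α j β := by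
  simp only [cg, ha, hb, rel00, D1of, greenL_hat, greenR_hat, hat_eq_iff, rnk0_eq_iff ha hb]
  have h3 := C.f.f3 i j
  have h1 := C.f.f1 i j
  have h6 : ∀ i p N, M 0 i ≠ CEntry.nsym p N := by
    intro i p N
    rcases C.f.f6 i with e | e | e | e | e <;> simp [e]
  have hn : ¬ ∃ p N, M 0 i = CEntry.nsym p N ∧ M 0 j = CEntry.nsym p N ∧ Θ 0 i j ∧ 0 = p ∧
    greenH pmul α β ∧ pdIn p (· ∈ N) α β := by
    rintro ⟨p, N, h, -⟩; exact h6 _ _ _ h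
  by_cases ht : Θ 0 i j
  · have e := h1 ht
    rcases C.f.f6 i with e1 | e1 | e1 | e1 | e1 <;> rw [e1] at e <;>
      simp [e1, ← e, ht]
  · rcases C.f.f6 i with e1 | e1 | e1 | e1 | e1 <;>
      simp only [e1] at h3 <;> simp [e1, ht] <;> intro e2 <;>
      exact absurd (h3 (by simp [big]) e2) ht

theorem CF.cg11 (C : CF n Θ M) {i j} {α β : PM n} (ha : rnk α = 1) (hb : rnk β = 1) :
    cg n Θ M (i, α) (j, β) ↔ (M 1 i = CEntry.R ∧ M 1 j = CEntry.R) ∨ rel11 (D1of (Θ 0) (Θ 1) (M 0) (M 1)) i α j β := by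
  simp only [rel11, C.E_lam, C.E_rho]
  simp only [cg, ha, hb, D1of, greenL_hat, greenR_hat, hat_eq_iff, rnk1_eq_iff ha hb]
  simp only [greenL_iff', greenR_iff']
  have h3 := C.f.f4a i j
  have h1 := C.f.f2 i j
  have h5 := C.f.f5 i j
  have hr : i = j → Θ 1 i j := fun e => by
    rw [e]
    exact nc_refl (C.cong 1 (by rw [← ha]; exact rnk_le α)) j
  have h6 : ∀ i p N, M 1 i ≠ CEntry.nsym p N := by
    intro i p N
    rcases C.f.f6' i with (e | e | e | e) | e | e | e <;> simp [e]
  have hn : ¬ ∃ p N, M 1 i = CEntry.nsym p N ∧ M 1 j = CEntry.nsym p N ∧ Θ 1 i j ∧ 1 = p ∧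
    greenH pmul α β ∧ pdIn p (· ∈ N) α β := by
    rintro ⟨p, N, h, -⟩; exact h6 _ _ _ h
  have key : (big (M 1 i) ∨ M 1 i = CEntry.muUp ∨ M 1 i = CEntry.muDown) → M 1 j = M 1 i → Θ 1 i j := by
    rintro (h | h) e
    · exact h3 h e
    · exact hr (h5 h e)
  by_cases ht : Θ 1 i j
  · have e := h1 ht
    rcases C.f.f6' i with (e1 | e1 | e1 | e1) | e1 | e1 | e1 <;> rw [e1] at e <;>
      simp [e1, ← e, ht, mid, big] <;> tauto
  · rcases C.f.f6' i with (e1 | e1 | e1 | e1) | e1 | e1 | e1 <;>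
      simp [e1, big] at key <;> simp [e1, ht] <;> intro e2 <;>
      exact absurd (key e2) ht

theorem CF.cg10 (C : CF n Θ M) {i j} {α β : PM n} (ha : rnk α = 1) (hb : rnk β = 0) :
    cg n Θ M (i, α) (j, β) ↔ (M 1 i = CEntry.R ∧ M 0 j = CEntry.R) ∨ rel10 (D1of (Θ 0) (Θ 1) (M 0) (M 1)) i α j β := by
  have hne : α ≠ β := by rintro rfl; omega
  simp only [rel10]
  simp only [cg, ha, hb, greenL_hat, greenR_hat, hat_eq_iff, hne]
  have h6 : ∀ i p N, M 1 i ≠ CEntry.nsym p N := by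
    intro i p N
    rcases C.f.f6' i with (e | e | e | e) | e | e | e <;> simp [e]
  have hE := C.E_self (i := i) (j := j)
  have hg : greenL pmul α β → cd α = cd β := fun h => (greenL_iff'.1 h).2
  have hm0 : ∀ j, M 0 j ≠ CEntry.muUp ∧ M 0 j ≠ CEntry.muDown := by
    intro i
    rcases C.f.f6 i with e | e | e | e | e <;> simp [e]
  have hEe : (D1of (Θ 0) (Θ 1) (M 0) (M 1)).E i j → M 1 i = M 0 j := fun h => h.1
  have hEm : (D1of (Θ 0) (Θ 1) (M 0) (M 1)).E i j → mid (M 1 i) := fun h => h.2.1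
  rcases C.f.f6' i with (e1 | e1 | e1 | e1) | e1 | e1 | e1
  · simp only [e1, D1of, h6, mid_mu]
    have := hm0 j
    constructor
    · simp
      intro h2 h3 h4 h5
      refine ⟨⟨h2.symm, ?_⟩, ?_, ?_⟩
      · rcases h5 with ⟨a, b, c⟩ | ⟨a, b, c⟩ <;> simp [*]
      · simp [h3]
      · simp [h4]
    · rintro (h | ⟨⟨h2, -, h3, h4⟩, h5, h6⟩)
      · simp at h
      · rw [← h2] at h5 h6
        simp only [reduceCtorEq, or_self, false_or] at h5 h6
        rw [← h2]
        simp [h5, h6, h3]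
        tauto
  · have : ¬ (D1of (Θ 0) (Θ 1) (M 0) (M 1)).E i j := fun h => by have := hEm h; simp [e1] at this
    simp [e1, this, (hm0 j).1]
  · have : ¬ (D1of (Θ 0) (Θ 1) (M 0) (M 1)).E i j := fun h => by have := hEm h; simp [e1] at this
    simp [e1, this, (hm0 j).2]
  · have : ¬ (D1of (Θ 0) (Θ 1) (M 0) (M 1)).E i j := fun h => by have := hEm h; simp [e1] at this
    simp [e1, this]
  all_goals
    simp only [e1] at hE hEe
    by_cases e2 : M 0 j = M 1 i
    · rw [e1] at e2
      have hE := hE (by simp [big]) e2.symm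
      simp [e1, e2, hE]
      try simp [D1of, e2]
    · rw [e1] at e2
      have : ¬ (D1of (Θ 0) (Θ 1) (M 0) (M 1)).E i j := fun h => e2 (hEe h).symm
      simp [e1, e2, this]

theorem CF.cg01 (C : CF n Θ M) {i j} {α β : PM n} (ha : rnk α = 1) (hb : rnk β = 0) :
    cg n Θ M (j, β) (i, α) ↔ cg n Θ M (i, α) (j, β) := by
  have hne : α ≠ β := by rintro rfl; omega
  have hs : Θ 0 (i + 0) (j + 1) ↔ Θ 0 (j + 1) (i + 0) :=
    ⟨nc_symm (C.cong 0 (by omega)), nc_symm (C.cong 0 (by omega))⟩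
  have h6 : ∀ i p N, M 1 i ≠ CEntry.nsym p N := by
    intro i p N
    rcases C.f.f6' i with (e | e | e | e) | e | e | e <;> simp [e]
  have h7 : ∀ j, M 0 j ≠ CEntry.muUp ∧ M 0 j ≠ CEntry.muDown := by
    intro i
    rcases C.f.f6 i with e | e | e | e | e <;> simp [e]
  have c1 : ckS β = ckS α ↔ ckS α = ckS β := eq_comm
  have c2 : krS β = krS α ↔ krS α = krS β := eq_comm
  simp only [cg, ha, hb, greenL_hat, greenR_hat, hat_eq_iff, hne, hne.symm, h6, hs, (h7 j).1, (h7 j).2, c1, c2]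
  simp only [false_and, and_false, exists_false, false_or, or_false, zero_ne_one, one_ne_zero, ne_eq,
    not_false_eq_true, true_and]
  rw [and_left_comm (a := M 0 j = CEntry.lam), and_left_comm (a := M 0 j = CEntry.rho),
    and_left_comm (a := M 0 j = CEntry.mu), and_comm (a := M 0 j = CEntry.R),
    and_comm (a := ¬ minLE (Θ 0) j), and_comm (a := minLE (Θ 0) j)]

theorem CF.cg_big (C : CF n Θ M) {i j} {α β : PM n} (h : 2 ≤ rnk α ∨ 2 ≤ rnk β) (hne : rnk α ≠ rnk β) :
    cg n Θ M (i, α) (j, β) ↔ M (rnk α) i = CEntry.R ∧ M (rnk β) j = CEntry.R := by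
  have hab : α ≠ β := by rintro rfl; exact hne rfl
  have hH : ¬ greenH pmul α β := fun h => hne (rnk_eq_of_H h)
  simp only [cg, hab, hH]
  rcases h with h | h
  · rcases (C.rf _ h (rnk_le α)).r2 i with e | e | ⟨N, e, -⟩ <;> simp [e]
  · rcases (C.rf _ h (rnk_le β)).r2 j with e | e | ⟨N, e, -⟩ <;> simp [e]

theorem cg_same {i j} {α β : PM n} {q} (C : CF n Θ M) (hq : 2 ≤ q) (ha : rnk α = q) (hb : rnk β = q) :
    cg n Θ M (i, α) (j, β) ↔ (M q i = CEntry.R ∧ M q j = CEntry.R) ∨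
      (greenH pmul α β ∧ pdIn q (fun π => Θ q i j ∧ (π = 1 ∨ M q i = CEntry.R ∨ ∃ N, M q i = CEntry.nsym q N ∧ π ∈ N)) α β) := by
  have hqn : q ≤ n := ha ▸ rnk_le α
  constructor
  · intro h
    simp only [cg, ha, hb] at h
    rcases h with ⟨h1, h2, h3, rfl⟩ | h | ⟨p, N, h1, h2, h3, rfl, h5, h6⟩ | h
    · right
      obtain ⟨a, b, h4, h5⟩ := le_rnk_iff.1 (le_of_eq ha.symm)
      exact ⟨⟨rfl, rfl⟩, a, b, 1, h5, h4, by simpa using h4, h3, Or.inl rfl⟩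
    · exact Or.inl h
    · obtain ⟨a, b, π, h7, h8, h9, h10⟩ := h6
      exact Or.inr ⟨h5, a, b, π, h7, h8, h9, h3, Or.inr (Or.inr ⟨N, h1, h10⟩)⟩
    · exfalso
      rcases (C.rf q hq hqn).r2 i with e | e | ⟨N, e, -⟩ <;> simp [e] at h
  · rintro (h | ⟨hH, a, b, π, h1, h2, h3, h4, h5⟩)
    · simp only [cg, ha, hb]; exact Or.inr (Or.inl h)
    · have e := (C.rf q hq hqn).r1 _ _ h4
      simp only [cg, ha, hb]
      rcases h5 with rfl | h5 | ⟨N, h5, h6⟩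
      · have hab : α = β := eq_of_pd_one ha hH h1 h2 (by simpa using h3)
        rcases (C.rf q hq hqn).r2 i with e1 | e1 | ⟨N, e1, -⟩
        · exact Or.inl ⟨e1, e ▸ e1, h4, hab⟩
        · exact Or.inr (Or.inl ⟨e1, e ▸ e1⟩)
        · exact Or.inr (Or.inr (Or.inl ⟨q, N, e1, e ▸ e1, h4, rfl, hH, a, b, 1, h1, h2, h3, N.one_mem⟩))
      · exact Or.inr (Or.inl ⟨h5, e ▸ h5⟩)
      · exact Or.inr (Or.inr (Or.inl ⟨q, N, h5, e ▸ h5, h4, rfl, hH, a, b, π, h1, h2, h3, h6⟩))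

theorem CF.rel_iff (C : CF n Θ M) (a b : ℕ × PM n) : rel (dataOf Θ M exc) a b ↔
    cg n Θ M a b ∨ (∃ q, 2 ≤ q ∧ rnk a.2 = q ∧ rnk b.2 = q ∧ exc q a.1 b.1 ∧ greenH pmul a.2 b.2 ∧
      pdIn q (fun π => π ∉ alternatingGroup (Fin q)) a.2 b.2) := by
  obtain ⟨i, α⟩ := a
  obtain ⟨j, β⟩ := b
  simp only [rel, C.Rs, rel1]
  have hD : (dataOf Θ M exc).toD1 = D1of (Θ 0) (Θ 1) (M 0) (M 1) := rfl
  rw [hD]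
  by_cases hbig : 2 ≤ rnk α ∨ 2 ≤ rnk β
  · have n1 : ¬ (rnk α = 0 ∧ rnk β = 0) := by omega
    have n2 : ¬ (rnk α = 1 ∧ rnk β = 1) := by omega
    have n3 : ¬ (rnk α = 1 ∧ rnk β = 0) := by omega
    have n4 : ¬ (rnk α = 0 ∧ rnk β = 1) := by omega
    simp only [← and_assoc, n1, n2, n3, n4, false_and, false_or, or_false]
    by_cases hne : rnk α = rnk β
    · obtain ⟨q, hq⟩ : ∃ q, q = rnk α := ⟨_, rfl⟩
      have hq2 : 2 ≤ q := by omega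
      rw [cg_same C hq2 hq.symm (hne ▸ hq.symm), ← hq, ← hne, ← hq]
      constructor
      · rintro (h | ⟨p, ⟨⟨⟨-, rfl⟩, -⟩, hH⟩, x, y, π, h1, h2, h3, h4 | h4⟩)
        · exact Or.inl (Or.inl h)
        · exact Or.inl (Or.inr ⟨hH, x, y, π, h1, h2, h3, h4⟩)
        · exact Or.inr ⟨q, ⟨⟨⟨⟨hq2, rfl⟩, rfl⟩, h4.1⟩, hH⟩, x, y, π, h1, h2, h3, h4.2⟩
      · rintro ((h | ⟨hH, x, y, π, h1, h2, h3, h4⟩) | ⟨p, ⟨⟨⟨⟨-, rfl⟩, -⟩, h5⟩, hH⟩, x, y, π, h1, h2, h3, h4⟩)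
        · exact Or.inl h
        · exact Or.inr ⟨q, ⟨⟨⟨hq2, rfl⟩, rfl⟩, hH⟩, x, y, π, h1, h2, h3, Or.inl h4⟩
        · exact Or.inr ⟨q, ⟨⟨⟨hq2, rfl⟩, rfl⟩, hH⟩, x, y, π, h1, h2, h3, Or.inr ⟨h5, h4⟩⟩
    · rw [C.cg_big hbig hne]
      constructor
      · rintro (h | ⟨p, ⟨⟨⟨-, h1⟩, h2⟩, -⟩, -⟩)
        · exact Or.inl h
        · omega
      · rintro (h | ⟨p, ⟨⟨⟨⟨-, h1⟩, h2⟩, -⟩, -⟩, -⟩)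
        · exact Or.inl h
        · omega
  · have k1 : ∀ X : ℕ → Prop, ¬ ∃ q, 2 ≤ q ∧ rnk α = q ∧ X q := by
      rintro X ⟨q, h1, h2, -⟩; omega
    simp only [k1, or_false]
    have ra : rnk α = 0 ∨ rnk α = 1 := by omega
    have rb : rnk β = 0 ∨ rnk β = 1 := by omega
    rcases ra with ra | ra <;> rcases rb with rb | rb
    · rw [C.cg00 ra rb]; simp [ra, rb]
    · rw [C.cg01 rb ra, C.cg10 rb ra]; simp [ra, rb, and_comm]
    · rw [C.cg10 ra rb]; simp [ra, rb]
    · rw [C.cg11 ra rb]; simp [ra, rb]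

theorem cg_cong (hn : 1 ≤ n) (h : IsCPair n Θ M) : IsCongruence (tmul (n := n)) (cg n Θ M) := by
  have C := CF_of h
  have : cg n Θ M = rel (dataOf Θ M fun _ _ _ => False) := by
    funext a b
    apply propext
    rw [C.rel_iff]
    simp
  rw [this]
  exact rel_cong (C.valid hn ⟨id, id, fun _ h => h, fun h => h.elim, fun h => h.elim⟩)

theorem cgx_eq {q m d : ℕ} (C : CF n Θ M) (hq : 2 ≤ q) :
    cgx n Θ M q m d = rel (dataOf Θ M fun p i j => p = q ∧ natCong m d i j ∧ ¬ Θ p i j) := by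
  funext a b
  apply propext
  rw [C.rel_iff, cgx]
  refine or_congr Iff.rfl ?_
  constructor
  · rintro ⟨h1, h2, h3, h4, h5⟩
    exact ⟨q, hq, h1, h2, ⟨rfl, h3, h4⟩, h5⟩
  · rintro ⟨p, -, h1, h2, ⟨rfl, h3, h4⟩, h5⟩
    exact ⟨h1, h2, h3, h4, h5⟩

theorem mod_two_d {i j d : ℕ} (h : i % d = j % d) (h2 : ¬ i % (2 * d) = j % (2 * d)) :
    (i + d) % (2 * d) = j % (2 * d) := by
  have key : ∀ i, i % (2 * d) = i % d ∨ i % (2 * d) = i % d + d := by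
    intro i
    have e : i % (2 * d) = i % d + d * (i / d % 2) := by rw [mul_comm, Nat.mod_mul]
    rcases Nat.mod_two_eq_zero_or_one (i / d) with h | h <;> rw [h] at e <;> simp at e <;> tauto
  rcases le_total i j with hij | hij
  · obtain ⟨k, hk⟩ := (Nat.modEq_iff_dvd' hij).1 h
    have hj : j = i + d * k := by omega
    rcases Nat.even_or_odd' k with ⟨c, rfl | rfl⟩
    · exfalso; apply h2
      rw [hj, show i + d * (2 * c) = i + (2 * d) * c by ring, Nat.add_mul_mod_self_left]
    · rw [hj, show i + d * (2 * c + 1) = i + d + (2 * d) * c by ring, Nat.add_mul_mod_self_left]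
  · obtain ⟨k, hk⟩ := (Nat.modEq_iff_dvd' hij).1 h.symm
    have hj : i = j + d * k := by omega
    rcases Nat.even_or_odd' k with ⟨c, rfl | rfl⟩
    · exfalso; apply h2
      rw [hj, show j + d * (2 * c) = j + (2 * d) * c by ring, Nat.add_mul_mod_self_left]
    · rw [hj, show j + d * (2 * c + 1) + d = j + (2 * d) * (c + 1) by ring, Nat.add_mul_mod_self_left]

theorem cgx_cong (hn : 1 ≤ n) (h : IsCPair n Θ M) {q m d} (hx : ExcAt n Θ M q m d) :
    IsCongruence (tmul (n := n)) (cgx n Θ M q m d) := by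
  have C := CF_of h
  obtain ⟨hq, hqn, hd, hΘ, hM⟩ := hx
  rw [cgx_eq C hq]
  apply rel_cong (C.valid hn _)
  have cq := C.cong q hqn
  have cd := natCong_cong m d
  have hle : ∀ i j, Θ q i j → natCong m d i j := by
    rw [hΘ]
    rintro i j (rfl | ⟨h1, h2, h3⟩)
    · exact Or.inl rfl
    · exact Or.inr ⟨h1, h2, by
        have := congrArg (· % d) h3
        simpa using this⟩
  have hform : ∀ {i j}, natCong m d i j → ¬ Θ q i j → m ≤ i ∧ m ≤ j ∧ i % d = j % d ∧ ¬ i % (2 * d) = j % (2 * d) := by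
    rintro i j (rfl | ⟨h1, h2, h3⟩) h4
    · exact absurd (nc_refl cq _) h4
    · refine ⟨h1, h2, h3, fun h5 => h4 ?_⟩
      rw [hΘ]
      exact Or.inr ⟨h1, h2, h5⟩
  have ment : ∀ i, m ≤ i → M q i = M q m := by
    intro i hi
    obtain ⟨k, rfl⟩ := Nat.exists_eq_add_of_le hi
    have R := C.rf q hq hqn
    have hper : ∀ c, M q (m + c * (2 * d)) = M q m := fun c => by
      refine (R.r1 _ _ ?_).symm
      rw [hΘ]
      exact Or.inr ⟨le_rfl, by omega, by simp⟩
    have up : ∀ (i k : ℕ) (N : Subgroup (Equiv.Perm (Fin q))), M q i = CEntry.nsym q N →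
        M q (i + k) = CEntry.R ∨ ∃ N', M q (i + k) = CEntry.nsym q N' ∧ N ≤ N' := by
      intro i k N hN
      induction k with
      | zero => exact Or.inr ⟨N, hN, le_rfl⟩
      | succ k ih =>
        rcases ih with e | ⟨N', e, hl⟩
        · exact Or.inl (R.r4 _ e)
        · rcases R.r3 _ _ e with e' | ⟨N'', e', hl'⟩
          · exact Or.inl e'
          · exact Or.inr ⟨N'', e', hl.trans hl'⟩
    have upR : ∀ (i k : ℕ), M q i = CEntry.R → M q (i + k) = CEntry.R := by
      intro i k hN
      induction k with
      | zero => exact hN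
      | succ k ih => exact R.r4 _ ih
    have hb : m + k + (k * (2 * d) - k) = m + k * (2 * d) := by
      have : k ≤ k * (2 * d) := by nlinarith
      omega
    rcases hM with ⟨-, hM⟩ | ⟨rfl, hM, -⟩
    · rcases up m k _ hM with e | ⟨N, e, hl⟩
      · have := upR _ (k * (2 * d) - k) e
        rw [hb, hper, hM] at this; simp at this
      · rcases up _ (k * (2 * d) - k) _ e with e' | ⟨N', e', hl'⟩
        · rw [hb, hper, hM] at e'; simp at e'
        · rw [hb, hper, hM] at e'
          simp only [CEntry.nsym.injEq, heq_eq_eq, true_and] at e'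
          subst e'
          rw [e, hM, le_antisymm hl hl']
    · rcases R.r2 (m + k) with e | e | ⟨N, e, -⟩
      · rw [e, hM]
      · have := upR _ (k * (2 * d) - k) e
        rw [hb, hper, hM] at this; simp at this
      · rcases up _ (k * (2 * d) - k) _ e with e' | ⟨N', e', hl'⟩
        · rw [hb, hper, hM] at e'; simp at e'
        · rw [hb, hper, hM] at e'; simp at e'
  refine ⟨?_, ?_, ?_, ?_, ?_⟩
  · rintro p i j ⟨rfl, h1, h2⟩
    exact ⟨rfl, nc_symm cd h1, fun h => h2 (nc_symm cq h)⟩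
  · rintro p i j ⟨rfl, h1, h2⟩
    refine ⟨rfl, nc_add cd 1 h1, fun h => ?_⟩
    obtain ⟨a1, a2, a3, a4⟩ := hform h1 h2
    rw [hΘ] at h
    rcases h with h | ⟨-, -, h⟩
    · have : i = j := by omega
      exact a4 (by rw [this])
    · exact a4 (mod_pred h)
  · rintro p i j k h1 ⟨rfl, h2, h3⟩
    exact ⟨rfl, nc_trans cd (hle _ _ h1) h2, fun h => h3 (nc_trans cq (nc_symm cq h1) h)⟩
  · rintro p i j k ⟨rfl, h1, h2⟩ ⟨-, h3, h4⟩
    obtain ⟨a1, a2, a3, a4⟩ := hform h1 h2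
    obtain ⟨b1, b2, b3, b4⟩ := hform h3 h4
    rw [hΘ]
    refine Or.inr ⟨a1, b2, ?_⟩
    have h5 := mod_two_d a3 a4
    have h6 := mod_two_d b3.symm (fun h => b4 h.symm)
    exact Nat.ModEq.add_right_cancel' d (h5.trans h6.symm)
  · rintro p i j ⟨rfl, h1, h2⟩
    obtain ⟨a1, a2, a3, a4⟩ := hform h1 h2
    rcases hM with ⟨h3, hM⟩ | ⟨rfl, hM, h4, h5⟩
    · exact Or.inl ⟨h3, by rw [ment i a1, hM]⟩
    · have hmid : mid (M 1 m) := by rcases h4 with h | h | h | h <;> simp [h, mid, big]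
      refine Or.inr ⟨rfl, by rw [ment i a1, hM], h5 _ _ h1, ?_⟩
      have C1 := D1of_valid (C.cong 0 (by omega)) (C.cong 1 hn) (C.chain 0 1 (by omega) hn) C.f
      have hu := C1.up_add (i := m) (i - m) (Or.inl hmid)
      have hv := C1.dn_add (i := m) (i - m) (Or.inl hmid)
      rw [show m + (i - m) = i by omega] at hu hv
      rcases hu with hu | hu
      · exact hu
      · rcases hv with hv | hv
        · exact hv
        · rw [hu] at hv; simp at hv

end


end Part15

section Part16

/-! ### From data to C-pairs: rows 0 and 1 -/

open Classical in
/-- Row 0 entry of data. -/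
noncomputable def M0of (D : D1) (i : ℕ) : CEntry :=
  if D.lam i then (if D.rho i then CEntry.R else CEntry.lam)
  else if D.rho i then CEntry.rho else if ∃ j, D.E j i then CEntry.mu else CEntry.delta

open Classical in
/-- Row 1 entry of data. -/
noncomputable def M1of (D : D1) (i : ℕ) : CEntry :=
  if D.E i i ∧ D.lam i then (if D.rho i then CEntry.R else CEntry.lam)
  else if D.E i i ∧ D.rho i then CEntry.rho
  else if D.up i then (if D.dn i then CEntry.mu else CEntry.muUp)
  else if D.dn i then CEntry.muDown else CEntry.delta

theorem t0_cong {D : D1} (h : D.Valid) : IsCongruence (· + ·) D.t0 := by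
  refine ⟨⟨h.t0_refl, h.t0_symm, h.t0_trans⟩, fun x y a hh => ⟨?_, h.t0_add a hh⟩⟩
  have := h.t0_add a hh
  rwa [add_comm x, add_comm y] at this

theorem t1_cong {D : D1} (h : D.Valid) : IsCongruence (· + ·) D.t1 := by
  refine ⟨⟨h.t1_refl, h.t1_symm, h.t1_trans⟩, fun x y a hh => ⟨?_, h.t1_add a hh⟩⟩
  have := h.t1_add a hh
  rwa [add_comm x, add_comm y] at this

theorem minLE_iff {θ : ℕ → ℕ → Prop} (h : IsCongruence (· + ·) θ) (i : ℕ) :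
    minLE θ i ↔ ∃ e, 1 ≤ e ∧ θ i (i + e) := by
  constructor
  · rintro ⟨a, b, hab, hne, hi⟩
    rcases lt_or_gt_of_ne hne with hl | hl
    · refine ⟨b - a, by omega, ?_⟩
      have := nc_add h (i - a) hab
      rwa [show a + (i - a) = i by omega, show b + (i - a) = i + (b - a) by omega] at this
    · refine ⟨a - b, by omega, ?_⟩
      have := nc_add h (i - b) (nc_symm h hab)
      rwa [show b + (i - b) = i by omega, show a + (i - b) = i + (a - b) by omega] at this
  · rintro ⟨e, he, hh⟩
    exact ⟨i, i + e, hh, by omega, le_rfl⟩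

theorem E_minLE {D : D1} (h : D.Valid) {i j} (hE : D.E i j) : minLE D.t1 i ↔ minLE D.t0 j := by
  rw [minLE_iff (t1_cong h), minLE_iff (t0_cong h)]
  constructor
  · rintro ⟨e, he, hh⟩
    exact ⟨e, he, h.E_inj0 (h.E_t1 hE hh) (h.E_add e hE)⟩
  · rintro ⟨e, he, hh⟩
    exact ⟨e, he, h.E_inj1 (h.E_t0 hE hh) (h.E_add e hE)⟩

theorem E_M {D : D1} (h : D.Valid) {i j} (hE : D.E i j) : M1of D i = M0of D j := by
  have hl := h.lam_E hE
  have hr := h.rho_E hE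
  have hu := h.E_up hE
  have hd := h.E_dn hE
  have hex : ∃ i, D.E i j := ⟨i, hE⟩
  unfold M1of M0of
  by_cases h1 : D.lam j <;> by_cases h2 : D.rho j <;> by_cases h3 : D.E i i <;> simp_all

theorem M0_lam (D : D1) (i) : (M0of D i = CEntry.lam ∨ M0of D i = CEntry.R) ↔ D.lam i := by
  unfold M0of; split_ifs <;> simp_all
theorem M0_rho (D : D1) (i) : (M0of D i = CEntry.rho ∨ M0of D i = CEntry.R) ↔ D.rho i := by
  unfold M0of; split_ifs <;> simp_all
theorem M0_mid (D : D1) (i) : mid (M0of D i) ↔ (D.lam i ∨ D.rho i ∨ ∃ j, D.E j i) := by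
  unfold M0of; split_ifs <;> simp_all [mid, big]
theorem M0_mu (D : D1) (i) : M0of D i = CEntry.mu ↔ (¬ D.lam i ∧ ¬ D.rho i ∧ ∃ j, D.E j i) := by
  unfold M0of; split_ifs <;> simp_all
theorem M0_delta (D : D1) (i) : M0of D i = CEntry.delta ↔ (¬ D.lam i ∧ ¬ D.rho i ∧ ¬ ∃ j, D.E j i) := by
  unfold M0of; split_ifs <;> simp_all
theorem M1_mu (D : D1) (i) : M1of D i = CEntry.mu → (D.up i ∧ D.dn i) := by
  unfold M1of; split_ifs <;> simp_all
theorem M1_big (D : D1) (i) : big (M1of D i) ↔ (D.E i i ∧ (D.lam i ∨ D.rho i)) := by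
  unfold M1of; split_ifs <;> simp_all [big]
theorem M1_delta {D : D1} (h : D.Valid) (i) (hu : ¬ D.up i) (hd : ¬ D.dn i) : M1of D i = CEntry.delta := by
  have : ¬ D.E i i := fun h' => hu (h.E_up h')
  unfold M1of; simp_all
theorem M1_zeta (D : D1) (i) (hu : ¬ big (M1of D i)) : isZeta (M1of D i) := by
  rw [M1_big] at hu
  unfold M1of; split_ifs <;> simp_all [isZeta]
theorem M1_E {D : D1} (h : D.Valid) {i} (hi : M1of D i ≠ CEntry.delta) : D.E (i + 1) i := by
  by_cases hu : D.up i
  · exact h.up_E hu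
  by_cases hd : D.dn i
  · exact h.dn_E hd
  exact absurd (M1_delta h i hu hd) hi
theorem M1_up {D : D1} (h : D.Valid) (i) : (mid (M1of D i) ∨ M1of D i = CEntry.muUp) ↔ D.up i := by
  have : D.E i i → D.up i := h.E_up
  unfold M1of; split_ifs <;> simp_all [mid, big]
theorem M1_dn {D : D1} (h : D.Valid) (i) : (mid (M1of D i) ∨ M1of D i = CEntry.muDown) ↔ D.dn i := by
  have : D.E i i → D.dn i := h.E_dn
  unfold M1of; split_ifs <;> simp_all [mid, big]

theorem D1of_eq {D : D1} (h : D.Valid) : D1of D.t0 D.t1 (M0of D) (M1of D) = D := by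
  have hE : ∀ i j, (D1of D.t0 D.t1 (M0of D) (M1of D)).E i j ↔ D.E i j := by
    intro i j
    constructor
    · rintro ⟨h1, h2, h3, h4⟩
      rcases h2 with h2 | h2
      · obtain ⟨hu, hd⟩ := M1_mu D i h2
        rw [h2] at h1
        obtain ⟨-, -, i', hE'⟩ := (M0_mu D j).1 h1.symm
        have e1 := h.up_E hu
        have e2 := h.up_E (h.E_up hE')
        have t : D.t0 i i' := h.t0_trans h3 (h.t0_symm (h.E_next hE'))
        have t' := h.E_inj1 (h.E_t0 e1 t) e2
        have := minLE_cancel (t1_cong h) t' (h4.trans (E_minLE h hE').symm)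
        exact h.E_t1 hE' (h.t1_symm this)
      · have hb := (M1_big D i).1 h2
        have : D.t0 j (j + 1) := by
          rw [h1] at h2
          rcases h2 with e | e | e
          · exact h.lam_next ((M0_lam D j).1 (Or.inl e))
          · exact h.rho_next ((M0_rho D j).1 (Or.inl e))
          · exact h.rho_next ((M0_rho D j).1 (Or.inr e))
        exact h.E_t0 hb.1 (h.t0_trans h3 (h.t0_symm this))
    · intro hE
      refine ⟨E_M h hE, ?_, h.E_next hE, E_minLE h hE⟩
      rw [E_M h hE, M0_mid]
      exact Or.inr (Or.inr ⟨i, hE⟩)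
  have e1 : (D1of D.t0 D.t1 (M0of D) (M1of D)).E = D.E := by
    funext i j; exact propext (hE i j)
  have e2 : (D1of D.t0 D.t1 (M0of D) (M1of D)).lam = D.lam := by
    funext i; exact propext (M0_lam D i)
  have e3 : (D1of D.t0 D.t1 (M0of D) (M1of D)).rho = D.rho := by
    funext i; exact propext (M0_rho D i)
  have e4 : (D1of D.t0 D.t1 (M0of D) (M1of D)).up = D.up := by
    funext i; exact propext (M1_up h i)
  have e5 : (D1of D.t0 D.t1 (M0of D) (M1of D)).dn = D.dn := by
    funext i; exact propext (M1_dn h i)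
  calc D1of D.t0 D.t1 (M0of D) (M1of D) = ⟨D.t0, D.t1, (D1of D.t0 D.t1 (M0of D) (M1of D)).E,
      (D1of D.t0 D.t1 (M0of D) (M1of D)).lam, (D1of D.t0 D.t1 (M0of D) (M1of D)).rho,
      (D1of D.t0 D.t1 (M0of D) (M1of D)).up, (D1of D.t0 D.t1 (M0of D) (M1of D)).dn⟩ := rfl
    _ = D := by rw [e1, e2, e3, e4, e5]

/-- Flags force period one. -/
theorem flag_per {D : D1} (h : D.Valid) {m d j} (e0 : D.t0 = natCong m d) (hf : D.lam j ∨ D.rho j) :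
    m ≤ j ∧ d = 1 := by
  have : D.t0 j (j + 1) := hf.elim h.lam_next h.rho_next
  rw [e0] at this
  rcases this with h1 | ⟨h1, -, h2⟩
  · omega
  · refine ⟨h1, ?_⟩
    have : d ∣ (j + 1) - j := (Nat.modEq_iff_dvd' (by omega)).1 h2
    simpa using this

theorem flag_const {D : D1} (h : D.Valid) {m j} (e0 : D.t0 = natCong m 1) (hj : m ≤ j) :
    (D.lam j ↔ D.lam m) ∧ (D.rho j ↔ D.rho m) := by
  have t : D.t0 m j := by rw [e0]; exact Or.inr ⟨le_rfl, hj, by simp [Nat.mod_one]⟩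
  exact ⟨⟨fun h' => h.lam_t0 h' (h.t0_symm t), fun h' => h.lam_t0 h' t⟩,
    ⟨fun h' => h.rho_t0 h' (h.t0_symm t), fun h' => h.rho_t0 h' t⟩⟩

theorem rows_empty {D : D1} (h : D.Valid) (hE : ∀ i j, ¬ D.E i j) :
    RT1 (M0of D) (M1of D) ∨ RT3 D.t0 (M0of D) (M1of D) := by
  have h1 : ∀ i, M1of D i = CEntry.delta := fun i =>
    M1_delta h i (fun h' => hE _ _ (h.up_E h')) (fun h' => hE _ _ (h.dn_E h'))
  by_cases hf : ∃ i, D.lam i ∨ D.rho i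
  · right
    obtain ⟨i, hi⟩ := hf
    have hne : D.t0 ≠ Eq := by
      intro e
      have : D.t0 i (i + 1) := hi.elim h.lam_next h.rho_next
      rw [e] at this; omega
    obtain ⟨m, d, hd, e0⟩ := (cong_class (t0_cong h)).resolve_left hne
    obtain ⟨hm, rfl⟩ := flag_per h e0 hi
    have hc := fun j (hj : m ≤ j) => flag_const h e0 hj
    rw [(hc i hm).1, (hc i hm).2] at hi
    refine ⟨m, M0of D m, e0, ?_, h1, fun j hj => ?_, fun j hj => ?_⟩
    · unfold M0of; split_ifs <;> simp_all
    · rw [M0_delta]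
      refine ⟨fun h' => ?_, fun h' => ?_, fun ⟨k, h'⟩ => hE _ _ h'⟩
      · have := (flag_per h e0 (Or.inl h')).1; omega
      · have := (flag_per h e0 (Or.inr h')).1; omega
    · have := hc j hj
      unfold M0of; split_ifs <;> simp_all
  · left
    refine ⟨fun i => ?_, h1⟩
    rw [M0_delta]
    exact ⟨fun h' => hf ⟨i, Or.inl h'⟩, fun h' => hf ⟨i, Or.inr h'⟩, fun ⟨k, h'⟩ => hE _ _ h'⟩

theorem rows_Eq {D : D1} (h : D.Valid) {i1 j1} (hE : D.E i1 j1) (e0 : D.t0 = Eq) :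
    RT2 D.t0 D.t1 (M0of D) (M1of D) := by
  have e1 : D.t1 = Eq := by
    funext i j
    refine propext ⟨fun h' => ?_, fun h' => h' ▸ h.t1_refl i⟩
    have := h.t1_t0 h'; rwa [e0] at this
  have hnl : ∀ i, ¬ D.lam i := fun i h' => by
    have := h.lam_next h'; rw [e0] at this; omega
  have hnr : ∀ i, ¬ D.rho i := fun i h' => by
    have := h.rho_next h'; rw [e0] at this; omega
  have hs : ∀ i j, D.E i j → i = j + 1 := fun i j h' => by
    have := h.E_next h'; rwa [e0] at this
  classical
  have hex : ∃ j, D.E (j + 1) j := ⟨j1, by have := hs _ _ hE; rwa [← this]⟩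
  have hmin : ∀ {k}, k < Nat.find hex → ¬ D.E (k + 1) k := Nat.find_min hex
  have hsp := Nat.find_spec hex
  set i0 := Nat.find hex
  have hup : ∀ j, i0 ≤ j → D.E (j + 1) j := by
    intro j hj
    have := h.E_add (j - i0) hsp
    rwa [show i0 + 1 + (j - i0) = j + 1 by omega, show i0 + (j - i0) = j by omega] at this
  have hmu : ∀ j, i0 ≤ j → M0of D j = CEntry.mu := fun j hj => (M0_mu D j).2 ⟨hnl j, hnr j, _, hup j hj⟩
  refine ⟨e0, e1, i0, M1of D i0, M1_zeta D i0 ?_, fun j hj => ?_, hmu, fun j hj => ?_, rfl, fun j hj => ?_⟩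
  · rw [M1_big]; rintro ⟨-, h' | h'⟩
    · exact hnl _ h'
    · exact hnr _ h'
  · rw [M0_delta]
    refine ⟨hnl j, hnr j, ?_⟩
    rintro ⟨k, hk⟩
    have := hs _ _ hk; subst this
    exact hmin hj hk
  · by_contra hne
    exact hmin hj (M1_E h hne)
  · have := E_M h (hup (j - 1) (by omega))
    rw [show j - 1 + 1 = j by omega] at this
    rw [this]; exact hmu _ (by omega)

theorem rows_nat {D : D1} (h : D.Valid) {i1 j1 m d} (hE : D.E i1 j1) (hd : 1 ≤ d) (e0 : D.t0 = natCong m d) :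
    RT4 D.t0 D.t1 (M0of D) (M1of D) ∨ RT5 D.t0 D.t1 (M0of D) (M1of D) ∨
    RT6 D.t0 D.t1 (M0of D) (M1of D) ∨ RT7 D.t0 D.t1 (M0of D) (M1of D) := by
  have key : ∀ i j, D.E i j → m ≤ j → D.t1 i (i + d) := by
    intro i j hij hj
    have t : D.t0 j (j + d) := by rw [e0]; exact Or.inr ⟨hj, by omega, by simp⟩
    exact h.E_inj1 (h.E_t0 hij t) (h.E_add d hij)
  have k0 := key _ _ (h.E_add m hE) (by omega)
  have hne : D.t1 ≠ Eq := by
    intro e; rw [e] at k0; omega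
  obtain ⟨l, d', hd', e1⟩ := (cong_class (t1_cong h)).resolve_left hne
  have hdd : d = d' := by
    symm
    apply Nat.dvd_antisymm
    · rw [e1] at k0
      rcases k0 with k0 | ⟨-, -, k0⟩
      · omega
      · have := (Nat.modEq_iff_dvd' (by omega)).1 k0
        simpa using this
    · have : D.t1 l (l + d') := by rw [e1]; exact Or.inr ⟨le_rfl, by omega, by simp⟩
      have := h.t1_t0 this
      rw [e0] at this
      rcases this with k0 | ⟨-, -, k0⟩
      · omega
      · have := (Nat.modEq_iff_dvd' (by omega)).1 k0
        simpa using this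
  subst hdd
  have hlm : m ≤ l := by
    have : D.t1 l (l + d) := by rw [e1]; exact Or.inr ⟨le_rfl, by omega, by simp⟩
    have := h.t1_t0 this
    rw [e0] at this
    rcases this with k0 | ⟨k0, -, -⟩ <;> omega
  have K1 : ∀ i j, D.E i j → (l ≤ i ↔ m ≤ j) := by
    intro i j hij
    have := E_minLE h hij
    rwa [e0, e1, minLE_nat hd, minLE_nat hd] at this
  have hmod : ∀ j K, (j + d * K) % d = j % d := fun j K => Nat.add_mul_mod_self_left j d K
  have K2 : ∀ i j, l ≤ i → m ≤ j → i % d = (j + 1) % d → D.E i j := by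
    intro i j hi hj hij
    have hK : l + m + j1 ≤ d * (l + m + j1) := Nat.le_mul_of_pos_left _ hd
    have q := h.E_add (j + d * (l + m + j1) - j1) hE
    rw [show j1 + (j + d * (l + m + j1) - j1) = j + d * (l + m + j1) by omega] at q
    generalize hi2 : i1 + (j + d * (l + m + j1) - j1) = i2 at q
    have q1 : D.E i2 j := h.E_t0 q (by rw [e0]; exact Or.inr ⟨by omega, hj, hmod _ _⟩)
    refine h.E_t1 q1 ?_
    rw [e1]
    refine Or.inr ⟨(K1 _ _ q1).2 hj, hi, ?_⟩
    have q2 := h.E_next q1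
    rw [e0] at q2
    rw [hij]
    rcases q2 with q2 | ⟨-, -, q2⟩
    · rw [q2]
    · exact q2
  have hex0 : ∀ j, m ≤ j → ∃ i, D.E i j := by
    intro j hj
    have hK : l ≤ d * l := Nat.le_mul_of_pos_left _ hd
    exact ⟨j + 1 + d * l, K2 _ _ (by omega) hj (hmod _ _)⟩
  have M0c : ∀ j, m ≤ j → M0of D j = M0of D m := by
    intro j hj
    have a1 := hex0 j hj
    have a2 := hex0 m le_rfl
    by_cases hd1 : d = 1
    · subst hd1
      have := flag_const h e0 hj
      unfold M0of; rw [this.1, this.2]; simp only [a1, a2]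
    · have hn : ∀ k, ¬ D.lam k ∧ ¬ D.rho k := fun k =>
        ⟨fun h' => hd1 (flag_per h e0 (Or.inl h')).2, fun h' => hd1 (flag_per h e0 (Or.inr h')).2⟩
      rw [(M0_mu D j).2 ⟨(hn j).1, (hn j).2, a1⟩, (M0_mu D m).2 ⟨(hn m).1, (hn m).2, a2⟩]
  have M1c : ∀ i, l ≤ i → M1of D i = M0of D m := by
    intro i hi
    have hK : m + 1 ≤ d * (m + 1) := Nat.le_mul_of_pos_left _ hd
    have := K2 i (i + d * (m + 1) - 1) hi (by omega) (by
      rw [show i + d * (m + 1) - 1 + 1 = i + d * (m + 1) by omega, hmod])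
    rw [E_M h this]
    exact M0c _ (by omega)
  have hxi : xiOK d (M0of D m) := by
    have a2 := hex0 m le_rfl
    by_cases hf : D.lam m ∨ D.rho m
    · refine Or.inr ⟨(flag_per h e0 hf).2, ?_⟩
      unfold M0of; split_ifs <;> simp_all
    · push Not at hf
      exact Or.inl ((M0_mu D m).2 ⟨hf.1, hf.2, a2⟩)
  have nf : ∀ j, j < m → ¬ D.lam j ∧ ¬ D.rho j := by
    intro j hj
    refine ⟨fun h' => ?_, fun h' => ?_⟩
    · have := (flag_per h e0 (Or.inl h')).1; omega
    · have := (flag_per h e0 (Or.inr h')).1; omega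
  have M1z : ∀ i, i < l → isZeta (M1of D i) := by
    intro i hi
    refine M1_zeta D i fun hb => ?_
    obtain ⟨q1, q2⟩ := (M1_big D i).1 hb
    have : D.t1 i (i + 1) := q2.elim (fun q => h.lam1_run 1 q1 q) (fun q => h.rho1_run 1 q1 q)
    rw [e1] at this
    rcases this with q | ⟨q, -⟩ <;> omega
  have M0d : ∀ j, j < m → (∀ i, i < l → ¬ D.E i j) → M0of D j = CEntry.delta := by
    intro j hj hh
    refine (M0_delta D j).2 ⟨(nf j hj).1, (nf j hj).2, ?_⟩
    rintro ⟨i, hi⟩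
    refine hh i ?_ hi
    have := K1 _ _ hi
    omega
  have M0m : ∀ i j, j < m → D.E i j → M0of D j = CEntry.mu := by
    intro i j hj hh
    exact (M0_mu D j).2 ⟨(nf j hj).1, (nf j hj).2, i, hh⟩
  have M1n : ∀ i, M1of D i ≠ CEntry.delta → i < l → D.E (i + 1) i ∧ ((i + 1 = l ∧ m ≤ i) ∨ (i + 1 < l ∧ i < m)) := by
    intro i hi hil
    have q := M1_E h hi
    have := K1 _ _ q
    exact ⟨q, by omega⟩
  by_cases hs : ∃ i j, i < l ∧ D.E i j
  · obtain ⟨i2, j2, hi2, hE2⟩ := hs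
    have hdiff : ∀ i j, i < l → D.E i j → l + j = m + i ∧ j < m := by
      intro i j hi hij
      have := K1 _ _ hij
      have q1 := K1 _ _ (h.E_add (l - i) hij)
      have q2 := K1 _ _ (h.E_add (m - j) hij)
      omega
    obtain ⟨f1, f2⟩ := hdiff _ _ hi2 hE2
    have hnx : ∀ i j, D.E i j → i = j + 1 ∨ (m ≤ i ∧ m ≤ j + 1 ∧ i % d = (j + 1) % d) := by
      intro i j hij
      have := h.E_next hij
      rwa [e0] at this
    have hlm1 : m < l := by
      have := hnx _ _ hE2
      omega
    by_cases hl1 : l = m + 1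
    · right; left
      subst hl1
      have hs : ∀ i j, i < m + 1 → D.E i j → i = j + 1 := fun i j hi hij => by
        have := hdiff _ _ hi hij; omega
      classical
      have hex : ∃ j, D.E (j + 1) j := ⟨j2, by have := hs _ _ hi2 hE2; rwa [← this]⟩
      have hmin : ∀ {k}, k < Nat.find hex → ¬ D.E (k + 1) k := Nat.find_min hex
      have hsp := Nat.find_spec hex
      have hle : Nat.find hex ≤ j2 := Nat.find_le (by have := hs _ _ hi2 hE2; rwa [← this])
      set i0 := Nat.find hex
      have hup : ∀ j, i0 ≤ j → D.E (j + 1) j := by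
        intro j hj
        have := h.E_add (j - i0) hsp
        rwa [show i0 + 1 + (j - i0) = j + 1 by omega, show i0 + (j - i0) = j by omega] at this
      refine ⟨m, d, i0, M0of D m, M1of D i0, hd, by omega, e0, e1, hxi, M1z _ (by omega), fun j hj => ?_,
        fun j hj hj' => M0m _ _ hj' (hup j hj), M0c, fun j hj => ?_, rfl, fun j hj hj' => ?_, fun j hj => M1c j hj⟩
      · refine M0d j (by omega) fun i hi hij => ?_
        have := hs _ _ hi hij
        subst this
        exact hmin hj hij
      · by_contra hne
        exact hmin hj (M1_E h hne)
      · have := E_M h (hup (j - 1) (by omega))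
        rw [show j - 1 + 1 = j by omega] at this
        rw [this]; exact M0m _ _ (by omega) (hup (j - 1) (by omega))
    · right; right; right
      have hs : ∀ i j, i < l → D.E i j → i + 1 = l ∧ j + 1 = m := by
        intro i j hi hij
        have a1 := hdiff _ _ hi hij
        have a2 := hnx _ _ hij
        omega
      obtain ⟨g1, g2⟩ := hs _ _ hi2 hE2
      obtain rfl : i2 = l - 1 := by omega
      obtain rfl : j2 = m - 1 := by omega
      have hmu : M0of D (m - 1) = CEntry.mu := M0m _ _ (by omega) hE2
      refine ⟨m, l, d, M0of D m, hd, by omega, by omega, ?_, e0, e1, hxi, fun j hj => ?_, hmu, M0c,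
        fun j hj => ?_, by rw [E_M h hE2, hmu], M1c⟩
      · have := hnx _ _ hE2
        rw [g2] at this
        rcases this with q | q
        · rw [q]
        · exact q.2.2
      · refine M0d j (by omega) fun i hi hij => ?_
        have := hs _ _ hi hij
        omega
      · by_contra hne
        obtain ⟨q1, q2⟩ := M1n j hne (by omega)
        have := hs (j + 1) j (by omega) q1
        omega
  · push Not at hs
    have A0 : ∀ j, j < m → M0of D j = CEntry.delta := fun j hj => M0d j hj fun i hi => hs i j hi
    have A1 : ∀ j, j < l → M1of D j ≠ CEntry.delta → j + 1 = l ∧ m ≤ j := by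
      intro j hj hne
      obtain ⟨q1, q2⟩ := M1n j hne hj
      rcases q2 with q2 | q2
      · exact q2
      · exact absurd q1 (hs _ _ q2.1)
    rcases Nat.eq_or_lt_of_le hlm with rfl | hlt
    · left
      refine ⟨m, d, M0of D m, hd, e0, e1, hxi, fun j hj => ⟨A0 j hj, ?_⟩, fun j hj => ⟨M0c j hj, M1c j hj⟩⟩
      by_contra hne
      have := A1 j hj hne
      omega
    · right; right; left
      refine ⟨m, l, d, M0of D m, M1of D (l - 1), hd, hlt, e0, e1, hxi, M1z _ (by omega), A0, M0c,
        fun j hj => ?_, rfl, M1c⟩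
      by_contra hne
      have := A1 j (by omega) hne
      omega

theorem rows01 {D : D1} (h : D.Valid) :
    RT1 (M0of D) (M1of D) ∨ RT2 D.t0 D.t1 (M0of D) (M1of D) ∨ RT3 D.t0 (M0of D) (M1of D) ∨
    RT4 D.t0 D.t1 (M0of D) (M1of D) ∨ RT5 D.t0 D.t1 (M0of D) (M1of D) ∨
    RT6 D.t0 D.t1 (M0of D) (M1of D) ∨ RT7 D.t0 D.t1 (M0of D) (M1of D) := by
  by_cases hE : ∃ i j, D.E i j
  · obtain ⟨i, j, hE⟩ := hE
    rcases cong_class (t0_cong h) with e | ⟨m, d, hd, e⟩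
    · have := rows_Eq h hE e; tauto
    · have := rows_nat h hE hd e; tauto
  · push Not at hE
    have := rows_empty h hE; tauto


end Part16

section Part17

/-! ### A lemma on normal subgroups of symmetric groups -/

open Equiv in
theorem three_in {q : ℕ} (hq : 3 ≤ q) {N : Subgroup (Perm (Fin q))} (hN : N.Normal) {π : Perm (Fin q)}
    (hπ : π ∉ N) (hc : ∀ τ : Perm (Fin q), τ⁻¹ * π * τ * π⁻¹ ∈ N) : ∃ c ∈ N, c.IsThreeCycle := by
  have hs : ∀ x y, swap x y * swap (π x) (π y) ∈ N := by
    intro x y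
    have := hc (swap x y)
    rwa [swap_inv, mul_assoc, mul_assoc, ← mul_assoc π, ← Equiv.swap_apply_apply] at this
  have h1 : π ≠ 1 := fun h => hπ (h ▸ N.one_mem)
  obtain ⟨a, ha⟩ : ∃ a, π a ≠ a := by
    by_contra hcon
    push Not at hcon
    exact h1 (Equiv.ext hcon)
  by_cases hinv : ∃ a, π (π a) ≠ a
  · obtain ⟨a, ha⟩ := hinv
    have hab : π a ≠ a := fun h => ha (by rw [h, h])
    refine ⟨_, hs a (π a), ?_⟩
    rw [swap_comm a (π a)]
    exact Perm.isThreeCycle_swap_mul_swap_same hab (fun h => hab (π.injective h).symm) (Ne.symm ha)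
  push Not at hinv
  by_cases hfix : ∃ c, π c = c
  · obtain ⟨c, hcc⟩ := hfix
    have hac : a ≠ c := fun h => ha (by rw [h]; exact hcc)
    have hbc : π a ≠ c := fun h => by rw [← hcc] at h; exact hac (π.injective h)
    refine ⟨_, hs a c, ?_⟩
    rw [hcc, swap_comm a c, swap_comm (π a) c]
    exact Perm.isThreeCycle_swap_mul_swap_same hac.symm hbc.symm ha.symm
  push Not at hfix
  obtain ⟨c, hca⟩ : ∃ c, c ∉ ({a, π a} : Finset (Fin q)) := by
    by_contra hcon
    push Not at hcon
    have := Finset.card_le_card (fun x _ => hcon x : Finset.univ ⊆ ({a, π a} : Finset (Fin q)))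
    have h2 := Finset.card_le_two (a := a) (b := π a)
    simp at this
    omega
  simp only [Finset.mem_insert, Finset.mem_singleton, not_or] at hca
  obtain ⟨hca, hcb⟩ := hca
  have hda : π c ≠ a := fun h => hcb (by rw [← h, hinv])
  have hdb : π c ≠ π a := fun h => hca (π.injective h)
  have hdc := hfix c
  have hk := hs a c
  by_cases hex : ∃ e, e ≠ a ∧ e ≠ π a ∧ e ≠ c ∧ e ≠ π c
  · obtain ⟨e, h1, h2, h3, h4⟩ := hex
    have hk2 := hN.conj_mem _ hk (swap (π c) e)
    have e1 : swap (π c) e * (swap a c * swap (π a) (π c)) * (swap (π c) e)⁻¹ = swap a c * swap (π a) e := by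
      have f1 : swap (π c) e * swap a c * (swap (π c) e)⁻¹ = swap a c := by
        rw [← swap_apply_apply, swap_apply_of_ne_of_ne hda.symm h1.symm, swap_apply_of_ne_of_ne hdc.symm h3.symm]
      have f2 : swap (π c) e * swap (π a) (π c) * (swap (π c) e)⁻¹ = swap (π a) e := by
        rw [← swap_apply_apply, swap_apply_left, swap_apply_of_ne_of_ne hdb.symm h2.symm]
      exact (conj_mul).symm.trans (congrArg₂ (· * ·) f1 f2)
    rw [e1] at hk2
    refine ⟨_, N.mul_mem (N.inv_mem hk) hk2, ?_⟩
    have : (swap a c * swap (π a) (π c))⁻¹ * (swap a c * swap (π a) e) = swap (π a) (π c) * swap (π a) e := by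
      simp [mul_assoc]
    rw [this]
    exact Perm.isThreeCycle_swap_mul_swap_same hdb.symm h2.symm h4.symm
  · push Not at hex
    exfalso
    apply hπ
    have hk2 := hN.conj_mem _ hk (swap (π a) c)
    have f1 : swap (π a) c * (swap a c * swap (π a) (π c)) * (swap (π a) c)⁻¹ = swap a (π a) * swap c (π c) := by
      have f1 : swap (π a) c * swap a c * (swap (π a) c)⁻¹ = swap a (π a) := by
        rw [← swap_apply_apply, swap_apply_of_ne_of_ne ha.symm (Ne.symm hca), swap_apply_right]
      have f2 : swap (π a) c * swap (π a) (π c) * (swap (π a) c)⁻¹ = swap c (π c) := by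
        rw [← swap_apply_apply, swap_apply_left, swap_apply_of_ne_of_ne hdb hdc]
      exact (conj_mul).symm.trans (congrArg₂ (· * ·) f1 f2)
    rw [f1] at hk2
    have : swap a (π a) * swap c (π c) = π := by
      ext1 x
      rw [Perm.mul_apply]
      by_cases g1 : x = a
      · subst g1; rw [swap_apply_of_ne_of_ne (Ne.symm hca) hda.symm, swap_apply_left]
      by_cases g2 : x = π a
      · subst g2; rw [swap_apply_of_ne_of_ne (Ne.symm hcb) hdb.symm, swap_apply_right, hinv]
      by_cases g3 : x = c
      · subst g3; rw [swap_apply_left, swap_apply_of_ne_of_ne hda hdb]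
      have g4 := hex x g1 g2 g3
      subst g4; rw [swap_apply_right, hinv, swap_apply_of_ne_of_ne hca hcb]
    rwa [this] at hk2

theorem alt_of_three {q : ℕ} {N : Subgroup (Equiv.Perm (Fin q))} (hN : N.Normal) {c : Equiv.Perm (Fin q)}
    (hc : c ∈ N) (h3 : c.IsThreeCycle) : alternatingGroup (Fin q) ≤ N := by
  rw [← Equiv.Perm.closure_three_cycles_eq_alternating, Subgroup.closure_le]
  intro g hg
  have : IsConj c g := Equiv.Perm.isConj_iff_cycleType_eq.2 (h3.trans (Eq.symm hg))
  obtain ⟨t, ht⟩ := isConj_iff.1 this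
  rw [← ht]
  exact hN.conj_mem _ hc t

theorem alt_of_le {q : ℕ} {N : Subgroup (Equiv.Perm (Fin q))} (h : alternatingGroup (Fin q) ≤ N)
    {π : Equiv.Perm (Fin q)} (hπ : π ∉ N) : N = alternatingGroup (Fin q) := by
  refine le_antisymm (fun x hx => ?_) h
  by_contra hxn
  have h1 : π ∉ alternatingGroup (Fin q) := fun h' => hπ (h h')
  have h2 := h (alt_mul hxn h1)
  exact hπ ((Subgroup.mul_mem_cancel_left N hx).1 h2)

theorem two_bot {N : Subgroup (Equiv.Perm (Fin 2))} {π : Equiv.Perm (Fin 2)} (hπ : π ∉ N) : N = ⊥ := by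
  rw [Subgroup.eq_bot_iff_forall]
  intro x hx
  have : ∀ x π : Equiv.Perm (Fin 2), x = 1 ∨ π = 1 ∨ x = π := by decide
  rcases this x π with h | h | h
  · exact h
  · exact absurd (h ▸ N.one_mem) hπ
  · exact absurd (h ▸ hx) hπ

theorem group_lemma {q : ℕ} (hq : 2 ≤ q) {N : Subgroup (Equiv.Perm (Fin q))} (hN : N.Normal)
    {π : Equiv.Perm (Fin q)} (hπ : π ∉ N) (hc : ∀ τ : Equiv.Perm (Fin q), τ⁻¹ * π * τ * π⁻¹ ∈ N) :
    N = alternatingGroup (Fin q) := by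
  rcases Nat.eq_or_lt_of_le hq with rfl | hq
  · rw [alt_two]; exact two_bot hπ
  · obtain ⟨c, h1, h2⟩ := three_in hq hN hπ hc
    exact alt_of_le (alt_of_three hN h1 h2) hπ


end Part17

section Part18

/-! ### From data to C-pairs: rows at least 2 -/

/-- The normal subgroup at position `(q,i)`. -/
def Nsub (D : Dat) (q i : ℕ) : Subgroup (Equiv.Perm (Fin q)) := Subgroup.closure {π | D.NN q i i π}

/-- The index congruences of data. -/
def Tof (D : Dat) (q i j : ℕ) : Prop :=
  (q = 0 ∧ D.t0 i j) ∨ (q = 1 ∧ D.t1 i j) ∨ (2 ≤ q ∧ (D.NN q i j 1 ∨ (D.Re q i ∧ D.Re q j)))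

open Classical in
/-- The matrix of data. -/
noncomputable def Mof (D : Dat) (q i : ℕ) : CEntry :=
  if q = 0 then M0of D.toD1 i else if q = 1 then M1of D.toD1 i
  else if D.Re q i then CEntry.R else if Nsub D q i = ⊥ then CEntry.delta else CEntry.nsym q (Nsub D q i)

theorem Tof0 (D : Dat) : Tof D 0 = D.t0 := by funext i j; simp [Tof]
theorem Tof1 (D : Dat) : Tof D 1 = D.t1 := by funext i j; simp [Tof]
theorem Tof2 (D : Dat) {q} (hq : 2 ≤ q) (i j) : Tof D q i j ↔ (D.NN q i j 1 ∨ (D.Re q i ∧ D.Re q j)) := by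
  have h0 : q ≠ 0 := by omega
  have h1 : q ≠ 1 := by omega
  simp [Tof, h0, h1, hq]
theorem Mof0 (D : Dat) : Mof D 0 = M0of D.toD1 := by funext i; simp [Mof]
theorem Mof1 (D : Dat) : Mof D 1 = M1of D.toD1 := by funext i; simp [Mof]
open Classical in
theorem Mof2 (D : Dat) {q} (hq : 2 ≤ q) (i) : Mof D q i = if D.Re q i then CEntry.R else
    if Nsub D q i = ⊥ then CEntry.delta else CEntry.nsym q (Nsub D q i) := by
  have h0 : q ≠ 0 := by omega
  have h1 : q ≠ 1 := by omega
  simp [Mof, h0, h1]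

variable {D : Dat}

theorem mem_Nsub (h : D.Valid n) {q i} (hq : 2 ≤ q) (hq' : q ≤ n) {π} : π ∈ Nsub D q i ↔ D.NN q i i π := by
  refine ⟨fun hx => ?_, fun hx => Subgroup.subset_closure hx⟩
  refine Subgroup.closure_induction (p := fun π _ => D.NN q i i π) (fun x hx => hx) (h.nn_one i hq hq') ?_ ?_ hx
  · intro x y _ _ hx hy; exact h.nn_mul hq hq' hx hy
  · intro x _ hx; exact h.nn_inv hq hq' hx

theorem Nsub_normal (h : D.Valid n) {q i} (hq : 2 ≤ q) (hq' : q ≤ n) : (Nsub D q i).Normal := by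
  refine ⟨fun x hx g => ?_⟩
  rw [mem_Nsub h hq hq'] at hx ⊢
  have := h.nn_conj g⁻¹ hq hq' hx
  rwa [inv_inv] at this

theorem Nsub_mono (h : D.Valid n) {q i j} (hq : 2 ≤ q) (hq' : q ≤ n) (hij : i ≤ j) : Nsub D q i ≤ Nsub D q j := by
  intro x hx
  rw [mem_Nsub h hq hq'] at hx ⊢
  have := h.nn_add (j - i) hq hq' hx
  rwa [show i + (j - i) = j by omega] at this

theorem Nsub_le (h : D.Valid n) {q i j π} (hq : 2 ≤ q) (hq' : q ≤ n) (hN : D.NN q i j π) :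
    Nsub D q j ≤ Nsub D q i := by
  intro x hx
  rw [mem_Nsub h hq hq'] at hx ⊢
  have h1 := h.nn_mul hq hq' (h.nn_mul hq hq' hN hx) (h.nn_inv hq hq' hN)
  have h2 := h.nn_conj π hq hq' h1
  have e : π⁻¹ * (π * x * π⁻¹) * π = x := by group
  rwa [e] at h2

theorem Re_add (h : D.Valid n) {q i} (k) (hq : 2 ≤ q) (hq' : q ≤ n) (hR : D.Re q i) : D.Re q (i + k) := by
  induction k with
  | zero => exact hR
  | succ k ih => exact h.re_shift hq hq' ih

theorem Re_le (h : D.Valid n) {q i j} (hq : 2 ≤ q) (hq' : q ≤ n) (hR : D.Re q i) (hij : i ≤ j) : D.Re q j := by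
  have := Re_add h (j - i) hq hq' hR
  rwa [show i + (j - i) = j by omega] at this

theorem Tof_cong (h : D.Valid n) {q} (hq' : q ≤ n) : IsCongruence (· + ·) (Tof D q) := by
  rcases Nat.lt_or_ge q 2 with hq | hq
  · have : q = 0 ∨ q = 1 := by omega
    rcases this with rfl | rfl
    · rw [Tof0]; exact t0_cong h.toValid
    · rw [Tof1]; exact t1_cong h.toValid
  · have ad : ∀ x y a, Tof D q x y → Tof D q (x + a) (y + a) := by
      intro x y a hh
      rw [Tof2 D hq] at hh ⊢
      rcases hh with hh | hh
      · exact Or.inl (h.nn_add a hq hq' hh)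
      · exact Or.inr ⟨Re_add h a hq hq' hh.1, Re_add h a hq hq' hh.2⟩
    refine ⟨⟨fun x => ?_, fun {x y} hh => ?_, fun {x y z} h1 h2 => ?_⟩, fun x y a hh => ⟨?_, ad x y a hh⟩⟩
    · rw [Tof2 D hq]; exact Or.inl (h.nn_one x hq hq')
    · rw [Tof2 D hq] at hh ⊢
      rcases hh with hh | hh
      · have := h.nn_inv hq hq' hh
        rw [inv_one] at this; exact Or.inl this
      · exact Or.inr hh.symm
    · rw [Tof2 D hq] at h1 h2 ⊢
      rcases h1 with h1 | h1 <;> rcases h2 with h2 | h2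
      · have := h.nn_mul hq hq' h1 h2
        rw [one_mul] at this; exact Or.inl this
      · exact Or.inr ⟨h.re_nn hq hq' (h.nn_inv hq hq' h1) h2.1, h2.2⟩
      · exact Or.inr ⟨h1.1, h.re_nn hq hq' h2 h1.2⟩
      · exact Or.inr ⟨h1.1, h2.2⟩
    · have := ad x y a hh
      rwa [add_comm x, add_comm y] at this

theorem Tof_down1 (h : D.Valid n) {q i j} (hq : q + 1 ≤ n) (hT : Tof D (q + 1) i j) : Tof D q i j := by
  match q with
  | 0 => rw [Tof0]; rw [Tof1] at hT; exact h.t1_t0 hT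
  | 1 =>
    rw [Tof1]; rw [Tof2 D (by omega)] at hT
    rcases hT with hT | ⟨h1, h2⟩
    · exact h.t_down (q := 2) (by omega) hq hT
    · have r1 := h.re_down (q := 2) (by omega) hq h1
      have r2 := h.re_down (q := 2) (by omega) hq h2
      rcases le_total i j with hij | hij
      · have := h.toValid.lam1_run (j - i) r1.1 r1.2.1
        rwa [show i + (j - i) = j by omega] at this
      · have := h.toValid.lam1_run (i - j) r2.1 r2.2.1
        rw [show j + (i - j) = i by omega] at this
        exact h.t1_symm this
  | q + 2 =>
    rw [Tof2 D (by omega)] at hT ⊢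
    rcases hT with hT | ⟨h1, h2⟩
    · exact Or.inl (h.t_down (q := q + 3) (by omega) hq hT)
    · exact Or.inr ⟨h.re_down (q := q + 3) (by omega) hq h1, h.re_down (q := q + 3) (by omega) hq h2⟩

theorem Tof_down (h : D.Valid n) {q r i j} (hqr : q ≤ r) (hr : r ≤ n) (hT : Tof D r i j) : Tof D q i j := by
  induction r with
  | zero => obtain rfl : q = 0 := by omega
            exact hT
  | succ r ih =>
    rcases Nat.eq_or_lt_of_le hqr with rfl | h'
    · exact hT
    · exact ih (by omega) (by omega) (Tof_down1 h hr hT)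

theorem nat_sub {θ : ℕ → ℕ → Prop} (h : IsCongruence (· + ·) θ) {m e} (hh : θ m (m + e)) {i j}
    (hij : natCong m e i j) : θ i j := by
  have key : ∀ i j, i ≤ j → natCong m e i j → θ i j := by
    intro i j hl hij
    rcases hij with rfl | ⟨h1, h2, h3⟩
    · exact nc_refl h i
    · obtain ⟨k, hk⟩ := (Nat.modEq_iff_dvd' hl).1 h3
      have := nc_mul h (nc_add h (i - m) hh |> fun x => by
        rwa [show m + (i - m) = i by omega, show m + e + (i - m) = i + e by omega] at x) k
      rwa [mul_comm, ← hk, show i + (j - i) = j by omega] at this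
  rcases le_total i j with hl | hl
  · exact key i j hl hij
  · exact nc_symm h (key j i hl (nc_symm (natCong_cong m e) hij))

theorem rows2 (h : D.Valid n) {q} (hq : 2 ≤ q) (hq' : q ≤ n) :
    RT8 (Mof D q) ∨ RT9 q (Tof D q) (Mof D q) ∨ RT10 q (Tof D q) (Mof D q) := by
  classical
  have hM := Mof2 D hq
  have cg := Tof_cong h hq'
  by_cases hR : ∃ i, D.Re q i
  · right; right
    have hsp := Nat.find_spec hR
    have hmin : ∀ {k}, k < Nat.find hR → ¬ D.Re q k := Nat.find_min hR
    set m := Nat.find hR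
    have t1 : Tof D q m (m + 1) := (Tof2 D hq _ _).2 (Or.inr ⟨hsp, Re_add h 1 hq hq' hsp⟩)
    have e0 : Tof D q = natCong m 1 := by
      rcases cong_class cg with e | ⟨m', d, hd, e⟩
      · rw [e] at t1; omega
      · rw [e] at t1
        rcases t1 with t1 | ⟨t1, -, t2⟩
        · omega
        · have hd1 : d ∣ (m + 1) - m := (Nat.modEq_iff_dvd' (by omega)).1 t2
          have hd1 : d = 1 := by simpa using hd1
          subst hd1
          rw [e]
          rcases Nat.eq_or_lt_of_le t1 with rfl | hlt
          · rfl
          · exfalso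
            have : Tof D q m' m := by rw [e]; exact Or.inr ⟨le_rfl, t1, by simp [Nat.mod_one]⟩
            rw [Tof2 D hq] at this
            rcases this with this | this
            · exact hmin hlt (h.re_nn hq hq' (h.nn_inv hq hq' this) hsp)
            · exact hmin hlt this.1
    have hex : ∃ j, m ≤ j ∨ Nsub D q j ≠ ⊥ := ⟨m, Or.inl le_rfl⟩
    have hsp2 := Nat.find_spec hex
    have hmin2 : ∀ {k}, k < Nat.find hex → ¬ (m ≤ k ∨ Nsub D q k ≠ ⊥) := Nat.find_min hex
    have hle2 : Nat.find hex ≤ m := Nat.find_le (Or.inl le_rfl)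
    set i := Nat.find hex
    have hnb : ∀ j, i ≤ j → j < m → Nsub D q j ≠ ⊥ := by
      intro j h1 h2 h3
      have := hsp2.resolve_left (by omega)
      exact this (le_bot_iff.1 (h3 ▸ Nsub_mono h hq hq' h1))
    refine ⟨i, m, Nsub D q, hle2, e0, fun j h1 h2 => ⟨hnb j h1 h2, Nsub_normal h hq hq'⟩,
      fun j j' h1 h2 h3 => Nsub_mono h hq hq' h2, fun j hj => ?_, fun j h1 h2 => ?_, fun j h1 => ?_⟩
    · have := hmin2 hj
      push Not at this
      rw [hM, if_neg (hmin this.1), if_pos this.2]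
    · rw [hM, if_neg (hmin h2), if_neg (hnb j h1 h2)]
    · rw [hM, if_pos (Re_le h hq hq' hsp h1)]
  · push Not at hR
    by_cases hex : ∃ j, Nsub D q j ≠ ⊥
    · right; left
      have hsp2 := Nat.find_spec hex
      have hmin2 : ∀ {k}, k < Nat.find hex → ¬ (Nsub D q k ≠ ⊥) := Nat.find_min hex
      set i := Nat.find hex with hi
      have hnb : ∀ j, i ≤ j → Nsub D q j ≠ ⊥ := by
        intro j h1 h3
        exact hsp2 (le_bot_iff.1 (h3 ▸ Nsub_mono h hq hq' h1))
      obtain ⟨k, hik, hkm, hkc⟩ : ∃ k, i ≤ k ∧ leMin k (Tof D q) ∧ ∀ j, k ≤ j → Nsub D q j = Nsub D q k := by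
        rcases cong_class cg with e | ⟨m, d, hd, e⟩
        · obtain ⟨k, hk⟩ := WellFoundedGT.monotone_chain_condition
            (⟨Nsub D q, fun a b hab => Nsub_mono h hq hq' hab⟩ : ℕ →o Subgroup (Equiv.Perm (Fin q)))
          refine ⟨max i k, le_max_left _ _, ?_, fun j hj => ?_⟩
          · rw [e]; intro a b h1 h2; exact absurd h1 h2
          · have h1 := hk (max i k) (le_max_right _ _)
            have h2 := hk j (le_trans (le_max_right _ _) hj)
            exact h2.symm.trans h1
        · have hc : ∀ j, m ≤ j → Nsub D q j = Nsub D q m := by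
            intro j hj
            refine le_antisymm ?_ (Nsub_mono h hq hq' hj)
            have : Tof D q m (m + d * j) := by
              rw [e]; exact Or.inr ⟨le_rfl, by omega, (Nat.add_mul_mod_self_left m d j).symm⟩
            rw [Tof2 D hq] at this
            have := this.resolve_right fun h' => hR _ h'.1
            refine le_trans (Nsub_mono h hq hq' ?_) (Nsub_le h hq hq' this)
            have := Nat.le_mul_of_pos_left j hd
            omega
          refine ⟨m, ?_, ?_, hc⟩
          · by_contra hlt
            push Not at hlt
            have := hc i hlt.le
            rw [this] at hsp2
            exact hmin2 hlt hsp2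
          · rw [e]
            intro a b h1 h2
            exact (h1.resolve_left h2).1
      refine ⟨i, k, Nsub D q, hik, hkm, fun j h1 h2 => ⟨hnb j h1, Nsub_normal h hq hq'⟩,
        fun j j' h1 h2 h3 => Nsub_mono h hq hq' h2, fun j hj => ?_, fun j h1 h2 => ?_, fun j h1 => ?_⟩
      · rw [hM, if_neg (hR j), if_pos (not_not.1 (hmin2 hj))]
      · rw [hM, if_neg (hR j), if_neg (hnb j h1)]
      · rw [hM, if_neg (hR j), if_neg (hnb j (hik.trans h1)), hkc j h1]
    · left
      push Not at hex
      intro j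
      rw [hM, if_neg (hR j), if_pos (hex j)]

theorem M1_not_nsym (D : D1) (i) : ¬ isNsym (M1of D i) := by
  unfold M1of; split_ifs <;> simp [isNsym]

theorem M1_mid {D : D1} {i} (hu : D.up i) (hd : D.dn i) : mid (M1of D i) := by
  unfold M1of; split_ifs <;> simp_all [mid, big]

theorem Mof_R (h : D.Valid n) {q i} (hq' : q ≤ n) : Mof D q i = CEntry.R ↔ D.Rs q i := by
  match q with
  | 0 => rw [Mof0]; unfold M0of; split_ifs <;> simp_all [Dat.Rs]
  | 1 => rw [Mof1]; unfold M1of; split_ifs <;> simp_all [Dat.Rs]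
  | q + 2 => rw [Mof2 D (by omega)]; split_ifs <;> simp_all [Dat.Rs]

theorem Mof_CPair (h : D.Valid n) : IsCPair n (Tof D) (Mof D) := by
  refine ⟨fun q hq => Tof_cong h hq, fun q r h1 h2 i j h3 => Tof_down h h1 h2 h3, ?_, fun q h1 h2 => rows2 h h1 h2,
    fun q i h1 h2 h3 => ?_, fun q i h1 h2 h3 => ?_⟩
  · rw [Tof0, Tof1, Mof0, Mof1]
    exact rows01 h.toValid
  · classical
    have hq : 2 ≤ q := by
      by_contra hlt
      obtain rfl : q = 1 := by omega
      rw [Mof1] at h3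
      exact M1_not_nsym _ _ h3
    rw [Mof2 D hq] at h3
    have hN : Nsub D q i ≠ ⊥ := by
      intro hN
      rw [if_pos hN] at h3
      split_ifs at h3 <;> simp [isNsym] at h3
    obtain ⟨⟨π, hπ⟩, hπ1⟩ := Subgroup.ne_bot_iff_exists_ne_one.1 hN
    replace hπ1 : π ≠ 1 := fun e => hπ1 (Subtype.ext e)
    rw [mem_Nsub h hq h2] at hπ
    rcases Nat.eq_or_lt_of_le hq with rfl | hq3
    · have := h.nn_drop2 h2 hπ1 hπ
      have hm := M1_mid this.2.1 this.2.2
      rw [show 2 - 1 = 1 from rfl, Mof1]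
      have := M1_not_nsym D.toD1 i
      rintro (e | e | e | e)
      · rw [e] at hm; simp at hm
      · rw [e] at hm; simp at hm
      · rw [e] at hm; simp at hm
      · exact this e
    · have := h.nn_drop hq3 h2 hπ1 hπ
      rw [Mof2 D (by omega), if_pos this]
      simp [isNsym]
  · rw [Mof_R h (by omega)] at h3 ⊢
    exact h.Rs_down h2 (by omega) h3


end Part18

section Part19

/-! ### From data to C-pairs: the exceptional part -/

/-- The exceptional part of data. -/
def Xof (n : ℕ) (D : Dat) (q i j : ℕ) : Prop :=
  2 ≤ q ∧ q ≤ n ∧ ¬ D.Re q i ∧ (∃ π, D.NN q i j π) ∧ ¬ D.NN q i j 1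

variable {D : Dat}

theorem not_mem_of (h : D.Valid n) {q i j π} (hq : 2 ≤ q) (hq' : q ≤ n) (hN : D.NN q i j π)
    (hn1 : ¬ D.NN q i j 1) : π ∉ Nsub D q i := by
  intro hm
  rw [mem_Nsub h hq hq'] at hm
  have := h.nn_mul hq hq' (h.nn_inv hq hq' hm) hN
  rw [inv_mul_cancel] at this
  exact hn1 this

theorem X_alt (h : D.Valid n) {q i j} (hX : Xof n D q i j) : Nsub D q i = alternatingGroup (Fin q) := by
  obtain ⟨hq, hq', -, ⟨π, hN⟩, hn1⟩ := hX
  refine group_lemma hq (Nsub_normal h hq hq') (not_mem_of h hq hq' hN hn1) fun τ => ?_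
  rw [mem_Nsub h hq hq']
  exact h.nn_mul hq hq' (h.nn_conj τ hq hq' hN) (h.nn_inv hq hq' hN)

theorem X_iff (h : D.Valid n) {q i j} (hX : Xof n D q i j) (π) : D.NN q i j π ↔ π ∉ alternatingGroup (Fin q) := by
  have hA := X_alt h hX
  obtain ⟨hq, hq', -, ⟨π0, hN⟩, hn1⟩ := hX
  have h0 := not_mem_of h hq hq' hN hn1
  rw [hA] at h0
  constructor
  · intro hp
    have := not_mem_of h hq hq' hp hn1
    rwa [hA] at this
  · intro hp
    have : π * π0⁻¹ ∈ Nsub D q i := by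
      rw [hA]; exact alt_mul hp (fun h' => h0 (by simpa using h'))
    rw [mem_Nsub h hq hq'] at this
    have := h.nn_mul hq hq' this hN
    rwa [inv_mul_cancel_right] at this

theorem NN_dataOf_iff (h : D.Valid n) {q i j} (hq : 2 ≤ q) (hq' : q ≤ n) (hR : ¬ D.Re q i) (π) :
    (dataOf (Tof D) (Mof D) (Xof n D)).NN q i j π ↔ D.NN q i j π := by
  classical
  have hM := Mof2 D hq i
  rw [if_neg hR] at hM
  have hmem : (π = 1 ∨ Mof D q i = CEntry.R ∨ ∃ N, Mof D q i = CEntry.nsym q N ∧ π ∈ N) ↔ π ∈ Nsub D q i := by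
    rw [hM]
    split_ifs with hb
    · simp [hb]
    · constructor
      · rintro (rfl | hh | ⟨N, hh, hp⟩)
        · exact one_mem _
        · cases hh
        · cases hh; exact hp
      · intro hp; exact Or.inr (Or.inr ⟨_, rfl, hp⟩)
  have hT : Tof D q i j ↔ D.NN q i j 1 := by
    rw [Tof2 D hq]; exact or_iff_left fun h' => hR h'.1
  change ((Tof D q i j ∧ _) ∨ (Xof n D q i j ∧ _)) ↔ _
  rw [hT, hmem]
  by_cases hX : Xof n D q i j
  · rw [X_iff h hX, X_iff h hX]
    simp [hX]
  · simp only [hX, false_and, or_false]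
    rw [mem_Nsub h hq hq']
    constructor
    · rintro ⟨h1, h2⟩
      have := h.nn_mul hq hq' h2 h1
      rwa [mul_one] at this
    · intro hN
      have h1 : D.NN q i j 1 := by
        by_contra h1
        exact hX ⟨hq, hq', hR, ⟨π, hN⟩, h1⟩
      refine ⟨h1, ?_⟩
      have h2 := h.nn_inv hq hq' h1
      have := h.nn_mul hq hq' hN h2
      rwa [inv_one, mul_one] at this

theorem pdIn_mono {q : ℕ} {P Q : Equiv.Perm (Fin q) → Prop} {α β : PM n} (h : ∀ π, P π → Q π)
    (hp : pdIn q P α β) : pdIn q Q α β := by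
  obtain ⟨a, b, π, h1, h2, h3, h4⟩ := hp
  exact ⟨a, b, π, h1, h2, h3, h _ h4⟩

theorem rel_eq (h : D.Valid n) : (rel D : ℕ × PM n → ℕ × PM n → Prop) = rel (dataOf (Tof D) (Mof D) (Xof n D)) := by
  have C := CF_of (Mof_CPair h)
  have hD1 : (dataOf (Tof D) (Mof D) (Xof n D)).toD1 = D.toD1 := by
    change D1of (Tof D 0) (Tof D 1) (Mof D 0) (Mof D 1) = D.toD1
    rw [Tof0, Tof1, Mof0, Mof1]
    exact D1of_eq h.toValid
  have hRs : ∀ q i, q ≤ n → ((dataOf (Tof D) (Mof D) (Xof n D)).Rs q i ↔ D.Rs q i) := fun q i hq => by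
    rw [C.Rs, Mof_R h hq]
  have hRe : ∀ q i, 2 ≤ q → (D.Rs q i ↔ D.Re q i) := fun q i hq => by
    obtain ⟨q, rfl⟩ : ∃ r, q = r + 2 := ⟨q - 2, by omega⟩
    exact Iff.rfl
  funext a b
  apply propext
  unfold rel
  rw [hRs _ _ (rnk_le a.2), hRs _ _ (rnk_le b.2), hD1]
  by_cases hR : 2 ≤ rnk a.2 ∧ D.Re (rnk a.2) a.1
  · constructor
    · rintro (h1 | h1 | ⟨q, hq, h1, h2, h3, h4⟩)
      · exact Or.inl h1
      · exact Or.inr (Or.inl h1)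
      · subst h1
        obtain ⟨x, y, π, -, -, -, hN⟩ := h4
        refine Or.inl ⟨(hRe _ _ hq).2 hR.2, ?_⟩
        rw [h2, hRe _ _ hq]
        exact h.re_nn hq (rnk_le _) hN hR.2
    · rintro (h1 | h1 | ⟨q, hq, h1, h2, h3, h4⟩)
      · exact Or.inl h1
      · exact Or.inr (Or.inl h1)
      · subst h1
        obtain ⟨x, y, π, -, -, -, hN⟩ := h4
        refine Or.inl ⟨(hRe _ _ hq).2 hR.2, ?_⟩
        rw [h2, hRe _ _ hq]
        rcases hN with ⟨hT, -⟩ | ⟨hX, -⟩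
        · rw [Tof2 D hq] at hT
          rcases hT with hT | hT
          · exact h.re_nn hq (rnk_le _) hT hR.2
          · exact hT.2
        · exact absurd hR.2 hX.2.2.1
  · refine or_congr Iff.rfl (or_congr Iff.rfl ?_)
    constructor
    · rintro ⟨q, hq, h1, h2, h3, h4⟩
      subst h1
      exact ⟨_, hq, rfl, h2, h3, pdIn_mono (fun π hp => (NN_dataOf_iff h hq (rnk_le _) (fun h' => hR ⟨hq, h'⟩) π).2 hp) h4⟩
    · rintro ⟨q, hq, h1, h2, h3, h4⟩
      subst h1
      exact ⟨_, hq, rfl, h2, h3, pdIn_mono (fun π hp => (NN_dataOf_iff h hq (rnk_le _) (fun h' => hR ⟨hq, h'⟩) π).1 hp) h4⟩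

theorem NNex_cong (h : D.Valid n) {q} (hq : 2 ≤ q) (hq' : q ≤ n) :
    IsCongruence (· + ·) (fun i j => ∃ π, D.NN q i j π) := by
  refine ⟨⟨fun i => ⟨1, h.nn_one i hq hq'⟩, fun ⟨π, hp⟩ => ⟨_, h.nn_inv hq hq' hp⟩,
    fun ⟨π, hp⟩ ⟨π', hp'⟩ => ⟨_, h.nn_mul hq hq' hp hp'⟩⟩, fun x y a ⟨π, hp⟩ => ⟨⟨π, ?_⟩, ⟨π, h.nn_add a hq hq' hp⟩⟩⟩
  have := h.nn_add a hq hq' hp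
  rwa [add_comm x, add_comm y] at this

theorem alt_ne_bot {q : ℕ} (hq : 3 ≤ q) : alternatingGroup (Fin q) ≠ ⊥ := by
  intro hb
  have h3 := Equiv.Perm.isThreeCycle_swap_mul_swap_same (a := (⟨0, by omega⟩ : Fin q)) (b := ⟨1, by omega⟩)
    (c := ⟨2, by omega⟩) (by simp) (by simp) (by simp)
  have := h3.mem_alternatingGroup
  rw [hb, Subgroup.mem_bot] at this
  rw [this] at h3
  simp [Equiv.Perm.IsThreeCycle] at h3

theorem exc_main (h : D.Valid n) {q i0 j0} (hX : Xof n D q i0 j0) :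
    ∃ m d, ExcAt n (Tof D) (Mof D) q m d ∧
      Xof n D = fun p i j => p = q ∧ natCong m d i j ∧ ¬ Tof D p i j := by
  have hX0 := hX
  obtain ⟨hq, hq', hRi, ⟨π0, hN0⟩, hn1⟩ := hX
  have hθ := NNex_cong h hq hq'
  have hij : i0 ≠ j0 := by rintro rfl; exact hn1 (h.nn_one _ hq hq')
  obtain ⟨m, d, hd, e⟩ := (cong_class hθ).resolve_left (fun e => by
    have : (fun i j => ∃ π, D.NN q i j π) i0 j0 := ⟨π0, hN0⟩
    rw [e] at this; exact hij this)
  have eθ : ∀ i j, (∃ π, D.NN q i j π) ↔ natCong m d i j := fun i j => by rw [← e]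
  have hm0 : m ≤ i0 ∧ m ≤ j0 ∧ i0 % d = j0 % d := ((eθ _ _).1 ⟨π0, hN0⟩).resolve_left hij
  have hRe : ∀ i, ¬ D.Re q i := by
    intro i hi
    obtain ⟨π, hp⟩ : ∃ π, D.NN q i0 (i0 + d * i) π := (eθ _ _).2
      (Or.inr ⟨hm0.1, by omega, (Nat.add_mul_mod_self_left _ _ _).symm⟩)
    have hle := Nat.le_mul_of_pos_left i hd
    have := Re_le h hq hq' hi (show i ≤ i0 + d * i by omega)
    exact hRi (h.re_nn hq hq' (h.nn_inv hq hq' hp) this)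
  have hT : ∀ i j, Tof D q i j ↔ D.NN q i j 1 := fun i j => by
    rw [Tof2 D hq]; exact or_iff_left fun h' => hRe _ h'.1
  have hXq : ∀ i j, Xof n D q i j ↔ natCong m d i j ∧ ¬ Tof D q i j := fun i j => by
    rw [← eθ, hT]
    exact ⟨fun h' => h'.2.2.2, fun h' => ⟨hq, hq', hRe i, h'.1, h'.2⟩⟩
  have cT := Tof_cong h hq'
  have hnT : ¬ Tof D q m (m + d) := fun hT' =>
    ((hXq _ _).1 hX0).2 (nat_sub cT hT' ((hXq _ _).1 hX0).1)
  have hXm : Xof n D q m (m + d) := (hXq _ _).2 ⟨Or.inr ⟨le_rfl, by omega, by simp⟩, hnT⟩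
  have hA := X_alt h hXm
  obtain ⟨-, -, -, ⟨π, hN⟩, -⟩ := id hXm
  have hπ := (X_iff h hXm π).1 hN
  have hT2 : Tof D q m (m + 2 * d) := by
    rw [hT]
    have h1 := h.nn_add d hq hq' hN
    rw [show m + d + d = m + 2 * d by omega] at h1
    have h2 := h.nn_mul hq hq' hN h1
    by_contra hcon
    have := not_mem_of h hq hq' h2 hcon
    rw [hA] at this
    exact this (alt_mul hπ hπ)
  have hTe : Tof D q = natCong m (2 * d) := by
    funext i j
    refine propext ⟨fun hh => ?_, fun hh => nat_sub cT hT2 hh⟩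
    have h1 := (eθ i j).1 ⟨1, (hT _ _).1 hh⟩
    rcases h1 with h1 | ⟨h1, h2, h3⟩
    · exact Or.inl h1
    · right
      refine ⟨h1, h2, ?_⟩
      by_contra h4
      have h5 := mod_two_d h3 h4
      have h6 : Tof D q (i + d) j := nat_sub cT hT2 (Or.inr ⟨by omega, h2, h5⟩)
      have h7 : Tof D q i (i + d) := nc_trans cT hh (nc_symm cT h6)
      have hle := Nat.le_mul_of_pos_left i (show 0 < 2 * d by omega)
      have h8 := nc_add cT (m + 2 * d * i - i) h7
      rw [show i + (m + 2 * d * i - i) = m + 2 * d * i by omega,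
        show i + d + (m + 2 * d * i - i) = m + d + 2 * d * i by omega] at h8
      have h9 : Tof D q m (m + 2 * d * i) := nat_sub cT hT2
        (Or.inr ⟨le_rfl, by omega, (Nat.add_mul_mod_self_left _ _ _).symm⟩)
      have h10 : Tof D q (m + d) (m + d + 2 * d * i) := nat_sub cT hT2
        (Or.inr ⟨by omega, by omega, (Nat.add_mul_mod_self_left _ _ _).symm⟩)
      exact hnT (nc_trans cT h9 (nc_trans cT h8 (nc_symm cT h10)))
  have hdrop : ∀ p i j, Xof n D p i j → ∀ r, 2 ≤ r → r < p → D.Re r i := by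
    intro p i j hXp r h1 h2
    obtain ⟨g1, g2, -, ⟨τ, g3⟩, g4⟩ := hXp
    have hτ : τ ≠ 1 := by rintro rfl; exact g4 g3
    have := h.nn_drop (by omega) g2 hτ g3
    obtain ⟨r, rfl⟩ : ∃ s, r = s + 2 := ⟨r - 2, by omega⟩
    obtain ⟨p, rfl⟩ : ∃ s, p = s + 3 := ⟨p - 3, by omega⟩
    exact h.Rs_down (q := p + 2) (r := r + 2) (by omega) (by omega) this
  refine ⟨m, d, ⟨hq, hq', hd, hTe, ?_⟩, ?_⟩
  · classical
    have hM := Mof2 D hq m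
    rw [if_neg (hRe m), hA] at hM
    rcases Nat.eq_or_lt_of_le hq with rfl | hq3
    · right
      rw [if_pos alt_two] at hM
      have hπ1 : π ≠ 1 := fun e1 => hπ (e1 ▸ one_mem _)
      obtain ⟨h1, h2, h3⟩ := h.nn_drop2 hq' hπ1 hN
      refine ⟨rfl, hM, ?_, fun i j hh => ?_⟩
      · have := M1_mid h2 h3
        rw [Mof1]
        unfold mid big at this
        tauto
      · rw [Tof1]; exact nat_sub (t1_cong h.toValid) h1 hh
    · left
      rw [if_neg (alt_ne_bot hq3)] at hM
      exact ⟨hq3, hM⟩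
  · funext p i j
    refine propext ⟨fun hh => ?_, ?_⟩
    · have hpq : p = q := by
        rcases lt_trichotomy p q with hlt | heq | hlt
        · exfalso
          have hR := hdrop q i0 j0 hX0 p hh.1 hlt
          -- p-row has a Rees entry and an exceptional pair
          obtain ⟨g1, g2, g5, ⟨τ, g3⟩, g4⟩ := hh
          have hθ' := NNex_cong h g1 g2
          have hij' : i ≠ j := by rintro rfl; exact g4 (h.nn_one _ g1 g2)
          obtain ⟨m', d', hd', e'⟩ := (cong_class hθ').resolve_left (fun e => by
            have : (fun i j => ∃ π, D.NN p i j π) i j := ⟨τ, g3⟩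
            rw [e] at this; exact hij' this)
          have eθ' : ∀ i j, (∃ π, D.NN p i j π) ↔ natCong m' d' i j := fun i j => by rw [← e']
          have hm0' := ((eθ' _ _).1 ⟨τ, g3⟩).resolve_left hij'
          obtain ⟨υ, hp⟩ : ∃ π, D.NN p i (i + d' * i0) π := (eθ' _ _).2
            (Or.inr ⟨hm0'.1, by omega, (Nat.add_mul_mod_self_left _ _ _).symm⟩)
          have hle := Nat.le_mul_of_pos_left i0 hd'
          have := Re_le h g1 g2 hR (show i0 ≤ i + d' * i0 by omega)
          exact g5 (h.re_nn g1 g2 (h.nn_inv g1 g2 hp) this)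
        · exact heq
        · exact absurd (hdrop p i j hh q hq hlt) (hRe i)
      subst hpq
      exact ⟨rfl, (hXq _ _).1 hh⟩
    · rintro ⟨rfl, hh⟩
      exact (hXq _ _).2 hh

theorem forward (h : D.Valid n) :
    (∃ Θ M, IsCPair n Θ M ∧ (rel D : ℕ × PM n → ℕ × PM n → Prop) = cg n Θ M) ∨
    (∃ Θ M q m d, IsCPair n Θ M ∧ ExcAt n Θ M q m d ∧
      (rel D : ℕ × PM n → ℕ × PM n → Prop) = cgx n Θ M q m d) := by
  have hC := Mof_CPair h
  have C := CF_of hC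
  by_cases hX : ∃ q i j, Xof n D q i j
  · obtain ⟨q, i, j, hX⟩ := hX
    right
    obtain ⟨m, d, h1, h2⟩ := exc_main h hX
    refine ⟨Tof D, Mof D, q, m, d, hC, h1, ?_⟩
    rw [rel_eq h, cgx_eq C h1.1, h2]
  · left
    push Not at hX
    refine ⟨Tof D, Mof D, hC, ?_⟩
    rw [rel_eq h]
    funext a b
    apply propext
    rw [C.rel_iff]
    refine or_iff_left ?_
    rintro ⟨q, -, -, -, hx, -⟩
    exact hX _ _ _ hx


end Part19

/-- For every `n ≥ 1`, the congruences on the twisted partition monoid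
`P_n^Φ` are precisely the relations `cg(Θ,M)` for C-pairs `(Θ,M)`, together with the
relations `cgx(Θ,M)` for exceptional C-pairs `(Θ,M)`. -/
theorem classification_of_congruences (n : ℕ) (hn : 1 ≤ n)
    (σ : (ℕ × PM n) → (ℕ × PM n) → Prop) :
    IsCongruence (tmul (n := n)) σ ↔
      ((∃ (Θ : ℕ → ℕ → ℕ → Prop) (M : ℕ → ℕ → CEntry),
          IsCPair n Θ M ∧ σ = cg n Θ M) ∨
       (∃ (Θ : ℕ → ℕ → ℕ → Prop) (M : ℕ → ℕ → CEntry) (q m d : ℕ),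
          IsCPair n Θ M ∧ ExcAt n Θ M q m d ∧ σ = cgx n Θ M q m d)) := by
  haveI : NeZero n := ⟨by omega⟩
  constructor
  · intro h
    have h1 := forward (Dof_valid h)
    rw [← eq_rel h] at h1
    exact h1
  · rintro (⟨Θ, M, h, rfl⟩ | ⟨Θ, M, q, m, d, h, hx, rfl⟩)
    · exact cg_cong hn h
    · exact cgx_cong hn h hx

end TPM
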